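/- (Iteration inequality) There is an absolute constant C ≥ 1 such that for every real p with 4 < p < 6, every integer N ≥ 1, and every δ ∈ (0,1) with δ^{1/2^{N+1}} ∈ {1/m : m ∈ ℕ} ∩ (0, 1/100), one has D_p(δ) ≤ C^{N²} · ( D_p(δ^{1 − 1/2^{N+1}}) + δ^{−(1/2^{N+1})·(1 + (2/p)·Σ_{j=0}^{N} (2/(p−2))^j)} · Π_{j=0}^{N} D_p(δ^{1 − 1/2^{j+1}})^{((p−4)/(p−2))·(2/(p−2))^{N−j}} ). -/

import Mathlib

open MeasureTheory

noncomputable section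

/-- The weight `w_B` attached to the axis-parallel square of center `c` and side length `R`:
`w_B(x) = (1 + |x - c|/R)^(-100)` with `|·|` the Euclidean norm on `ℝ²`. -/
def wB (c : ℝ × ℝ) (R : ℝ) (x : ℝ × ℝ) : ℝ :=
  (1 + Real.sqrt ((x.1 - c.1) ^ 2 + (x.2 - c.2) ^ 2) / R) ^ (-100 : ℤ)

/-- The product weight `w̃_B(x) = (1 + |x₁ - c₁|/R)^(-100) * (1 + |x₂ - c₂|/R)^(-100)`. -/
def wtB (c : ℝ × ℝ) (R : ℝ) (x : ℝ × ℝ) : ℝ :=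
  (1 + |x.1 - c.1| / R) ^ (-100 : ℤ) * (1 + |x.2 - c.2| / R) ^ (-100 : ℤ)

/-- The axis-parallel square `B(c, R)` with center `c` and side length `R`, as a subset of `ℝ²`. -/
def sqr (c : ℝ × ℝ) (R : ℝ) : Set (ℝ × ℝ) :=
  Set.Icc (c.1 - R / 2) (c.1 + R / 2) ×ˢ Set.Icc (c.2 - R / 2) (c.2 + R / 2)

/-- The extension operator associated to the parabola, over the interval `[a, b]`:
`(E_{[a,b]} g)(x) = ∫_{[a,b]} g(ξ) e(ξ x₁ + ξ² x₂) dξ`. -/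
def extOp (a b : ℝ) (g : ℝ → ℂ) (x : ℝ × ℝ) : ℂ :=
  ∫ ξ in Set.Icc a b,
    g ξ * Complex.exp (2 * Real.pi * Complex.I * ((ξ * x.1 + ξ ^ 2 * x.2 : ℝ) : ℂ))

/-- Weighted `L^p` norm `‖f‖_{L^p(w)} = (∫_{ℝ²} |f|^p w)^{1/p}`. -/
def wLp (p : ℝ) (w : ℝ × ℝ → ℝ) (f : ℝ × ℝ → ℂ) : ℝ :=
  (∫ x : ℝ × ℝ, ‖f x‖ ^ p * w x) ^ (1 / p)

/-- `L^p` norm over the square of center `c` and side `R`. -/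
def sqLp (p : ℝ) (c : ℝ × ℝ) (R : ℝ) (f : ℝ × ℝ → ℂ) : ℝ :=
  (∫ x in sqr c R, ‖f x‖ ^ p) ^ (1 / p)

/-- Normalized weighted `L^p` norm `‖f‖_{L^p_#(w)} = (|B|⁻¹ ∫_{ℝ²} |f|^p w)^{1/p}` where the
normalizing square has side length `R` (so `|B| = R²`). -/
def shLp (p R : ℝ) (w : ℝ × ℝ → ℝ) (f : ℝ × ℝ → ℂ) : ℝ :=
  ((R ^ 2)⁻¹ * ∫ x : ℝ × ℝ, ‖f x‖ ^ p * w x) ^ (1 / p)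

/-- Normalized `L^p` norm over the square of center `c` and side `R`:
`‖f‖_{L^p_#(B)} = (|B|⁻¹ ∫_B |f|^p)^{1/p}`. -/
def shLpSq (p : ℝ) (c : ℝ × ℝ) (R : ℝ) (f : ℝ × ℝ → ℂ) : ℝ :=
  ((R ^ 2)⁻¹ * ∫ x in sqr c R, ‖f x‖ ^ p) ^ (1 / p)

/-- `DecIneq p n D` says that the constant `D` is admissible in the `l²L^p` decoupling
inequality for the parabola at scale `δ = 1/n`: for every integrable `g : [0,1] → ℂ` and every
axis-parallel square `B` of side length `δ⁻² = n²`,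
`‖E_{[0,1]} g‖_{L^p(B)} ≤ D (Σ_{J ∈ P_δ([0,1])} ‖E_J g‖_{L^p(w_B)}²)^{1/2}`. -/
def DecIneq (p : ℝ) (n : ℕ) (D : ℝ) : Prop :=
  ∀ g : ℝ → ℂ, IntegrableOn g (Set.Icc 0 1) → ∀ c : ℝ × ℝ,
    sqLp p c ((n : ℝ) ^ 2) (extOp 0 1 g) ≤
      D * (∑ k ∈ Finset.range n,
        wLp p (wB c ((n : ℝ) ^ 2)) (extOp ((k : ℝ) / (n : ℝ)) (((k : ℝ) + 1) / (n : ℝ)) g) ^ 2)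
        ^ (1 / 2 : ℝ)

/-- The decoupling constant `D_p(δ)` for the parabola at scale `δ = 1/n`, i.e. the smallest
admissible constant in the decoupling inequality. -/
def Dconst (p : ℝ) (n : ℕ) : ℝ := sInf {D : ℝ | 0 ≤ D ∧ DecIneq p n D}

/-- Center of the `(i,j)` square in the partition of the axis-parallel square of center `c` and
side length `Rb` into axis-parallel squares of side length `r`. -/
def subCtr (c : ℝ × ℝ) (Rb r : ℝ) (i j : ℕ) : ℝ × ℝ :=
  (c.1 - Rb / 2 + ((i : ℝ) + 1 / 2) * r, c.2 - Rb / 2 + ((j : ℝ) + 1 / 2) * r)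

/-- `BilIneq p n k b M` says `M` is admissible in the bilinear decoupling inequality with
`δ = 1/n`, `ν = 1/k`: for every square `B` of side `δ⁻² = n²`, every integrable `g`, and all
`ν`-separated intervals `I = [i/k, (i+1)/k]`, `I' = [i'/k, (i'+1)/k]` of the partition
`P_ν([0,1])`,
`Avg_{Δ ∈ P_{ν^{-b}}(B)} Π (Σ_{J ∈ P_{ν^b}} ‖E_J g‖_{L²_#(w̃_Δ)}²)^{p/4}
  ≤ M^p Π (Σ_{J ∈ P_δ} ‖E_J g‖_{L^p_#(w_B)}²)^{p/4}`. -/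
def BilIneq (p : ℝ) (n k b : ℕ) (M : ℝ) : Prop :=
  ∀ g : ℝ → ℂ, IntegrableOn g (Set.Icc 0 1) → ∀ c : ℝ × ℝ,
    ∀ i i' : ℕ, i < k → i' < k → (i + 1 < i' ∨ i' + 1 < i) →
    (((n ^ 2 / k ^ b : ℕ) : ℝ) ^ 2)⁻¹ *
        ∑ a ∈ Finset.range (n ^ 2 / k ^ b), ∑ a' ∈ Finset.range (n ^ 2 / k ^ b),
          ((∑ J ∈ Finset.range (k ^ (b - 1)),
              shLp 2 ((k : ℝ) ^ b)
                (wtB (subCtr c ((n : ℝ) ^ 2) ((k : ℝ) ^ b) a a') ((k : ℝ) ^ b))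
                (extOp ((i : ℝ) / (k : ℝ) + (J : ℝ) / (k : ℝ) ^ b)
                  ((i : ℝ) / (k : ℝ) + ((J : ℝ) + 1) / (k : ℝ) ^ b) g) ^ 2) ^ (p / 4) *
            (∑ J ∈ Finset.range (k ^ (b - 1)),
              shLp 2 ((k : ℝ) ^ b)
                (wtB (subCtr c ((n : ℝ) ^ 2) ((k : ℝ) ^ b) a a') ((k : ℝ) ^ b))
                (extOp ((i' : ℝ) / (k : ℝ) + (J : ℝ) / (k : ℝ) ^ b)
                  ((i' : ℝ) / (k : ℝ) + ((J : ℝ) + 1) / (k : ℝ) ^ b) g) ^ 2) ^ (p / 4))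
      ≤ M ^ p *
        ((∑ J ∈ Finset.range (n / k),
            shLp p ((n : ℝ) ^ 2) (wB c ((n : ℝ) ^ 2))
              (extOp ((i : ℝ) / (k : ℝ) + (J : ℝ) / (n : ℝ))
                ((i : ℝ) / (k : ℝ) + ((J : ℝ) + 1) / (n : ℝ)) g) ^ 2) ^ (p / 4) *
          (∑ J ∈ Finset.range (n / k),
            shLp p ((n : ℝ) ^ 2) (wB c ((n : ℝ) ^ 2))
              (extOp ((i' : ℝ) / (k : ℝ) + (J : ℝ) / (n : ℝ))
                ((i' : ℝ) / (k : ℝ) + ((J : ℝ) + 1) / (n : ℝ)) g) ^ 2) ^ (p / 4))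

/-- The bilinear decoupling constant `M_{p,b}(δ, ν)` with `δ = 1/n`, `ν = 1/k`. -/
def Mconst (p : ℝ) (n k b : ℕ) : ℝ := sInf {M : ℝ | 0 ≤ M ∧ BilIneq p n k b M}

/-- The Fourier transform of a function on `ℝ²`. -/
def ftR2 (η : ℝ × ℝ → ℝ) (ξ : ℝ × ℝ) : ℂ :=
  ∫ x : ℝ × ℝ, (η x : ℂ) * Complex.exp (-(2 * Real.pi * Complex.I) * ((x.1 * ξ.1 + x.2 * ξ.2 : ℝ) : ℂ))

end

open scoped ENNReal NNReal

/-- The character `t ↦ e(t) = exp (2πit)`. -/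
noncomputable def ch (t : ℝ) : ℂ := Complex.exp (2 * Real.pi * Complex.I * (t : ℂ))

lemma ch_add (s t : ℝ) : ch (s + t) = ch s * ch t := by
  unfold ch; rw [← Complex.exp_add]; push_cast; ring_nf

@[simp] lemma norm_ch (t : ℝ) : ‖ch t‖ = 1 := by
  unfold ch
  rw [show 2 * (Real.pi : ℂ) * Complex.I * (t : ℂ) = ((2 * Real.pi * t : ℝ) : ℂ) * Complex.I by
    push_cast; ring]
  exact Complex.norm_exp_ofReal_mul_I _

@[simp] lemma enorm_ch (t : ℝ) : ‖ch t‖ₑ = 1 := by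
  rw [← ofReal_norm, norm_ch]; simp

lemma continuous_ch : Continuous ch := by
  unfold ch; fun_prop

@[fun_prop] lemma Continuous.ch' {X : Type*} [TopologicalSpace X] {f : X → ℝ} (hf : Continuous f) :
    Continuous fun x => ch (f x) := continuous_ch.comp hf

@[fun_prop] lemma measurable_ch : Measurable ch := continuous_ch.measurable

lemma conj_ch (t : ℝ) : (starRingEnd ℂ) (ch t) = ch (-t) := by
  unfold ch
  rw [← Complex.exp_conj]
  congr 1
  simp only [map_mul, Complex.conj_I, Complex.conj_ofReal, map_ofNat]
  push_cast
  ring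

/-- The extension operator applied to a function on the whole line. -/
noncomputable def ext (g : ℝ → ℂ) (x : ℝ × ℝ) : ℂ :=
  ∫ ξ, g ξ * ch (ξ * x.1 + ξ ^ 2 * x.2)

lemma MeasureTheory.Integrable.mul_ch {X : Type*} [MeasurableSpace X] {μ : Measure X} {g : X → ℂ}
    (hg : Integrable g μ) {f : X → ℝ} (hf : Measurable f) :
    Integrable (fun x => g x * ch (f x)) μ := by
  refine hg.mono (hg.aestronglyMeasurable.mul
    (measurable_ch.comp hf).aestronglyMeasurable) ?_
  exact Filter.Eventually.of_forall fun x => by simp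

lemma integrable_ext {g : ℝ → ℂ} (hg : Integrable g) (x : ℝ × ℝ) :
    Integrable fun ξ => g ξ * ch (ξ * x.1 + ξ ^ 2 * x.2) :=
  hg.mul_ch (by fun_prop)

lemma continuous_ext {g : ℝ → ℂ} (hg : Integrable g) : Continuous (ext g) := by
  unfold ext
  refine continuous_of_dominated (bound := fun ξ => ‖g ξ‖)
    (fun x => (integrable_ext hg x).aestronglyMeasurable) ?_ hg.norm ?_
  · exact fun x => Filter.Eventually.of_forall fun ξ => by simp
  · exact Filter.Eventually.of_forall fun ξ => by fun_prop

lemma norm_ext_le (g : ℝ → ℂ) (x : ℝ × ℝ) : ‖ext g x‖ ≤ ∫ ξ, ‖g ξ‖ := by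
  refine (norm_integral_le_integral_norm _).trans (le_of_eq ?_)
  simp

lemma ext_congr_ae {g h : ℝ → ℂ} (H : g =ᵐ[volume] h) : ext g = ext h := by
  funext x
  refine integral_congr_ae ?_
  filter_upwards [H] with ξ hξ
  rw [hξ]

lemma ext_sum {ι : Type*} (s : Finset ι) (g : ι → ℝ → ℂ) (hg : ∀ i ∈ s, Integrable (g i))
    (x : ℝ × ℝ) : ext (fun ξ => ∑ i ∈ s, g i ξ) x = ∑ i ∈ s, ext (g i) x := by
  unfold ext
  simp_rw [Finset.sum_mul]
  exact integral_finsetSum _ fun i hi => integrable_ext (hg i hi) x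

/-- Modulation of `g` translates `ext g`. -/
noncomputable def modul (z : ℝ × ℝ) (g : ℝ → ℂ) (ξ : ℝ) : ℂ := g ξ * ch (ξ * z.1 + ξ ^ 2 * z.2)

lemma ext_modul (z : ℝ × ℝ) (g : ℝ → ℂ) (x : ℝ × ℝ) : ext (modul z g) x = ext g (z + x) := by
  unfold ext modul
  refine integral_congr_ae (Filter.Eventually.of_forall fun ξ => ?_)
  simp only [mul_assoc, ← ch_add, Prod.fst_add, Prod.snd_add]
  ring_nf

lemma integrable_modul {g : ℝ → ℂ} (hg : Integrable g) (z : ℝ × ℝ) : Integrable (modul z g) :=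
  integrable_ext hg z

lemma modul_indicator (z : ℝ × ℝ) (g : ℝ → ℂ) (s : Set ℝ) :
    modul z (s.indicator g) = s.indicator (modul z g) := by
  funext ξ
  by_cases h : ξ ∈ s <;> simp [modul, h]

/-- The affine change of variables on the frequency side. -/
noncomputable def dil (a M : ℝ) (g : ℝ → ℂ) (s : ℝ) : ℂ := g (a + s / M)

/-- The affine map of the plane induced by `ξ = a + s / M`. -/
noncomputable def parab (a M : ℝ) (x : ℝ × ℝ) : ℝ × ℝ := ((x.1 + 2 * a * x.2) / M, x.2 / M ^ 2)

lemma integrable_dil {g : ℝ → ℂ} (hg : Integrable g) (a : ℝ) {M : ℝ} (hM : 0 < M) :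
    Integrable (dil a M g) := by
  have h1 := (hg.comp_add_left a)
  exact h1.comp_div hM.ne'

lemma ext_dil (a : ℝ) {M : ℝ} (hM : 0 < M) (g : ℝ → ℂ) (x : ℝ × ℝ) :
    ext (dil a M g) (parab a M x) * ch (a * x.1 + a ^ 2 * x.2) = M * ext g x := by
  unfold ext dil parab
  have h1 : ∀ s : ℝ, g (a + s / M) * ch (s * ((x.1 + 2 * a * x.2) / M) + s ^ 2 * (x.2 / M ^ 2))
      * ch (a * x.1 + a ^ 2 * x.2)
      = (fun ξ => g ξ * ch (ξ * x.1 + ξ ^ 2 * x.2)) (a + s / M) := by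
    intro s
    simp only [mul_assoc, ← ch_add]
    congr 2
    field_simp
    ring
  rw [← integral_mul_const]
  simp_rw [h1]
  have h2 := Measure.integral_comp_div
    (fun s => (fun ξ => g ξ * ch (ξ * x.1 + ξ ^ 2 * x.2)) (a + s)) M
  simp only at h2 ⊢
  rw [h2, integral_add_left_eq_self (fun ξ => g ξ * ch (ξ * x.1 + ξ ^ 2 * x.2)) a, abs_of_pos hM]
  simp

lemma norm_ext_dil (a : ℝ) {M : ℝ} (hM : 0 < M) (g : ℝ → ℂ) (x : ℝ × ℝ) :
    ‖ext (dil a M g) (parab a M x)‖ = M * ‖ext g x‖ := by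
  have := congrArg norm (ext_dil a hM g x)
  simpa [abs_of_pos hM] using this

lemma dil_indicator (a : ℝ) {M : ℝ} (g : ℝ → ℂ) (s : Set ℝ) :
    dil a M (s.indicator g) = ((fun t => a + t / M) ⁻¹' s).indicator (dil a M g) := by
  funext t
  by_cases h : a + t / M ∈ s
  · rw [Set.indicator_of_mem (by exact h), dil, Set.indicator_of_mem h, dil]
  · rw [Set.indicator_of_notMem (by exact h), dil, Set.indicator_of_notMem h]

lemma extOp_eq_ext (a b : ℝ) (g : ℝ → ℂ) : extOp a b g = ext ((Set.Icc a b).indicator g) := by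
  funext x
  unfold extOp ext
  rw [← integral_indicator measurableSet_Icc]
  refine integral_congr_ae (Filter.Eventually.of_forall fun ξ => ?_)
  by_cases h : ξ ∈ Set.Icc a b <;> simp [h, ch]

lemma ext_indicator_Icc (a b : ℝ) (g : ℝ → ℂ) :
    ext ((Set.Icc a b).indicator g) = ext ((Set.Ico a b).indicator g) :=
  ext_congr_ae (indicator_ae_eq_of_ae_eq_set Ico_ae_eq_Icc.symm)

/-- The restriction of `g` to the cell `[l/M, (l+1)/M)`. -/
noncomputable def piece (g : ℝ → ℂ) (M : ℝ) (l : ℤ) : ℝ → ℂ :=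
  (Set.Ico ((l : ℝ) / M) (((l : ℝ) + 1) / M)).indicator g

lemma integrable_piece {g : ℝ → ℂ} (hg : Integrable g) (M : ℝ) (l : ℤ) :
    Integrable (piece g M l) := hg.indicator measurableSet_Ico

section

open scoped ContDiff FourierTransform

/-- Oscillatory integral with quadratic phase. -/
noncomputable def osc (φ : ℝ → ℂ) (T t : ℝ) : ℂ := ∫ s, φ s * ch (T * s ^ 2 + t * s)

lemma hasDerivAt_ch (t : ℝ) : HasDerivAt ch (2 * Real.pi * Complex.I * ch t) t := by
  unfold ch
  have h : HasDerivAt (fun t : ℝ => 2 * Real.pi * Complex.I * (t : ℂ))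
      (2 * Real.pi * Complex.I * 1) t :=
    (Complex.ofRealCLM.hasDerivAt (x := t)).const_mul _
  have := h.cexp
  convert this using 1
  ring

lemma integrable_osc {φ : ℝ → ℂ} (hφ : Integrable φ) (T t : ℝ) :
    Integrable fun s => φ s * ch (T * s ^ 2 + t * s) := hφ.mul_ch (by fun_prop)

lemma osc_by_parts {φ : ℝ → ℂ} (hφ : ContDiff ℝ ∞ φ) (hc : HasCompactSupport φ) (T t : ℝ) :
    osc (deriv φ) T t + 2 * Real.pi * Complex.I *
      (2 * T * osc (fun s => (s : ℂ) * φ s) T t + t * osc φ T t) = 0 := by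
  have hi : Integrable φ := hφ.continuous.integrable_of_hasCompactSupport hc
  have hd : ContDiff ℝ ∞ (deriv φ) := (contDiff_infty_iff_deriv.1 hφ).2
  have hi' : Integrable (deriv φ) := hd.continuous.integrable_of_hasCompactSupport hc.deriv
  have hs : Integrable (fun s : ℝ => (s : ℂ) * φ s) :=
    (Complex.continuous_ofReal.mul hφ.continuous).integrable_of_hasCompactSupport hc.mul_left
  have key : ∀ s, HasDerivAt (fun s => φ s * ch (T * s ^ 2 + t * s))
      (deriv φ s * ch (T * s ^ 2 + t * s) + 2 * Real.pi * Complex.I *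
        (2 * T * ((s : ℂ) * φ s * ch (T * s ^ 2 + t * s)) +
          t * (φ s * ch (T * s ^ 2 + t * s)))) s := by
    intro s
    have h1 : HasDerivAt φ (deriv φ s) s :=
      ((hφ.differentiable (by simp)) s).hasDerivAt
    have h2 : HasDerivAt (fun s : ℝ => T * s ^ 2 + t * s) (T * (2 * s) + t * 1) s := by
      refine HasDerivAt.add (HasDerivAt.const_mul T ?_) ((hasDerivAt_id s).const_mul t)
      simpa using hasDerivAt_pow 2 s
    have h3 := (hasDerivAt_ch (T * s ^ 2 + t * s)).scomp s h2
    have h4 := h1.mul h3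
    refine h4.congr_deriv ?_
    rw [Complex.real_smul]
    simp only [Function.comp]
    push_cast
    ring
  have := integral_eq_zero_of_hasDerivAt_of_integrable key
    ((integrable_osc hi' T t).add ((((integrable_osc hs T t).const_mul _).add
      ((integrable_osc hi T t).const_mul _)).const_mul _)) (integrable_osc hi T t)
  have hsum : Integrable fun s : ℝ => 2 * Real.pi * Complex.I *
        (2 * T * ((s : ℂ) * φ s * ch (T * s ^ 2 + t * s)) +
          t * (φ s * ch (T * s ^ 2 + t * s))) :=
    (((integrable_osc hs T t).const_mul _).add ((integrable_osc hi T t).const_mul _)).const_mul _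
  rw [integral_add (integrable_osc hi' T t) hsum, integral_const_mul,
      integral_add ((integrable_osc hs T t).const_mul _) ((integrable_osc hi T t).const_mul _),
      integral_const_mul, integral_const_mul] at this
  exact this

lemma norm_osc_le (φ : ℝ → ℂ) (T t : ℝ) : ‖osc φ T t‖ ≤ ∫ s, ‖φ s‖ := by
  refine (norm_integral_le_integral_norm _).trans (le_of_eq ?_)
  simp

lemma pow_mul_osc_le (q : ℕ) : ∀ {φ : ℝ → ℂ}, ContDiff ℝ ∞ φ → HasCompactSupport φ →
    ∃ C : ℝ, 0 ≤ C ∧ ∀ T t, |t| ^ q * ‖osc φ T t‖ ≤ C * (1 + |T|) ^ q := by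
  induction q with
  | zero =>
    intro φ _ _
    refine ⟨∫ s, ‖φ s‖, by positivity, fun T t => by simpa using norm_osc_le φ T t⟩
  | succ q ih =>
    intro φ hφ hc
    have hd : ContDiff ℝ ∞ (deriv φ) := (contDiff_infty_iff_deriv.1 hφ).2
    obtain ⟨C₁, h₁, H₁⟩ := ih hd hc.deriv
    obtain ⟨C₂, h₂, H₂⟩ := ih (φ := fun s : ℝ => (s : ℂ) * φ s)
      (Complex.ofRealCLM.contDiff.mul hφ) hc.mul_left
    refine ⟨C₁ + 2 * C₂, by positivity, fun T t => ?_⟩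
    have key := osc_by_parts hφ hc T t
    have hpi : (1 : ℝ) ≤ 2 * Real.pi := by linarith [Real.pi_gt_three]
    have h3 : |t| * ‖osc φ T t‖ ≤ ‖osc (deriv φ) T t‖ +
        2 * |T| * ‖osc (fun s => (s : ℂ) * φ s) T t‖ := by
      have e : (t : ℂ) * osc φ T t = -((2 * Real.pi * Complex.I)⁻¹ * osc (deriv φ) T t +
          2 * T * osc (fun s => (s : ℂ) * φ s) T t) := by
        have hne : (2 * Real.pi * Complex.I : ℂ) ≠ 0 := by
          simp [Real.pi_ne_zero]
        apply mul_left_cancel₀ hne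
        rw [mul_neg, mul_add, ← mul_assoc _ _⁻¹, mul_inv_cancel₀ hne]
        linear_combination key
      have e2 := congrArg norm e
      rw [norm_mul, norm_neg] at e2
      have : ‖(t : ℂ)‖ = |t| := by simp
      rw [← this, e2]
      refine (norm_add_le _ _).trans (add_le_add ?_ ?_)
      · rw [norm_mul]
        refine mul_le_of_le_one_left (norm_nonneg _) ?_
        simp only [norm_inv, norm_mul, Complex.norm_I, Complex.norm_real, Complex.norm_ofNat,
          Real.norm_eq_abs, abs_of_pos Real.pi_pos, mul_one]
        exact inv_le_one_of_one_le₀ hpi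
      · simp
    calc |t| ^ (q + 1) * ‖osc φ T t‖ = |t| ^ q * (|t| * ‖osc φ T t‖) := by ring
      _ ≤ |t| ^ q * (‖osc (deriv φ) T t‖ + 2 * |T| * ‖osc (fun s => (s : ℂ) * φ s) T t‖) := by
        gcongr
      _ = |t| ^ q * ‖osc (deriv φ) T t‖ +
          2 * |T| * (|t| ^ q * ‖osc (fun s => (s : ℂ) * φ s) T t‖) := by ring
      _ ≤ C₁ * (1 + |T|) ^ q + 2 * |T| * (C₂ * (1 + |T|) ^ q) := by
        exact add_le_add (H₁ T t) (mul_le_mul_of_nonneg_left (H₂ T t) (by positivity))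
      _ ≤ C₁ * (1 + |T|) ^ q * (1 + |T|) + 2 * (1 + |T|) * (C₂ * (1 + |T|) ^ q) := by
        refine add_le_add (le_mul_of_one_le_right (by positivity) (by linarith [abs_nonneg T]))
          (mul_le_mul_of_nonneg_right (by linarith) (by positivity))
      _ = _ := by ring

lemma osc_decay {φ : ℝ → ℂ} (hφ : ContDiff ℝ ∞ φ) (hc : HasCompactSupport φ) (q : ℕ) :
    ∃ C : ℝ, 0 ≤ C ∧ ∀ T t, (1 + |t|) ^ q * ‖osc φ T t‖ ≤ C * (1 + |T|) ^ q := by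
  obtain ⟨C, hC, H⟩ := pow_mul_osc_le q hφ hc
  refine ⟨2 ^ q * (C + ∫ s, ‖φ s‖), by positivity, fun T t => ?_⟩
  have h1 : (1 + |t|) ^ q ≤ 2 ^ q * (|t| ^ q + 1) := by
    have : 1 + |t| ≤ 2 * max |t| 1 := by
      rcases le_total |t| 1 with h | h
      · rw [max_eq_right h]; linarith
      · rw [max_eq_left h]; linarith
    calc (1 + |t|) ^ q ≤ (2 * max |t| 1) ^ q := by gcongr
      _ = 2 ^ q * (max |t| 1) ^ q := by ring
      _ ≤ _ := by
        gcongr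
        rcases le_total |t| 1 with h | h
        · rw [max_eq_right h]; simp
        · rw [max_eq_left h]; simp
  calc (1 + |t|) ^ q * ‖osc φ T t‖ ≤ 2 ^ q * (|t| ^ q + 1) * ‖osc φ T t‖ := by gcongr
    _ = 2 ^ q * (|t| ^ q * ‖osc φ T t‖ + ‖osc φ T t‖) := by ring
    _ ≤ 2 ^ q * (C * (1 + |T|) ^ q + (∫ s, ‖φ s‖) * (1 + |T|) ^ q) := by
      refine mul_le_mul_of_nonneg_left (add_le_add (H T t) ?_) (by positivity)
      · refine (norm_osc_le φ T t).trans (le_mul_of_one_le_right (by positivity) ?_)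
        exact one_le_pow₀ (by linarith [abs_nonneg T])
    _ = _ := by ring

lemma continuous_osc {φ : ℝ → ℂ} (hi : Integrable φ) :
    Continuous fun x : ℝ × ℝ => osc φ x.1 x.2 := by
  unfold osc
  refine continuous_of_dominated (bound := fun ξ => ‖φ ξ‖)
    (fun x => (integrable_osc hi x.1 x.2).aestronglyMeasurable) ?_ hi.norm ?_
  · exact fun x => Filter.Eventually.of_forall fun ξ => by simp
  · exact Filter.Eventually.of_forall fun ξ => by fun_prop

lemma integrable_osc_zero {φ : ℝ → ℂ} (hφ : ContDiff ℝ ∞ φ) (hc : HasCompactSupport φ) :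
    Integrable (osc φ 0) := by
  obtain ⟨C, hC, H⟩ := osc_decay hφ hc 2
  have hi : Integrable φ := hφ.continuous.integrable_of_hasCompactSupport hc
  have hcont : Continuous (osc φ 0) :=
    (continuous_osc hi).comp (by fun_prop : Continuous fun t : ℝ => ((0 : ℝ), t))
  have h1 : Integrable (fun t : ℝ => C * (1 + ‖t‖) ^ (-2 : ℝ)) :=
    (integrable_one_add_norm (by simp)).const_mul C
  refine h1.mono' hcont.aestronglyMeasurable (Filter.Eventually.of_forall fun t => ?_)
  have h2 := H 0 t
  have h3 : (0 : ℝ) < 1 + |t| := by positivity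
  rw [Real.norm_eq_abs, Real.rpow_neg h3.le, ← div_eq_mul_inv, le_div_iff₀ (by positivity)]
  norm_cast
  simpa [mul_comm] using h2

lemma integral_osc_zero_mul_ch {φ : ℝ → ℂ} (hφ : ContDiff ℝ ∞ φ) (hc : HasCompactSupport φ)
    (s : ℝ) : ∫ t, osc φ 0 t * ch (-(s * t)) = φ s := by
  have hi : Integrable φ := hφ.continuous.integrable_of_hasCompactSupport hc
  have e0 : ∀ t : ℝ, ((Real.fourierChar t : Circle) : ℂ) = ch t := by
    intro t
    rw [Real.fourierChar_apply, ch]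
    congr 1
    push_cast
    ring
  have e1 : 𝓕⁻ φ = osc φ 0 := by
    funext t
    rw [Real.fourierInv_eq]
    unfold osc
    congr 1
    funext v
    rw [Circle.smul_def, e0, smul_eq_mul, mul_comm]
    simp [mul_comm]
  have e2 : 𝓕 φ = fun t => osc φ 0 (-t) := by
    funext t
    rw [← e1, Real.fourierInv_eq_fourier_neg, neg_neg]
  have e3 : Integrable (𝓕 φ) := by
    rw [e2]; exact (integrable_osc_zero hφ hc).comp_neg
  have e4 := hφ.continuous.fourier_fourierInv_eq hi e3
  rw [e1] at e4
  have e5 := congrFun e4 s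
  rw [Real.fourier_eq] at e5
  rw [← e5]
  congr 1
  funext v
  rw [Circle.smul_def, e0, smul_eq_mul, mul_comm]
  simp

/-- A smooth bump supported in `[-1/2, 1/2]`. -/
noncomputable def bumpS : ContDiffBump (0 : ℝ) := ⟨1 / 4, 1 / 2, by norm_num, by norm_num⟩

/-- A smooth bump equal to one on `[-2, 2]`. -/
noncomputable def bumpL : ContDiffBump (0 : ℝ) := ⟨2, 3, by norm_num, by norm_num⟩

/-- A bump function with complex values. -/
noncomputable def cb (b : ContDiffBump (0 : ℝ)) (s : ℝ) : ℂ := (b s : ℝ)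

lemma contDiff_cb (b : ContDiffBump (0 : ℝ)) : ContDiff ℝ ∞ (cb b) :=
  Complex.ofRealCLM.contDiff.comp b.contDiff

lemma hasCompactSupport_cb (b : ContDiffBump (0 : ℝ)) : HasCompactSupport (cb b) :=
  b.hasCompactSupport.comp_left (g := fun x : ℝ => (x : ℂ)) (by simp)

lemma continuous_cb (b : ContDiffBump (0 : ℝ)) : Continuous (cb b) := (contDiff_cb b).continuous

lemma integrable_cb (b : ContDiffBump (0 : ℝ)) : Integrable (cb b) :=
  (continuous_cb b).integrable_of_hasCompactSupport (hasCompactSupport_cb b)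

lemma norm_cb_le (b : ContDiffBump (0 : ℝ)) (s : ℝ) : ‖cb b s‖ ≤ 1 := by
  unfold cb
  rw [Complex.norm_real, Real.norm_eq_abs, abs_of_nonneg b.nonneg]
  exact b.le_one

lemma cb_bumpS_eq_zero {s : ℝ} (hs : 1 / 2 ≤ |s|) : cb bumpS s = 0 := by
  unfold cb
  rw [bumpS.zero_of_le_dist (x := s) (by simpa [bumpS] using hs)]
  simp

lemma cb_bumpL_eq_one {s : ℝ} (hs : |s| ≤ 2) : cb bumpL s = 1 := by
  unfold cb
  rw [bumpL.one_of_mem_closedBall (by simpa [bumpL] using hs)]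
  simp

/-- The inverse Fourier transform of a bump. -/
noncomputable def kb (b : ContDiffBump (0 : ℝ)) (t : ℝ) : ℂ := osc (cb b) 0 t

lemma continuous_kb (b : ContDiffBump (0 : ℝ)) : Continuous (kb b) :=
  (continuous_osc (integrable_cb b)).comp (by fun_prop : Continuous fun t : ℝ => ((0 : ℝ), t))

lemma integrable_kb (b : ContDiffBump (0 : ℝ)) : Integrable (kb b) :=
  integrable_osc_zero (contDiff_cb b) (hasCompactSupport_cb b)

lemma integral_kb_mul_ch (b : ContDiffBump (0 : ℝ)) (s : ℝ) :
    ∫ t, kb b t * ch (-(s * t)) = cb b s :=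
  integral_osc_zero_mul_ch (contDiff_cb b) (hasCompactSupport_cb b) s

lemma kb_decay (b : ContDiffBump (0 : ℝ)) (q : ℕ) :
    ∃ C : ℝ, 0 ≤ C ∧ ∀ t, (1 + |t|) ^ q * ‖kb b t‖ ≤ C := by
  obtain ⟨C, hC, H⟩ := osc_decay (contDiff_cb b) (hasCompactSupport_cb b) q
  exact ⟨C, hC, fun t => by simpa [kb] using H 0 t⟩

lemma kb_bumpS_lower : ∃ c : ℝ, 0 < c ∧ ∀ t, |t| ≤ 1 / 3 → c ≤ ‖kb bumpS t‖ := by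
  have hpos : 0 < ∫ s, bumpS s := bumpS.integral_pos
  refine ⟨(1 / 2) * ∫ s, bumpS s, by positivity, fun t ht => ?_⟩
  have hre : (kb bumpS t).re = ∫ s, bumpS s * Real.cos (2 * Real.pi * (t * s)) := by
    unfold kb osc
    have := integral_re (𝕜 := ℂ) (integrable_osc (integrable_cb bumpS) 0 t)
    rw [RCLike.re_eq_complex_re] at this
    rw [← this]
    congr 1
    funext s
    simp only [cb, Complex.re_ofReal_mul]
    congr 1
    unfold ch
    rw [show 2 * (Real.pi : ℂ) * Complex.I * ((0 * s ^ 2 + t * s : ℝ) : ℂ)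
      = ((2 * Real.pi * (t * s) : ℝ) : ℂ) * Complex.I by push_cast; ring]
    exact Complex.exp_ofReal_mul_I_re _
  have hint : Integrable bumpS :=
    bumpS.continuous.integrable_of_hasCompactSupport bumpS.hasCompactSupport
  calc (1 / 2) * ∫ s, bumpS s = ∫ s, (1 / 2) * bumpS s := by rw [integral_const_mul]
    _ ≤ ∫ s, bumpS s * Real.cos (2 * Real.pi * (t * s)) := by
      refine integral_mono (hint.const_mul _) ?_ fun s => ?_
      · refine hint.mono (Continuous.aestronglyMeasurable ?_) (Filter.Eventually.of_forall ?_)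
        · have := bumpS.continuous
          fun_prop
        · intro s
          rw [norm_mul]
          exact mul_le_of_le_one_right (norm_nonneg _) (Real.abs_cos_le_one _)
      · by_cases hs : 1 / 2 ≤ |s|
        · rw [bumpS.zero_of_le_dist (x := s) (by simpa [bumpS] using hs)]
          simp
        · rw [mul_comm]
          refine mul_le_mul_of_nonneg_left ?_ bumpS.nonneg
          rw [← Real.cos_abs, ← Real.cos_pi_div_three]
          refine Real.cos_le_cos_of_nonneg_of_le_pi (abs_nonneg _)
            (by linarith [Real.pi_pos]) ?_
          rw [abs_mul, abs_of_pos (by positivity : 0 < 2 * Real.pi), abs_mul]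
          have : |t| * |s| ≤ 1 / 3 * (1 / 2) :=
            mul_le_mul ht (not_le.1 hs).le (abs_nonneg _) (by norm_num)
          nlinarith [Real.pi_pos]
    _ = (kb bumpS t).re := hre.symm
    _ ≤ ‖kb bumpS t‖ := Complex.re_le_norm _

/-- Fubini for an oscillatory superposition against an integrable kernel. -/
lemma integral_osc_mul_kernel {X : Type*} [MeasurableSpace X] {μ : Measure X} [SFinite μ]
    {G : X → ℂ} (hG : Integrable G μ) {h : X → ℝ} (hh : Measurable h) {κ : ℝ → ℂ}
    (hκ : Integrable κ) :
    ∫ τ, (∫ x, G x * ch (-(h x * τ)) ∂μ) * κ τ = ∫ x, G x * (∫ τ, κ τ * ch (-(h x * τ))) ∂μ := by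
  have h1 : Integrable (Function.uncurry fun (τ : ℝ) (x : X) => G x * ch (-(h x * τ)) * κ τ)
      (volume.prod μ) := by
    have := (hκ.mul_prod hG).mul_ch (f := fun z : ℝ × X => -(h z.2 * z.1)) (by fun_prop)
    refine this.congr (Filter.Eventually.of_forall fun z => ?_)
    simp only [Function.uncurry]
    ring
  calc ∫ τ, (∫ x, G x * ch (-(h x * τ)) ∂μ) * κ τ
      = ∫ τ, ∫ x, G x * ch (-(h x * τ)) * κ τ ∂μ := by simp_rw [integral_mul_const]
    _ = ∫ x, (∫ τ, G x * ch (-(h x * τ)) * κ τ) ∂μ := integral_integral_swap h1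
    _ = _ := by
      congr 1
      funext x
      rw [← integral_const_mul]
      congr 1
      funext τ
      ring

lemma integral_kb_scaled (b : ContDiffBump (0 : ℝ)) {R : ℝ} (hR : 0 < R) (s : ℝ) :
    ∫ t, ((R⁻¹ : ℝ) : ℂ) * kb b (t / R) * ch (-(s * t)) = cb b (R * s) := by
  rw [← integral_kb_mul_ch b (R * s)]
  have h := Measure.integral_comp_div (fun t => kb b t * ch (-(R * s * t))) R
  have e : ∀ t : ℝ, ((R⁻¹ : ℝ) : ℂ) * kb b (t / R) * ch (-(s * t)) =
      ((R⁻¹ : ℝ) : ℂ) * ((fun t => kb b t * ch (-(R * s * t))) (t / R)) := by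
    intro t
    have : R * s * (t / R) = s * t := by field_simp
    simp only [this]
    ring
  simp_rw [e]
  rw [integral_const_mul, h, abs_of_pos hR, Complex.real_smul, ← mul_assoc]
  simp [hR.ne']

lemma integrable_kb_scaled (b : ContDiffBump (0 : ℝ)) {R : ℝ} (hR : 0 < R) :
    Integrable fun t => ((R⁻¹ : ℝ) : ℂ) * kb b (t / R) :=
  ((integrable_kb b).comp_div hR.ne').const_mul _

end

lemma lintegral_mul_rpow_le {X : Type*} [MeasurableSpace X] {μ : Measure X} {q : ℝ} (hq : 1 ≤ q)
    {f k : X → ℝ≥0∞} (hf : AEMeasurable f μ) (hk : AEMeasurable k μ) :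
    (∫⁻ x, f x * k x ∂μ) ^ q ≤ (∫⁻ x, k x ∂μ) ^ (q - 1) * ∫⁻ x, f x ^ q * k x ∂μ := by
  have hq0 : 0 < q := by linarith
  have hq1 : q⁻¹ ≤ 1 := inv_le_one_of_one_le₀ hq
  have h := ENNReal.lintegral_mul_norm_pow_le (μ := μ) ((hf.pow_const q).mul hk) hk
    (p := q⁻¹) (q := 1 - q⁻¹) (by positivity) (by linarith) (by ring)
  have e : ∀ x, ((fun x => f x ^ q) * k) x ^ q⁻¹ * k x ^ (1 - q⁻¹) = f x * k x := by
    intro x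
    rw [Pi.mul_apply, ENNReal.mul_rpow_of_nonneg _ _ (by positivity), ← ENNReal.rpow_mul,
      mul_inv_cancel₀ hq0.ne', ENNReal.rpow_one, mul_assoc,
      ← ENNReal.rpow_add_of_nonneg _ _ (by positivity) (by linarith)]
    simp
  simp_rw [e] at h
  refine (ENNReal.rpow_le_rpow h hq0.le).trans (le_of_eq ?_)
  rw [ENNReal.mul_rpow_of_nonneg _ _ hq0.le, ← ENNReal.rpow_mul, ← ENNReal.rpow_mul,
    inv_mul_cancel₀ hq0.ne', ENNReal.rpow_one, mul_comm]
  congr 2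
  field_simp

lemma lintegral_sum_rpow_le {X ι : Type*} [MeasurableSpace X] {μ : Measure X} {q : ℝ} (hq : 1 ≤ q)
    (s : Finset ι) {f : ι → X → ℝ≥0∞} (hf : ∀ i ∈ s, AEMeasurable (f i) μ) :
    (∫⁻ x, (∑ i ∈ s, f i x) ^ q ∂μ) ^ (1 / q) ≤ ∑ i ∈ s, (∫⁻ x, f i x ^ q ∂μ) ^ (1 / q) := by
  have hq0 : 0 < q := by linarith
  classical
  induction s using Finset.induction_on with
  | empty => simp [hq0]
  | insert i s hi ih =>
    have h1 := ENNReal.lintegral_Lp_add_le (μ := μ) (hf i (Finset.mem_insert_self i s))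
      (Finset.aemeasurable_fun_sum s fun j hj => hf j (Finset.mem_insert_of_mem hj)) hq
    simp only [Pi.add_apply] at h1
    simp_rw [Finset.sum_insert hi]
    exact h1.trans (add_le_add le_rfl (ih fun j hj => hf j (Finset.mem_insert_of_mem hj)))

lemma lintegral_sum_rpow_le' {X ι : Type*} [MeasurableSpace X] {μ : Measure X} {q : ℝ}
    (hq : 1 ≤ q) (s : Finset ι) {f : ι → X → ℝ≥0∞} (hf : ∀ i ∈ s, AEMeasurable (f i) μ) :
    ∫⁻ x, (∑ i ∈ s, f i x) ^ q ∂μ ≤ (∑ i ∈ s, (∫⁻ x, f i x ^ q ∂μ) ^ (1 / q)) ^ q := by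
  have hq0 : 0 < q := by linarith
  have := ENNReal.rpow_le_rpow (lintegral_sum_rpow_le hq s hf) hq0.le
  rwa [← ENNReal.rpow_mul, one_div_mul_cancel hq0.ne', ENNReal.rpow_one] at this

lemma sum_rpow_mul_rpow_le {ι : Type*} (s : Finset ι) (a b : ι → ℝ≥0∞) {u v : ℝ} (hu : 0 ≤ u)
    (hv : 0 ≤ v) (huv : u + v = 1) :
    ∑ i ∈ s, a i ^ u * b i ^ v ≤ (∑ i ∈ s, a i) ^ u * (∑ i ∈ s, b i) ^ v := by
  let _ : MeasurableSpace ι := ⊤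
  have h := ENNReal.lintegral_mul_norm_pow_le (μ := ∑ i ∈ s, Measure.dirac i) (f := a) (g := b)
    measurable_from_top.aemeasurable measurable_from_top.aemeasurable hu hv huv
  simpa [lintegral_finsetSum_measure, lintegral_dirac' _ measurable_from_top] using h

lemma lintegral_sq_le {X : Type*} [MeasurableSpace X] {μ : Measure X}
    {f g : X → ℝ≥0∞} (hf : AEMeasurable f μ) (hg : AEMeasurable g μ) {u : ℝ} :
    ∫⁻ x, f x ^ u * g x ^ u ∂μ ≤
      (∫⁻ x, f x ^ (2 * u) ∂μ) ^ (1 / 2 : ℝ) * (∫⁻ x, g x ^ (2 * u) ∂μ) ^ (1 / 2 : ℝ) := by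
  have h := ENNReal.lintegral_mul_norm_pow_le (μ := μ) (hf.pow_const (2 * u))
    (hg.pow_const (2 * u)) (p := 1 / 2) (q := 1 / 2) (by norm_num) (by norm_num) (by norm_num)
  simpa [← ENNReal.rpow_mul, show 2 * u * 2⁻¹ = u by ring] using h

/-- The bracket `1 + ‖z‖ / R`. -/
noncomputable def br {E : Type*} [NormedAddCommGroup E] (R : ℝ) (z : E) : ℝ≥0∞ :=
  ENNReal.ofReal (1 + ‖z‖ / R)

section br
variable {E : Type*} [NormedAddCommGroup E]

lemma one_le_br {R : ℝ} (hR : 0 < R) (z : E) : 1 ≤ br R z := by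
  rw [br, ENNReal.one_le_ofReal]
  have : 0 ≤ ‖z‖ / R := by positivity
  linarith

lemma br_ne_top (R : ℝ) (z : E) : br R z ≠ ⊤ := ENNReal.ofReal_ne_top

lemma br_ne_zero {R : ℝ} (hR : 0 < R) (z : E) : br R z ≠ 0 :=
  (zero_lt_one.trans_le (one_le_br hR z)).ne'

lemma br_neg (R : ℝ) (z : E) : br R (-z) = br R z := by simp [br]

lemma br_sub_comm (R : ℝ) (y z : E) : br R (y - z) = br R (z - y) := by
  rw [← br_neg, neg_sub]

lemma br_mono {R : ℝ} (hR : 0 < R) {E' : Type*} [NormedAddCommGroup E'] {y : E} {z : E'}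
    (h : ‖y‖ ≤ ‖z‖) : br R y ≤ br R z := by
  unfold br; gcongr

lemma br_anti {r R : ℝ} (hr : 0 < r) (hrR : r ≤ R) (z : E) : br R z ≤ br r z := by
  unfold br; gcongr

lemma br_add_le {R : ℝ} (hR : 0 < R) (y z : E) : br R (y + z) ≤ br R y * br R z := by
  unfold br
  rw [← ENNReal.ofReal_mul (by positivity)]
  apply ENNReal.ofReal_le_ofReal
  have h1 : ‖y + z‖ / R ≤ ‖y‖ / R + ‖z‖ / R := by rw [← add_div]; gcongr; exact norm_add_le _ _
  have h2 : 0 ≤ ‖y‖ / R * (‖z‖ / R) := by positivity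
  nlinarith

lemma br_add_le' {R : ℝ} (hR : 0 < R) (y z : E) : br R (y + z) ≤ br R y + br R z := by
  unfold br
  rw [← ENNReal.ofReal_add (by positivity) (by positivity)]
  apply ENNReal.ofReal_le_ofReal
  have h1 : ‖y + z‖ / R ≤ ‖y‖ / R + ‖z‖ / R := by rw [← add_div]; gcongr; exact norm_add_le _ _
  linarith

lemma br_inv_add_le {R : ℝ} (hR : 0 < R) (y z : E) :
    (br R y)⁻¹ ≤ br R z * (br R (y + z))⁻¹ := by
  rw [ENNReal.inv_le_iff_inv_le, ENNReal.mul_inv (Or.inl (br_ne_zero hR _))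
    (Or.inl (br_ne_top _ _)), inv_inv, mul_comm, ← div_eq_mul_inv]
  exact ENNReal.div_le_of_le_mul (br_add_le hR y z)

lemma br_inv_le_one {R : ℝ} (hR : 0 < R) (z : E) : (br R z)⁻¹ ≤ 1 :=
  ENNReal.inv_le_one.2 (one_le_br hR z)

lemma br_le_two {R : ℝ} (hR : 0 < R) {z : E} (hz : ‖z‖ ≤ R) : br R z ≤ 2 := by
  rw [br, ← ENNReal.ofReal_ofNat]
  apply ENNReal.ofReal_le_ofReal
  have : ‖z‖ / R ≤ 1 := (div_le_one hR).2 hz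
  linarith

@[fun_prop] lemma continuous_br (R : ℝ) : Continuous (br R : E → ℝ≥0∞) := by
  unfold br
  exact ENNReal.continuous_ofReal.comp (by fun_prop)

@[fun_prop] lemma measurable_br [MeasurableSpace E] [BorelSpace E] (R : ℝ) :
    Measurable (br R : E → ℝ≥0∞) := (continuous_br R).measurable

end br

lemma br_pow_inv_le {E : Type*} [NormedAddCommGroup E] {R : ℝ} (hR : 0 < R) {a b : ℕ} (h : a ≤ b)
    (z : E) : ((br R z)⁻¹) ^ b ≤ ((br R z)⁻¹) ^ a := by
  exact pow_le_pow_right_of_le_one' (br_inv_le_one hR z) h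

lemma exists_lintegral_br_real : ∃ C : ℝ≥0, ∀ R : ℝ, 0 < R →
    ∫⁻ t : ℝ, ((br R t)⁻¹) ^ 2 ≤ C * ENNReal.ofReal R := by
  have h1 : ∫⁻ t : ℝ, ((br 1 t)⁻¹) ^ 2 < ⊤ := by
    have := finite_integral_one_add_norm (E := ℝ) (μ := volume) (r := 2) (by simp)
    refine lt_of_le_of_lt (lintegral_mono fun t => ?_) this
    rw [br, div_one, ← ENNReal.ofReal_inv_of_pos (by positivity), ← ENNReal.ofReal_pow (by positivity),
      Real.rpow_neg (by positivity)]
    norm_cast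
    rw [inv_pow]
  refine ⟨(∫⁻ t : ℝ, ((br 1 t)⁻¹) ^ 2).toNNReal, fun R hR => ?_⟩
  rw [ENNReal.coe_toNNReal h1.ne]
  have e : ∀ t : ℝ, br R t = br 1 (R⁻¹ * t) := by
    intro t
    simp only [br, norm_mul, div_one, norm_inv, Real.norm_eq_abs, abs_of_pos hR]
    congr 2
    field_simp
  simp_rw [e]
  have hm := Real.map_volume_mul_left (inv_pos.2 hR).ne'
  rw [← lintegral_map (f := fun t : ℝ => ((br 1 t)⁻¹) ^ 2) (by fun_prop) (measurable_const_mul R⁻¹),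
    hm, lintegral_smul_measure, inv_inv, abs_of_pos hR, smul_eq_mul, mul_comm]

lemma exists_lintegral_br_plane : ∃ C : ℝ≥0, ∀ R : ℝ, 0 < R →
    ∫⁻ z : ℝ × ℝ, ((br R z)⁻¹) ^ 4 ≤ C * ENNReal.ofReal R ^ 2 := by
  obtain ⟨C, hC⟩ := exists_lintegral_br_real
  refine ⟨C ^ 2, fun R hR => ?_⟩
  calc ∫⁻ z : ℝ × ℝ, ((br R z)⁻¹) ^ 4
      ≤ ∫⁻ z : ℝ × ℝ, ((br R z.1)⁻¹) ^ 2 * ((br R z.2)⁻¹) ^ 2 := by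
        refine lintegral_mono fun z => ?_
        rw [show 4 = 2 + 2 from rfl, pow_add]
        gcongr
        · exact br_mono hR (norm_fst_le z)
        · exact br_mono hR (norm_snd_le z)
    _ = (∫⁻ t : ℝ, ((br R t)⁻¹) ^ 2) * ∫⁻ t : ℝ, ((br R t)⁻¹) ^ 2 := by
        rw [Measure.volume_eq_prod]
        exact lintegral_prod_mul (f := fun t : ℝ => ((br R t)⁻¹) ^ 2)
          (g := fun t : ℝ => ((br R t)⁻¹) ^ 2) (by fun_prop) (by fun_prop)
    _ ≤ (C * ENNReal.ofReal R) * (C * ENNReal.ofReal R) := by gcongr <;> exact hC R hR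
    _ = _ := by push_cast; ring

/-- The `L¹`-normalized weight at scale `R`. -/
noncomputable def Om (R : ℝ) (z : ℝ × ℝ) : ℝ≥0∞ :=
  (ENNReal.ofReal R)⁻¹ ^ 2 * ((br R z)⁻¹) ^ 104

@[fun_prop] lemma measurable_Om (R : ℝ) : Measurable (Om R) := by
  unfold Om; fun_prop

lemma Om_neg (R : ℝ) (z : ℝ × ℝ) : Om R (-z) = Om R z := by simp [Om, br_neg]

lemma Om_sub_comm (R : ℝ) (y z : ℝ × ℝ) : Om R (y - z) = Om R (z - y) := by
  rw [← Om_neg, neg_sub]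

lemma Om_le (R : ℝ) (hR : 0 < R) (z : ℝ × ℝ) : Om R z ≤ (ENNReal.ofReal R)⁻¹ ^ 2 :=
  mul_le_of_le_one_right' (pow_le_one' (br_inv_le_one hR z) _)

lemma ofReal_inv_sq_mul {R : ℝ} (hR : 0 < R) :
    (ENNReal.ofReal R)⁻¹ ^ 2 * ENNReal.ofReal R ^ 2 = 1 := by
  rw [← mul_pow, ENNReal.inv_mul_cancel (by simpa using hR) ENNReal.ofReal_ne_top, one_pow]

lemma exists_normalized_br : ∃ C : ℝ≥0, ∀ R : ℝ, 0 < R → ∀ b : ℕ, 4 ≤ b →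
    ∫⁻ z : ℝ × ℝ, (ENNReal.ofReal R)⁻¹ ^ 2 * ((br R z)⁻¹) ^ b ≤ C := by
  obtain ⟨C, hC⟩ := exists_lintegral_br_plane
  refine ⟨C, fun R hR b hb => ?_⟩
  rw [lintegral_const_mul _ (by fun_prop)]
  calc _ ≤ (ENNReal.ofReal R)⁻¹ ^ 2 * (C * ENNReal.ofReal R ^ 2) := by
        gcongr
        exact (lintegral_mono fun z => br_pow_inv_le hR hb z).trans (hC R hR)
    _ = C * ((ENNReal.ofReal R)⁻¹ ^ 2 * ENNReal.ofReal R ^ 2) := by ring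
    _ = C := by rw [ofReal_inv_sq_mul hR, mul_one]

/-- `w` varies slowly at scale `R`. -/
def Slow (A : ℝ≥0) (R : ℝ) (w : ℝ × ℝ → ℝ≥0∞) : Prop :=
  ∀ y z, w y ≤ A * w z * br R (y - z) ^ 100

lemma br_mul_inv {E : Type*} [NormedAddCommGroup E] {R : ℝ} (hR : 0 < R) (z : E) :
    br R z * (br R z)⁻¹ = 1 := ENNReal.mul_inv_cancel (br_ne_zero hR z) (br_ne_top R z)

lemma Slow.mono {A : ℝ≥0} {r R : ℝ} {w : ℝ × ℝ → ℝ≥0∞} (h : Slow A R w) (hr : 0 < r)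
    (hrR : r ≤ R) : Slow A r w := fun y z => (h y z).trans (by gcongr; exact br_anti hr hrR _)

lemma exists_slow_conv : ∃ C : ℝ≥0, ∀ (A : ℝ≥0) (R : ℝ), 0 < R → ∀ w : ℝ × ℝ → ℝ≥0∞,
    Slow A R w → ∀ x, ∫⁻ y, w y * Om R (y - x) ≤ C * A * w x := by
  obtain ⟨C, hC⟩ := exists_normalized_br
  refine ⟨C, fun A R hR w hw x => ?_⟩
  calc ∫⁻ y, w y * Om R (y - x)
      ≤ ∫⁻ y, (A * w x) * ((ENNReal.ofReal R)⁻¹ ^ 2 * ((br R (y - x))⁻¹) ^ 4) := by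
        refine lintegral_mono fun y => ?_
        calc w y * Om R (y - x) ≤ (A * w x * br R (y - x) ^ 100) * Om R (y - x) := by
              gcongr; exact hw y x
          _ = (A * w x) * ((ENNReal.ofReal R)⁻¹ ^ 2 * ((br R (y - x))⁻¹) ^ 4) *
              (br R (y - x) * (br R (y - x))⁻¹) ^ 100 := by
              rw [Om]; ring
          _ = _ := by rw [br_mul_inv hR]; simp
    _ = (A * w x) * ∫⁻ y, (ENNReal.ofReal R)⁻¹ ^ 2 * ((br R (y - x))⁻¹) ^ 4 := by
        rw [lintegral_const_mul _ (by fun_prop)]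
    _ ≤ (A * w x) * C := by
        gcongr
        rw [lintegral_sub_right_eq_self
          (fun y : ℝ × ℝ => (ENNReal.ofReal R)⁻¹ ^ 2 * ((br R y)⁻¹) ^ 4) x]
        exact hC R hR 4 le_rfl
    _ = _ := by ring

lemma volume_closedBall_plane (y : ℝ × ℝ) (ρ : ℝ) :
    volume (Metric.closedBall y ρ) = 4 * ENNReal.ofReal ρ ^ 2 := by
  rw [← closedBall_prod_same, Measure.volume_eq_prod, Measure.prod_prod, Real.volume_closedBall,
    Real.volume_closedBall, ENNReal.ofReal_mul (by norm_num)]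
  norm_num
  ring

lemma Slow.le_average {A : ℝ≥0} {R ρ : ℝ} {w : ℝ × ℝ → ℝ≥0∞} (h : Slow A R w) (hρ : 0 < ρ)
    (hρR : ρ ≤ R) (y : ℝ × ℝ) :
    w y ≤ A * 2 ^ 100 * ((ENNReal.ofReal ρ)⁻¹ ^ 2 * ∫⁻ x in Metric.closedBall y ρ, w x) := by
  have h1 : ∀ x ∈ Metric.closedBall y ρ, w y ≤ A * 2 ^ 100 * w x := by
    intro x hx
    refine (h y x).trans ?_
    rw [mul_right_comm]
    gcongr
    refine br_le_two (hρ.trans_le hρR) (le_trans ?_ hρR)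
    rw [← dist_eq_norm, dist_comm]
    exact hx
  have h2 : w y * volume (Metric.closedBall y ρ) ≤
      A * 2 ^ 100 * ∫⁻ x in Metric.closedBall y ρ, w x := by
    rw [← lintegral_const_mul' _ _ (ENNReal.mul_ne_top ENNReal.coe_ne_top (by simp)),
      ← setLIntegral_const]
    exact setLIntegral_mono' Metric.isClosed_closedBall.measurableSet h1
  rw [volume_closedBall_plane y ρ] at h2
  calc w y = (w y * 1) * ((ENNReal.ofReal ρ)⁻¹ ^ 2 * ENNReal.ofReal ρ ^ 2) := by
        rw [ofReal_inv_sq_mul hρ]; simp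
    _ ≤ (w y * 4) * ((ENNReal.ofReal ρ)⁻¹ ^ 2 * ENNReal.ofReal ρ ^ 2) := by gcongr; norm_num
    _ = (ENNReal.ofReal ρ)⁻¹ ^ 2 * (w y * (4 * ENNReal.ofReal ρ ^ 2)) := by ring
    _ ≤ (ENNReal.ofReal ρ)⁻¹ ^ 2 * (A * 2 ^ 100 * ∫⁻ x in Metric.closedBall y ρ, w x) := by gcongr
    _ = _ := by ring

lemma br_ratio {r R : ℝ} (hr : 0 < r) (hrR : r ≤ R) (z : ℝ × ℝ) :
    br R z * (br r z)⁻¹ ≤ ENNReal.ofReal (r / R) + (br r z)⁻¹ := by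
  have hR : 0 < R := hr.trans_le hrR
  have e : br R z ≤ ENNReal.ofReal (r / R) * br r z + 1 := by
    unfold br
    rw [← ENNReal.ofReal_mul (by positivity), ← ENNReal.ofReal_one, ← ENNReal.ofReal_add
      (by positivity) (by norm_num)]
    apply ENNReal.ofReal_le_ofReal
    have : r / R * (1 + ‖z‖ / r) = r / R + ‖z‖ / R := by field_simp
    rw [this]
    have : 0 < r / R := by positivity
    linarith
  calc br R z * (br r z)⁻¹ ≤ (ENNReal.ofReal (r / R) * br r z + 1) * (br r z)⁻¹ := by gcongr
    _ = ENNReal.ofReal (r / R) * (br r z * (br r z)⁻¹) + (br r z)⁻¹ := by ring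
    _ = _ := by rw [br_mul_inv hr, mul_one]

lemma add_pow_le_two_pow (a b : ℝ≥0∞) (n : ℕ) : (a + b) ^ n ≤ 2 ^ n * (a ^ n + b ^ n) := by
  rcases le_total a b with h | h
  · calc (a + b) ^ n ≤ (b + b) ^ n := by gcongr
      _ = 2 ^ n * b ^ n := by rw [← two_mul, mul_pow]
      _ ≤ _ := by gcongr; exact le_add_self
  · calc (a + b) ^ n ≤ (a + a) ^ n := by gcongr
      _ = 2 ^ n * a ^ n := by rw [← two_mul, mul_pow]
      _ ≤ _ := by gcongr; exact le_self_add

lemma exists_Om_conv : ∃ C : ℝ≥0, ∀ r R : ℝ, 0 < r → r ≤ R → ∀ z,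
    ∫⁻ u, Om R (z - u) * Om r u ≤ C * Om R z := by
  obtain ⟨C, hC⟩ := exists_normalized_br
  refine ⟨2 ^ 104 * (C + 2 ^ 104 * (C + C)), fun r R hr hrR z => ?_⟩
  have hR : 0 < R := hr.trans_le hrR
  set ρ := (ENNReal.ofReal R)⁻¹ ^ 2
  have hC1 : ∫⁻ u, Om r u ≤ C := hC r hr 104 (by norm_num)
  have hC2 : ∫⁻ u, Om R (z - u) ≤ C := by
    rw [lintegral_sub_left_eq_self (Om R) z]; exact hC R hR 104 (by norm_num)
  have hscale : (ENNReal.ofReal r)⁻¹ ^ 2 * ENNReal.ofReal (r / R) ^ 104 ≤ ρ := by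
    have h1 : ENNReal.ofReal (r / R) ≤ 1 := by
      rw [ENNReal.ofReal_le_one]; exact (div_le_one hR).2 hrR
    calc (ENNReal.ofReal r)⁻¹ ^ 2 * ENNReal.ofReal (r / R) ^ 104
        ≤ (ENNReal.ofReal r)⁻¹ ^ 2 * ENNReal.ofReal (r / R) ^ 2 := by
          gcongr 1; exact pow_le_pow_right_of_le_one' h1 (by norm_num)
      _ = ((ENNReal.ofReal r)⁻¹ ^ 2 * ENNReal.ofReal r ^ 2) * ρ := by
          rw [ENNReal.ofReal_div_of_pos hR, div_eq_mul_inv]; ring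
      _ = ρ := by rw [ofReal_inv_sq_mul hr, one_mul]
  have key : ∀ u, br R z ^ 104 * (Om R (z - u) * Om r u) ≤ 2 ^ 104 * (ρ * Om r u +
      2 ^ 104 * (ρ * Om R (z - u) +
        ρ * ((ENNReal.ofReal r)⁻¹ ^ 2 * ((br r u)⁻¹) ^ 104))) := by
    intro u
    have h1 : br R z ^ 104 ≤ 2 ^ 104 * (br R (z - u) ^ 104 + br R u ^ 104) := by
      refine le_trans ?_ (add_pow_le_two_pow _ _ _)
      gcongr
      calc br R z = br R ((z - u) + u) := by simp
        _ ≤ _ := br_add_le' hR _ _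
    have h2 : br R (z - u) ^ 104 * Om R (z - u) = ρ := by
      rw [Om, mul_left_comm, ← mul_pow, br_mul_inv hR, one_pow, mul_one]
    have h3 : br R u ^ 104 * Om r u ≤ 2 ^ 104 * (ρ +
        (ENNReal.ofReal r)⁻¹ ^ 2 * ((br r u)⁻¹) ^ 104) := by
      calc br R u ^ 104 * Om r u = (ENNReal.ofReal r)⁻¹ ^ 2 * (br R u * (br r u)⁻¹) ^ 104 := by
            rw [Om]; ring
        _ ≤ (ENNReal.ofReal r)⁻¹ ^ 2 * (2 ^ 104 * (ENNReal.ofReal (r / R) ^ 104 +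
            ((br r u)⁻¹) ^ 104)) := by
            gcongr
            refine le_trans ?_ (add_pow_le_two_pow _ _ _)
            gcongr
            exact br_ratio hr hrR u
        _ = 2 ^ 104 * ((ENNReal.ofReal r)⁻¹ ^ 2 * ENNReal.ofReal (r / R) ^ 104 +
            (ENNReal.ofReal r)⁻¹ ^ 2 * ((br r u)⁻¹) ^ 104) := by ring
        _ ≤ _ := by gcongr
    calc br R z ^ 104 * (Om R (z - u) * Om r u)
        ≤ (2 ^ 104 * (br R (z - u) ^ 104 + br R u ^ 104)) * (Om R (z - u) * Om r u) := by gcongr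
      _ = 2 ^ 104 * ((br R (z - u) ^ 104 * Om R (z - u)) * Om r u +
          Om R (z - u) * (br R u ^ 104 * Om r u)) := by ring
      _ ≤ 2 ^ 104 * (ρ * Om r u + Om R (z - u) * (2 ^ 104 * (ρ +
        (ENNReal.ofReal r)⁻¹ ^ 2 * ((br r u)⁻¹) ^ 104))) := by
          rw [h2]; gcongr
      _ = 2 ^ 104 * (ρ * Om r u + 2 ^ 104 * (ρ * Om R (z - u) +
          Om R (z - u) * ((ENNReal.ofReal r)⁻¹ ^ 2 * ((br r u)⁻¹) ^ 104))) := by ring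
      _ ≤ _ := by gcongr; exact Om_le R hR _
  have hint : br R z ^ 104 * ∫⁻ u, Om R (z - u) * Om r u ≤
      2 ^ 104 * (ρ * C + 2 ^ 104 * (ρ * C + ρ * C)) := by
    rw [← lintegral_const_mul _ (by fun_prop)]
    refine (lintegral_mono key).trans ?_
    rw [lintegral_const_mul _ (by fun_prop), lintegral_add_left (by fun_prop),
      lintegral_const_mul _ (by fun_prop), lintegral_const_mul _ (by fun_prop),
      lintegral_add_left (by fun_prop), lintegral_const_mul _ (by fun_prop),
      lintegral_const_mul ρ (by fun_prop)]
    gcongr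
    exact hC r hr 104 (by norm_num)
  calc ∫⁻ u, Om R (z - u) * Om r u
      = ((br R z)⁻¹) ^ 104 * (br R z ^ 104 * ∫⁻ u, Om R (z - u) * Om r u) := by
        rw [← mul_assoc, ← mul_pow, mul_comm _ (br R z), br_mul_inv hR, one_pow, one_mul]
    _ ≤ ((br R z)⁻¹) ^ 104 * (2 ^ 104 * (ρ * C + 2 ^ 104 * (ρ * C + ρ * C))) := by gcongr
    _ = _ := by rw [Om]; push_cast; ring

/-- The `p`-th power of the weighted `L^p` norm, with values in `[0, ∞]`. -/
noncomputable def Np (p : ℝ) (w : ℝ × ℝ → ℝ≥0∞) (f : ℝ × ℝ → ℂ) : ℝ≥0∞ := ∫⁻ x, ‖f x‖ₑ ^ p * w x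

/-- The `[0, ∞]`-valued version of the weight `wB`. -/
noncomputable def WB (c : ℝ × ℝ) (R : ℝ) (x : ℝ × ℝ) : ℝ≥0∞ := ENNReal.ofReal (wB c R x)

lemma norm_le_euclid (z : ℝ × ℝ) : ‖z‖ ≤ Real.sqrt (z.1 ^ 2 + z.2 ^ 2) := by
  rw [Prod.norm_def]
  refine max_le ?_ ?_
  · exact Real.abs_le_sqrt (by nlinarith [sq_nonneg z.2])
  · exact Real.abs_le_sqrt (by nlinarith [sq_nonneg z.1])

lemma euclid_le_norm (z : ℝ × ℝ) : Real.sqrt (z.1 ^ 2 + z.2 ^ 2) ≤ 2 * ‖z‖ := by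
  refine Real.sqrt_le_iff.2 ⟨by positivity, ?_⟩
  have h1 : z.1 ^ 2 ≤ ‖z‖ ^ 2 := sq_le_sq.2 (by rw [abs_norm]; exact norm_fst_le z)
  have h2 : z.2 ^ 2 ≤ ‖z‖ ^ 2 := sq_le_sq.2 (by rw [abs_norm]; exact norm_snd_le z)
  nlinarith [sq_nonneg ‖z‖]

lemma euclid_add_le (y z : ℝ × ℝ) : Real.sqrt ((y + z).1 ^ 2 + (y + z).2 ^ 2) ≤
    Real.sqrt (y.1 ^ 2 + y.2 ^ 2) + Real.sqrt (z.1 ^ 2 + z.2 ^ 2) := by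
  have e : ∀ x : ℝ × ℝ, Real.sqrt (x.1 ^ 2 + x.2 ^ 2) = ‖(⟨x.1, x.2⟩ : ℂ)‖ := fun x => by
    rw [Complex.norm_eq_sqrt_sq_add_sq]
  rw [e, e, e]
  exact norm_add_le (⟨y.1, y.2⟩ : ℂ) ⟨z.1, z.2⟩

lemma continuous_wB (c : ℝ × ℝ) {R : ℝ} (hR : 0 < R) : Continuous (wB c R) := by
  have : wB c R = fun x => ((1 + Real.sqrt ((x.1 - c.1) ^ 2 + (x.2 - c.2) ^ 2) / R) ^ 100)⁻¹ := by
    funext x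
    rw [wB, zpow_neg]; rfl
  rw [this]
  refine Continuous.inv₀ (by fun_prop) fun x => ?_
  positivity

lemma measurable_WB (c : ℝ × ℝ) {R : ℝ} (hR : 0 < R) : Measurable (WB c R) :=
  (continuous_wB c hR).measurable.ennreal_ofReal

lemma WB_eq (c : ℝ × ℝ) {R : ℝ} (hR : 0 < R) (x : ℝ × ℝ) : WB c R x =
    (ENNReal.ofReal (1 + Real.sqrt ((x - c).1 ^ 2 + (x - c).2 ^ 2) / R))⁻¹ ^ 100 := by
  rw [WB, wB, zpow_neg, ENNReal.ofReal_inv_of_pos (by positivity), ← ENNReal.inv_pow]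
  congr 1
  exact ENNReal.ofReal_pow (by positivity) 100

lemma WB_le (c : ℝ × ℝ) {R : ℝ} (hR : 0 < R) (x : ℝ × ℝ) :
    WB c R x ≤ ((br R (x - c))⁻¹) ^ 100 := by
  rw [WB_eq c hR]
  gcongr
  refine ENNReal.ofReal_le_ofReal ?_
  gcongr
  exact norm_le_euclid _

lemma slow_WB (c : ℝ × ℝ) {R : ℝ} (hR : 0 < R) : Slow (2 ^ 100) R (WB c R) := by
  intro y z
  rw [WB_eq c hR, WB_eq c hR]
  have h : (ENNReal.ofReal (1 + Real.sqrt ((z - c).1 ^ 2 + (z - c).2 ^ 2) / R)) ≤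
      2 * br R (y - z) *
      (ENNReal.ofReal (1 + Real.sqrt ((y - c).1 ^ 2 + (y - c).2 ^ 2) / R)) := by
    rw [br, ← ENNReal.ofReal_ofNat, ← ENNReal.ofReal_mul (by positivity),
      ← ENNReal.ofReal_mul (by positivity)]
    apply ENNReal.ofReal_le_ofReal
    have h1 := euclid_add_le (z - y) (y - c)
    have h2 := euclid_le_norm (z - y)
    rw [sub_add_sub_cancel] at h1
    rw [norm_sub_rev] at h2
    set a := Real.sqrt ((z - c).1 ^ 2 + (z - c).2 ^ 2)
    set b := Real.sqrt ((y - c).1 ^ 2 + (y - c).2 ^ 2) with hb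
    have hb0 : 0 ≤ b := Real.sqrt_nonneg _
    have h3 : a / R ≤ 2 * (‖y - z‖ / R) + b / R := by
      rw [← mul_div_assoc, ← add_div]; gcongr; linarith
    have h4 : 0 ≤ ‖y - z‖ / R := by positivity
    have h5 : 0 ≤ b / R := by positivity
    nlinarith [mul_nonneg h4 h5]
  set a := ENNReal.ofReal (1 + Real.sqrt ((z - c).1 ^ 2 + (z - c).2 ^ 2) / R) with ha
  set b := ENNReal.ofReal (1 + Real.sqrt ((y - c).1 ^ 2 + (y - c).2 ^ 2) / R) with hb
  have hb0 : b ≠ 0 := by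
    simp only [hb, ne_eq, ENNReal.ofReal_eq_zero, not_le]; positivity
  have ha0 : a ≠ 0 := by
    simp only [ha, ne_eq, ENNReal.ofReal_eq_zero, not_le]; positivity
  have h' : b⁻¹ ≤ 2 * a⁻¹ * br R (y - z) := by
    calc b⁻¹ = a⁻¹ * a * b⁻¹ := by
          rw [ENNReal.inv_mul_cancel ha0 ENNReal.ofReal_ne_top, one_mul]
      _ ≤ a⁻¹ * (2 * br R (y - z) * b) * b⁻¹ := by gcongr
      _ = a⁻¹ * (2 * br R (y - z)) * (b * b⁻¹) := by ring
      _ = 2 * a⁻¹ * br R (y - z) := by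
          rw [ENNReal.mul_inv_cancel hb0 ENNReal.ofReal_ne_top]; ring
  calc b⁻¹ ^ 100 ≤ (2 * a⁻¹ * br R (y - z)) ^ 100 := by gcongr
    _ = _ := by push_cast; ring

lemma lintegral_WB_lt_top (c : ℝ × ℝ) {R : ℝ} (hR : 0 < R) : ∫⁻ x, WB c R x < ⊤ := by
  obtain ⟨C, hC⟩ := exists_lintegral_br_plane
  calc ∫⁻ x, WB c R x ≤ ∫⁻ x, ((br R (x - c))⁻¹) ^ 4 :=
        lintegral_mono fun x => (WB_le c hR x).trans (br_pow_inv_le hR (by norm_num) _)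
    _ = ∫⁻ x, ((br R x)⁻¹) ^ 4 := lintegral_sub_right_eq_self (fun x => ((br R x)⁻¹) ^ 4) c
    _ ≤ _ := hC R hR
    _ < ⊤ := by finiteness

lemma enorm_ext_le (g : ℝ → ℂ) (x : ℝ × ℝ) : ‖ext g x‖ₑ ≤ ENNReal.ofReal (∫ ξ, ‖g ξ‖) := by
  rw [← ofReal_norm]
  exact ENNReal.ofReal_le_ofReal (norm_ext_le g x)

lemma Np_WB_lt_top {p : ℝ} (hp : 0 ≤ p) (g : ℝ → ℂ) (c : ℝ × ℝ) {R : ℝ} (hR : 0 < R) :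
    Np p (WB c R) (ext g) < ⊤ := by
  calc Np p (WB c R) (ext g) ≤ ∫⁻ x, ENNReal.ofReal (∫ ξ, ‖g ξ‖) ^ p * WB c R x :=
        lintegral_mono fun x => by gcongr; exact enorm_ext_le g x
    _ = ENNReal.ofReal (∫ ξ, ‖g ξ‖) ^ p * ∫⁻ x, WB c R x :=
        lintegral_const_mul _ (measurable_WB c hR)
    _ < ⊤ := ENNReal.mul_lt_top (ENNReal.rpow_lt_top_of_nonneg hp ENNReal.ofReal_ne_top)
        (lintegral_WB_lt_top c hR)

lemma ofReal_wLp {p : ℝ} (hp : 0 < p) {g : ℝ → ℂ} (hg : Integrable g) (c : ℝ × ℝ) {R : ℝ}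
    (hR : 0 < R) : ENNReal.ofReal (wLp p (wB c R) (ext g)) = Np p (WB c R) (ext g) ^ (1 / p) := by
  have hw : ∀ x, 0 ≤ wB c R x := fun x => by unfold wB; positivity
  have e : ∀ x, ‖ext g x‖ₑ ^ p * WB c R x = ENNReal.ofReal (‖ext g x‖ ^ p * wB c R x) := fun x => by
    rw [ENNReal.ofReal_mul (by positivity), ← ENNReal.ofReal_rpow_of_nonneg (norm_nonneg _) hp.le,
      ofReal_norm, WB]
  have hc : Continuous fun x => ‖ext g x‖ ^ p * wB c R x :=
    ((continuous_ext hg).norm.rpow_const fun _ => Or.inr hp.le).mul (continuous_wB c hR)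
  have e2 : ∫ x, ‖ext g x‖ ^ p * wB c R x = (Np p (WB c R) (ext g)).toReal := by
    rw [integral_eq_lintegral_of_nonneg_ae
      (Filter.Eventually.of_forall fun x => mul_nonneg (by positivity) (hw x))
      hc.aestronglyMeasurable, Np]
    simp_rw [e]
  rw [wLp, e2, ← ENNReal.ofReal_rpow_of_nonneg ENNReal.toReal_nonneg (by positivity),
    ENNReal.ofReal_toReal (Np_WB_lt_top hp.le g c hR).ne]

lemma sqr_eq (c : ℝ × ℝ) (R : ℝ) : sqr c R = Metric.closedBall c (R / 2) := by
  rw [← closedBall_prod_same, Real.closedBall_eq_Icc, Real.closedBall_eq_Icc, sqr]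

lemma lintegral_ball_ext_lt_top {p : ℝ} (hp : 0 ≤ p) (g : ℝ → ℂ) (c : ℝ × ℝ) (R : ℝ) :
    ∫⁻ x in Metric.closedBall c R, ‖ext g x‖ₑ ^ p < ⊤ := by
  calc ∫⁻ x in Metric.closedBall c R, ‖ext g x‖ₑ ^ p
      ≤ ∫⁻ x in Metric.closedBall c R, ENNReal.ofReal (∫ ξ, ‖g ξ‖) ^ p :=
        lintegral_mono fun x => by gcongr; exact enorm_ext_le g x
    _ = ENNReal.ofReal (∫ ξ, ‖g ξ‖) ^ p * volume (Metric.closedBall c R) := by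
        rw [lintegral_const, Measure.restrict_apply_univ]
    _ < ⊤ := ENNReal.mul_lt_top (ENNReal.rpow_lt_top_of_nonneg hp ENNReal.ofReal_ne_top)
        measure_closedBall_lt_top

lemma ofReal_sqLp {p : ℝ} (hp : 0 < p) {g : ℝ → ℂ} (hg : Integrable g) (c : ℝ × ℝ) (R : ℝ) :
    ENNReal.ofReal (sqLp p c R (ext g)) =
      (∫⁻ x in Metric.closedBall c (R / 2), ‖ext g x‖ₑ ^ p) ^ (1 / p) := by
  have e : ∀ x, ‖ext g x‖ₑ ^ p = ENNReal.ofReal (‖ext g x‖ ^ p) := fun x => by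
    rw [← ENNReal.ofReal_rpow_of_nonneg (norm_nonneg _) hp.le, ofReal_norm]
  have hc : Continuous fun x => ‖ext g x‖ ^ p :=
    ((continuous_ext hg).norm.rpow_const fun _ => Or.inr hp.le)
  have e2 : ∫ x in Metric.closedBall c (R / 2), ‖ext g x‖ ^ p =
      (∫⁻ x in Metric.closedBall c (R / 2), ‖ext g x‖ₑ ^ p).toReal := by
    rw [integral_eq_lintegral_of_nonneg_ae
      (Filter.Eventually.of_forall fun x => by positivity) hc.aestronglyMeasurable]
    simp_rw [e]
  rw [sqLp, sqr_eq, e2, ← ENNReal.ofReal_rpow_of_nonneg ENNReal.toReal_nonneg (by positivity),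
    ENNReal.ofReal_toReal (lintegral_ball_ext_lt_top hp.le g c _).ne]

/-- The square of the `l²L^p` norm of a family of functions. -/
noncomputable def l2p {ι : Type*} (p : ℝ) (w : ℝ × ℝ → ℝ≥0∞) (s : Finset ι)
    (f : ι → ℝ × ℝ → ℂ) : ℝ≥0∞ := ∑ i ∈ s, Np p w (f i) ^ (2 / p)

lemma extOp_zero_one (g : ℝ → ℂ) : extOp 0 1 g = ext (piece g 1 0) := by
  rw [extOp_eq_ext, ext_indicator_Icc, piece]; simp

lemma extOp_cell (g : ℝ → ℂ) (n k : ℕ) :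
    extOp ((k : ℝ) / n) (((k : ℝ) + 1) / n) g = ext (piece g n k) := by
  rw [extOp_eq_ext, ext_indicator_Icc, piece]; simp

lemma piece_indicator (g : ℝ → ℂ) {s : Set ℝ} {M : ℝ} {l : ℤ}
    (h : Set.Ico ((l : ℝ) / M) (((l : ℝ) + 1) / M) ⊆ s) : piece (s.indicator g) M l = piece g M l := by
  rw [piece, Set.indicator_indicator, Set.inter_eq_left.2 h, piece]

lemma Ico_cell_subset {n k : ℕ} (hk : k < n) :
    Set.Ico (((k : ℤ) : ℝ) / n) ((((k : ℤ) : ℝ) + 1) / n) ⊆ Set.Icc 0 1 := by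
  have hn : (0 : ℝ) < n := by exact_mod_cast (Nat.zero_le k).trans_lt hk
  intro x hx
  refine ⟨le_trans (by positivity) hx.1, hx.2.le.trans ?_⟩
  rw [div_le_one hn]
  exact_mod_cast hk

/-- Reformulation of the decoupling inequality in `[0, ∞]`. -/
lemma decIneq_iff {p : ℝ} (hp : 0 < p) {n : ℕ} (hn : 0 < n) {D : ℝ} (hD : 0 ≤ D) :
    DecIneq p n D ↔ ∀ g : ℝ → ℂ, Integrable g → ∀ c : ℝ × ℝ,
      ∫⁻ x in Metric.closedBall c ((n : ℝ) ^ 2 / 2), ‖ext (piece g 1 0) x‖ₑ ^ p ≤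
        ENNReal.ofReal D ^ p * l2p p (WB c ((n : ℝ) ^ 2)) (Finset.range n)
          (fun k => ext (piece g n k)) ^ (p / 2) := by
  have hR : (0 : ℝ) < (n : ℝ) ^ 2 := by positivity
  have key : ∀ g : ℝ → ℂ, Integrable g → ∀ c : ℝ × ℝ,
      (sqLp p c ((n : ℝ) ^ 2) (extOp 0 1 g) ≤ D * (∑ k ∈ Finset.range n,
        wLp p (wB c ((n : ℝ) ^ 2)) (extOp ((k : ℝ) / (n : ℝ)) (((k : ℝ) + 1) / (n : ℝ)) g) ^ 2)
        ^ (1 / 2 : ℝ) ↔ ∫⁻ x in Metric.closedBall c ((n : ℝ) ^ 2 / 2), ‖ext (piece g 1 0) x‖ₑ ^ p ≤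
        ENNReal.ofReal D ^ p * l2p p (WB c ((n : ℝ) ^ 2)) (Finset.range n)
          (fun k => ext (piece g n k)) ^ (p / 2)) := by
    intro g hg c
    have h1 : ∀ k : ℕ, ENNReal.ofReal (wLp p (wB c ((n : ℝ) ^ 2))
        (extOp ((k : ℝ) / (n : ℝ)) (((k : ℝ) + 1) / (n : ℝ)) g) ^ 2) =
        Np p (WB c ((n : ℝ) ^ 2)) (ext (piece g n k)) ^ (2 / p) := fun k => by
      rw [extOp_cell, ENNReal.ofReal_pow, ofReal_wLp hp (integrable_piece hg _ _) c hR,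
        ← ENNReal.rpow_natCast, ← ENNReal.rpow_mul]
      · congr 1; push_cast; ring
      · unfold wLp
        refine Real.rpow_nonneg (integral_nonneg fun x => ?_) _
        unfold wB; positivity
    have h2 : ENNReal.ofReal (D * (∑ k ∈ Finset.range n,
        wLp p (wB c ((n : ℝ) ^ 2)) (extOp ((k : ℝ) / (n : ℝ)) (((k : ℝ) + 1) / (n : ℝ)) g) ^ 2)
        ^ (1 / 2 : ℝ)) = ENNReal.ofReal D * l2p p (WB c ((n : ℝ) ^ 2)) (Finset.range n)
          (fun k => ext (piece g n k)) ^ (1 / 2 : ℝ) := by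
      rw [ENNReal.ofReal_mul hD, ← ENNReal.ofReal_rpow_of_nonneg
        (Finset.sum_nonneg fun _ _ => sq_nonneg _) (by norm_num),
        ENNReal.ofReal_sum_of_nonneg (fun _ _ => sq_nonneg _)]
      simp_rw [h1]
      rfl
    rw [← ENNReal.ofReal_le_ofReal_iff (by positivity), h2, extOp_zero_one,
      ofReal_sqLp hp (integrable_piece hg _ _), ← ENNReal.rpow_le_rpow_iff hp, ← ENNReal.rpow_mul,
      one_div_mul_cancel hp.ne', ENNReal.rpow_one, ENNReal.mul_rpow_of_nonneg _ _ hp.le,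
      ← ENNReal.rpow_mul]
    ring_nf
  constructor
  · intro h g hg c
    exact (key g hg c).1 (h g hg.integrableOn c)
  · intro h g hg c
    have hg' : Integrable ((Set.Icc 0 1).indicator g) := hg.integrable_indicator measurableSet_Icc
    have := (key _ hg' c).2 (h _ hg' c)
    have e1 : extOp 0 1 ((Set.Icc 0 1).indicator g) = extOp 0 1 g := by
      rw [extOp_eq_ext, extOp_eq_ext, Set.indicator_indicator, Set.inter_self]
    rw [e1] at this
    refine this.trans (le_of_eq ?_)
    congr 2
    refine Finset.sum_congr rfl fun k hk => ?_
    rw [extOp_cell, extOp_cell, piece_indicator]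
    exact Ico_cell_subset (Finset.mem_range.1 hk)

lemma sum_piece (g : ℝ → ℂ) {M : ℝ} (hM : 0 < M) (l : ℤ) {n : ℕ} (hn : 0 < n) :
    piece g M l = fun ξ => ∑ k ∈ Finset.range n, piece g (M * n) (l * n + k) ξ := by
  have hn' : (0 : ℝ) < n := by exact_mod_cast hn
  have hMn : 0 < M * n := by positivity
  funext ξ
  have key : ∀ k : ℤ, (ξ ∈ Set.Ico (((l * n + k : ℤ) : ℝ) / (M * n))
      ((((l * n + k : ℤ) : ℝ) + 1) / (M * n)) ↔ k = ⌊ξ * (M * n)⌋ - l * n) := by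
    intro k
    rw [Set.mem_Ico, div_le_iff₀ hMn, lt_div_iff₀ hMn, ← Int.floor_eq_iff]
    omega
  have key2 : ξ ∈ Set.Ico ((l : ℝ) / M) (((l : ℝ) + 1) / M) ↔
      0 ≤ ⌊ξ * (M * n)⌋ - l * n ∧ ⌊ξ * (M * n)⌋ - l * n < n := by
    rw [Set.mem_Ico, div_le_iff₀ hM, lt_div_iff₀ hM, sub_nonneg, Int.le_floor,
      sub_lt_iff_lt_add, Int.floor_lt]
    push_cast
    rw [← mul_assoc, mul_le_mul_iff_left₀ hn', show (n : ℝ) + l * n = (l + 1) * n by ring,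
      mul_lt_mul_iff_left₀ hn']
  by_cases h : ξ ∈ Set.Ico ((l : ℝ) / M) (((l : ℝ) + 1) / M)
  · rw [piece, Set.indicator_of_mem h]
    obtain ⟨h1, h2⟩ := key2.1 h
    obtain ⟨k, hk⟩ := Int.eq_ofNat_of_zero_le h1
    rw [Finset.sum_eq_single_of_mem k (Finset.mem_range.2 (by omega))]
    · rw [piece, Set.indicator_of_mem ((key k).2 hk.symm)]
    · intro j _ hj
      rw [piece, Set.indicator_of_notMem]
      rw [key j]
      omega
  · rw [piece, Set.indicator_of_notMem h]
    refine (Finset.sum_eq_zero fun j hj => ?_).symm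
    rw [piece, Set.indicator_of_notMem]
    rw [key j]
    rw [Finset.mem_range] at hj
    intro h'
    exact h (key2.2 (by omega))

lemma ext_piece_eq_sum {g : ℝ → ℂ} (hg : Integrable g) {M : ℝ} (hM : 0 < M) (l : ℤ) {n : ℕ}
    (hn : 0 < n) (x : ℝ × ℝ) :
    ext (piece g M l) x = ∑ k ∈ Finset.range n, ext (piece g (M * n) (l * n + k)) x := by
  rw [sum_piece g hM l hn]
  exact ext_sum _ _ (fun _ _ => integrable_piece hg _ _) x

/-- On the square itself the weight `WB` is bounded below. -/
lemma setLIntegral_closedBall_le_Np (p : ℝ) (c : ℝ × ℝ) {R : ℝ} (hR : 0 < R) (f : ℝ × ℝ → ℂ) :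
    ∫⁻ x in Metric.closedBall c (R / 2), ‖f x‖ₑ ^ p ≤ 2 ^ 200 * Np p (WB c R) f := by
  have hW : ∀ x ∈ Metric.closedBall c (R / 2), (1 : ℝ≥0∞) ≤ 2 ^ 200 * WB c R x := by
    intro x hx
    have h := slow_WB c hR c x
    rw [WB_eq c hR, show c - c = 0 from sub_self c] at h
    have h2 : br R (c - x) ≤ 2 := by
      refine br_le_two hR ?_
      rw [← dist_eq_norm, dist_comm]
      exact (Metric.mem_closedBall.1 hx).trans (by linarith)
    simp only [Prod.fst_zero, Prod.snd_zero] at h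
    rw [show (ENNReal.ofReal (1 + Real.sqrt (0 ^ 2 + 0 ^ 2) / R))⁻¹ ^ 100 = 1 by simp,
      ENNReal.coe_pow, ENNReal.coe_ofNat] at h
    refine h.trans ?_
    calc (2 : ℝ≥0∞) ^ 100 * WB c R x * br R (c - x) ^ 100
        ≤ 2 ^ 100 * WB c R x * 2 ^ 100 := by gcongr
      _ = 2 ^ 200 * WB c R x := by ring
  rw [Np, ← lintegral_const_mul']
  swap
  · finiteness
  calc _ ≤ ∫⁻ x in Metric.closedBall c (R / 2), 2 ^ 200 * (‖f x‖ₑ ^ p * WB c R x) := by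
        refine setLIntegral_mono' measurableSet_closedBall fun x hx => ?_
        calc _ = ‖f x‖ₑ ^ p * 1 := (mul_one _).symm
          _ ≤ ‖f x‖ₑ ^ p * (2 ^ 200 * WB c R x) := by gcongr; exact hW x hx
          _ = _ := by ring
    _ ≤ _ := setLIntegral_le_lintegral _ _

lemma exists_decIneq {p : ℝ} (hp : 2 ≤ p) {n : ℕ} (hn : 0 < n) : ∃ D, 0 ≤ D ∧ DecIneq p n D := by
  have hp0 : 0 < p := by linarith
  refine ⟨2 ^ 200 * n, by positivity, (decIneq_iff hp0 hn (by positivity)).2 fun g hg c => ?_⟩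
  have hR : (0 : ℝ) < (n : ℝ) ^ 2 := by positivity
  set W := WB c ((n : ℝ) ^ 2)
  calc ∫⁻ x in Metric.closedBall c ((n : ℝ) ^ 2 / 2), ‖ext (piece g 1 0) x‖ₑ ^ p
      ≤ ∫⁻ x in Metric.closedBall c ((n : ℝ) ^ 2 / 2),
          (∑ k ∈ Finset.range n, ‖ext (piece g n k) x‖ₑ) ^ p := by
        refine lintegral_mono fun x => ?_
        gcongr
        rw [ext_piece_eq_sum hg one_pos 0 hn x]
        simp only [one_mul, zero_mul, zero_add]
        exact enorm_sum_le _ _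
    _ ≤ (∑ k ∈ Finset.range n, (∫⁻ x in Metric.closedBall c ((n : ℝ) ^ 2 / 2),
          ‖ext (piece g n k) x‖ₑ ^ p) ^ (1 / p)) ^ p :=
        lintegral_sum_rpow_le' (by linarith) _ fun k _ =>
          ((continuous_ext (integrable_piece hg _ _)).enorm.measurable).aemeasurable
    _ ≤ (∑ k ∈ Finset.range n, 2 ^ 200 * l2p p W (Finset.range n)
          (fun k => ext (piece g n k)) ^ (1 / 2 : ℝ)) ^ p := by
        gcongr with k hkm
        calc _ ≤ (2 ^ 200 * Np p W (ext (piece g n k))) ^ (1 / p) := by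
              gcongr; exact setLIntegral_closedBall_le_Np p c hR _
          _ = (2 ^ 200) ^ (1 / p) * (Np p W (ext (piece g n k)) ^ (2 / p)) ^ (1 / 2 : ℝ) := by
            rw [ENNReal.mul_rpow_of_nonneg _ _ (by positivity), ← ENNReal.rpow_mul]
            congr 2; ring
          _ ≤ (2 ^ 200) ^ (1 : ℝ) * l2p p W (Finset.range n)
                (fun k => ext (piece g n k)) ^ (1 / 2 : ℝ) := by
            gcongr
            · exact one_le_pow_of_one_le' (by norm_num) _
            · rw [div_le_one hp0]; linarith
            · exact Finset.single_le_sum (f := fun k : ℕ => Np p W (ext (piece g n k)) ^ (2 / p))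
                (fun _ _ => zero_le) hkm
          _ = _ := by rw [ENNReal.rpow_one]
    _ = _ := by
        rw [Finset.sum_const, Finset.card_range, nsmul_eq_mul, ← mul_assoc,
          ENNReal.mul_rpow_of_nonneg _ _ hp0.le, ← ENNReal.rpow_mul]
        congr 1
        · congr 1
          rw [ENNReal.ofReal_mul (by positivity), ENNReal.ofReal_pow (by norm_num), mul_comm]
          simp
        · congr 1; ring

lemma Dconst_nonneg (p : ℝ) (n : ℕ) : 0 ≤ Dconst p n := Real.sInf_nonneg fun _ h => h.1

lemma Dconst_le {p : ℝ} {n : ℕ} {D : ℝ} (hD : 0 ≤ D) (h : DecIneq p n D) : Dconst p n ≤ D :=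
  csInf_le ⟨0, fun _ h => h.1⟩ ⟨hD, h⟩

lemma decIneq_Dconst {p : ℝ} (hp : 2 ≤ p) {n : ℕ} (hn : 0 < n) : DecIneq p n (Dconst p n) := by
  intro g hg c
  have hne : {D : ℝ | 0 ≤ D ∧ DecIneq p n D}.Nonempty := exists_decIneq hp hn
  set T := (∑ k ∈ Finset.range n, wLp p (wB c ((n : ℝ) ^ 2))
    (extOp ((k : ℝ) / (n : ℝ)) (((k : ℝ) + 1) / (n : ℝ)) g) ^ 2) ^ (1 / 2 : ℝ) with hT
  have hT0 : 0 ≤ T := Real.rpow_nonneg (Finset.sum_nonneg fun _ _ => sq_nonneg _) _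
  rcases hT0.eq_or_lt with h0 | h0
  · obtain ⟨D, hD⟩ := hne
    have := hD.2 g hg c
    rw [← hT, ← h0, mul_zero] at this
    rwa [← h0, mul_zero]
  · rw [← div_le_iff₀ h0]
    exact le_csInf hne fun D hD => (div_le_iff₀ h0).2 (hD.2 g hg c)

lemma decoupling {p : ℝ} (hp : 2 ≤ p) {n : ℕ} (hn : 0 < n) {g : ℝ → ℂ} (hg : Integrable g)
    (c : ℝ × ℝ) : ∫⁻ x in Metric.closedBall c ((n : ℝ) ^ 2 / 2), ‖ext (piece g 1 0) x‖ₑ ^ p ≤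
        ENNReal.ofReal (Dconst p n) ^ p * l2p p (fun x => (br ((n : ℝ) ^ 2) (x - c))⁻¹ ^ 100)
          (Finset.range n) (fun k => ext (piece g n k)) ^ (p / 2) := by
  have hR : (0 : ℝ) < (n : ℝ) ^ 2 := by positivity
  refine ((decIneq_iff (by linarith) hn (Dconst_nonneg p n)).1 (decIneq_Dconst hp hn) g hg c).trans
    ?_
  unfold l2p Np
  gcongr with k hk x
  exact WB_le c hR x

/-- The mollifying factor, with Fourier transform supported in a ball of radius `1 / (2 * r)`. -/
noncomputable def chi (r : ℝ) (y : ℝ × ℝ) : ℂ :=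
  (((r⁻¹ : ℝ) : ℂ) * kb bumpS (y.1 / r)) * (((r⁻¹ : ℝ) : ℂ) * kb bumpS (y.2 / r))

lemma integrable_chi {r : ℝ} (hr : 0 < r) : Integrable (chi r) :=
  (integrable_kb_scaled bumpS hr).mul_prod (integrable_kb_scaled bumpS hr)

lemma continuous_chi {r : ℝ} : Continuous (chi r) := by
  unfold chi
  have := continuous_kb bumpS
  fun_prop

/-- The Fourier transform of `Φ` at the point `(η, η² + t)`. -/
noncomputable def slice (Φ : ℝ × ℝ → ℂ) (t η : ℝ) : ℂ :=
  ∫ y, Φ y * ch (-(η * y.1 + (η ^ 2 + t) * y.2))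

lemma continuous_slice {Φ : ℝ × ℝ → ℂ} (h : Integrable Φ) :
    Continuous fun q : ℝ × ℝ => slice Φ q.1 q.2 := by
  unfold slice
  refine continuous_of_dominated (bound := fun y => ‖Φ y‖) (fun q => ?_) ?_ h.norm ?_
  · exact (h.mul_ch (by fun_prop)).aestronglyMeasurable
  · exact fun q => Filter.Eventually.of_forall fun y => by simp
  · exact Filter.Eventually.of_forall fun y => by fun_prop

lemma integrable_ext_mul_chi {g : ℝ → ℂ} (hg : Integrable g) {r : ℝ} (hr : 0 < r) :
    Integrable fun y => ext g y * chi r y :=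
  (integrable_chi hr).bdd_mul (continuous_ext hg).aestronglyMeasurable
    (Filter.Eventually.of_forall fun y => norm_ext_le g y)

lemma slice_eq {g : ℝ → ℂ} (hg : Integrable g) {r : ℝ} (hr : 0 < r) (t η : ℝ) :
    slice (fun y => ext g y * chi r y) t η =
      ∫ ξ, g ξ * (cb bumpS (r * (η - ξ)) * cb bumpS (r * (t + η ^ 2 - ξ ^ 2))) := by
  have hI : Integrable (Function.uncurry fun (y : ℝ × ℝ) (ξ : ℝ) =>
      g ξ * ch (ξ * y.1 + ξ ^ 2 * y.2) * chi r y * ch (-(η * y.1 + (η ^ 2 + t) * y.2)))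
      (volume.prod volume) := by
    have h0 : Integrable (fun q : (ℝ × ℝ) × ℝ => chi r q.1 * g q.2) (volume.prod volume) :=
      (integrable_chi hr).mul_prod hg
    have h1 := (h0.mul_ch (f := fun q : (ℝ × ℝ) × ℝ => q.2 * q.1.1 + q.2 ^ 2 * q.1.2)
      (by fun_prop)).mul_ch (f := fun q : (ℝ × ℝ) × ℝ => -(η * q.1.1 + (η ^ 2 + t) * q.1.2))
      (by fun_prop)
    refine h1.congr (Filter.Eventually.of_forall fun q => ?_)
    simp only [Function.uncurry]; ring
  have e1 : slice (fun y => ext g y * chi r y) t η = ∫ y : ℝ × ℝ, ∫ ξ,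
      g ξ * ch (ξ * y.1 + ξ ^ 2 * y.2) * chi r y * ch (-(η * y.1 + (η ^ 2 + t) * y.2)) := by
    unfold slice ext
    refine integral_congr_ae (Filter.Eventually.of_forall fun y => ?_)
    simp only
    rw [mul_assoc, ← integral_mul_const]
    simp_rw [mul_assoc]
  rw [e1, integral_integral_swap hI]
  refine integral_congr_ae (Filter.Eventually.of_forall fun ξ => ?_)
  simp only
  rw [← integral_kb_scaled bumpS hr (η - ξ), ← integral_kb_scaled bumpS hr (t + η ^ 2 - ξ ^ 2),
    ← integral_prod_mul, ← integral_const_mul]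
  refine integral_congr_ae (Filter.Eventually.of_forall fun y => ?_)
  simp only [chi]
  have : ch (-((η - ξ) * y.1)) * ch (-((t + η ^ 2 - ξ ^ 2) * y.2)) =
      ch (ξ * y.1 + ξ ^ 2 * y.2) * ch (-(η * y.1 + (η ^ 2 + t) * y.2)) := by
    rw [← ch_add, ← ch_add]; ring_nf
  calc _ = g ξ * (((r⁻¹ : ℝ) : ℂ) * kb bumpS (y.1 / r)) * (((r⁻¹ : ℝ) : ℂ) * kb bumpS (y.2 / r)) *
        (ch (ξ * y.1 + ξ ^ 2 * y.2) * ch (-(η * y.1 + (η ^ 2 + t) * y.2))) := by ring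
    _ = _ := by rw [← this]; ring

lemma slice_ne_zero {g : ℝ → ℂ} (hg : Integrable g) {r : ℝ} (hr : 0 < r) {t η : ℝ}
    (h : slice (fun y => ext g y * chi r y) t η ≠ 0) :
    ∃ ξ, g ξ ≠ 0 ∧ |r * (η - ξ)| < 1 / 2 ∧ |r * (t + η ^ 2 - ξ ^ 2)| < 1 / 2 := by
  by_contra! hcon
  apply h
  rw [slice_eq hg hr]
  refine integral_eq_zero_of_ae (Filter.Eventually.of_forall fun ξ => ?_)
  simp only [Pi.zero_apply]
  by_cases h1 : g ξ = 0
  · simp [h1]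
  by_cases h2 : |r * (η - ξ)| < 1 / 2
  · rw [cb_bumpS_eq_zero (hcon ξ h1 h2)]; simp
  · rw [cb_bumpS_eq_zero (not_lt.1 h2)]; simp

lemma slice_bounds {g : ℝ → ℂ} (hg : Integrable g) (hs : ∀ ξ, g ξ ≠ 0 → ξ ∈ Set.Icc (0 : ℝ) 1)
    {r : ℝ} (hr : 1 ≤ r) {t η : ℝ} (h : slice (fun y => ext g y * chi r y) t η ≠ 0) :
    |η| ≤ 2 ∧ |t| ≤ 2 / r := by
  have hr0 : 0 < r := by linarith
  obtain ⟨ξ, h0, h1, h2⟩ := slice_ne_zero hg hr0 h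
  obtain ⟨hξ0, hξ1⟩ := hs ξ h0
  rw [abs_mul, abs_of_pos hr0] at h1 h2
  have h3 : |η - ξ| ≤ 1 / 2 := by nlinarith [abs_nonneg (η - ξ)]
  have h4 : |η| ≤ 3 / 2 := by
    rw [abs_le] at h3 ⊢; constructor <;> linarith
  refine ⟨by linarith, ?_⟩
  rw [le_div_iff₀ hr0]
  have h5 : |t| ≤ |t + η ^ 2 - ξ ^ 2| + |η - ξ| * |η + ξ| := by
    calc |t| = |(t + η ^ 2 - ξ ^ 2) + -((η - ξ) * (η + ξ))| := by ring_nf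
      _ ≤ _ := (abs_add_le _ _).trans (by rw [abs_neg, abs_mul])
  have h6 : |η + ξ| ≤ 3 := by
    rw [abs_le] at h4 ⊢; constructor <;> linarith
  nlinarith [mul_le_mul_of_nonneg_left h6 (abs_nonneg (η - ξ))]

lemma integrable_slice_prod {g : ℝ → ℂ} (hg : Integrable g)
    (hs : ∀ ξ, g ξ ≠ 0 → ξ ∈ Set.Icc (0 : ℝ) 1) {r : ℝ} (hr : 1 ≤ r) :
    Integrable fun q : ℝ × ℝ => slice (fun y => ext g y * chi r y) q.1 q.2 := by
  refine (continuous_slice (integrable_ext_mul_chi hg (by linarith))).integrable_of_hasCompactSupport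
    (HasCompactSupport.of_support_subset_isCompact
      ((isCompact_closedBall (0 : ℝ) (2 / r)).prod (isCompact_closedBall (0 : ℝ) 2)) ?_)
  intro q hq
  obtain ⟨h1, h2⟩ := slice_bounds hg hs hr hq
  exact ⟨by simpa using h2, by simpa using h1⟩

lemma integrable_slice {g : ℝ → ℂ} (hg : Integrable g)
    (hs : ∀ ξ, g ξ ≠ 0 → ξ ∈ Set.Icc (0 : ℝ) 1) {r : ℝ} (hr : 1 ≤ r) (t : ℝ) :
    Integrable (slice (fun y => ext g y * chi r y) t) := by
  refine ((continuous_slice (integrable_ext_mul_chi hg (by linarith))).comp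
    (by fun_prop : Continuous fun η : ℝ => (t, η))).integrable_of_hasCompactSupport
    (HasCompactSupport.of_support_subset_isCompact (isCompact_closedBall (0 : ℝ) 2) ?_)
  intro η hη
  simpa using (slice_bounds hg hs hr hη).1

lemma integral_cb_shift (b : ContDiffBump (0 : ℝ)) {r : ℝ} (hr : 0 < r) (c x : ℝ) :
    ∫ t, cb b (r * (t - c)) * ch (t * x) = ch (c * x) * (((r⁻¹ : ℝ) : ℂ) * kb b (x / r)) := by
  have h1 : ∫ t, cb b (r * (t - c)) * ch (t * x) = ∫ t, cb b (r * t) * ch ((t + c) * x) := by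
    rw [← integral_sub_right_eq_self (fun t => cb b (r * t) * ch ((t + c) * x)) c]
    simp
  have h2 := Measure.integral_comp_mul_left (fun s => cb b s * ch ((s / r + c) * x)) r
  rw [abs_of_pos (inv_pos.2 hr)] at h2
  have h3 : ∀ t : ℝ, r * t / r = t := fun t => by field_simp
  simp_rw [h3] at h2
  rw [h1, h2, kb, osc, Complex.real_smul, ← integral_const_mul, ← integral_const_mul,
    ← integral_const_mul]
  refine integral_congr_ae (Filter.Eventually.of_forall fun s => ?_)
  simp only
  rw [show (s / r + c) * x = c * x + (0 * s ^ 2 + x / r * s) by field_simp; ring, ch_add]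
  ring

lemma integrable_cb_shift (b : ContDiffBump (0 : ℝ)) {r : ℝ} (hr : 0 < r) (c : ℝ) :
    Integrable fun t => cb b (r * (t - c)) :=
  ((integrable_cb b).comp_mul_left' hr.ne').comp_sub_right c

lemma integral_norm_cb_shift (b : ContDiffBump (0 : ℝ)) (r c : ℝ) :
    ∫ t, ‖cb b (r * (t - c))‖ = ∫ t, ‖cb b (r * t)‖ :=
  integral_sub_right_eq_self (fun t => ‖cb b (r * t)‖) c

lemma integrable_cb_prod {g : ℝ → ℂ} (hg : Integrable g) (b : ContDiffBump (0 : ℝ)) {r : ℝ}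
    (hr : 0 < r) {c : ℝ → ℝ} (hc : Continuous c) :
    Integrable (Function.uncurry fun (t ξ : ℝ) => g ξ * cb b (r * (t - c ξ)))
      (volume.prod volume) := by
  have hm : AEStronglyMeasurable (Function.uncurry fun (t ξ : ℝ) => g ξ * cb b (r * (t - c ξ)))
      (volume.prod volume) := by
    refine hg.aestronglyMeasurable.comp_snd.mul (Continuous.aestronglyMeasurable ?_)
    have := continuous_cb b
    fun_prop
  refine (integrable_prod_iff' hm).2 ⟨Filter.Eventually.of_forall fun ξ => ?_, ?_⟩
  · simp only [Function.uncurry]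
    exact (integrable_cb_shift b hr _).const_mul _
  · simp only [Function.uncurry, norm_mul, integral_const_mul, integral_norm_cb_shift]
    exact hg.norm.mul_const _

/-- Inversion formula: a mollified extension is an average of modulated extensions. -/
lemma ext_mul_chi {g : ℝ → ℂ} (hg : Integrable g) (hs : ∀ ξ, g ξ ≠ 0 → ξ ∈ Set.Icc (0 : ℝ) 1)
    {r : ℝ} (hr : 1 ≤ r) (x : ℝ × ℝ) :
    ext g x * chi r x = ∫ t, ch (t * x.2) * ext (slice (fun y => ext g y * chi r y) t) x := by
  have hr0 : 0 < r := by linarith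
  set S := slice (fun y => ext g y * chi r y) with hS
  have hI : Integrable (Function.uncurry fun (t η : ℝ) =>
      S t η * ch (t * x.2 + (η * x.1 + η ^ 2 * x.2))) (volume.prod volume) :=
    (integrable_slice_prod hg hs hr).mul_ch (f := fun q : ℝ × ℝ =>
      q.1 * x.2 + (q.2 * x.1 + q.2 ^ 2 * x.2)) (by fun_prop)
  have e1 : ∫ t, ch (t * x.2) * ext (S t) x =
      ∫ t, ∫ η, S t η * ch (t * x.2 + (η * x.1 + η ^ 2 * x.2)) := by
    refine integral_congr_ae (Filter.Eventually.of_forall fun t => ?_)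
    simp only [ext]
    rw [← integral_const_mul]
    refine integral_congr_ae (Filter.Eventually.of_forall fun η => ?_)
    simp only
    rw [ch_add (t * x.2)]; ring
  have e2 : ∀ η : ℝ, ∫ t, S t η * ch (t * x.2 + (η * x.1 + η ^ 2 * x.2)) =
      ∫ ξ, g ξ * ch (ξ ^ 2 * x.2) * (((r⁻¹ : ℝ) : ℂ) * kb bumpS (x.2 / r)) *
        (cb bumpS (r * (η - ξ)) * ch (η * x.1)) := by
    intro η
    have h1 : Integrable (Function.uncurry fun (t ξ : ℝ) => g ξ * (cb bumpS (r * (η - ξ)) *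
        cb bumpS (r * (t + η ^ 2 - ξ ^ 2))) * ch (t * x.2 + (η * x.1 + η ^ 2 * x.2)))
        (volume.prod volume) := by
      have hg2 : Integrable fun ξ => g ξ * cb bumpS (r * (η - ξ)) := by
        refine hg.mul_bdd (c := 1) (Continuous.aestronglyMeasurable ?_)
          (Filter.Eventually.of_forall fun ξ => norm_cb_le _ _)
        have := continuous_cb bumpS
        fun_prop
      have h2 := (integrable_cb_prod hg2 bumpS hr0 (c := fun ξ => ξ ^ 2 - η ^ 2)
        (by fun_prop)).mul_ch (f := fun q : ℝ × ℝ => q.1 * x.2 + (η * x.1 + η ^ 2 * x.2))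
        (by fun_prop)
      refine h2.congr (Filter.Eventually.of_forall fun q => ?_)
      simp only [Function.uncurry]
      rw [show q.1 - (q.2 ^ 2 - η ^ 2) = q.1 + η ^ 2 - q.2 ^ 2 by ring]
      ring
    calc ∫ t, S t η * ch (t * x.2 + (η * x.1 + η ^ 2 * x.2))
        = ∫ t, ∫ ξ, g ξ * (cb bumpS (r * (η - ξ)) *
          cb bumpS (r * (t + η ^ 2 - ξ ^ 2))) * ch (t * x.2 + (η * x.1 + η ^ 2 * x.2)) := by
          refine integral_congr_ae (Filter.Eventually.of_forall fun t => ?_)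
          simp only [hS]
          rw [slice_eq hg hr0, integral_mul_const]
      _ = _ := by
          rw [integral_integral_swap h1]
          refine integral_congr_ae (Filter.Eventually.of_forall fun ξ => ?_)
          simp only
          have h3 := integral_cb_shift bumpS hr0 (ξ ^ 2 - η ^ 2) x.2
          calc _ = ∫ t, (g ξ * cb bumpS (r * (η - ξ)) * ch (η * x.1 + η ^ 2 * x.2)) *
                (cb bumpS (r * (t - (ξ ^ 2 - η ^ 2))) * ch (t * x.2)) := by
                refine integral_congr_ae (Filter.Eventually.of_forall fun t => ?_)
                simp only
                rw [ch_add, show t - (ξ ^ 2 - η ^ 2) = t + η ^ 2 - ξ ^ 2 by ring]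
                ring
            _ = _ := by
                rw [integral_const_mul, h3, ch_add (η * x.1)]
                have h4 : ch (ξ ^ 2 * x.2) = ch (η ^ 2 * x.2) * ch ((ξ ^ 2 - η ^ 2) * x.2) := by
                  rw [← ch_add]; ring_nf
                rw [h4]; ring
  have h5 : Integrable (Function.uncurry fun (η ξ : ℝ) =>
      g ξ * ch (ξ ^ 2 * x.2) * (((r⁻¹ : ℝ) : ℂ) * kb bumpS (x.2 / r)) *
        (cb bumpS (r * (η - ξ)) * ch (η * x.1))) (volume.prod volume) := by
    have hg2 : Integrable fun ξ => g ξ * ch (ξ ^ 2 * x.2) *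
        (((r⁻¹ : ℝ) : ℂ) * kb bumpS (x.2 / r)) := (hg.mul_ch (by fun_prop)).mul_const _
    have h2 := (integrable_cb_prod hg2 bumpS hr0 (c := fun ξ => ξ) (by fun_prop)).mul_ch
      (f := fun q : ℝ × ℝ => q.1 * x.1) (by fun_prop)
    refine h2.congr (Filter.Eventually.of_forall fun q => ?_)
    simp only [Function.uncurry]
    ring
  rw [e1, integral_integral_swap hI]
  simp_rw [e2]
  rw [integral_integral_swap h5]
  simp_rw [integral_const_mul, integral_cb_shift bumpS hr0]
  rw [ext, ← integral_mul_const]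
  refine integral_congr_ae (Filter.Eventually.of_forall fun ξ => ?_)
  simp only [chi]
  rw [ch_add]; ring

/-- A smooth bump adapted to a cell of length `1/n` near `a`. -/
noncomputable def cellBump (a n η : ℝ) : ℂ := cb bumpL ((η - a) * n)

lemma dil_cellBump (a : ℝ) {n : ℝ} (hn : 0 < n) : dil a n (cellBump a n) = cb bumpL := by
  funext s
  simp only [dil, cellBump]
  congr 1
  field_simp
  ring

lemma integrable_cellBump (a : ℝ) {n : ℝ} (hn : 0 < n) : Integrable (cellBump a n) := by
  have := integrable_cb_shift bumpL hn a
  refine this.congr (Filter.Eventually.of_forall fun t => ?_)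
  simp only [cellBump, mul_comm]

lemma exists_ext_cellBump_le : ∃ C : ℝ≥0, ∀ (a n : ℝ), 0 < n → ∀ u : ℝ × ℝ,
    ‖ext (cellBump a n) u‖ₑ ≤ C * ((ENNReal.ofReal n)⁻¹ * ((br n (u.1 + 2 * a * u.2))⁻¹) ^ 2) *
      br (n ^ 2) u.2 ^ 2 := by
  obtain ⟨C, hC, H⟩ := osc_decay (contDiff_cb bumpL) (hasCompactSupport_cb bumpL) 2
  refine ⟨C.toNNReal, fun a n hn u => ?_⟩
  have h1 := norm_ext_dil a hn (cellBump a n) u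
  rw [dil_cellBump a hn] at h1
  have h2 : ext (cb bumpL) (parab a n u) =
      osc (cb bumpL) (u.2 / n ^ 2) ((u.1 + 2 * a * u.2) / n) := by
    unfold ext osc parab
    refine integral_congr_ae (Filter.Eventually.of_forall fun s => ?_)
    simp only
    ring_nf
  have h3 := H (u.2 / n ^ 2) ((u.1 + 2 * a * u.2) / n)
  rw [← h2, h1] at h3
  have e1 : (1 + |(u.1 + 2 * a * u.2) / n|) = 1 + ‖u.1 + 2 * a * u.2‖ / n := by
    rw [abs_div, abs_of_pos hn, Real.norm_eq_abs]
  have e2 : (1 + |u.2 / n ^ 2|) = 1 + ‖u.2‖ / n ^ 2 := by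
    rw [abs_div, abs_of_pos (by positivity : 0 < n ^ 2), Real.norm_eq_abs]
  rw [e1, e2] at h3
  have h4 := ENNReal.ofReal_le_ofReal h3
  rw [ENNReal.ofReal_mul (by positivity), ENNReal.ofReal_mul hn.le, ENNReal.ofReal_mul hC,
    ENNReal.ofReal_pow (by positivity), ENNReal.ofReal_pow (by positivity), ofReal_norm] at h4
  change br n (u.1 + 2 * a * u.2) ^ 2 * _ ≤ _ * br (n ^ 2) u.2 ^ 2 at h4
  have h5 := br_mul_inv hn (u.1 + 2 * a * u.2)
  set b := br n (u.1 + 2 * a * u.2)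
  have hn0 : ENNReal.ofReal n * (ENNReal.ofReal n)⁻¹ = 1 :=
    ENNReal.mul_inv_cancel (by simpa using hn) ENNReal.ofReal_ne_top
  calc ‖ext (cellBump a n) u‖ₑ
      = (b * b⁻¹) ^ 2 * (ENNReal.ofReal n * (ENNReal.ofReal n)⁻¹) * ‖ext (cellBump a n) u‖ₑ := by
        rw [h5, hn0]; simp
    _ = (b ^ 2 * (ENNReal.ofReal n * ‖ext (cellBump a n) u‖ₑ)) *
        ((ENNReal.ofReal n)⁻¹ * b⁻¹ ^ 2) := by ring
    _ ≤ (ENNReal.ofReal C * br (n ^ 2) u.2 ^ 2) * ((ENNReal.ofReal n)⁻¹ * b⁻¹ ^ 2) := by gcongr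
    _ = _ := by rw [ENNReal.ofReal]; ring

lemma enorm_ext_slice_le {Φ : ℝ × ℝ → ℂ} (hΦ : Integrable Φ) {a n : ℝ} (hn : 0 < n) {t : ℝ}
    (hs : ∀ η, slice Φ t η ≠ 0 → |(η - a) * n| ≤ 2) (x : ℝ × ℝ) :
    ‖ext (slice Φ t) x‖ₑ ≤ ∫⁻ y, ‖Φ y‖ₑ * ‖ext (cellBump a n) (x - y)‖ₑ := by
  have e1 : ext (slice Φ t) x = ∫ η, ∫ y, cellBump a n η * ch (η * x.1 + η ^ 2 * x.2) *
      (Φ y * ch (-(η * y.1 + (η ^ 2 + t) * y.2))) := by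
    unfold ext
    refine integral_congr_ae (Filter.Eventually.of_forall fun η => ?_)
    simp only
    rw [integral_const_mul]
    change slice Φ t η * _ = cellBump a n η * _ * slice Φ t η
    by_cases h : slice Φ t η = 0
    · simp [h]
    · rw [cellBump, cb_bumpL_eq_one (hs η h)]; ring
  have hI : Integrable (Function.uncurry fun (η : ℝ) (y : ℝ × ℝ) =>
      cellBump a n η * ch (η * x.1 + η ^ 2 * x.2) *
      (Φ y * ch (-(η * y.1 + (η ^ 2 + t) * y.2)))) (volume.prod volume) := by
    have h0 : Integrable (fun q : ℝ × (ℝ × ℝ) => cellBump a n q.1 * Φ q.2)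
        (volume.prod volume) := (integrable_cellBump a hn).mul_prod hΦ
    have h1 := (h0.mul_ch (f := fun q : ℝ × (ℝ × ℝ) => q.1 * x.1 + q.1 ^ 2 * x.2)
      (by fun_prop)).mul_ch (f := fun q : ℝ × (ℝ × ℝ) => -(q.1 * q.2.1 + (q.1 ^ 2 + t) * q.2.2))
      (by fun_prop)
    refine h1.congr (Filter.Eventually.of_forall fun q => ?_)
    simp only [Function.uncurry]; ring
  rw [e1, integral_integral_swap hI]
  refine (enorm_integral_le_lintegral_enorm _).trans (lintegral_mono fun y => le_of_eq ?_)
  simp only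
  have e2 : ∫ η, cellBump a n η * ch (η * x.1 + η ^ 2 * x.2) *
      (Φ y * ch (-(η * y.1 + (η ^ 2 + t) * y.2))) =
      Φ y * ch (-(t * y.2)) * ext (cellBump a n) (x - y) := by
    unfold ext
    rw [← integral_const_mul]
    refine integral_congr_ae (Filter.Eventually.of_forall fun η => ?_)
    simp only [Prod.fst_sub, Prod.snd_sub]
    have : ch (η * x.1 + η ^ 2 * x.2) * ch (-(η * y.1 + (η ^ 2 + t) * y.2)) =
        ch (-(t * y.2)) * ch (η * (x.1 - y.1) + η ^ 2 * (x.2 - y.2)) := by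
      rw [← ch_add, ← ch_add]; ring_nf
    calc _ = cellBump a n η * Φ y * (ch (η * x.1 + η ^ 2 * x.2) *
          ch (-(η * y.1 + (η ^ 2 + t) * y.2))) := by ring
      _ = _ := by rw [this]; ring
  rw [e2, enorm_mul, enorm_mul, enorm_ch, mul_one]

lemma enorm_kb_le (b : ContDiffBump (0 : ℝ)) (q : ℕ) : ∃ C : ℝ≥0, ∀ R : ℝ, 0 < R → ∀ t : ℝ,
    ‖kb b (t / R)‖ₑ ≤ C * ((br R t)⁻¹) ^ q := by
  obtain ⟨C, hC, H⟩ := kb_decay b q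
  refine ⟨C.toNNReal, fun R hR t => ?_⟩
  have h1 := ENNReal.ofReal_le_ofReal (H (t / R))
  rw [abs_div, abs_of_pos hR, ENNReal.ofReal_mul (by positivity),
    ENNReal.ofReal_pow (by positivity), ofReal_norm] at h1
  change br R t ^ q * _ ≤ _ at h1
  calc ‖kb b (t / R)‖ₑ = (br R t * (br R t)⁻¹) ^ q * ‖kb b (t / R)‖ₑ := by
        rw [br_mul_inv hR]; simp
    _ = (br R t ^ q * ‖kb b (t / R)‖ₑ) * ((br R t)⁻¹) ^ q := by ring
    _ ≤ _ := by gcongr; exact h1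

lemma br_snd_le {R : ℝ} (hR : 0 < R) (y : ℝ × ℝ) : br R y.2 ≤ br R y := br_mono hR (norm_snd_le y)

lemma br_inv_mul_le {R : ℝ} (hR : 0 < R) (y : ℝ × ℝ) :
    (br R y.1)⁻¹ * (br R y.2)⁻¹ ≤ (br R y)⁻¹ := by
  rcases le_total ‖y.1‖ ‖y.2‖ with h | h
  · have : br R y ≤ br R y.2 := br_mono hR (by rw [Prod.norm_def]; exact max_le h le_rfl)
    calc _ ≤ 1 * (br R y)⁻¹ := by gcongr; exact br_inv_le_one hR _
      _ = _ := one_mul _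
  · have : br R y ≤ br R y.1 := br_mono hR (by rw [Prod.norm_def]; exact max_le le_rfl h)
    calc _ ≤ (br R y)⁻¹ * 1 := by gcongr; exact br_inv_le_one hR _
      _ = _ := mul_one _

lemma exists_chi_le : ∃ C : ℝ≥0, ∀ r : ℝ, 0 < r → ∀ y : ℝ × ℝ,
    ‖chi r y‖ₑ ≤ C * (ENNReal.ofReal r)⁻¹ ^ 2 * ((br r y)⁻¹) ^ 130 := by
  obtain ⟨C, hC⟩ := enorm_kb_le bumpS 130
  refine ⟨C ^ 2, fun r hr y => ?_⟩
  have e : ‖((r⁻¹ : ℝ) : ℂ)‖ₑ = (ENNReal.ofReal r)⁻¹ := by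
    rw [← ofReal_norm, Complex.norm_real, Real.norm_of_nonneg (by positivity),
      ENNReal.ofReal_inv_of_pos hr]
  rw [chi, enorm_mul, enorm_mul, enorm_mul, e]
  calc _ ≤ (ENNReal.ofReal r)⁻¹ * (C * ((br r y.1)⁻¹) ^ 130) *
        ((ENNReal.ofReal r)⁻¹ * (C * ((br r y.2)⁻¹) ^ 130)) := by
        gcongr
        · exact hC r hr _
        · exact hC r hr _
    _ = C ^ 2 * (ENNReal.ofReal r)⁻¹ ^ 2 * ((br r y.1)⁻¹ * (br r y.2)⁻¹) ^ 130 := by ring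
    _ ≤ _ := by push_cast; gcongr; exact br_inv_mul_le hr y

lemma lintegral_prod_mul_le {f : ℝ × ℝ → ℝ≥0∞} (hf : Measurable f) {h : ℝ → ℝ≥0∞}
    (hh : Measurable h) {A : ℝ≥0∞} (H : ∀ y2, ∫⁻ y1, f (y1, y2) ≤ A) :
    ∫⁻ y, f y * h y.2 ≤ A * ∫⁻ t, h t := by
  rw [Measure.volume_eq_prod, lintegral_prod_symm' _ (by fun_prop)]
  calc _ ≤ ∫⁻ y2, A * h y2 := by
        refine lintegral_mono fun y2 => ?_
        simp only
        rw [lintegral_mul_const _ (by fun_prop)]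
        gcongr
        exact H y2
    _ = _ := lintegral_const_mul _ hh

lemma exists_kernel_Lp : ∃ C : ℝ≥0, ∀ p : ℝ, 4 < p → p < 6 → ∀ a n : ℝ, 0 < n →
    ∀ f h : ℝ × ℝ → ℝ≥0∞, Measurable f →
    (∀ x, h x ≤ ∫⁻ y, f y * (((ENNReal.ofReal n)⁻¹ *
      ((br n ((x - y).1 + 2 * a * (x - y).2))⁻¹) ^ 2) * br (n ^ 2) (x - y).2 ^ 2)) →
    ∫⁻ x, h x ^ p * ((br (n ^ 2) x)⁻¹) ^ 100 ≤
      (C * ENNReal.ofReal (n ^ 2)) ^ p * ∫⁻ y, f y ^ p * br (n ^ 2) y ^ 24 := by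
  obtain ⟨C, hC⟩ := exists_lintegral_br_real
  refine ⟨C * C, fun p hp4 hp6 a n hn f h hf H => ?_⟩
  set r := n ^ 2 with hr_def
  have hr : 0 < r := by positivity
  set κ : ℝ × ℝ → ℝ≥0∞ := fun u => (ENNReal.ofReal n)⁻¹ * ((br n (u.1 + 2 * a * u.2))⁻¹) ^ 2
    with hκ
  have hκm : Measurable κ := by fun_prop
  have hn0 : (ENNReal.ofReal n)⁻¹ * ENNReal.ofReal n = 1 :=
    ENNReal.inv_mul_cancel (by simpa using hn) ENNReal.ofReal_ne_top
  have hκ1 : ∀ c u2 : ℝ, ∫⁻ u1 : ℝ, κ (u1 + c, u2) ≤ C := by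
    intro c u2
    simp only [hκ]
    rw [lintegral_const_mul _ (by fun_prop)]
    have := lintegral_add_right_eq_self (μ := (volume : Measure ℝ)) (fun u : ℝ => ((br n u)⁻¹) ^ 2)
      (c + 2 * a * u2)
    simp_rw [← add_assoc] at this
    rw [this]
    calc _ ≤ (ENNReal.ofReal n)⁻¹ * (C * ENNReal.ofReal n) := by gcongr; exact hC n hn
      _ = C * ((ENNReal.ofReal n)⁻¹ * ENNReal.ofReal n) := by ring
      _ = C := by rw [hn0, mul_one]
  have hκneg : ∀ u, κ (-u) = κ u := by
    intro u
    simp only [hκ]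
    rw [← br_neg]
    congr 4
    simp only [Prod.fst_neg, Prod.snd_neg]
    ring
  have hk1 : ∀ x, ∫⁻ y : ℝ × ℝ, κ (x - y) * ((br r y.2)⁻¹) ^ 2 ≤ C * (C * ENNReal.ofReal r) := by
    intro x
    refine (lintegral_prod_mul_le (A := C) (f := fun y => κ (x - y))
      (h := fun t => ((br r t)⁻¹) ^ 2) (by fun_prop) (by fun_prop) fun y2 => ?_).trans ?_
    · have : ∀ y1, κ (x - (y1, y2)) = κ (y1 + -x.1, y2 - x.2) := fun y1 => by
        rw [← hκneg]; congr 1; ext <;> simp; ring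
      simp_rw [this]
      exact hκ1 _ _
    · gcongr; exact hC r hr
  have hk2 : ∀ y, ∫⁻ x : ℝ × ℝ, κ (x - y) * ((br r x.2)⁻¹) ^ 2 ≤ C * (C * ENNReal.ofReal r) := by
    intro y
    refine (lintegral_prod_mul_le (A := C) (f := fun x => κ (x - y))
      (h := fun t => ((br r t)⁻¹) ^ 2) (by fun_prop) (by fun_prop) fun y2 => ?_).trans ?_
    · have : ∀ y1, κ ((y1, y2) - y) = κ (y1 + -y.1, y2 - y.2) := fun y1 => by
        congr 1
      simp_rw [this]
      exact hκ1 _ _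
    · gcongr; exact hC r hr
  have hp0 : 0 ≤ p := by linarith
  have pow12 : ∀ b : ℝ≥0∞, 1 ≤ b → (b ^ 2) ^ p ≤ b ^ 12 := by
    intro b hb
    rw [← ENNReal.rpow_natCast, ← ENNReal.rpow_mul, ← ENNReal.rpow_natCast]
    exact ENNReal.rpow_le_rpow_of_exponent_le hb (by push_cast; linarith)
  have hpt : ∀ x, h x ^ p * ((br r x)⁻¹) ^ 100 ≤ (C * (C * ENNReal.ofReal r)) ^ (p - 1) *
      ∫⁻ y : ℝ × ℝ, f y ^ p * br r y ^ 24 * (κ (x - y) * ((br r x.2)⁻¹) ^ 2) := by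
    intro x
    have h1 : h x ≤ ∫⁻ y : ℝ × ℝ, (f y * (br r x.2 ^ 2 * (br r y.2 ^ 2 * br r y.2 ^ 2))) *
        (κ (x - y) * ((br r y.2)⁻¹) ^ 2) := by
      refine (H x).trans (lintegral_mono fun y => ?_)
      have h2 : br r (x - y).2 ≤ br r x.2 * br r y.2 := by
        have := br_add_le hr x.2 (-y.2)
        rwa [br_neg, ← sub_eq_add_neg] at this
      calc f y * (κ (x - y) * br r (x - y).2 ^ 2)
          ≤ f y * (κ (x - y) * (br r x.2 * br r y.2) ^ 2) := by gcongr
        _ = f y * (κ (x - y) * (br r x.2 * br r y.2) ^ 2) * (br r y.2 * (br r y.2)⁻¹) ^ 2 := by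
            rw [br_mul_inv hr]; simp
        _ = _ := by ring
    calc h x ^ p * ((br r x)⁻¹) ^ 100
        ≤ (∫⁻ y : ℝ × ℝ, (f y * (br r x.2 ^ 2 * (br r y.2 ^ 2 * br r y.2 ^ 2))) *
        (κ (x - y) * ((br r y.2)⁻¹) ^ 2)) ^ p * ((br r x)⁻¹) ^ 100 := by gcongr
      _ ≤ ((∫⁻ y : ℝ × ℝ, κ (x - y) * ((br r y.2)⁻¹) ^ 2) ^ (p - 1) *
          ∫⁻ y : ℝ × ℝ, (f y * (br r x.2 ^ 2 * (br r y.2 ^ 2 * br r y.2 ^ 2))) ^ p *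
          (κ (x - y) * ((br r y.2)⁻¹) ^ 2)) * ((br r x)⁻¹) ^ 100 := by
          gcongr
          exact lintegral_mul_rpow_le (by linarith) (by fun_prop) (by fun_prop)
      _ ≤ ((C * (C * ENNReal.ofReal r)) ^ (p - 1) *
          ∫⁻ y : ℝ × ℝ, f y ^ p * br r y ^ 24 * br r x.2 ^ 12 * κ (x - y)) *
          ((br r x)⁻¹) ^ 100 := by
          refine mul_le_mul' (mul_le_mul' (ENNReal.rpow_le_rpow (hk1 x) (by linarith))
            (lintegral_mono fun y => ?_)) le_rfl
          simp only
          rw [ENNReal.mul_rpow_of_nonneg _ _ hp0, ENNReal.mul_rpow_of_nonneg _ _ hp0,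
            ENNReal.mul_rpow_of_nonneg _ _ hp0]
          calc _ ≤ f y ^ p * (br r x.2 ^ 12 * (br r y ^ 12 * br r y ^ 12)) * (κ (x - y) * 1) := by
                have h5 : (br r y.2 ^ 2) ^ p ≤ br r y ^ 12 :=
                  (pow12 _ (one_le_br hr _)).trans (by gcongr; exact br_snd_le hr y)
                have h6 := pow12 _ (one_le_br hr x.2)
                have h7 : (br r y.2)⁻¹ ^ 2 ≤ 1 := pow_le_one' (br_inv_le_one hr _) _
                exact mul_le_mul' (mul_le_mul' le_rfl (mul_le_mul' h6 (mul_le_mul' h5 h5)))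
                  (mul_le_mul' le_rfl h7)
            _ = _ := by ring
      _ = (C * (C * ENNReal.ofReal r)) ^ (p - 1) *
          ((∫⁻ y : ℝ × ℝ, f y ^ p * br r y ^ 24 * br r x.2 ^ 12 * κ (x - y)) *
          ((br r x)⁻¹) ^ 100) := by rw [mul_assoc]
      _ ≤ _ := by
          rw [← lintegral_mul_const _ (by fun_prop)]
          refine mul_le_mul' le_rfl (lintegral_mono fun y => ?_)
          simp only
          have h8 : br r x.2 ^ 12 * ((br r x)⁻¹) ^ 100 ≤ ((br r x.2)⁻¹) ^ 2 := by
            calc br r x.2 ^ 12 * ((br r x)⁻¹) ^ 100 ≤ br r x.2 ^ 12 * ((br r x.2)⁻¹) ^ 100 := by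
                  gcongr; exact br_snd_le hr x
              _ = (br r x.2 * (br r x.2)⁻¹) ^ 12 * ((br r x.2)⁻¹) ^ 88 := by ring
              _ ≤ _ := by
                  rw [br_mul_inv hr, one_pow, one_mul]
                  exact br_pow_inv_le hr (by norm_num) _
          calc _ = f y ^ p * br r y ^ 24 * κ (x - y) * (br r x.2 ^ 12 * ((br r x)⁻¹) ^ 100) := by
                ring
            _ ≤ f y ^ p * br r y ^ 24 * κ (x - y) * ((br r x.2)⁻¹) ^ 2 := by gcongr
            _ = _ := by ring
  calc ∫⁻ x, h x ^ p * ((br r x)⁻¹) ^ 100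
      ≤ ∫⁻ x : ℝ × ℝ, (C * (C * ENNReal.ofReal r)) ^ (p - 1) *
      ∫⁻ y : ℝ × ℝ, f y ^ p * br r y ^ 24 * (κ (x - y) * ((br r x.2)⁻¹) ^ 2) := lintegral_mono hpt
    _ = (C * (C * ENNReal.ofReal r)) ^ (p - 1) * ∫⁻ y : ℝ × ℝ, ∫⁻ x : ℝ × ℝ,
        f y ^ p * br r y ^ 24 * (κ (x - y) * ((br r x.2)⁻¹) ^ 2) := by
        rw [lintegral_const_mul', lintegral_lintegral_swap]
        · fun_prop
        · exact ENNReal.rpow_ne_top_of_nonneg (by linarith) (by finiteness)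
    _ ≤ (C * (C * ENNReal.ofReal r)) ^ (p - 1) * ∫⁻ y : ℝ × ℝ,
        f y ^ p * br r y ^ 24 * (C * (C * ENNReal.ofReal r)) := by
        gcongr with y
        rw [lintegral_const_mul _ (by fun_prop)]
        gcongr
        exact hk2 y
    _ = _ := by
        rw [lintegral_mul_const _ (by fun_prop), mul_comm (∫⁻ y, f y ^ p * br r y ^ 24), ← mul_assoc]
        congr 1
        nth_rw 2 [← ENNReal.rpow_one (C * (C * ENNReal.ofReal r))]
        rw [← ENNReal.rpow_add_of_nonneg _ _ (by linarith) (by norm_num), sub_add_cancel]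
        push_cast
        rw [mul_assoc]

/-- The extension of a slice is controlled by the original extension. -/
lemma exists_slice_Lp : ∃ C : ℝ≥0, ∀ p : ℝ, 4 < p → p < 6 → ∀ a n : ℝ, 0 < n →
    ∀ g : ℝ → ℂ, Integrable g → ∀ t : ℝ,
    (∀ η, slice (fun y => ext g y * chi (n ^ 2) y) t η ≠ 0 → |(η - a) * n| ≤ 2) →
    Np p (fun x => ((br (n ^ 2) x)⁻¹) ^ 100) (ext (slice (fun y => ext g y * chi (n ^ 2) y) t)) ≤
      (C * (ENNReal.ofReal (n ^ 2))⁻¹) ^ p *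
        Np p (fun x => ((br (n ^ 2) x)⁻¹) ^ 104) (ext g) := by
  obtain ⟨C₁, h₁⟩ := exists_ext_cellBump_le
  obtain ⟨C₂, h₂⟩ := exists_kernel_Lp
  obtain ⟨C₃, h₃⟩ := exists_chi_le
  refine ⟨C₁ * C₂ * C₃, fun p hp4 hp6 a n hn g hg t hs => ?_⟩
  have hr : 0 < n ^ 2 := by positivity
  have hp0 : 0 ≤ p := by linarith
  have hΦ := integrable_ext_mul_chi hg hr
  have hcont : Continuous fun y => ext g y * chi (n ^ 2) y :=
    (continuous_ext hg).mul continuous_chi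
  refine (h₂ p hp4 hp6 a n hn (fun y => C₁ * ‖ext g y * chi (n ^ 2) y‖ₑ)
    (fun x => ‖ext (slice (fun y => ext g y * chi (n ^ 2) y) t) x‖ₑ)
    (hcont.enorm.measurable.const_mul _) fun x => ?_).trans ?_
  · refine (enorm_ext_slice_le hΦ hn hs x).trans (lintegral_mono fun y => ?_)
    calc _ ≤ ‖ext g y * chi (n ^ 2) y‖ₑ * (C₁ * ((ENNReal.ofReal n)⁻¹ *
          ((br n ((x - y).1 + 2 * a * (x - y).2))⁻¹) ^ 2) * br (n ^ 2) (x - y).2 ^ 2) := by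
          gcongr; exact h₁ a n hn _
      _ = _ := by ring
  · set ρ := ENNReal.ofReal (n ^ 2) with hρ
    have hρ1 : ρ * ρ⁻¹ = 1 := ENNReal.mul_inv_cancel (by simpa [hρ] using hn.ne')
      ENNReal.ofReal_ne_top
    have hpt : ∀ y, (C₁ * ‖ext g y * chi (n ^ 2) y‖ₑ) ^ p * br (n ^ 2) y ^ 24 ≤
        (C₁ * C₃ * ρ⁻¹ ^ 2) ^ p * (‖ext g y‖ₑ ^ p * ((br (n ^ 2) y)⁻¹) ^ 104) := by
      intro y
      have h4 : (((br (n ^ 2) y)⁻¹) ^ 130) ^ p ≤ ((br (n ^ 2) y)⁻¹) ^ 130 := by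
        nth_rw 2 [← ENNReal.rpow_one (((br (n ^ 2) y)⁻¹) ^ 130)]
        exact ENNReal.rpow_le_rpow_of_exponent_ge (pow_le_one' (br_inv_le_one hr _) _) (by linarith)
      have h5 : br (n ^ 2) y ^ 24 * ((br (n ^ 2) y)⁻¹) ^ 130 ≤ ((br (n ^ 2) y)⁻¹) ^ 104 := by
        calc _ = (br (n ^ 2) y * (br (n ^ 2) y)⁻¹) ^ 24 * ((br (n ^ 2) y)⁻¹) ^ 106 := by ring
          _ ≤ _ := by
            rw [br_mul_inv hr, one_pow, one_mul]
            exact br_pow_inv_le hr (by norm_num) _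
      calc (C₁ * ‖ext g y * chi (n ^ 2) y‖ₑ) ^ p * br (n ^ 2) y ^ 24
          ≤ (C₁ * (‖ext g y‖ₑ * (C₃ * ρ⁻¹ ^ 2 * ((br (n ^ 2) y)⁻¹) ^ 130))) ^ p *
            br (n ^ 2) y ^ 24 := by
            rw [enorm_mul]; gcongr; exact h₃ _ hr y
        _ = ((C₁ * C₃ * ρ⁻¹ ^ 2) * (‖ext g y‖ₑ * ((br (n ^ 2) y)⁻¹) ^ 130)) ^ p *
            br (n ^ 2) y ^ 24 := by congr 2; ring
        _ = (C₁ * C₃ * ρ⁻¹ ^ 2) ^ p * (‖ext g y‖ₑ ^ p *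
            (br (n ^ 2) y ^ 24 * (((br (n ^ 2) y)⁻¹) ^ 130) ^ p)) := by
            rw [ENNReal.mul_rpow_of_nonneg (C₁ * C₃ * ρ⁻¹ ^ 2) _ hp0,
              ENNReal.mul_rpow_of_nonneg ‖ext g y‖ₑ _ hp0]; ring
        _ ≤ _ := by
            gcongr
            exact le_trans (by gcongr) h5
    calc _ ≤ (C₂ * ρ) ^ p * ∫⁻ y, (C₁ * C₃ * ρ⁻¹ ^ 2) ^ p *
          (‖ext g y‖ₑ ^ p * ((br (n ^ 2) y)⁻¹) ^ 104) := by
          exact mul_le_mul' le_rfl (lintegral_mono hpt)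
      _ = ((C₂ * ρ) ^ p * (C₁ * C₃ * ρ⁻¹ ^ 2) ^ p) *
          Np p (fun x => ((br (n ^ 2) x)⁻¹) ^ 104) (ext g) := by
          rw [lintegral_const_mul _ (by
            have := (continuous_ext hg).enorm.measurable
            fun_prop), Np, ← mul_assoc]
      _ = _ := by
          rw [← ENNReal.mul_rpow_of_nonneg _ _ hp0]
          congr 2
          push_cast
          calc _ = C₁ * C₂ * C₃ * ρ⁻¹ * (ρ * ρ⁻¹) := by ring
            _ = _ := by rw [hρ1, mul_one]

lemma lintegral_comp_div {f : ℝ → ℝ≥0∞} (hf : Measurable f) {M : ℝ} (hM : 0 < M) :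
    ∫⁻ x, f (x / M) = ENNReal.ofReal M * ∫⁻ x, f x := by
  have h := Real.map_volume_mul_left (a := M⁻¹) (inv_ne_zero hM.ne')
  calc ∫⁻ x, f (x / M) = ∫⁻ x, f x ∂(Measure.map (M⁻¹ * ·) volume) := by
        rw [lintegral_map hf (by fun_prop)]
        simp_rw [div_eq_inv_mul]
    _ = _ := by rw [h, lintegral_smul_measure, inv_inv, abs_of_pos hM, smul_eq_mul]

lemma measurable_parab (a M : ℝ) : Measurable (parab a M) := by
  unfold parab
  fun_prop

lemma lintegral_parab (a : ℝ) {M : ℝ} (hM : 0 < M) {f : ℝ × ℝ → ℝ≥0∞} (hf : Measurable f) :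
    ∫⁻ x, f (parab a M x) = ENNReal.ofReal (M ^ 3) * ∫⁻ x, f x := by
  have hm := measurable_parab a M
  rw [Measure.volume_eq_prod, lintegral_prod_symm' _ (by fun_prop), lintegral_prod_symm' _ hf]
  have h1 : ∀ y, ∫⁻ x, f (parab a M (x, y)) = ENNReal.ofReal M * ∫⁻ x, f (x, y / M ^ 2) := by
    intro y
    unfold parab
    simp only
    rw [lintegral_add_right_eq_self (μ := (volume : Measure ℝ)) (fun x => f (x / M, y / M ^ 2)),
      lintegral_comp_div (f := fun x => f (x, y / M ^ 2)) (by fun_prop) hM]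
  simp_rw [h1]
  have h2 : Measurable fun y => ∫⁻ x, f (x, y) := hf.lintegral_prod_left'
  have h3 : Measurable fun y => ∫⁻ x, f (x, y / M ^ 2) :=
    h2.comp (by fun_prop : Measurable fun y : ℝ => y / M ^ 2)
  rw [lintegral_const_mul _ h3, lintegral_comp_div h2 (by positivity), ← mul_assoc, ← ENNReal.ofReal_mul hM.le]
  congr 2
  ring

lemma Np_dil {p : ℝ} (hp : 0 ≤ p) (a : ℝ) {M : ℝ} (hM : 0 < M) {w : ℝ × ℝ → ℝ≥0∞}
    (hw : Measurable w) {g : ℝ → ℂ} (hg : Integrable g) :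
    Np p w (ext (dil a M g)) = (ENNReal.ofReal (M ^ 3))⁻¹ * ENNReal.ofReal M ^ p *
      Np p (fun x => w (parab a M x)) (ext g) := by
  have hd := (continuous_ext (integrable_dil hg a hM)).enorm.measurable
  have h0 := (continuous_ext hg).enorm.measurable
  have hm := measurable_parab a M
  have h := lintegral_parab a hM (f := fun x => ‖ext (dil a M g) x‖ₑ ^ p * w x) (by fun_prop)
  have e : ∀ x, ‖ext (dil a M g) (parab a M x)‖ₑ = ENNReal.ofReal M * ‖ext g x‖ₑ := by
    intro x
    rw [← ofReal_norm, norm_ext_dil a hM, ENNReal.ofReal_mul hM.le, ofReal_norm]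
  simp_rw [e, ENNReal.mul_rpow_of_nonneg _ _ hp, mul_assoc] at h
  rw [lintegral_const_mul _ (by fun_prop)] at h
  rw [Np, Np, mul_assoc, h, ← mul_assoc, ENNReal.inv_mul_cancel (by simpa using pow_pos hM 3)
    ENNReal.ofReal_ne_top, one_mul]

lemma sum_const_mul_rpow {ι : Type*} {p : ℝ} (hp : 0 < p) (s : Finset ι) (K : ℝ≥0∞)
    (N : ι → ℝ≥0∞) :
    (∑ i ∈ s, (K * N i) ^ (2 / p)) ^ (p / 2) = K * (∑ i ∈ s, N i ^ (2 / p)) ^ (p / 2) := by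
  have h2 : 2 / p * (p / 2) = 1 := by field_simp
  simp_rw [ENNReal.mul_rpow_of_nonneg _ _ (by positivity : 0 ≤ 2 / p)]
  rw [← Finset.mul_sum, ENNReal.mul_rpow_of_nonneg _ _ (by positivity), ← ENNReal.rpow_mul, h2,
    ENNReal.rpow_one]

lemma dil_sum {ι : Type*} (a M : ℝ) (s : Finset ι) (G : ι → ℝ → ℂ) :
    dil a M (∑ i ∈ s, G i) = ∑ i ∈ s, dil a M (G i) := by
  funext x
  simp [dil]

/-- Parabolic rescaling of a decoupling inequality. -/
lemma rescale {ι : Type*} {p : ℝ} (hp : 0 < p) (a : ℝ) {M : ℝ} (hM : 0 < M)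
    {w₁ w₂ : ℝ × ℝ → ℝ≥0∞} (h₁ : Measurable w₁) (h₂ : Measurable w₂) (s : Finset ι)
    {G : ι → ℝ → ℂ} (hG : ∀ i ∈ s, Integrable (G i)) {K : ℝ≥0∞}
    (H : Np p w₁ (ext (∑ i ∈ s, dil a M (G i))) ≤
      K * l2p p w₂ s (fun i => ext (dil a M (G i))) ^ (p / 2)) :
    Np p (fun x => w₁ (parab a M x)) (ext (∑ i ∈ s, G i)) ≤
      K * l2p p (fun x => w₂ (parab a M x)) s (fun i => ext (G i)) ^ (p / 2) := by
  set κ := (ENNReal.ofReal (M ^ 3))⁻¹ * ENNReal.ofReal M ^ p with hκ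
  have hM0 : ENNReal.ofReal M ≠ 0 := by simpa using hM
  have hκ0 : κ ≠ 0 := by
    refine mul_ne_zero (ENNReal.inv_ne_zero.2 ENNReal.ofReal_ne_top) ?_
    simp [ENNReal.rpow_eq_zero_iff, hM0, hp.not_gt]
  have hκt : κ ≠ ⊤ := by
    refine ENNReal.mul_ne_top (ENNReal.inv_ne_top.2 (by simpa using pow_pos hM 3))
      (ENNReal.rpow_ne_top_of_nonneg hp.le ENNReal.ofReal_ne_top)
  rw [← dil_sum, Np_dil hp.le a hM h₁ (integrable_finsetSum' _ hG), ← hκ] at H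
  have e : l2p p w₂ s (fun i => ext (dil a M (G i))) =
      ∑ i ∈ s, (κ * Np p (fun x => w₂ (parab a M x)) (ext (G i))) ^ (2 / p) := by
    refine Finset.sum_congr rfl fun i hi => ?_
    rw [Np_dil hp.le a hM h₂ (hG i hi)]
  rw [e, sum_const_mul_rpow hp, mul_left_comm] at H
  rw [← ENNReal.mul_le_mul_iff_right hκ0 hκt]
  exact H

lemma piece_sum {n : ℕ} (hn : 0 < n) {F : ℕ → ℝ → ℂ}
    (hF : ∀ j < n, ∀ s, F j s ≠ 0 → s ∈ Set.Ico ((j : ℝ) / n) (((j : ℝ) + 1) / n)) :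
    piece (∑ j ∈ Finset.range n, F j) 1 0 = ∑ j ∈ Finset.range n, F j ∧
    ∀ k < n, piece (∑ j ∈ Finset.range n, F j) n k = F k := by
  have hn0 : (0 : ℝ) < n := by exact_mod_cast hn
  constructor
  · refine Set.indicator_eq_self.2 fun s hs => ?_
    rw [Function.mem_support, Finset.sum_apply] at hs
    obtain ⟨j, hj, hjs⟩ := Finset.exists_ne_zero_of_sum_ne_zero hs
    rw [Finset.mem_range] at hj
    obtain ⟨h1, h2⟩ := hF j hj s hjs
    have h3 : ((j : ℝ) + 1) / n ≤ 1 := by rw [div_le_one hn0]; exact_mod_cast hj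
    constructor
    · simpa using le_trans (by positivity) h1
    · simpa using h2.trans_le h3
  · intro k hk
    funext s
    rw [piece]
    by_cases h : s ∈ Set.Ico (((k : ℤ) : ℝ) / n) ((((k : ℤ) : ℝ) + 1) / n)
    · rw [Set.indicator_of_mem h, Finset.sum_apply]
      refine Finset.sum_eq_single k (fun j hj hjk => ?_) (fun h => absurd (Finset.mem_range.2 hk) h)
      by_contra h0
      obtain ⟨h1, h2⟩ := hF j (Finset.mem_range.1 hj) s h0
      obtain ⟨h3, h4⟩ := h
      rw [div_le_iff₀ hn0] at h1 h3
      rw [lt_div_iff₀ hn0] at h2 h4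
      push_cast at h3 h4
      apply hjk
      have h5 : (j : ℝ) < k + 1 := h1.trans_lt h4
      have h6 : (k : ℝ) < j + 1 := h3.trans_lt h2
      have h7 : j < k + 1 := by exact_mod_cast h5
      have h8 : k < j + 1 := by exact_mod_cast h6
      omega
    · rw [Set.indicator_of_notMem h]
      by_contra h0
      apply h
      simpa using hF k hk s (Ne.symm h0)

lemma decoupling_of_support {p : ℝ} (hp : 2 ≤ p) {n : ℕ} (hn : 0 < n) {F : ℕ → ℝ → ℂ}
    (hFi : ∀ j, Integrable (F j))
    (hF : ∀ j < n, ∀ s, F j s ≠ 0 → s ∈ Set.Ico ((j : ℝ) / n) (((j : ℝ) + 1) / n)) :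
    Np p ((Metric.closedBall 0 ((n : ℝ) ^ 2 / 2)).indicator 1) (ext (∑ j ∈ Finset.range n, F j)) ≤
      ENNReal.ofReal (Dconst p n) ^ p * l2p p (fun x => (br ((n : ℝ) ^ 2) x)⁻¹ ^ 100)
        (Finset.range n) (fun j => ext (F j)) ^ (p / 2) := by
  obtain ⟨h1, h2⟩ := piece_sum hn hF
  have h := decoupling hp hn (integrable_finsetSum' (Finset.range n) fun j _ => hFi j) 0
  rw [h1] at h
  have e : l2p p (fun x => (br ((n : ℝ) ^ 2) (x - 0))⁻¹ ^ 100) (Finset.range n)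
      (fun k => ext (piece (∑ j ∈ Finset.range n, F j) n k)) =
      l2p p (fun x => (br ((n : ℝ) ^ 2) x)⁻¹ ^ 100) (Finset.range n) (fun j => ext (F j)) := by
    refine Finset.sum_congr rfl fun k hk => ?_
    simp_rw [h2 k (Finset.mem_range.1 hk), sub_zero]
  rw [e] at h
  refine le_trans (le_of_eq ?_) h
  rw [Np, ← lintegral_indicator Metric.isClosed_closedBall.measurableSet]
  refine lintegral_congr fun x => ?_
  by_cases hx : x ∈ Metric.closedBall (0 : ℝ × ℝ) ((n : ℝ) ^ 2 / 2) <;> simp [hx]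

lemma norm_le_norm_parab_half {a : ℝ} (ha : |a| ≤ 1 / 2) (x : ℝ × ℝ) :
    ‖x‖ ≤ ‖parab a (1 / 2) x‖ ∧ ‖parab a (1 / 2) x‖ ≤ 4 * ‖x‖ := by
  have h1 : ‖parab a (1 / 2) x‖ = max |2 * x.1 + 4 * a * x.2| |4 * x.2| := by
    rw [parab, Prod.norm_def]
    simp only [Real.norm_eq_abs]
    congr 2 <;> ring
  have h2 : ‖x‖ = max |x.1| |x.2| := by rw [Prod.norm_def]; rfl
  rw [h1, h2]
  have e1 : |a * x.2| ≤ |x.2| / 2 := by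
    rw [abs_mul]; nlinarith [abs_nonneg x.2]
  have e2 : |4 * x.2| = 4 * |x.2| := by rw [abs_mul]; norm_num
  rw [e2]
  constructor
  · refine max_le ?_ ?_
    · have : |x.1| ≤ |2 * x.1 + 4 * a * x.2| / 2 + |x.2| := by
        have h3 : x.1 = (2 * x.1 + 4 * a * x.2) / 2 + -(2 * (a * x.2)) := by ring
        calc |x.1| = |(2 * x.1 + 4 * a * x.2) / 2 + -(2 * (a * x.2))| := by rw [← h3]
          _ ≤ |(2 * x.1 + 4 * a * x.2) / 2| + |-(2 * (a * x.2))| := abs_add_le _ _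
          _ ≤ _ := by
            rw [abs_neg, abs_div, abs_mul 2 (a * x.2)]
            norm_num
            rw [abs_mul] at e1
            linarith
      have h4 := le_max_left |2 * x.1 + 4 * a * x.2| (4 * |x.2|)
      have h5 := le_max_right |2 * x.1 + 4 * a * x.2| (4 * |x.2|)
      linarith [abs_nonneg x.2, abs_nonneg (2 * x.1 + 4 * a * x.2)]
    · exact le_max_of_le_right (by linarith [abs_nonneg x.2])
  · have h6 := le_max_left |x.1| |x.2|
    have h7 := le_max_right |x.1| |x.2|
    refine max_le ?_ (by linarith)
    calc |2 * x.1 + 4 * a * x.2| = |2 * x.1 + 4 * (a * x.2)| := by ring_nf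
      _ ≤ |2 * x.1| + |4 * (a * x.2)| := abs_add_le _ _
      _ ≤ _ := by
        rw [abs_mul 2, abs_mul 4]
        norm_num
        rw [abs_mul] at e1
        linarith

/-- Decoupling for functions living in slightly enlarged cells of one parity. -/
lemma decoupling_parity {p : ℝ} (hp : 2 ≤ p) {n : ℕ} (hn : 0 < n) {ε : ℕ} (hε : ε < 2)
    {G : ℕ → ℝ → ℂ} (hGi : ∀ j, Integrable (G j))
    (hG : ∀ j < n, ∀ s, G j s ≠ 0 → s ∈ Set.Ioo (((2 * j + ε : ℕ) : ℝ) / n - 1 / (2 * n))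
      ((((2 * j + ε : ℕ) : ℝ) + 1) / n + 1 / (2 * n))) :
    Np p ((Metric.closedBall 0 ((n : ℝ) ^ 2 / 8)).indicator 1) (ext (∑ j ∈ Finset.range n, G j)) ≤
      ENNReal.ofReal (Dconst p n) ^ p * l2p p (fun x => (br ((n : ℝ) ^ 2) x)⁻¹ ^ 100)
        (Finset.range n) (fun j => ext (G j)) ^ (p / 2) := by
  have hn0 : (0 : ℝ) < n := by exact_mod_cast hn
  have hn1 : (1 : ℝ) ≤ n := by exact_mod_cast hn
  have hr : (0 : ℝ) < (n : ℝ) ^ 2 := by positivity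
  set a : ℝ := (2 * ε - 1) / (2 * n) with ha
  have hε' : (ε : ℝ) = 0 ∨ (ε : ℝ) = 1 := by
    interval_cases ε <;> simp
  have ha2 : |a| ≤ 1 / 2 := by
    rw [ha, abs_div, abs_of_pos (by positivity : (0 : ℝ) < 2 * n), div_le_iff₀ (by positivity)]
    rcases hε' with h | h <;> rw [h] <;> norm_num <;> linarith
  have h := rescale (p := p) (by linarith) a (M := 1 / 2) (by norm_num)
    (w₁ := (Metric.closedBall 0 ((n : ℝ) ^ 2 / 2)).indicator 1)
    (w₂ := fun x => (br ((n : ℝ) ^ 2) x)⁻¹ ^ 100)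
    (measurable_one.indicator Metric.isClosed_closedBall.measurableSet) (by fun_prop)
    (Finset.range n) (fun j _ => hGi j)
    (decoupling_of_support hp hn (fun j => integrable_dil (hGi j) a (by norm_num)) ?_)
  · refine le_trans ?_ (h.trans ?_)
    · unfold Np
      refine lintegral_mono fun x => mul_le_mul' le_rfl ?_
      by_cases hx : x ∈ Metric.closedBall (0 : ℝ × ℝ) ((n : ℝ) ^ 2 / 8)
      · have : parab a (1 / 2) x ∈ Metric.closedBall (0 : ℝ × ℝ) ((n : ℝ) ^ 2 / 2) := by
          rw [mem_closedBall_zero_iff] at hx ⊢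
          linarith [(norm_le_norm_parab_half ha2 x).2]
        simp only
        rw [Set.indicator_of_mem this, Pi.one_apply]
        exact Set.indicator_le_self' (fun _ _ => zero_le) _ |>.trans (by simp)
      · rw [Set.indicator_of_notMem hx]; exact zero_le
    · unfold l2p Np
      gcongr with j hj x
      simp only
      gcongr
      exact br_mono hr (norm_le_norm_parab_half ha2 x).1
  · intro j hj s hs
    obtain ⟨h1, h2⟩ := hG j hj _ hs
    have e1 : a + s / (1 / 2) = a + 2 * s := by ring
    rw [e1, ha] at h1 h2
    push_cast at h1 h2
    constructor
    · rw [div_le_iff₀ hn0]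
      have h3 : (2 * (j : ℝ) + ε) / n - 1 / (2 * n) = (2 * (2 * j + ε) - 1) / (2 * n) := by
        field_simp
      have h4 : (2 * (ε : ℝ) - 1) / (2 * n) + 2 * s = (2 * ε - 1 + 4 * n * s) / (2 * n) := by
        field_simp; ring
      rw [h3, h4, div_lt_div_iff_of_pos_right (by positivity)] at h1
      linarith
    · rw [lt_div_iff₀ hn0]
      have h3 : (2 * (j : ℝ) + ε + 1) / n + 1 / (2 * n) = (2 * (2 * j + ε + 1) + 1) / (2 * n) := by
        field_simp
      have h4 : (2 * (ε : ℝ) - 1) / (2 * n) + 2 * s = (2 * ε - 1 + 4 * n * s) / (2 * n) := by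
        field_simp; ring
      rw [h3, h4, div_lt_div_iff_of_pos_right (by positivity)] at h2
      linarith

lemma slice_sum {ι : Type*} (s : Finset ι) {g : ι → ℝ → ℂ} (hg : ∀ i ∈ s, Integrable (g i)) {r : ℝ}
    (hr : 0 < r) (t : ℝ) : slice (fun y => ext (∑ i ∈ s, g i) y * chi r y) t =
      ∑ i ∈ s, slice (fun y => ext (g i) y * chi r y) t := by
  funext η
  simp only [slice, Finset.sum_apply]
  rw [← integral_finsetSum]
  · congr 1
    funext y
    have e : (∑ i ∈ s, g i) = fun ξ => ∑ i ∈ s, g i ξ := by funext ξ; simp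
    rw [e, ext_sum s g hg, Finset.sum_mul, Finset.sum_mul]
  · exact fun i hi => (integrable_ext_mul_chi (hg i hi) hr).mul_ch (by fun_prop)

lemma measurable_ext_slice {g : ℝ → ℂ} (hg : Integrable g) {r : ℝ} (hr : 0 < r) :
    Measurable fun q : ℝ × (ℝ × ℝ) => ext (slice (fun y => ext g y * chi r y) q.1) q.2 := by
  unfold ext
  have h := continuous_slice (integrable_ext_mul_chi hg hr)
  have h1 : Continuous fun z : (ℝ × (ℝ × ℝ)) × ℝ =>
      slice (fun y => ext g y * chi r y) z.1.1 z.2 :=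
    h.comp (by fun_prop : Continuous fun z : (ℝ × (ℝ × ℝ)) × ℝ => (z.1.1, z.2))
  have h2 : Continuous fun z : (ℝ × (ℝ × ℝ)) × ℝ =>
      slice (fun y => ext g y * chi r y) z.1.1 z.2 * ch (z.2 * z.1.2.1 + z.2 ^ 2 * z.1.2.2) :=
    h1.mul (continuous_ch.comp (by fun_prop))
  exact (h2.stronglyMeasurable.integral_prod_right').measurable

lemma Np_indicator_ball (p : ℝ) (c : ℝ × ℝ) (ρ : ℝ) (f : ℝ × ℝ → ℂ) :
    Np p ((Metric.closedBall c ρ).indicator 1) f = ∫⁻ x in Metric.closedBall c ρ, ‖f x‖ₑ ^ p := by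
  rw [Np, ← lintegral_indicator Metric.isClosed_closedBall.measurableSet]
  refine lintegral_congr fun x => ?_
  by_cases hx : x ∈ Metric.closedBall c ρ <;> simp [hx]

lemma exists_enorm_ext_le_slice : ∃ C : ℝ≥0, ∀ r : ℝ, 1 ≤ r → ∀ g : ℝ → ℂ, Integrable g →
    (∀ ξ, g ξ ≠ 0 → ξ ∈ Set.Icc (0 : ℝ) 1) → ∀ x ∈ Metric.closedBall (0 : ℝ × ℝ) (r / 8),
    ‖ext g x‖ₑ ≤ C * ENNReal.ofReal r ^ 2 * ∫⁻ t in Metric.closedBall (0 : ℝ) (2 / r),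
      ‖ext (slice (fun y => ext g y * chi r y) t) x‖ₑ := by
  obtain ⟨c, hc, hlow⟩ := kb_bumpS_lower
  refine ⟨((c.toNNReal)⁻¹) ^ 2, fun r hr g hg hs x hx => ?_⟩
  have hr0 : 0 < r := by linarith
  set ρ := ENNReal.ofReal r with hρ
  have hρ1 : ρ⁻¹ * ρ = 1 := ENNReal.inv_mul_cancel (by simpa [hρ] using hr0) ENNReal.ofReal_ne_top
  have hc0 : c.toNNReal ≠ 0 := by simpa using hc
  have hc1 : ((c.toNNReal⁻¹ : ℝ≥0) : ℝ≥0∞) * ENNReal.ofReal c = 1 := by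
    rw [ENNReal.ofReal, ← ENNReal.coe_mul, inv_mul_cancel₀ hc0, ENNReal.coe_one]
  have h1 : ‖ext g x * chi r x‖ₑ ≤ ∫⁻ t in Metric.closedBall (0 : ℝ) (2 / r),
      ‖ext (slice (fun y => ext g y * chi r y) t) x‖ₑ := by
    rw [ext_mul_chi hg hs hr]
    refine (enorm_integral_le_lintegral_enorm _).trans ?_
    rw [← lintegral_indicator Metric.isClosed_closedBall.measurableSet]
    refine lintegral_mono fun t => ?_
    by_cases ht : t ∈ Metric.closedBall (0 : ℝ) (2 / r)
    · rw [Set.indicator_of_mem ht, enorm_mul, enorm_ch, one_mul]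
    · have : slice (fun y => ext g y * chi r y) t = 0 := by
        funext η
        by_contra h
        exact ht (by simpa using (slice_bounds hg hs hr h).2)
      simp only
      rw [this]
      simp [ext]
  have hx' : ‖x‖ ≤ r / 8 := by simpa using hx
  have hb : ∀ u : ℝ, |u| ≤ ‖x‖ → ENNReal.ofReal c ≤ ‖kb bumpS (u / r)‖ₑ := by
    intro u hu
    rw [← ofReal_norm]
    refine ENNReal.ofReal_le_ofReal (hlow _ ?_)
    rw [abs_div, abs_of_pos hr0, div_le_iff₀ hr0]
    linarith
  have e : ‖((r⁻¹ : ℝ) : ℂ)‖ₑ = ρ⁻¹ := by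
    rw [← ofReal_norm, Complex.norm_real, Real.norm_of_nonneg (by positivity),
      ENNReal.ofReal_inv_of_pos hr0]
  have h2 : (ρ⁻¹ * ENNReal.ofReal c) * (ρ⁻¹ * ENNReal.ofReal c) ≤ ‖chi r x‖ₑ := by
    rw [chi, enorm_mul, enorm_mul, enorm_mul, e]
    exact mul_le_mul' (mul_le_mul' le_rfl (hb _ (norm_fst_le x)))
      (mul_le_mul' le_rfl (hb _ (norm_snd_le x)))
  calc ‖ext g x‖ₑ = ‖ext g x‖ₑ * ((ρ⁻¹ * ρ) ^ 2 *
        (((c.toNNReal⁻¹ : ℝ≥0) : ℝ≥0∞) * ENNReal.ofReal c) ^ 2) := by rw [hρ1, hc1]; simp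
    _ = ((c.toNNReal⁻¹ : ℝ≥0) : ℝ≥0∞) ^ 2 * ρ ^ 2 * (‖ext g x‖ₑ *
        ((ρ⁻¹ * ENNReal.ofReal c) * (ρ⁻¹ * ENNReal.ofReal c))) := by ring
    _ ≤ ((c.toNNReal⁻¹ : ℝ≥0) : ℝ≥0∞) ^ 2 * ρ ^ 2 * (‖ext g x‖ₑ * ‖chi r x‖ₑ) := by gcongr
    _ ≤ _ := by
      rw [← enorm_mul]
      push_cast
      gcongr

lemma exists_local_parity : ∃ C : ℝ≥0, ∀ p : ℝ, 4 < p → p < 6 → ∀ n : ℕ, 0 < n → ∀ ε < 2,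
    ∀ g : ℕ → ℝ → ℂ, (∀ j, Integrable (g j)) → (∀ j < n, ∀ s, g j s ≠ 0 → s ∈ Set.Icc (0 : ℝ) 1 ∧
      s ∈ Set.Ico (((2 * j + ε : ℕ) : ℝ) / n) ((((2 * j + ε : ℕ) : ℝ) + 1) / n)) →
    Np p ((Metric.closedBall 0 ((n : ℝ) ^ 2 / 8)).indicator 1) (ext (∑ j ∈ Finset.range n, g j)) ≤
      (C * ENNReal.ofReal (Dconst p n)) ^ p * l2p p (fun x => (br ((n : ℝ) ^ 2) x)⁻¹ ^ 104)
        (Finset.range n) (fun j => ext (g j)) ^ (p / 2) := by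
  obtain ⟨C₁, h₁⟩ := exists_slice_Lp
  obtain ⟨C₂, h₂⟩ := exists_enorm_ext_le_slice
  refine ⟨C₂ * 4 * C₁, fun p hp4 hp6 n hn ε hε g hgi hg => ?_⟩
  have hn0 : (0 : ℝ) < n := by exact_mod_cast hn
  have hn1 : (1 : ℝ) ≤ n := by exact_mod_cast hn
  set r : ℝ := (n : ℝ) ^ 2 with hr_def
  have hr : 1 ≤ r := one_le_pow₀ hn1
  have hr0 : 0 < r := by linarith
  have hp0 : 0 ≤ p := by linarith
  set ρ := ENNReal.ofReal r with hρ
  have hρ1 : ρ * ρ⁻¹ = 1 := ENNReal.mul_inv_cancel (by simpa [hρ] using hr0) ENNReal.ofReal_ne_top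
  set gs := ∑ j ∈ Finset.range n, g j with hgs
  have hgsi : Integrable gs := integrable_finsetSum' _ fun j _ => hgi j
  have hsupp : ∀ ξ, gs ξ ≠ 0 → ξ ∈ Set.Icc (0 : ℝ) 1 := by
    intro ξ h
    rw [hgs, Finset.sum_apply] at h
    obtain ⟨j, hj, hjs⟩ := Finset.exists_ne_zero_of_sum_ne_zero h
    exact (hg j (Finset.mem_range.1 hj) ξ hjs).1
  set D := ENNReal.ofReal (Dconst p n) with hD
  set L := l2p p (fun x => (br r x)⁻¹ ^ 104) (Finset.range n) (fun j => ext (g j)) ^ (p / 2) with hL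
  set S := fun t => slice (fun y => ext gs y * chi r y) t with hS
  have hmeas : Measurable fun q : ℝ × (ℝ × ℝ) => ‖ext (S q.1) q.2‖ₑ :=
    (measurable_ext_slice hgsi hr0).enorm
  have hspread : ∀ j < n, ∀ t s, slice (fun y => ext (g j) y * chi r y) t s ≠ 0 →
      s ∈ Set.Ioo (((2 * j + ε : ℕ) : ℝ) / n - 1 / (2 * n))
        ((((2 * j + ε : ℕ) : ℝ) + 1) / n + 1 / (2 * n)) := by
    intro j hj t s h
    obtain ⟨ξ, h0, h1, -⟩ := slice_ne_zero (hgi j) hr0 h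
    obtain ⟨h3, h4⟩ := (hg j hj ξ h0).2
    have h5 : |s - ξ| < 1 / (2 * n) := by
      rw [abs_mul, abs_of_pos hr0] at h1
      rw [lt_div_iff₀ (by positivity)]
      nlinarith [abs_nonneg (s - ξ), mul_le_mul_of_nonneg_right hn1 hn0.le]
    rw [abs_lt] at h5
    constructor <;> linarith
  have hslice : ∀ t, Np p ((Metric.closedBall 0 (r / 8)).indicator 1) (ext (S t)) ≤
      (D * (C₁ * ρ⁻¹)) ^ p * L := by
    intro t
    have h3 := decoupling_parity (p := p) (by linarith) hn hε
      (G := fun j => if j < n then slice (fun y => ext (g j) y * chi r y) t else 0) ?_ ?_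
    · have e : ∑ j ∈ Finset.range n, (if j < n then slice (fun y => ext (g j) y * chi r y) t else 0)
          = S t := by
        rw [hS]
        simp only
        rw [hgs, slice_sum _ (fun j _ => hgi j) hr0]
        exact Finset.sum_congr rfl fun j hj => if_pos (Finset.mem_range.1 hj)
      rw [e] at h3
      refine h3.trans ?_
      rw [ENNReal.mul_rpow_of_nonneg _ _ hp0, mul_assoc]
      refine mul_le_mul' le_rfl ?_
      rw [hL]
      unfold l2p
      rw [← sum_const_mul_rpow (by linarith)]
      refine ENNReal.rpow_le_rpow (Finset.sum_le_sum fun j hj => ENNReal.rpow_le_rpow ?_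
        (by positivity)) (by positivity)
      simp only [if_pos (Finset.mem_range.1 hj)]
      refine h₁ p hp4 hp6 ((((2 * j + ε : ℕ) : ℝ)) / n) n hn0 (g j) (hgi j) t fun η hη => ?_
      obtain ⟨h5, h6⟩ := hspread j (Finset.mem_range.1 hj) t η hη
      rw [abs_mul, abs_of_pos hn0, ← le_div_iff₀ hn0, abs_le]
      have e1 : (((2 * j + ε : ℕ) : ℝ) + 1) / n = ((2 * j + ε : ℕ) : ℝ) / n + 1 / n := add_div _ _ _
      have e2 : 1 / (2 * (n : ℝ)) = (1 / n) / 2 := by field_simp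
      have e3 : 2 / (n : ℝ) = 2 * (1 / n) := by ring
      have e4 : 0 < 1 / (n : ℝ) := by positivity
      rw [e1, e2] at h6
      rw [e2] at h5
      rw [e3]
      constructor <;> linarith
    · intro j
      split_ifs with hj
      · exact integrable_slice (hgi j) (fun ξ h => (hg j hj ξ h).1) hr t
      · exact integrable_zero _ _ _
    · intro j hj s h
      simp only [if_pos hj] at h
      exact hspread j hj t s h
  set I := Metric.closedBall (0 : ℝ) (2 / r) with hI
  have hvol : volume I = 4 * ρ⁻¹ := by
    rw [hI, Real.volume_closedBall, ← ENNReal.ofReal_inv_of_pos hr0,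
      show 2 * (2 / r) = 4 * r⁻¹ by ring, ENNReal.ofReal_mul (by norm_num)]
    norm_num
  have hpt : ∀ x ∈ Metric.closedBall (0 : ℝ × ℝ) (r / 8), ‖ext gs x‖ₑ ^ p ≤
      (C₂ * ρ ^ 2) ^ p * ((4 * ρ⁻¹) ^ (p - 1) * ∫⁻ t in I, ‖ext (S t) x‖ₑ ^ p) := by
    intro x hx
    refine (ENNReal.rpow_le_rpow (h₂ r hr gs hgsi hsupp x hx) hp0).trans ?_
    rw [ENNReal.mul_rpow_of_nonneg _ _ hp0]
    refine mul_le_mul' le_rfl ?_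
    have h4 := lintegral_mul_rpow_le (μ := volume.restrict I) (q := p) (by linarith)
      (f := fun t => ‖ext (S t) x‖ₑ) (k := fun _ => 1)
      (hmeas.comp (by fun_prop : Measurable fun t : ℝ => (t, x))).aemeasurable aemeasurable_const
    simpa [hvol] using h4
  rw [Np_indicator_ball]
  calc ∫⁻ x in Metric.closedBall 0 (r / 8), ‖ext gs x‖ₑ ^ p
      ≤ ∫⁻ x in Metric.closedBall 0 (r / 8),
        (C₂ * ρ ^ 2) ^ p * ((4 * ρ⁻¹) ^ (p - 1) * ∫⁻ t in I, ‖ext (S t) x‖ₑ ^ p) :=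
        setLIntegral_mono' Metric.isClosed_closedBall.measurableSet hpt
    _ = (C₂ * ρ ^ 2) ^ p * ((4 * ρ⁻¹) ^ (p - 1) *
        ∫⁻ t in I, Np p ((Metric.closedBall 0 (r / 8)).indicator 1) (ext (S t))) := by
        have hm2 : Measurable fun q : ℝ × (ℝ × ℝ) => ‖ext (S q.1) q.2‖ₑ ^ p := hmeas.pow_const p
        rw [lintegral_const_mul, lintegral_const_mul, lintegral_lintegral_swap]
        · simp_rw [Np_indicator_ball]
        · exact (hm2.comp measurable_swap).aemeasurable
        · exact (hm2.comp measurable_swap).lintegral_prod_right'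
        · exact ((hm2.comp measurable_swap).lintegral_prod_right').const_mul _
    _ ≤ (C₂ * ρ ^ 2) ^ p * ((4 * ρ⁻¹) ^ (p - 1) * ∫⁻ t in I, (D * (C₁ * ρ⁻¹)) ^ p * L) :=
        mul_le_mul' le_rfl (mul_le_mul' le_rfl (lintegral_mono hslice))
    _ = (C₂ * ρ ^ 2) ^ p * ((4 * ρ⁻¹) ^ (p - 1) * (4 * ρ⁻¹) ^ (1 : ℝ)) * (D * (C₁ * ρ⁻¹)) ^ p * L := by
        rw [setLIntegral_const, hvol, ENNReal.rpow_one]; ring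
    _ = ((C₂ * ρ ^ 2) * (4 * ρ⁻¹) * (D * (C₁ * ρ⁻¹))) ^ p * L := by
        rw [← ENNReal.rpow_add_of_nonneg _ _ (by linarith) (by norm_num), sub_add_cancel,
          ← ENNReal.mul_rpow_of_nonneg _ _ hp0, ← ENNReal.mul_rpow_of_nonneg _ _ hp0]
    _ = _ := by
        congr 2
        push_cast
        calc _ = C₂ * 4 * C₁ * D * (ρ * ρ⁻¹) ^ 2 := by ring
          _ = _ := by rw [hρ1]; simp

lemma sum_range_two_mul {M : Type*} [AddCommMonoid M] (f : ℕ → M) (n : ℕ) :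
    ∑ l ∈ Finset.range (2 * n), f l =
      ∑ j ∈ Finset.range n, f (2 * j + 0) + ∑ j ∈ Finset.range n, f (2 * j + 1) := by
  induction n with
  | zero => simp
  | succ n ih =>
    rw [show 2 * (n + 1) = 2 * n + 1 + 1 by ring, Finset.sum_range_succ, Finset.sum_range_succ, ih,
      Finset.sum_range_succ, Finset.sum_range_succ]
    simp only [add_zero]
    abel

lemma ext_zero : ext 0 = 0 := by funext x; simp [ext]

lemma ext_add {g h : ℝ → ℂ} (hg : Integrable g) (hh : Integrable h) (x : ℝ × ℝ) :
    ext (g + h) x = ext g x + ext h x := by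
  unfold ext
  rw [← integral_add (integrable_ext hg x) (integrable_ext hh x)]
  simp [add_mul]

lemma Np_zero {p : ℝ} (hp : 0 < p) (w : ℝ × ℝ → ℝ≥0∞) : Np p w 0 = 0 := by
  simp [Np, ENNReal.zero_rpow_of_pos hp]

lemma exists_local_zero : ∃ C : ℝ≥0, ∀ p : ℝ, 4 < p → p < 6 → ∀ n : ℕ, 0 < n →
    ∀ g : ℝ → ℂ, Integrable g →
    Np p ((Metric.closedBall 0 ((n : ℝ) ^ 2 / 8)).indicator 1) (ext (piece g 1 0)) ≤
      (C * ENNReal.ofReal (Dconst p n)) ^ p * l2p p (fun x => (br ((n : ℝ) ^ 2) x)⁻¹ ^ 104)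
        (Finset.range n) (fun k => ext (piece g n k)) ^ (p / 2) := by
  obtain ⟨C, hC⟩ := exists_local_parity
  refine ⟨2 * C, fun p hp4 hp6 n hn g hg => ?_⟩
  have hp0 : 0 < p := by linarith
  have hn0 : (0 : ℝ) < n := by exact_mod_cast hn
  set a : ℕ → ℝ → ℂ := fun l => if l < n then piece g n l else 0 with ha
  have hai : ∀ l, Integrable (a l) := by
    intro l
    simp only [ha]
    split_ifs
    · exact integrable_piece hg _ _
    · exact integrable_zero _ _ _
  have hsub : Finset.range n ⊆ Finset.range (2 * n) := Finset.range_subset_range.2 (by omega)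
  have hsum : piece g 1 0 = ∑ j ∈ Finset.range n, a (2 * j + 0) + ∑ j ∈ Finset.range n, a (2 * j + 1) := by
    rw [← sum_range_two_mul a n, ← Finset.sum_subset hsub]
    · rw [sum_piece g one_pos 0 hn]
      funext ξ
      rw [Finset.sum_apply]
      refine Finset.sum_congr rfl fun k hk => ?_
      simp [ha, Finset.mem_range.1 hk]
    · intro l _ hl
      simp only [ha]
      rw [if_neg (by simpa using hl)]
  set w : ℝ × ℝ → ℝ≥0∞ := fun x => (br ((n : ℝ) ^ 2) x)⁻¹ ^ 104 with hw
  have hL : l2p p w (Finset.range n) (fun k => ext (piece g n k)) =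
      l2p p w (Finset.range n) (fun j => ext (a (2 * j + 0))) +
      l2p p w (Finset.range n) (fun j => ext (a (2 * j + 1))) := by
    unfold l2p
    rw [← sum_range_two_mul (fun l => Np p w (ext (a l)) ^ (2 / p)) n, ← Finset.sum_subset hsub]
    · refine Finset.sum_congr rfl fun k hk => ?_
      simp [ha, Finset.mem_range.1 hk]
    · intro l _ hl
      simp only [ha]
      rw [if_neg (by simpa using hl), ext_zero, Np_zero hp0, ENNReal.zero_rpow_of_pos (by positivity)]
  have hkey : ∀ ε < 2, Np p ((Metric.closedBall 0 ((n : ℝ) ^ 2 / 8)).indicator 1)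
      (ext (∑ j ∈ Finset.range n, a (2 * j + ε))) ≤ (C * ENNReal.ofReal (Dconst p n)) ^ p *
        l2p p w (Finset.range n) (fun j => ext (a (2 * j + ε))) ^ (p / 2) := by
    intro ε hε
    refine hC p hp4 hp6 n hn ε hε (fun j => a (2 * j + ε)) (fun j => hai _) fun j _ s hs => ?_
    simp only [ha] at hs
    split_ifs at hs with h
    · have h1 : s ∈ Set.Ico (((2 * j + ε : ℕ) : ℝ) / n) ((((2 * j + ε : ℕ) : ℝ) + 1) / n) := by
        by_contra h2
        refine hs ?_
        rw [piece, Set.indicator_of_notMem]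
        rw [Int.cast_natCast]
        exact h2
      exact ⟨Set.Ico_subset_Icc_self.trans (Set.Icc_subset_Icc (by positivity) (by
        rw [div_le_one hn0]; exact_mod_cast h)) h1, h1⟩
    · exact absurd rfl hs
  set G₀ := ∑ j ∈ Finset.range n, a (2 * j + 0)
  set G₁ := ∑ j ∈ Finset.range n, a (2 * j + 1)
  have hG₀ : Integrable G₀ := integrable_finsetSum' _ fun j _ => hai _
  have hG₁ : Integrable G₁ := integrable_finsetSum' _ fun j _ => hai _
  set v : ℝ × ℝ → ℝ≥0∞ := (Metric.closedBall 0 ((n : ℝ) ^ 2 / 8)).indicator 1 with hv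
  have hvm : Measurable v := measurable_one.indicator Metric.isClosed_closedBall.measurableSet
  set Λ := l2p p w (Finset.range n) (fun k => ext (piece g n k))
  have hkey' : ∀ ε < 2, Np p v (ext (∑ j ∈ Finset.range n, a (2 * j + ε))) ≤
      (C * ENNReal.ofReal (Dconst p n)) ^ p * Λ ^ (p / 2) := by
    intro ε hε
    refine (hkey ε hε).trans (mul_le_mul' le_rfl (ENNReal.rpow_le_rpow ?_ (by positivity)))
    rw [hL]
    interval_cases ε
    · exact le_self_add
    · exact le_add_self
  have e2 : (2 : ℝ≥0∞) ^ (p - 1) * 2 = 2 ^ p := by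
    have := ENNReal.rpow_add (x := 2) (p - 1) 1 (by norm_num) (by norm_num)
    rw [sub_add_cancel, ENNReal.rpow_one] at this
    exact this.symm
  calc Np p v (ext (piece g 1 0))
      ≤ ∫⁻ x, 2 ^ (p - 1) * (‖ext G₀ x‖ₑ ^ p * v x + ‖ext G₁ x‖ₑ ^ p * v x) := by
        unfold Np
        refine lintegral_mono fun x => ?_
        rw [hsum, ext_add hG₀ hG₁, ← add_mul, ← mul_assoc]
        refine mul_le_mul' ?_ le_rfl
        exact (ENNReal.rpow_le_rpow (enorm_add_le _ _) hp0.le).trans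
          (ENNReal.rpow_add_le_mul_rpow_add_rpow _ _ (by linarith))
    _ = 2 ^ (p - 1) * (Np p v (ext G₀) + Np p v (ext G₁)) := by
        have h0 := continuous_ext hG₀
        have h1 := continuous_ext hG₁
        rw [lintegral_const_mul, lintegral_add_left] <;> first | rfl | fun_prop
    _ ≤ 2 ^ (p - 1) * ((C * ENNReal.ofReal (Dconst p n)) ^ p * Λ ^ (p / 2) +
          (C * ENNReal.ofReal (Dconst p n)) ^ p * Λ ^ (p / 2)) :=
        mul_le_mul' le_rfl (add_le_add (hkey' 0 (by norm_num)) (hkey' 1 (by norm_num)))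
    _ = (2 ^ (p - 1) * 2) * (C * ENNReal.ofReal (Dconst p n)) ^ p * Λ ^ (p / 2) := by ring
    _ = _ := by
        rw [e2, ← ENNReal.mul_rpow_of_nonneg _ _ hp0.le]
        congr 2
        push_cast
        ring

/-- Decoupling on a ball, with a weight decaying fast enough to be summed over translates. -/
lemma exists_local : ∃ C : ℝ≥0, ∀ p : ℝ, 4 < p → p < 6 → ∀ n : ℕ, 0 < n →
    ∀ g : ℝ → ℂ, Integrable g → ∀ z : ℝ × ℝ,
    ∫⁻ x in Metric.closedBall z ((n : ℝ) ^ 2 / 8), ‖ext (piece g 1 0) x‖ₑ ^ p ≤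
      (C * ENNReal.ofReal (Dconst p n)) ^ p * l2p p (fun x => (br ((n : ℝ) ^ 2) (x - z))⁻¹ ^ 104)
        (Finset.range n) (fun k => ext (piece g n k)) ^ (p / 2) := by
  obtain ⟨C, hC⟩ := exists_local_zero
  refine ⟨C, fun p hp4 hp6 n hn g hg z => ?_⟩
  have h := hC p hp4 hp6 n hn (modul z g) (integrable_modul hg z)
  have e : ∀ (M : ℝ) (l : ℤ), ext (piece (modul z g) M l) = fun x => ext (piece g M l) (z + x) := by
    intro M l
    funext x
    rw [piece, ← modul_indicator, ext_modul, piece]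
  have e2 : ∀ (w : ℝ × ℝ → ℝ≥0∞) (F : ℝ × ℝ → ℂ), Np p w (fun x => F (z + x)) =
      Np p (fun x => w (x - z)) F := by
    intro w F
    unfold Np
    rw [← lintegral_add_left_eq_self (fun x => ‖F x‖ₑ ^ p * w (x - z)) z]
    simp only [add_sub_cancel_left]
  have e3 : (fun x => (Metric.closedBall (0 : ℝ × ℝ) ((n : ℝ) ^ 2 / 8)).indicator
      (1 : ℝ × ℝ → ℝ≥0∞) (x - z)) = (Metric.closedBall z ((n : ℝ) ^ 2 / 8)).indicator 1 := by
    funext x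
    by_cases h : x ∈ Metric.closedBall z ((n : ℝ) ^ 2 / 8)
    · rw [Set.indicator_of_mem h, Set.indicator_of_mem]
      · rfl
      · rw [Metric.mem_closedBall, dist_eq_norm] at h ⊢
        simpa using h
    · rw [Set.indicator_of_notMem h, Set.indicator_of_notMem]
      rw [Metric.mem_closedBall, dist_eq_norm] at h ⊢
      simpa using h
  unfold l2p at h ⊢
  simp only [e, e2, e3, Np_indicator_ball] at h
  exact h

lemma lintegral_ball_eq (ρ : ℝ) (w : ℝ × ℝ → ℝ≥0∞) (x : ℝ × ℝ) :
    ∫⁻ z in Metric.closedBall x ρ, w z =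
      ∫⁻ z, w z * {q : (ℝ × ℝ) × (ℝ × ℝ) | dist q.2 q.1 ≤ ρ}.indicator 1 (x, z) := by
  rw [← lintegral_indicator Metric.isClosed_closedBall.measurableSet]
  refine lintegral_congr fun z => ?_
  by_cases h : dist z x ≤ ρ
  · rw [Set.indicator_of_mem (by exact h), Set.indicator_of_mem (by exact h), Pi.one_apply, mul_one]
  · rw [Set.indicator_of_notMem (by exact h), Set.indicator_of_notMem (by exact h), mul_zero]

lemma measurable_near (ρ : ℝ) : Measurable
    ({q : (ℝ × ℝ) × (ℝ × ℝ) | dist q.2 q.1 ≤ ρ}.indicator (1 : (ℝ × ℝ) × (ℝ × ℝ) → ℝ≥0∞)) :=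
  measurable_one.indicator (isClosed_le (by fun_prop) (by fun_prop)).measurableSet

lemma lintegral_mul_average {F w : ℝ × ℝ → ℝ≥0∞} (hF : Measurable F) (hw : Measurable w) (ρ : ℝ) :
    ∫⁻ x, F x * ∫⁻ z in Metric.closedBall x ρ, w z =
      ∫⁻ z, w z * ∫⁻ x in Metric.closedBall z ρ, F x := by
  have hm := measurable_near ρ
  have e : ∀ x, F x * ∫⁻ z in Metric.closedBall x ρ, w z = ∫⁻ z, F x *
      (w z * {q : (ℝ × ℝ) × (ℝ × ℝ) | dist q.2 q.1 ≤ ρ}.indicator 1 (x, z)) := by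
    intro x
    rw [lintegral_ball_eq, lintegral_const_mul]
    exact hw.mul (hm.comp (by fun_prop : Measurable fun z => (x, z)))
  simp_rw [e]
  rw [lintegral_lintegral_swap]
  · refine lintegral_congr fun z => ?_
    rw [lintegral_ball_eq, ← lintegral_const_mul]
    · refine lintegral_congr fun x => ?_
      have : {q : (ℝ × ℝ) × (ℝ × ℝ) | dist q.2 q.1 ≤ ρ}.indicator (1 : (ℝ × ℝ) × (ℝ × ℝ) → ℝ≥0∞) (x, z) =
          {q : (ℝ × ℝ) × (ℝ × ℝ) | dist q.2 q.1 ≤ ρ}.indicator 1 (z, x) := by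
        simp [Set.indicator_apply, dist_comm]
      rw [this]
      ring
    · exact hF.mul (hm.comp (by fun_prop : Measurable fun x => (z, x)))
  · exact ((hF.comp measurable_fst).mul ((hw.comp measurable_snd).mul hm)).aemeasurable

lemma exists_slow_br_conv : ∃ C : ℝ≥0, ∀ (A : ℝ≥0) (R : ℝ), 0 < R → ∀ w : ℝ × ℝ → ℝ≥0∞,
    Slow A R w → Measurable w → ∀ x, ∫⁻ z, w z * (br R (x - z))⁻¹ ^ 104 ≤
      C * A * ENNReal.ofReal R ^ 2 * w x := by
  obtain ⟨C, hC⟩ := exists_slow_conv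
  refine ⟨C, fun A R hR w hw hwm x => ?_⟩
  have e : ∀ z, w z * (br R (x - z))⁻¹ ^ 104 = ENNReal.ofReal R ^ 2 * (w z * Om R (z - x)) := by
    intro z
    rw [Om, br_sub_comm, mul_left_comm, ← mul_assoc (ENNReal.ofReal R ^ 2),
      mul_comm (ENNReal.ofReal R ^ 2), ofReal_inv_sq_mul hR, one_mul]
  simp_rw [e]
  rw [lintegral_const_mul' _ _ (by finiteness)]
  calc _ ≤ ENNReal.ofReal R ^ 2 * (C * A * w x) := mul_le_mul' le_rfl (hC A R hR w hw x)
    _ = _ := by ring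

lemma exists_decoupling_slow (A : ℝ≥0) : ∃ C : ℝ≥0, ∀ p : ℝ, 4 < p → p < 6 → ∀ n : ℕ, 0 < n →
    ∀ g : ℝ → ℂ, Integrable g → ∀ w : ℝ × ℝ → ℝ≥0∞, Measurable w → Slow A ((n : ℝ) ^ 2) w →
    Np p w (ext (piece g 1 0)) ≤ (C * ENNReal.ofReal (Dconst p n)) ^ p *
      l2p p w (Finset.range n) (fun k => ext (piece g n k)) ^ (p / 2) := by
  obtain ⟨C₁, h₁⟩ := exists_local
  obtain ⟨C₂, h₂⟩ := exists_slow_br_conv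
  refine ⟨(1 + A * 2 ^ 100 * 64 * (C₂ * A)) * C₁, fun p hp4 hp6 n hn g hg w hwm hw => ?_⟩
  have hp0 : 0 < p := by linarith
  have hn0 : (0 : ℝ) < n := by exact_mod_cast hn
  set r : ℝ := (n : ℝ) ^ 2 with hr_def
  have hr : 0 < r := by positivity
  set f := ext (piece g 1 0)
  have hf : Continuous f := continuous_ext (integrable_piece hg _ _)
  set D := ENNReal.ofReal (Dconst p n)
  set E : ℕ → ℝ × ℝ → ℂ := fun k => ext (piece g n k) with hE
  have hEc : ∀ k, Continuous (E k) := fun k => continuous_ext (integrable_piece hg _ _)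
  set a : ℕ → ℝ × ℝ → ℝ≥0∞ := fun k z => Np p (fun x => (br r (x - z))⁻¹ ^ 104) (E k) with ha
  have hjm : ∀ k, Measurable fun q : (ℝ × ℝ) × (ℝ × ℝ) =>
      ‖E k q.2‖ₑ ^ p * (br r (q.2 - q.1))⁻¹ ^ 104 := by
    intro k
    have := hEc k
    fun_prop
  have hjm' : ∀ k z, Measurable fun x => ‖E k x‖ₑ ^ p * (br r (x - z))⁻¹ ^ 104 := by
    intro k z
    have := hEc k
    fun_prop
  have ham : ∀ k, Measurable (a k) := fun k => (hjm k).lintegral_prod_right'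
  have h64 : (ENNReal.ofReal (r / 8))⁻¹ ^ 2 * ENNReal.ofReal r ^ 2 = 64 := by
    rw [← ENNReal.ofReal_inv_of_pos (by positivity), ← mul_pow, ← ENNReal.ofReal_mul (by positivity),
      show (r / 8)⁻¹ * r = 8 by field_simp]
    norm_num
  calc Np p w f
      ≤ ∫⁻ x, ‖f x‖ₑ ^ p * (A * 2 ^ 100 * ((ENNReal.ofReal (r / 8))⁻¹ ^ 2 *
          ∫⁻ z in Metric.closedBall x (r / 8), w z)) :=
        lintegral_mono fun x => mul_le_mul' le_rfl (hw.le_average (by positivity) (by linarith) x)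
    _ = A * 2 ^ 100 * (ENNReal.ofReal (r / 8))⁻¹ ^ 2 *
          ∫⁻ x, ‖f x‖ₑ ^ p * ∫⁻ z in Metric.closedBall x (r / 8), w z := by
        rw [← lintegral_const_mul']
        · refine lintegral_congr fun x => ?_
          ring
        · refine ENNReal.mul_ne_top (ENNReal.mul_ne_top ENNReal.coe_ne_top (by finiteness))
            (ENNReal.pow_ne_top (ENNReal.inv_ne_top.2 ?_))
          simpa using hr
    _ = A * 2 ^ 100 * (ENNReal.ofReal (r / 8))⁻¹ ^ 2 *
          ∫⁻ z, w z * ∫⁻ x in Metric.closedBall z (r / 8), ‖f x‖ₑ ^ p := by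
        rw [lintegral_mul_average (by fun_prop) hwm]
    _ ≤ A * 2 ^ 100 * (ENNReal.ofReal (r / 8))⁻¹ ^ 2 * ∫⁻ z, (C₁ * D) ^ p *
          (∑ k ∈ Finset.range n, (w z * a k z) ^ (2 / p)) ^ (p / 2) := by
        refine mul_le_mul' le_rfl (lintegral_mono fun z => ?_)
        rw [sum_const_mul_rpow hp0, mul_left_comm]
        exact mul_le_mul' le_rfl (h₁ p hp4 hp6 n hn g hg z)
    _ = A * 2 ^ 100 * (ENNReal.ofReal (r / 8))⁻¹ ^ 2 * ((C₁ * D) ^ p *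
          ∫⁻ z, (∑ k ∈ Finset.range n, (w z * a k z) ^ (2 / p)) ^ (p / 2)) := by
        rw [lintegral_const_mul']
        exact ENNReal.rpow_ne_top_of_nonneg hp0.le (by finiteness)
    _ ≤ A * 2 ^ 100 * (ENNReal.ofReal (r / 8))⁻¹ ^ 2 * ((C₁ * D) ^ p *
          (∑ k ∈ Finset.range n, (∫⁻ z, w z * a k z) ^ (2 / p)) ^ (p / 2)) := by
        refine mul_le_mul' le_rfl (mul_le_mul' le_rfl ?_)
        refine (lintegral_sum_rpow_le' (by linarith) _ fun k _ => ?_).trans (le_of_eq ?_)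
        · exact ((hwm.mul (ham k)).pow_const _).aemeasurable
        · congr 1
          refine Finset.sum_congr rfl fun k _ => ?_
          rw [show 1 / (p / 2) = 2 / p by field_simp]
          congr 1
          refine lintegral_congr fun z => ?_
          rw [← ENNReal.rpow_mul, show 2 / p * (p / 2) = 1 by field_simp, ENNReal.rpow_one]
    _ ≤ A * 2 ^ 100 * (ENNReal.ofReal (r / 8))⁻¹ ^ 2 * ((C₁ * D) ^ p *
          (∑ k ∈ Finset.range n, (C₂ * A * ENNReal.ofReal r ^ 2 * Np p w (E k)) ^ (2 / p)) ^ (p / 2)) := by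
        refine mul_le_mul' le_rfl (mul_le_mul' le_rfl (ENNReal.rpow_le_rpow
          (Finset.sum_le_sum fun k _ => ENNReal.rpow_le_rpow ?_ (by positivity)) (by positivity)))
        calc ∫⁻ z, w z * a k z = ∫⁻ z, ∫⁻ x, w z * (‖E k x‖ₑ ^ p * (br r (x - z))⁻¹ ^ 104) := by
              refine lintegral_congr fun z => ?_
              rw [lintegral_const_mul _ (hjm' k z)]
              rfl
          _ = ∫⁻ x, ∫⁻ z, w z * (‖E k x‖ₑ ^ p * (br r (x - z))⁻¹ ^ 104) := by
              rw [lintegral_lintegral_swap]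
              exact ((hwm.comp measurable_fst).mul (hjm k)).aemeasurable
          _ = ∫⁻ x, ‖E k x‖ₑ ^ p * ∫⁻ z, w z * (br r (x - z))⁻¹ ^ 104 := by
              refine lintegral_congr fun x => ?_
              rw [← lintegral_const_mul _ (by fun_prop)]
              refine lintegral_congr fun z => ?_
              ring
          _ ≤ ∫⁻ x, C₂ * A * ENNReal.ofReal r ^ 2 * (‖E k x‖ₑ ^ p * w x) := by
              refine lintegral_mono fun x => ?_
              calc _ ≤ ‖E k x‖ₑ ^ p * (C₂ * A * ENNReal.ofReal r ^ 2 * w x) :=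
                    mul_le_mul' le_rfl (h₂ A r hr w hw hwm x)
                _ = _ := by ring
          _ = _ := by
              rw [lintegral_const_mul' _ _ (by finiteness)]
              rfl
    _ = A * 2 ^ 100 * ((ENNReal.ofReal (r / 8))⁻¹ ^ 2 * ENNReal.ofReal r ^ 2) * (C₂ * A) *
          ((C₁ * D) ^ p * l2p p w (Finset.range n) E ^ (p / 2)) := by
        rw [sum_const_mul_rpow hp0, l2p]
        ring
    _ ≤ (1 + A * 2 ^ 100 * 64 * (C₂ * A)) ^ p *
          ((C₁ * D) ^ p * l2p p w (Finset.range n) E ^ (p / 2)) := by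
        rw [h64]
        refine mul_le_mul' ?_ le_rfl
        calc (A * 2 ^ 100 * 64 * (C₂ * A) : ℝ≥0∞) ≤ (1 + A * 2 ^ 100 * 64 * (C₂ * A)) ^ (1 : ℝ) := by
              rw [ENNReal.rpow_one]; exact le_add_self
          _ ≤ _ := ENNReal.rpow_le_rpow_of_exponent_le le_self_add (by linarith)
    _ = _ := by
        rw [← mul_assoc, ← ENNReal.mul_rpow_of_nonneg _ _ hp0.le]
        congr 2
        push_cast
        ring

/-- The inverse of `parab a M`. -/
noncomputable def parabInv (a M : ℝ) (y : ℝ × ℝ) : ℝ × ℝ :=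
  (M * y.1 - 2 * a * (M ^ 2 * y.2), M ^ 2 * y.2)

lemma parabInv_parab (a : ℝ) {M : ℝ} (hM : 0 < M) (x : ℝ × ℝ) : parabInv a M (parab a M x) = x := by
  ext
  · simp only [parabInv, parab]; field_simp; ring
  · simp only [parabInv, parab]; field_simp

lemma parabInv_sub (a M : ℝ) (y z : ℝ × ℝ) :
    parabInv a M y - parabInv a M z = parabInv a M (y - z) := by
  ext
  · simp only [parabInv, Prod.fst_sub, Prod.snd_sub]; ring
  · simp only [parabInv, Prod.snd_sub]; ring

lemma norm_parabInv_le {a M : ℝ} (ha : |a| ≤ 2) (hM : 1 ≤ M) (y : ℝ × ℝ) :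
    ‖parabInv a M y‖ ≤ 5 * (M ^ 2 * ‖y‖) := by
  have h1 : |y.1| ≤ ‖y‖ := norm_fst_le y
  have h2 : |y.2| ≤ ‖y‖ := norm_snd_le y
  have hM2 : M ≤ M ^ 2 := by nlinarith
  have h3 : M ^ 2 * |y.2| ≤ M ^ 2 * ‖y‖ := by gcongr
  have h4 : M * |y.1| ≤ M ^ 2 * ‖y‖ := by gcongr
  have h0 : 0 ≤ M ^ 2 * ‖y‖ := by positivity
  have h5 : |a| * (M ^ 2 * |y.2|) ≤ 2 * (M ^ 2 * ‖y‖) := by gcongr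
  rw [Prod.norm_def, parabInv]
  refine max_le ?_ ?_
  · rw [Real.norm_eq_abs]
    refine (abs_sub _ _).trans ?_
    rw [abs_mul, abs_mul, abs_mul, abs_mul, abs_of_pos (by linarith : 0 < M), abs_of_pos (by positivity : (0 : ℝ) < M ^ 2),
      abs_of_pos (by norm_num : (0 : ℝ) < 2)]
    linarith
  · rw [Real.norm_eq_abs, abs_mul, abs_of_pos (by positivity : (0 : ℝ) < M ^ 2)]
    linarith

lemma Slow.comp_parabInv {A : ℝ≥0} {R : ℝ} {w : ℝ × ℝ → ℝ≥0∞} (h : Slow A R w) (hR : 0 < R)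
    {a M : ℝ} (ha : |a| ≤ 2) (hM : 1 ≤ M) :
    Slow (A * 5 ^ 100) (R / M ^ 2) (fun y => w (parabInv a M y)) := by
  intro y z
  refine (h (parabInv a M y) (parabInv a M z)).trans ?_
  have h1 : br R (parabInv a M y - parabInv a M z) ≤ 5 * br (R / M ^ 2) (y - z) := by
    rw [parabInv_sub, br, br, show (5 : ℝ≥0∞) = ENNReal.ofReal 5 by norm_num,
      ← ENNReal.ofReal_mul (by norm_num)]
    refine ENNReal.ofReal_le_ofReal ?_
    have := div_le_div_of_nonneg_right (norm_parabInv_le ha hM (y - z)) hR.le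
    have e : 5 * (M ^ 2 * ‖y - z‖) / R = 5 * (‖y - z‖ / (R / M ^ 2)) := by field_simp
    rw [e] at this
    linarith
  calc _ ≤ A * w (parabInv a M z) * (5 * br (R / M ^ 2) (y - z)) ^ 100 := by gcongr
    _ = _ := by rw [mul_pow]; push_cast; ring

lemma measurable_parabInv (a M : ℝ) : Measurable (parabInv a M) := by
  unfold parabInv; fun_prop

lemma dil_piece (g : ℝ → ℂ) {M : ℝ} (hM : 0 < M) (l : ℤ) {n : ℝ} (hn : 0 < n) (k : ℤ) {L : ℤ}
    (hL : (L : ℝ) = l * n + k) :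
    dil (l / M) M (piece g (M * n) L) = piece (dil (l / M) M g) n k := by
  rw [piece, dil_indicator, piece]
  congr 1
  ext t
  have e1 : ((L : ℝ)) / (M * n) = l / M + k / n / M := by rw [hL]; field_simp
  have e2 : ((L : ℝ) + 1) / (M * n) = l / M + (k + 1) / n / M := by rw [hL]; field_simp; ring
  rw [Set.mem_preimage, Set.mem_Ico, Set.mem_Ico, e1, e2, add_le_add_iff_left,
    add_lt_add_iff_left, div_le_div_iff_of_pos_right hM, div_lt_div_iff_of_pos_right hM]

/-- Decoupling of one cell into its subcells, with respect to any slowly varying weight. -/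
lemma exists_decoupling_cell (A : ℝ≥0) : ∃ C : ℝ≥0, ∀ p : ℝ, 4 < p → p < 6 → ∀ n : ℕ, 0 < n →
    ∀ M : ℝ, 1 ≤ M → ∀ l : ℤ, |l / M| ≤ 2 → ∀ g : ℝ → ℂ, Integrable g →
    ∀ w : ℝ × ℝ → ℝ≥0∞, Measurable w → Slow A ((M * n) ^ 2) w →
    Np p w (ext (piece g M l)) ≤ (C * ENNReal.ofReal (Dconst p n)) ^ p *
      l2p p w (Finset.range n) (fun k => ext (piece g (M * n) (l * n + k))) ^ (p / 2) := by
  obtain ⟨C, hC⟩ := exists_decoupling_slow (A * 5 ^ 100)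
  refine ⟨C, fun p hp4 hp6 n hn M hM l hl g hg w hwm hw => ?_⟩
  have hM0 : 0 < M := by linarith
  have hn0 : (0 : ℝ) < n := by exact_mod_cast hn
  have hw' := hw.comp_parabInv (by positivity) hl hM
  rw [show (M * n) ^ 2 / M ^ 2 = (n : ℝ) ^ 2 by field_simp] at hw'
  have hwm' := hwm.comp (measurable_parabInv (l / M) M)
  have h := hC p hp4 hp6 n hn (dil (l / M) M g) (integrable_dil hg _ hM0) _ hwm' hw'
  have e : (fun x => (w ∘ parabInv (l / M) M) (parab (l / M) M x)) = w := by
    funext x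
    simp [parabInv_parab _ hM0]
  have e1 : ∀ k : ℕ, piece (dil (l / M) M g) n k = dil (l / M) M (piece g (M * n) (l * n + k)) := by
    intro k
    rw [dil_piece g hM0 l hn0 k (by push_cast; ring)]
  have e2 : piece (dil (l / M) M g) 1 0 =
      ∑ k ∈ Finset.range n, dil (l / M) M (piece g (M * n) (l * n + k)) := by
    simp_rw [← e1]
    rw [sum_piece _ one_pos 0 hn]
    funext ξ
    simp
  have e3 : piece g M l = ∑ k ∈ Finset.range n, piece g (M * n) (l * n + k) := by
    rw [sum_piece g hM0 l hn]
    funext ξ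
    simp
  simp_rw [e1] at h
  rw [e2] at h
  have h2 := rescale (by linarith) (l / M) hM0 hwm' hwm' _ (fun k _ => integrable_piece hg _ _) h
  rw [e, ← e3] at h2
  exact h2

/-- A rapidly decaying normalized kernel on the line, at scale `R`. -/
noncomputable def lk (R τ : ℝ) : ℝ≥0∞ := (ENNReal.ofReal R)⁻¹ * (br R τ)⁻¹ ^ 104

@[fun_prop] lemma measurable_lk (R : ℝ) : Measurable (lk R) := by unfold lk; fun_prop

/-- Motion with the velocity normal to the parabola at `a`. -/
noncomputable def vel (a τ : ℝ) : ℝ × ℝ := (-(2 * a * τ), τ)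

lemma continuous_vel (a : ℝ) : Continuous (vel a) := by unfold vel; fun_prop

lemma exists_lintegral_lk : ∃ C : ℝ≥0, ∀ R : ℝ, 0 < R → ∫⁻ τ, lk R τ ≤ C := by
  obtain ⟨C, hC⟩ := exists_lintegral_br_real
  refine ⟨C, fun R hR => ?_⟩
  have hR0 : ENNReal.ofReal R ≠ 0 := by simpa using hR
  unfold lk
  rw [lintegral_const_mul _ (by fun_prop)]
  calc _ ≤ (ENNReal.ofReal R)⁻¹ * (C * ENNReal.ofReal R) := by
        refine mul_le_mul' le_rfl (le_trans (lintegral_mono fun t => ?_) (hC R hR))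
        exact br_pow_inv_le hR (by norm_num) t
    _ = C * ((ENNReal.ofReal R)⁻¹ * ENNReal.ofReal R) := by ring
    _ = C := by rw [ENNReal.inv_mul_cancel hR0 ENNReal.ofReal_ne_top, mul_one]

lemma exists_enorm_kb_le (b : ContDiffBump (0 : ℝ)) : ∃ C : ℝ≥0, ∀ R : ℝ, 0 < R → ∀ τ : ℝ,
    ‖((R⁻¹ : ℝ) : ℂ) * kb b (τ / R)‖ₑ ≤ C * lk R τ := by
  obtain ⟨C, hC, H⟩ := kb_decay b 104
  refine ⟨⟨C, hC⟩, fun R hR τ => ?_⟩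
  have h := H (τ / R)
  have hb : br R τ = ENNReal.ofReal (1 + |τ / R|) := by
    rw [br, Real.norm_eq_abs, abs_div, abs_of_pos hR]
  have h1 : ‖kb b (τ / R)‖ ≤ C * (1 + |τ / R|)⁻¹ ^ 104 := by
    rw [inv_pow, ← div_eq_mul_inv, le_div_iff₀ (by positivity), mul_comm]
    exact h
  rw [enorm_mul, lk, hb, ← ENNReal.ofReal_inv_of_pos hR, ← ENNReal.ofReal_inv_of_pos (by positivity),
    ← ENNReal.ofReal_pow (by positivity), ← ofReal_norm, ← ofReal_norm, Complex.norm_real,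
    Real.norm_of_nonneg (by positivity), mul_left_comm]
  refine mul_le_mul' le_rfl ?_
  refine (ENNReal.ofReal_le_ofReal h1).trans (le_of_eq ?_)
  rw [ENNReal.ofReal_mul hC]
  congr 1
  exact ENNReal.ofReal_eq_coe_nnreal hC

lemma exists_local_constancy : ∃ C : ℝ≥0, ∀ s : ℝ, 1 ≤ s → s ≤ 3 → ∀ (a R : ℝ), 0 < R →
    ∀ g : ℝ → ℂ, Integrable g → (∀ ξ, g ξ ≠ 0 → R * (ξ - a) ^ 2 ≤ 2) → ∀ x : ℝ × ℝ,
    ‖ext g x‖ₑ ^ s ≤ C * ∫⁻ τ, ‖ext g (x - vel a τ)‖ₑ ^ s * lk R τ := by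
  obtain ⟨C₁, h₁⟩ := exists_enorm_kb_le bumpL
  obtain ⟨C₂, h₂⟩ := exists_lintegral_lk
  refine ⟨(1 + C₁ * C₂) ^ 2 * C₁, fun s hs1 hs3 a R hR g hg hsupp x => ?_⟩
  have hs0 : 0 ≤ s := by linarith
  have hid := integral_osc_mul_kernel (integrable_ext hg x) (h := fun ξ => (ξ - a) ^ 2)
    (by fun_prop) (integrable_kb_scaled bumpL hR)
  have e1 : ∀ τ : ℝ, ‖∫ ξ, g ξ * ch (ξ * x.1 + ξ ^ 2 * x.2) * ch (-((ξ - a) ^ 2 * τ))‖ₑ =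
      ‖ext g (x - vel a τ)‖ₑ := by
    intro τ
    have : ∫ ξ, g ξ * ch (ξ * x.1 + ξ ^ 2 * x.2) * ch (-((ξ - a) ^ 2 * τ)) =
        ext g (x - vel a τ) * ch (-(τ * a ^ 2)) := by
      unfold ext
      rw [← integral_mul_const]
      refine integral_congr_ae (Filter.Eventually.of_forall fun ξ => ?_)
      simp only [mul_assoc, ← ch_add, vel, Prod.fst_sub, Prod.snd_sub]
      congr 2
      ring
    rw [this, enorm_mul, ← ofReal_norm (ch _), norm_ch, ENNReal.ofReal_one, mul_one]
  have e2 : ext g x = ∫ τ, (∫ ξ, g ξ * ch (ξ * x.1 + ξ ^ 2 * x.2) * ch (-((ξ - a) ^ 2 * τ))) *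
      (((R⁻¹ : ℝ) : ℂ) * kb bumpL (τ / R)) := by
    rw [hid, ext]
    refine integral_congr_ae (Filter.Eventually.of_forall fun ξ => ?_)
    simp only
    rw [integral_kb_scaled bumpL hR]
    by_cases h : g ξ = 0
    · simp [h]
    · rw [cb_bumpL_eq_one, mul_one]
      rw [abs_of_nonneg (by positivity)]
      exact hsupp ξ h
  have hc := continuous_ext hg
  have hcv := continuous_vel a
  have hm : Measurable fun τ => ‖ext g (x - vel a τ)‖ₑ :=
    (hc.comp (by fun_prop : Continuous fun τ => x - vel a τ)).enorm.measurable
  have h3 : ‖ext g x‖ₑ ≤ ∫⁻ τ, ‖ext g (x - vel a τ)‖ₑ * (C₁ * lk R τ) := by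
    rw [e2]
    refine (enorm_integral_le_lintegral_enorm _).trans (lintegral_mono fun τ => ?_)
    rw [enorm_mul, e1]
    exact mul_le_mul' le_rfl (h₁ R hR τ)
  have h4 : ∫⁻ τ, C₁ * lk R τ ≤ C₁ * C₂ := by
    rw [lintegral_const_mul _ (by fun_prop)]
    exact mul_le_mul' le_rfl (h₂ R hR)
  calc ‖ext g x‖ₑ ^ s ≤ (∫⁻ τ, ‖ext g (x - vel a τ)‖ₑ * (C₁ * lk R τ)) ^ s :=
        ENNReal.rpow_le_rpow h3 hs0
    _ ≤ (∫⁻ τ, C₁ * lk R τ) ^ (s - 1) *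
          ∫⁻ τ, ‖ext g (x - vel a τ)‖ₑ ^ s * (C₁ * lk R τ) :=
        lintegral_mul_rpow_le hs1 hm.aemeasurable (by fun_prop)
    _ ≤ (1 + C₁ * C₂) ^ 2 * ∫⁻ τ, C₁ * (‖ext g (x - vel a τ)‖ₑ ^ s * lk R τ) := by
        refine mul_le_mul' ?_ (le_of_eq (lintegral_congr fun τ => by ring))
        rw [← ENNReal.rpow_natCast (1 + (C₁ : ℝ≥0∞) * C₂) 2]
        exact (ENNReal.rpow_le_rpow (h4.trans le_add_self) (by linarith)).trans
          (ENNReal.rpow_le_rpow_of_exponent_le le_self_add (by push_cast; linarith))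
    _ = _ := by
        rw [lintegral_const_mul _ (by fun_prop)]
        push_cast
        ring

lemma lintegral_comp_add_mul {F : ℝ → ℝ≥0∞} (hF : Measurable F) (u : ℝ) {c : ℝ} (hc : c ≠ 0) :
    ∫⁻ t, F (u + c * t) = ENNReal.ofReal |c⁻¹| * ∫⁻ t, F t := by
  have h := lintegral_map (μ := (volume : Measure ℝ)) (f := fun s => F (u + s)) (g := fun t => c * t)
    (by fun_prop) (by fun_prop)
  rw [Real.map_volume_mul_left hc, lintegral_smul_measure,
    lintegral_add_left_eq_self (μ := (volume : Measure ℝ)) F u] at h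
  rw [← h, smul_eq_mul]

lemma lintegral_vel_sub_vel {f : ℝ × ℝ → ℝ≥0∞} (hf : Measurable f) {a a' : ℝ} (ha : a ≠ a')
    (x : ℝ × ℝ) :
    ∫⁻ τ, ∫⁻ τ', f (x + vel a τ - vel a' τ') =
      ENNReal.ofReal |(2 * (a' - a))⁻¹| * ∫⁻ z, f z := by
  have hc : 2 * (a' - a) ≠ 0 := mul_ne_zero two_ne_zero (sub_ne_zero.2 ha.symm)
  have hv := continuous_vel a
  have hv' := continuous_vel a'
  rw [lintegral_lintegral_swap (Measurable.aemeasurable (by fun_prop))]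
  calc ∫⁻ τ', ∫⁻ τ, f (x + vel a τ - vel a' τ')
      = ∫⁻ τ', ∫⁻ τ, f (x + vel a (τ + τ') - vel a' τ') := by
        refine lintegral_congr fun τ' => ?_
        rw [lintegral_add_right_eq_self (μ := (volume : Measure ℝ))
          (fun τ => f (x + vel a τ - vel a' τ')) τ']
    _ = ∫⁻ τ, ∫⁻ τ', f (x.1 - 2 * a * τ + 2 * (a' - a) * τ', x.2 + τ) := by
        rw [lintegral_lintegral_swap (Measurable.aemeasurable (by fun_prop))]
        refine lintegral_congr fun τ => lintegral_congr fun τ' => ?_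
        congr 1
        ext <;> simp [vel] <;> ring
    _ = ∫⁻ τ, ENNReal.ofReal |(2 * (a' - a))⁻¹| * ∫⁻ s, f (s, x.2 + τ) := by
        refine lintegral_congr fun τ => ?_
        rw [lintegral_comp_add_mul (F := fun s => f (s, x.2 + τ)) (by fun_prop) _ hc]
    _ = ENNReal.ofReal |(2 * (a' - a))⁻¹| * ∫⁻ τ, ∫⁻ s, f (s, x.2 + τ) :=
        lintegral_const_mul' _ _ ENNReal.ofReal_ne_top
    _ = _ := by
        rw [lintegral_add_left_eq_self (μ := (volume : Measure ℝ)) (fun t => ∫⁻ s, f (s, t)),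
          Measure.volume_eq_prod, lintegral_prod_symm _ hf.aemeasurable]

lemma lintegral_mul_vel {f f' : ℝ × ℝ → ℝ≥0∞} (hf : Measurable f) (hf' : Measurable f')
    {a a' : ℝ} (ha : a ≠ a') :
    ∫⁻ x, (∫⁻ τ, f (x - vel a τ)) * ∫⁻ τ', f' (x - vel a' τ') =
      ENNReal.ofReal |(2 * (a' - a))⁻¹| * ((∫⁻ z, f z) * ∫⁻ z, f' z) := by
  have hv := continuous_vel a
  have hv' := continuous_vel a'
  calc ∫⁻ x, (∫⁻ τ, f (x - vel a τ)) * ∫⁻ τ', f' (x - vel a' τ')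
      = ∫⁻ x, ∫⁻ τ, ∫⁻ τ', f (x - vel a τ) * f' (x - vel a' τ') := by
        refine lintegral_congr fun x => ?_
        rw [← lintegral_mul_const _ (by fun_prop)]
        refine lintegral_congr fun τ => ?_
        rw [lintegral_const_mul _ (by fun_prop)]
    _ = ∫⁻ τ, ∫⁻ x, ∫⁻ τ', f (x - vel a τ) * f' (x - vel a' τ') := by
        rw [lintegral_lintegral_swap (Measurable.aemeasurable (by fun_prop))]
    _ = ∫⁻ τ, ∫⁻ x, ∫⁻ τ', f x * f' (x + vel a τ - vel a' τ') := by
        refine lintegral_congr fun τ => ?_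
        rw [← lintegral_add_right_eq_self (μ := (volume : Measure (ℝ × ℝ))) _ (vel a τ)]
        simp only [add_sub_cancel_right]
    _ = ∫⁻ x, ∫⁻ τ, ∫⁻ τ', f x * f' (x + vel a τ - vel a' τ') := by
        rw [lintegral_lintegral_swap (Measurable.aemeasurable (by fun_prop))]
    _ = ∫⁻ x, f x * ∫⁻ τ, ∫⁻ τ', f' (x + vel a τ - vel a' τ') := by
        refine lintegral_congr fun x => ?_
        rw [← lintegral_const_mul _ (by fun_prop)]
        refine lintegral_congr fun τ => ?_
        rw [lintegral_const_mul _ (by fun_prop)]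
    _ = ∫⁻ x, f x * (ENNReal.ofReal |(2 * (a' - a))⁻¹| * ∫⁻ z, f' z) := by
        simp_rw [lintegral_vel_sub_vel hf' ha]
    _ = _ := by
        rw [lintegral_mul_const _ hf]
        ring

lemma lk_le {a R : ℝ} (hR : 0 < R) (ha : |a| ≤ 2) {x y : ℝ × ℝ} (h : ‖x - y‖ ≤ R) (τ : ℝ) :
    lk R τ ≤ 8 ^ 104 * ENNReal.ofReal R * Om R (x - vel a τ - y) := by
  have hv : ‖vel a τ‖ ≤ 4 * |τ| := by
    rw [vel, Prod.norm_def, max_le_iff]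
    simp only [Real.norm_eq_abs, abs_neg, abs_mul, abs_two]
    constructor
    · nlinarith [abs_nonneg τ]
    · linarith [abs_nonneg τ]
  have hb : br R (x - vel a τ - y) ≤ 8 * br R τ := by
    have : ENNReal.ofReal 8 = 8 := by simp
    rw [br, br, ← this, ← ENNReal.ofReal_mul (by norm_num)]
    refine ENNReal.ofReal_le_ofReal ?_
    have h1 : ‖x - vel a τ - y‖ ≤ R + 4 * |τ| := by
      have := norm_sub_le (x - y) (vel a τ)
      rw [sub_right_comm] at this
      linarith
    have h2 : ‖x - vel a τ - y‖ / R ≤ 1 + 4 * (|τ| / R) := by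
      rw [div_le_iff₀ hR, add_mul, mul_assoc, div_mul_cancel₀ _ hR.ne']
      linarith
    rw [Real.norm_eq_abs]
    have : 0 ≤ |τ| / R := by positivity
    linarith
  have hb' : (br R τ)⁻¹ ≤ 8 * (br R (x - vel a τ - y))⁻¹ := by
    rw [ENNReal.inv_le_iff_inv_le, ENNReal.mul_inv (by simp) (by simp), inv_inv,
      mul_comm, ← div_eq_mul_inv]
    exact ENNReal.div_le_of_le_mul' hb
  have hR0 : ENNReal.ofReal R ≠ 0 := by simpa using hR
  calc lk R τ ≤ (ENNReal.ofReal R)⁻¹ * (8 * (br R (x - vel a τ - y))⁻¹) ^ 104 :=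
        mul_le_mul' le_rfl (pow_le_pow_left' hb' _)
    _ = 8 ^ 104 * (ENNReal.ofReal R * (ENNReal.ofReal R)⁻¹) *
        ((ENNReal.ofReal R)⁻¹ * (br R (x - vel a τ - y))⁻¹ ^ 104) := by
        rw [ENNReal.mul_inv_cancel hR0 ENNReal.ofReal_ne_top]; ring
    _ = _ := by rw [Om]; ring

/-- Bilinear Kakeya estimate: averages along two families of parallel segments are transversal. -/
lemma exists_kakeya : ∃ C : ℝ≥0, ∀ (a a' R S : ℝ), |a| ≤ 2 → |a'| ≤ 2 → 0 < R → 0 < S →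
    S⁻¹ ≤ |a - a'| → ∀ f f' : ℝ × ℝ → ℝ≥0∞, Measurable f → Measurable f' → ∀ y,
    (ENNReal.ofReal R)⁻¹ ^ 2 * ∫⁻ x in Metric.closedBall y R,
      (∫⁻ τ, f (x - vel a τ) * lk R τ) * ∫⁻ τ, f' (x - vel a' τ) * lk R τ ≤
    C * ENNReal.ofReal S * ((∫⁻ z, f z * Om R (z - y)) * ∫⁻ z, f' z * Om R (z - y)) := by
  refine ⟨8 ^ 104 * 8 ^ 104, fun a a' R S ha ha' hR hS hsep f f' hf hf' y => ?_⟩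
  have hne : a ≠ a' := by
    rintro rfl
    simp only [sub_self, abs_zero] at hsep
    exact absurd hsep (not_le.2 (by positivity))
  have hv := continuous_vel a
  have hv' := continuous_vel a'
  have key : ∀ (b : ℝ), |b| ≤ 2 → ∀ h : ℝ × ℝ → ℝ≥0∞, Measurable h →
      ∀ x ∈ Metric.closedBall y R, ∫⁻ τ, h (x - vel b τ) * lk R τ ≤
      8 ^ 104 * ENNReal.ofReal R * ∫⁻ τ, h (x - vel b τ) * Om R (x - vel b τ - y) := by
    intro b hb h hh x hx
    rw [← lintegral_const_mul' _ _ (by finiteness)]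
    refine lintegral_mono fun τ => ?_
    rw [mul_left_comm]
    refine mul_le_mul' le_rfl (lk_le hR hb ?_ τ)
    rwa [← dist_eq_norm]
  calc _ ≤ (ENNReal.ofReal R)⁻¹ ^ 2 * ∫⁻ x in Metric.closedBall y R,
      (8 ^ 104 * ENNReal.ofReal R) ^ 2 *
        ((∫⁻ τ, f (x - vel a τ) * Om R (x - vel a τ - y)) *
        ∫⁻ τ, f' (x - vel a' τ) * Om R (x - vel a' τ - y)) := by
        refine mul_le_mul' le_rfl (setLIntegral_mono' Metric.isClosed_closedBall.measurableSet
          fun x hx => ?_)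
        refine (mul_le_mul' (key a ha f hf x hx) (key a' ha' f' hf' x hx)).trans (le_of_eq ?_)
        ring
    _ ≤ (ENNReal.ofReal R)⁻¹ ^ 2 * ((8 ^ 104 * ENNReal.ofReal R) ^ 2 * ∫⁻ x,
        ((∫⁻ τ, f (x - vel a τ) * Om R (x - vel a τ - y)) *
        ∫⁻ τ, f' (x - vel a' τ) * Om R (x - vel a' τ - y))) := by
        rw [lintegral_const_mul' _ _ (by finiteness)]
        gcongr
        exact Measure.restrict_le_self
    _ = ((ENNReal.ofReal R)⁻¹ ^ 2 * ENNReal.ofReal R ^ 2) * (8 ^ 104 * 8 ^ 104) *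
        (ENNReal.ofReal |(2 * (a' - a))⁻¹| *
        ((∫⁻ z, f z * Om R (z - y)) * ∫⁻ z, f' z * Om R (z - y))) := by
        rw [lintegral_mul_vel (f := fun z => f z * Om R (z - y)) (f' := fun z => f' z * Om R (z - y))
          (by fun_prop) (by fun_prop) hne]
        ring
    _ ≤ _ := by
        rw [ofReal_inv_sq_mul hR, one_mul]
        rw [mul_assoc ((8 ^ 104 * 8 ^ 104 : ℝ≥0) : ℝ≥0∞)]
        push_cast
        gcongr
        rw [abs_inv, abs_mul, abs_two, abs_sub_comm]
        have h1 : S⁻¹ ≤ 2 * |a - a'| := by linarith [abs_nonneg (a - a')]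
        calc (2 * |a - a'|)⁻¹ ≤ (S⁻¹)⁻¹ := inv_anti₀ (by positivity) h1
          _ = S := inv_inv S

lemma conj_integral_mul_ch {h : ℝ → ℂ} (t : ℝ) :
    (starRingEnd ℂ) (ext h (t, 0)) = ∫ η, (starRingEnd ℂ) (h η) * ch (-(η * t)) := by
  rw [ext, ← integral_conj]
  refine integral_congr_ae (Filter.Eventually.of_forall fun η => ?_)
  simp only [map_mul, conj_ch, mul_zero, add_zero]

lemma integral_autocorrelation {R σ : ℝ} (hR : 0 < R) (hσ : 1 ≤ |R * σ|) :
    ∫ t, (starRingEnd ℂ) (kb bumpS (t / R)) * (kb bumpS (t / R) * ch (-(σ * t))) = 0 := by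
  have hcj : ∀ t : ℝ, (starRingEnd ℂ) (kb bumpS (t / R)) =
      ∫ s, cb bumpS s * ch (-(s / R * t)) := by
    intro t
    rw [kb, osc, ← integral_conj]
    refine integral_congr_ae (Filter.Eventually.of_forall fun s => ?_)
    simp only [map_mul, conj_ch, cb, Complex.conj_ofReal]
    congr 2
    ring
  have hk : Integrable fun t : ℝ => kb bumpS (t / R) * ch (-(σ * t)) :=
    ((integrable_kb bumpS).comp_div hR.ne').mul_ch (by fun_prop)
  simp_rw [hcj]
  rw [integral_osc_mul_kernel (integrable_cb bumpS) (h := fun s => s / R) (by fun_prop) hk]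
  refine integral_eq_zero_of_ae (Filter.Eventually.of_forall fun s => ?_)
  have h1 := integral_kb_scaled bumpS hR (σ + s / R)
  have h2 : ∫ t, kb bumpS (t / R) * ch (-(σ * t)) * ch (-(s / R * t)) =
      R * cb bumpS (R * (σ + s / R)) := by
    rw [← h1, ← integral_const_mul]
    refine integral_congr_ae (Filter.Eventually.of_forall fun t => ?_)
    simp only
    rw [show -((σ + s / R) * t) = -(σ * t) + -(s / R * t) by ring, ch_add]
    have : (R : ℂ) ≠ 0 := by exact_mod_cast hR.ne'
    push_cast
    field_simp
  simp only [h2, Pi.zero_apply]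
  by_cases hs : 1 / 2 ≤ |s|
  · rw [cb_bumpS_eq_zero hs, zero_mul]
  · rw [cb_bumpS_eq_zero (s := R * (σ + s / R)), mul_zero, mul_zero]
    rw [mul_add, mul_div_cancel₀ _ hR.ne']
    have := abs_sub_abs_le_abs_sub (R * σ) (-s)
    rw [abs_neg, sub_neg_eq_add] at this
    linarith

lemma continuous_ext_line {h : ℝ → ℂ} (hh : Integrable h) : Continuous fun t : ℝ => ext h (t, 0) := by
  have := continuous_ext hh
  fun_prop

lemma integrable_kb_mul_conj {R : ℝ} (hR : 0 < R) :
    Integrable fun t : ℝ => (starRingEnd ℂ) (kb bumpS (t / R)) * kb bumpS (t / R) := by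
  obtain ⟨C, hC, H⟩ := kb_decay bumpS 0
  refine ((integrable_kb bumpS).comp_div hR.ne').bdd_mul (c := C) ?_ ?_
  · have := continuous_kb bumpS
    exact Continuous.aestronglyMeasurable (by fun_prop)
  · exact Filter.Eventually.of_forall fun t => by simpa using H (t / R)

lemma integrable_mul_conj_line {h h' : ℝ → ℂ} (hh : Integrable h) (hh' : Integrable h') {R : ℝ}
    (hR : 0 < R) : Integrable fun t : ℝ => ext h (t, 0) * kb bumpS (t / R) *
      (starRingEnd ℂ) (ext h' (t, 0) * kb bumpS (t / R)) := by
  have h1 := (integrable_kb_mul_conj hR).bdd_mul (f := fun t => ext h (t, 0) *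
    (starRingEnd ℂ) (ext h' (t, 0))) (c := (∫ ξ, ‖h ξ‖) * ∫ ξ, ‖h' ξ‖) ?_ ?_
  · refine h1.congr (Filter.Eventually.of_forall fun t => ?_)
    simp only [map_mul]
    ring
  · have := continuous_ext_line hh
    have := continuous_ext_line hh'
    exact Continuous.aestronglyMeasurable (by fun_prop)
  · refine Filter.Eventually.of_forall fun t => ?_
    rw [norm_mul, RCLike.norm_conj]
    exact mul_le_mul (norm_ext_le _ _) (norm_ext_le _ _) (norm_nonneg _) (by positivity)

lemma integral_mul_conj_line_eq_zero {h h' : ℝ → ℂ} (hh : Integrable h) (hh' : Integrable h') {R : ℝ}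
    (hR : 0 < R) (hsep : ∀ ξ η, h ξ ≠ 0 → h' η ≠ 0 → 1 ≤ |R * (ξ - η)|) :
    ∫ t : ℝ, ext h (t, 0) * kb bumpS (t / R) *
      (starRingEnd ℂ) (ext h' (t, 0) * kb bumpS (t / R)) = 0 := by
  have hκ := integrable_kb_mul_conj hR
  have hcj : Integrable fun η => (starRingEnd ℂ) (h' η) :=
    hh'.mono (Complex.continuous_conj.comp_aestronglyMeasurable hh'.aestronglyMeasurable)
      (Filter.Eventually.of_forall fun η => by simp)
  have hκ1 : Integrable fun t : ℝ => (starRingEnd ℂ) (ext h' (t, 0)) *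
      ((starRingEnd ℂ) (kb bumpS (t / R)) * kb bumpS (t / R)) := by
    refine hκ.bdd_mul (c := ∫ ξ, ‖h' ξ‖) ?_ ?_
    · have := continuous_ext_line hh'
      exact Continuous.aestronglyMeasurable (by fun_prop)
    · refine Filter.Eventually.of_forall fun t => ?_
      rw [RCLike.norm_conj]
      exact norm_ext_le _ _
  have e1 : ∀ t : ℝ, ext h (t, 0) = ∫ ξ, h ξ * ch (-(-ξ * t)) := by
    intro t
    simp [ext]
  calc ∫ t : ℝ, ext h (t, 0) * kb bumpS (t / R) *
      (starRingEnd ℂ) (ext h' (t, 0) * kb bumpS (t / R))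
      = ∫ t : ℝ, (∫ ξ, h ξ * ch (-(-ξ * t))) * ((starRingEnd ℂ) (ext h' (t, 0)) *
      ((starRingEnd ℂ) (kb bumpS (t / R)) * kb bumpS (t / R))) := by
        refine integral_congr_ae (Filter.Eventually.of_forall fun t => ?_)
        simp only [map_mul, ← e1]
        ring
    _ = 0 := by
        rw [integral_osc_mul_kernel hh (h := fun ξ => -ξ) (by fun_prop) hκ1]
        refine integral_eq_zero_of_ae (Filter.Eventually.of_forall fun ξ => ?_)
        simp only [Pi.zero_apply]
        by_cases hξ : h ξ = 0
        · rw [hξ, zero_mul]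
        rw [mul_eq_zero]
        right
        calc ∫ τ : ℝ, (starRingEnd ℂ) (ext h' (τ, 0)) *
            ((starRingEnd ℂ) (kb bumpS (τ / R)) * kb bumpS (τ / R)) * ch (-(-ξ * τ))
            = ∫ τ : ℝ, (∫ η, (starRingEnd ℂ) (h' η) * ch (-(η * τ))) *
              (((starRingEnd ℂ) (kb bumpS (τ / R)) * kb bumpS (τ / R)) * ch (-(-ξ * τ))) := by
              refine integral_congr_ae (Filter.Eventually.of_forall fun t => ?_)
              simp only [conj_integral_mul_ch, mul_assoc]
          _ = 0 := by
              rw [integral_osc_mul_kernel hcj (h := fun η => η) (by fun_prop)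
                (hκ.mul_ch (by fun_prop))]
              refine integral_eq_zero_of_ae (Filter.Eventually.of_forall fun η => ?_)
              simp only [Pi.zero_apply]
              by_cases hη : h' η = 0
              · rw [hη, map_zero, zero_mul]
              rw [mul_eq_zero]
              right
              have := integral_autocorrelation (σ := η - ξ) hR (by
                rw [abs_mul, abs_sub_comm, ← abs_mul]; exact hsep ξ η hξ hη)
              rw [← this]
              refine integral_congr_ae (Filter.Eventually.of_forall fun t => ?_)
              simp only [mul_assoc, ← ch_add]
              congr 3
              ring

lemma lintegral_sum_sq_le {X : Type*} [MeasurableSpace X] {μ : Measure X} (f : ℕ → X → ℂ) (q : ℕ)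
    (hi : ∀ i j, Integrable (fun x => f i x * (starRingEnd ℂ) (f j x)) μ)
    (h0 : ∀ i j, i + 1 < j ∨ j + 1 < i → ∫ x, f i x * (starRingEnd ℂ) (f j x) ∂μ = 0) :
    ∫⁻ x, ‖∑ i ∈ Finset.range q, f i x‖ₑ ^ 2 ∂μ ≤
      3 * ∑ i ∈ Finset.range q, ∫⁻ x, ‖f i x‖ₑ ^ 2 ∂μ := by
  set s := Finset.range q
  have hsq : ∀ z : ℂ, z * (starRingEnd ℂ) z = ((‖z‖ ^ 2 : ℝ) : ℂ) := fun z => by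
    rw [Complex.mul_conj']; push_cast; rfl
  have hfi : ∀ i, Integrable (fun x => ‖f i x‖ ^ 2) μ := fun i => by
    refine (hi i i).norm.congr (Filter.Eventually.of_forall fun x => ?_)
    simp [sq]
  have hexp : ∀ x, ‖∑ i ∈ s, f i x‖ ^ 2 = ∑ i ∈ s, ∑ j ∈ s, (f i x * (starRingEnd ℂ) (f j x)).re := by
    intro x
    have := congrArg Complex.re (hsq (∑ i ∈ s, f i x))
    rw [Complex.ofReal_re, map_sum, Finset.sum_mul_sum, Complex.re_sum] at this
    rw [← this]
    exact Finset.sum_congr rfl fun i _ => Complex.re_sum _ _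
  have hre : ∀ i j, Integrable (fun x => (f i x * (starRingEnd ℂ) (f j x)).re) μ :=
    fun i j => (hi i j).re
  have hint : Integrable (fun x => ‖∑ i ∈ s, f i x‖ ^ 2) μ := by
    simp_rw [hexp]
    exact integrable_finsetSum _ fun i _ => integrable_finsetSum _ fun j _ => hre i j
  set A : ℕ → ℝ := fun i => ∫ x, ‖f i x‖ ^ 2 ∂μ
  have hA : ∀ i, 0 ≤ A i := fun i => integral_nonneg fun x => by positivity
  let c : ℕ → ℕ → ℝ := fun i j => if i + 1 < j ∨ j + 1 < i then 0 else 1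
  have hc : ∀ i j, c i j = c j i := fun i j => by simp only [c, or_comm]
  have hij : ∀ i j, ∫ x, (f i x * (starRingEnd ℂ) (f j x)).re ∂μ ≤ c i j * ((A i + A j) / 2) := by
    intro i j
    by_cases h : i + 1 < j ∨ j + 1 < i
    · have e := integral_re (𝕜 := ℂ) (hi i j)
      simp only [RCLike.re_eq_complex_re] at e
      rw [e, h0 i j h]
      simp [c, h]
    · simp only [c, if_neg h, one_mul, A]
      rw [← integral_add (hfi i) (hfi j), ← integral_div]
      refine integral_mono (hre i j) (((hfi i).add (hfi j)).div_const 2) fun x => ?_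
      have h1 := Complex.re_le_norm (f i x * (starRingEnd ℂ) (f j x))
      rw [norm_mul, RCLike.norm_conj] at h1
      simp only
      nlinarith [sq_nonneg (‖f i x‖ - ‖f j x‖)]
  have hcard : ∀ i, ∑ j ∈ s, c i j ≤ 3 := by
    intro i
    have h1 : ∑ j ∈ s, c i j = ((s.filter fun j => ¬ (i + 1 < j ∨ j + 1 < i)).card : ℝ) := by
      rw [Finset.card_filter]
      push_cast
      refine Finset.sum_congr rfl fun j _ => ?_
      by_cases h : i + 1 < j ∨ j + 1 < i <;> simp [c, h]
    rw [h1]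
    have h2 : (s.filter fun j => ¬ (i + 1 < j ∨ j + 1 < i)) ⊆ {i - 1, i, i + 1} := by
      intro j hj
      simp only [Finset.mem_filter, not_or, not_lt, Finset.mem_insert, Finset.mem_singleton] at hj ⊢
      omega
    exact_mod_cast (Finset.card_le_card h2).trans Finset.card_le_three
  have hreal : ∫ x, ‖∑ i ∈ s, f i x‖ ^ 2 ∂μ ≤ 3 * ∑ i ∈ s, A i := by
    simp_rw [hexp]
    rw [integral_finsetSum _ fun i _ => integrable_finsetSum _ fun j _ => hre i j]
    simp_rw [integral_finsetSum s fun j _ => hre _ j]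
    calc _ ≤ ∑ i ∈ s, ∑ j ∈ s, c i j * ((A i + A j) / 2) :=
          Finset.sum_le_sum fun i _ => Finset.sum_le_sum fun j _ => hij i j
      _ = (∑ i ∈ s, ∑ j ∈ s, c i j * A i) / 2 + (∑ i ∈ s, ∑ j ∈ s, c i j * A j) / 2 := by
          rw [← add_div, ← Finset.sum_add_distrib, Finset.sum_div]
          refine Finset.sum_congr rfl fun i _ => ?_
          rw [← Finset.sum_add_distrib, Finset.sum_div]
          exact Finset.sum_congr rfl fun j _ => by ring
      _ = ∑ i ∈ s, (∑ j ∈ s, c i j) * A i := by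
          rw [Finset.sum_comm (f := fun i j => c i j * A j)]
          simp_rw [fun i j => hc j i, Finset.sum_mul]
          rw [add_halves]
      _ ≤ ∑ i ∈ s, 3 * A i := Finset.sum_le_sum fun i _ => by
          have := hcard i
          have := hA i
          gcongr
      _ = _ := by rw [Finset.mul_sum]
  have hen : ∀ z : ℂ, ‖z‖ₑ ^ 2 = ENNReal.ofReal (‖z‖ ^ 2) := fun z => by
    rw [← ofReal_norm, ENNReal.ofReal_pow (norm_nonneg _)]
  simp_rw [hen]
  rw [← ofReal_integral_eq_lintegral_ofReal hint (Filter.Eventually.of_forall fun x => by positivity)]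
  simp_rw [fun i => (ofReal_integral_eq_lintegral_ofReal (hfi i)
    (Filter.Eventually.of_forall fun x => by positivity)).symm]
  rw [← ENNReal.ofReal_sum_of_nonneg fun i _ => hA i]
  have : (3 : ℝ≥0∞) = ENNReal.ofReal 3 := by simp
  rw [this, ← ENNReal.ofReal_mul (by norm_num)]
  exact ENNReal.ofReal_le_ofReal hreal

lemma lintegral_sum_sq_line_le {h : ℕ → ℝ → ℂ} (hh : ∀ i, Integrable (h i)) {R : ℝ} (hR : 0 < R)
    (hsep : ∀ i j, i + 1 < j ∨ j + 1 < i → ∀ ξ η, h i ξ ≠ 0 → h j η ≠ 0 → 1 ≤ |R * (ξ - η)|)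
    (q : ℕ) (x : ℝ × ℝ) :
    ∫⁻ t : ℝ, ‖∑ i ∈ Finset.range q, ext (h i) (x + (t, 0))‖ₑ ^ 2 * ‖kb bumpS (t / R)‖ₑ ^ 2 ≤
      3 * ∑ i ∈ Finset.range q, ∫⁻ t : ℝ, ‖ext (h i) (x + (t, 0))‖ₑ ^ 2 *
        ‖kb bumpS (t / R)‖ₑ ^ 2 := by
  have key := lintegral_sum_sq_le (μ := (volume : Measure ℝ))
    (fun i t => ext (modul x (h i)) (t, 0) * kb bumpS (t / R)) q
    (fun i j => integrable_mul_conj_line (integrable_modul (hh i) x) (integrable_modul (hh j) x) hR)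
    (fun i j hij => integral_mul_conj_line_eq_zero (integrable_modul (hh i) x)
      (integrable_modul (hh j) x) hR fun ξ η hξ hη =>
        hsep i j hij ξ η (left_ne_zero_of_mul hξ) (left_ne_zero_of_mul hη))
  simp_rw [← Finset.sum_mul, ext_modul, enorm_mul, mul_pow] at key
  exact key

@[fun_prop] lemma measurable_kb (b : ContDiffBump (0 : ℝ)) : Measurable (kb b) :=
  (continuous_kb b).measurable

lemma exists_le_lintegral_Om_line : ∃ C : ℝ≥0, ∀ R : ℝ, 0 < R → ∀ z : ℝ × ℝ,
    Om R z ≤ C * ((ENNReal.ofReal R)⁻¹ *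
      ∫⁻ t : ℝ, Om R (z - (t, 0)) * ‖kb bumpS (t / R)‖ₑ ^ 2) := by
  obtain ⟨c, hc, H⟩ := kb_bumpS_lower
  have hcne : ENNReal.ofReal c ^ 2 ≠ 0 := by
    simpa using hc
  set K : ℝ≥0∞ := 2 ^ 104 * (ENNReal.ofReal c ^ 2)⁻¹ * (ENNReal.ofReal (2 / 3))⁻¹
  have hK : K ≠ ⊤ := by
    refine ENNReal.mul_ne_top (ENNReal.mul_ne_top (by simp) (ENNReal.inv_ne_top.2 hcne))
      (ENNReal.inv_ne_top.2 (by simp))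
  refine ⟨K.toNNReal, fun R hR z => ?_⟩
  rw [ENNReal.coe_toNNReal hK]
  have hR0 : ENNReal.ofReal R ≠ 0 := by simpa using hR
  have h23 : ENNReal.ofReal (2 / 3) ≠ 0 := by simp
  have hpt : ∀ t ∈ Set.Icc (-(R / 3)) (R / 3),
      Om R z ≤ 2 ^ 104 * (ENNReal.ofReal c ^ 2)⁻¹ *
        (Om R (z - (t, 0)) * ‖kb bumpS (t / R)‖ₑ ^ 2) := by
    intro t ht
    have ht' : |t| ≤ R / 3 := abs_le.2 ht
    have h1 : ENNReal.ofReal c ^ 2 ≤ ‖kb bumpS (t / R)‖ₑ ^ 2 := by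
      gcongr
      rw [← ofReal_norm]
      refine ENNReal.ofReal_le_ofReal (H _ ?_)
      rw [abs_div, abs_of_pos hR, div_le_iff₀ hR]
      linarith
    have hnt : ‖((-t, 0) : ℝ × ℝ)‖ = |t| := by simp [Prod.norm_def]
    have h2 : Om R z ≤ 2 ^ 104 * Om R (z - (t, 0)) := by
      have hb := br_inv_add_le hR z (-t, 0)
      have hb2 : br R ((-t, 0) : ℝ × ℝ) ≤ 2 := br_le_two hR (by rw [hnt]; linarith)
      have e : z + (-t, 0) = z - (t, 0) := by
        rw [sub_eq_add_neg, Prod.neg_mk, neg_zero]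
      rw [e] at hb
      calc Om R z ≤ (ENNReal.ofReal R)⁻¹ ^ 2 * (2 * (br R (z - (t, 0)))⁻¹) ^ 104 :=
            mul_le_mul' le_rfl (pow_le_pow_left' (hb.trans (by gcongr)) _)
        _ = _ := by rw [Om]; ring
    calc Om R z ≤ 2 ^ 104 * Om R (z - (t, 0)) := h2
      _ = 2 ^ 104 * Om R (z - (t, 0)) * ((ENNReal.ofReal c ^ 2)⁻¹ * ENNReal.ofReal c ^ 2) := by
          rw [ENNReal.inv_mul_cancel hcne (by simp), mul_one]
      _ ≤ 2 ^ 104 * Om R (z - (t, 0)) * ((ENNReal.ofReal c ^ 2)⁻¹ * ‖kb bumpS (t / R)‖ₑ ^ 2) := by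
          gcongr
      _ = _ := by ring
  have hvol : (volume (Set.Icc (-(R / 3)) (R / 3))) = ENNReal.ofReal (2 / 3) * ENNReal.ofReal R := by
    rw [Real.volume_Icc, ← ENNReal.ofReal_mul (by norm_num)]
    congr 1; ring
  have hint : ENNReal.ofReal (2 / 3) * ENNReal.ofReal R * Om R z ≤
      2 ^ 104 * (ENNReal.ofReal c ^ 2)⁻¹ *
        ∫⁻ t : ℝ, Om R (z - (t, 0)) * ‖kb bumpS (t / R)‖ₑ ^ 2 := by
    rw [← hvol, mul_comm, ← setLIntegral_const, ← lintegral_const_mul' _ _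
      (ENNReal.mul_ne_top (by simp) (ENNReal.inv_ne_top.2 hcne))]
    exact (setLIntegral_mono' measurableSet_Icc hpt).trans (setLIntegral_le_lintegral _ _)
  calc Om R z = (ENNReal.ofReal (2 / 3))⁻¹ * ENNReal.ofReal (2 / 3) *
        ((ENNReal.ofReal R)⁻¹ * ENNReal.ofReal R) * Om R z := by
        rw [ENNReal.inv_mul_cancel h23 (by simp), ENNReal.inv_mul_cancel hR0 (by simp), one_mul,
          one_mul]
    _ = (ENNReal.ofReal (2 / 3))⁻¹ * (ENNReal.ofReal R)⁻¹ *
        (ENNReal.ofReal (2 / 3) * ENNReal.ofReal R * Om R z) := by ring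
    _ ≤ (ENNReal.ofReal (2 / 3))⁻¹ * (ENNReal.ofReal R)⁻¹ * _ := mul_le_mul' le_rfl hint
    _ = _ := by ring

lemma exists_lintegral_Om_line_le : ∃ C : ℝ≥0, ∀ R : ℝ, 0 < R → ∀ z : ℝ × ℝ,
    (ENNReal.ofReal R)⁻¹ * ∫⁻ t : ℝ, Om R (z - (t, 0)) * ‖kb bumpS (t / R)‖ₑ ^ 2 ≤ C * Om R z := by
  obtain ⟨C₁, hC₁, H⟩ := kb_decay bumpS 53
  obtain ⟨C₂, h₂⟩ := exists_lintegral_br_real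
  obtain ⟨K, rfl⟩ : ∃ K : ℝ≥0, (K : ℝ) = C₁ := ⟨⟨C₁, hC₁⟩, rfl⟩
  refine ⟨K ^ 2 * C₂, fun R hR z => ?_⟩
  have hR0 : ENNReal.ofReal R ≠ 0 := by simpa using hR
  have hpt : ∀ t : ℝ, Om R (z - (t, 0)) * ‖kb bumpS (t / R)‖ₑ ^ 2 ≤
      Om R z * (K : ℝ≥0∞) ^ 2 * (br R t)⁻¹ ^ 2 := by
    intro t
    have hbt : br R t = ENNReal.ofReal (1 + |t / R|) := by
      rw [br, Real.norm_eq_abs, abs_div, abs_of_pos hR]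
    have h1 : br R t ^ 53 * ‖kb bumpS (t / R)‖ₑ ≤ (K : ℝ≥0∞) := by
      rw [hbt, ← ENNReal.ofReal_pow (by positivity), ← ofReal_norm,
        ← ENNReal.ofReal_mul (by positivity)]
      exact (ENNReal.ofReal_le_ofReal (H (t / R))).trans (le_of_eq ENNReal.ofReal_coe_nnreal)
    have hb := br_inv_add_le hR (z - (t, 0)) ((t, 0) : ℝ × ℝ)
    rw [sub_add_cancel] at hb
    have hb' : br R ((t, 0) : ℝ × ℝ) = br R t := by simp [br, Prod.norm_def]
    rw [hb'] at hb
    calc Om R (z - (t, 0)) * ‖kb bumpS (t / R)‖ₑ ^ 2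
        ≤ ((ENNReal.ofReal R)⁻¹ ^ 2 * (br R t * (br R z)⁻¹) ^ 104) * ‖kb bumpS (t / R)‖ₑ ^ 2 :=
          mul_le_mul' (mul_le_mul' le_rfl (pow_le_pow_left' hb _)) le_rfl
      _ = Om R z * (br R t ^ 104 * (br R t * (br R t)⁻¹) ^ 2) * ‖kb bumpS (t / R)‖ₑ ^ 2 := by
          rw [br_mul_inv hR, Om]; ring
      _ = Om R z * (br R t ^ 53 * ‖kb bumpS (t / R)‖ₑ) ^ 2 * (br R t)⁻¹ ^ 2 := by ring
      _ ≤ _ := mul_le_mul' (mul_le_mul' le_rfl (pow_le_pow_left' h1 _)) le_rfl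
  calc _ ≤ (ENNReal.ofReal R)⁻¹ * ∫⁻ t : ℝ, Om R z * (K : ℝ≥0∞) ^ 2 *
        (br R t)⁻¹ ^ 2 := mul_le_mul' le_rfl (lintegral_mono hpt)
    _ ≤ (ENNReal.ofReal R)⁻¹ * (Om R z * (K : ℝ≥0∞) ^ 2 *
        (C₂ * ENNReal.ofReal R)) := by
        rw [lintegral_const_mul _ (by unfold br; fun_prop)]
        exact mul_le_mul' le_rfl (mul_le_mul' le_rfl (h₂ R hR))
    _ = ((ENNReal.ofReal R)⁻¹ * ENNReal.ofReal R) * ((K : ℝ≥0∞) ^ 2 * C₂ * Om R z) := by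
        ring
    _ = _ := by
        rw [ENNReal.inv_mul_cancel hR0 (by simp), one_mul]
        push_cast
        rfl

/-- Local orthogonality of pieces whose frequency supports are separated at scale `1 / R`. -/
lemma exists_local_orthogonality : ∃ C : ℝ≥0, ∀ (h : ℕ → ℝ → ℂ), (∀ i, Integrable (h i)) →
    ∀ R : ℝ, 0 < R →
    (∀ i j, i + 1 < j ∨ j + 1 < i → ∀ ξ η, h i ξ ≠ 0 → h j η ≠ 0 → 1 ≤ |R * (ξ - η)|) →
    ∀ (q : ℕ) (y : ℝ × ℝ),
    ∫⁻ x, ‖∑ i ∈ Finset.range q, ext (h i) x‖ₑ ^ 2 * Om R (x - y) ≤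
      C * ∑ i ∈ Finset.range q, ∫⁻ x, ‖ext (h i) x‖ₑ ^ 2 * Om R (x - y) := by
  obtain ⟨C₁, h₁⟩ := exists_le_lintegral_Om_line
  obtain ⟨C₂, h₂⟩ := exists_lintegral_Om_line_le
  refine ⟨C₁ * 3 * C₂, fun h hh R hR hsep q y => ?_⟩
  have hRi : (ENNReal.ofReal R)⁻¹ ≠ ⊤ := ENNReal.inv_ne_top.2 (by simpa using hR)
  have hswap : ∀ F : ℝ × ℝ → ℂ, Continuous F →
      ∫⁻ x, ‖F x‖ₑ ^ 2 * ((ENNReal.ofReal R)⁻¹ *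
        ∫⁻ t : ℝ, Om R (x - y - (t, 0)) * ‖kb bumpS (t / R)‖ₑ ^ 2) =
      (ENNReal.ofReal R)⁻¹ * ∫⁻ x, Om R (x - y) *
        ∫⁻ t : ℝ, ‖F (x + (t, 0))‖ₑ ^ 2 * ‖kb bumpS (t / R)‖ₑ ^ 2 := by
    intro F hF
    have hF' := hF.measurable
    simp_rw [fun x => mul_left_comm (‖F x‖ₑ ^ 2) (ENNReal.ofReal R)⁻¹]
    rw [lintegral_const_mul' _ _ hRi]
    congr 1
    calc _ = ∫⁻ x, ∫⁻ t : ℝ, ‖F x‖ₑ ^ 2 * (Om R (x - y - (t, 0)) * ‖kb bumpS (t / R)‖ₑ ^ 2) := by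
          refine lintegral_congr fun x => ?_
          rw [lintegral_const_mul _ (by fun_prop)]
      _ = ∫⁻ t : ℝ, ∫⁻ x, ‖F x‖ₑ ^ 2 * (Om R (x - y - (t, 0)) * ‖kb bumpS (t / R)‖ₑ ^ 2) := by
          rw [lintegral_lintegral_swap (Measurable.aemeasurable (by fun_prop))]
      _ = ∫⁻ t : ℝ, ∫⁻ x, Om R (x - y) * (‖F (x + (t, 0))‖ₑ ^ 2 * ‖kb bumpS (t / R)‖ₑ ^ 2) := by
          refine lintegral_congr fun t => ?_
          rw [← lintegral_add_right_eq_self (μ := (volume : Measure (ℝ × ℝ))) _ (t, 0)]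
          refine lintegral_congr fun x => ?_
          rw [show x + (t, 0) - y - (t, 0) = x - y by abel]
          ring
      _ = ∫⁻ x, ∫⁻ t : ℝ, Om R (x - y) * (‖F (x + (t, 0))‖ₑ ^ 2 * ‖kb bumpS (t / R)‖ₑ ^ 2) := by
          rw [lintegral_lintegral_swap (Measurable.aemeasurable (by fun_prop))]
      _ = _ := by
          refine lintegral_congr fun x => ?_
          rw [lintegral_const_mul _ (by fun_prop)]
  have hE : ∀ i, Continuous (ext (h i)) := fun i => continuous_ext (hh i)
  calc _ ≤ ∫⁻ x, C₁ * (‖∑ i ∈ Finset.range q, ext (h i) x‖ₑ ^ 2 * ((ENNReal.ofReal R)⁻¹ *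
        ∫⁻ t : ℝ, Om R (x - y - (t, 0)) * ‖kb bumpS (t / R)‖ₑ ^ 2)) := by
        refine lintegral_mono fun x => ?_
        rw [mul_left_comm]
        exact mul_le_mul' le_rfl (h₁ R hR (x - y))
    _ = C₁ * ((ENNReal.ofReal R)⁻¹ * ∫⁻ x, Om R (x - y) *
        ∫⁻ t : ℝ, ‖∑ i ∈ Finset.range q, ext (h i) (x + (t, 0))‖ₑ ^ 2 *
          ‖kb bumpS (t / R)‖ₑ ^ 2) := by
        rw [lintegral_const_mul' _ _ (by simp),
          hswap (fun x => ∑ i ∈ Finset.range q, ext (h i) x) (by fun_prop)]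
    _ ≤ C₁ * ((ENNReal.ofReal R)⁻¹ * ∫⁻ x, 3 * ∑ i ∈ Finset.range q, Om R (x - y) *
        ∫⁻ t : ℝ, ‖ext (h i) (x + (t, 0))‖ₑ ^ 2 * ‖kb bumpS (t / R)‖ₑ ^ 2) := by
        refine mul_le_mul' le_rfl (mul_le_mul' le_rfl (lintegral_mono fun x => ?_))
        rw [← Finset.mul_sum, mul_left_comm]
        exact mul_le_mul' le_rfl (lintegral_sum_sq_line_le hh hR hsep q x)
    _ = C₁ * 3 * ∑ i ∈ Finset.range q, ((ENNReal.ofReal R)⁻¹ * ∫⁻ x, Om R (x - y) *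
        ∫⁻ t : ℝ, ‖ext (h i) (x + (t, 0))‖ₑ ^ 2 * ‖kb bumpS (t / R)‖ₑ ^ 2) := by
        have hm : ∀ i, Measurable fun x : ℝ × ℝ => Om R (x - y) *
            ∫⁻ t : ℝ, ‖ext (h i) (x + (t, 0))‖ₑ ^ 2 * ‖kb bumpS (t / R)‖ₑ ^ 2 := by
          intro i
          have : Continuous fun z : (ℝ × ℝ) × ℝ => ext (h i) (z.1 + (z.2, 0)) :=
            (hE i).comp (by fun_prop)
          have := this.measurable
          refine Measurable.mul (by fun_prop) (Measurable.lintegral_prod_right' (f := fun z :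
            (ℝ × ℝ) × ℝ => ‖ext (h i) (z.1 + (z.2, 0))‖ₑ ^ 2 * ‖kb bumpS (z.2 / R)‖ₑ ^ 2) ?_)
          fun_prop
        rw [lintegral_const_mul' _ _ (by simp), lintegral_finsetSum' _ fun i _ => (hm i).aemeasurable,
          ← Finset.mul_sum]
        ring
    _ = C₁ * 3 * ∑ i ∈ Finset.range q, ∫⁻ x, ‖ext (h i) x‖ₑ ^ 2 * ((ENNReal.ofReal R)⁻¹ *
        ∫⁻ t : ℝ, Om R (x - y - (t, 0)) * ‖kb bumpS (t / R)‖ₑ ^ 2) := by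
        congr 1
        exact Finset.sum_congr rfl fun i _ => (hswap _ (hE i)).symm
    _ ≤ C₁ * 3 * ∑ i ∈ Finset.range q, ∫⁻ x, C₂ * (‖ext (h i) x‖ₑ ^ 2 * Om R (x - y)) := by
        refine mul_le_mul' le_rfl (Finset.sum_le_sum fun i _ => lintegral_mono fun x => ?_)
        rw [mul_left_comm (C₂ : ℝ≥0∞)]
        exact mul_le_mul' le_rfl (h₂ R hR (x - y))
    _ = _ := by
        rw [Finset.sum_congr rfl fun i _ => lintegral_const_mul' (C₂ : ℝ≥0∞) _ (by simp),
          ← Finset.mul_sum]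
        push_cast
        ring

/-- Average of the translates of `f` against a measure. -/
noncomputable def cv (μ : Measure (ℝ × ℝ)) (f : ℝ × ℝ → ℝ≥0∞) (x : ℝ × ℝ) : ℝ≥0∞ :=
  ∫⁻ u, f (x - u) ∂μ

/-- A measure of bounded mass that is concentrated at scale `R`. -/
structure Blur (C : ℝ≥0) (R : ℝ) (μ : Measure (ℝ × ℝ)) : Prop where
  univ_le : μ Set.univ ≤ C
  conv_le : ∀ z, ∫⁻ u, Om R (z - u) ∂μ ≤ C * Om R z

lemma measurable_cv (μ : Measure (ℝ × ℝ)) [SFinite μ] {f : ℝ × ℝ → ℝ≥0∞} (hf : Measurable f) :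
    Measurable (cv μ f) :=
  Measurable.lintegral_prod_right' (f := fun z : (ℝ × ℝ) × (ℝ × ℝ) => f (z.1 - z.2)) (by fun_prop)

lemma Blur.rpow_le {C : ℝ≥0} {R : ℝ} {μ : Measure (ℝ × ℝ)} (h : Blur C R μ) (hC : 1 ≤ C) {q : ℝ}
    (hq : 1 ≤ q) (hq' : q ≤ 3) {f : ℝ × ℝ → ℝ≥0∞} (hf : Measurable f) (x : ℝ × ℝ) :
    cv μ f x ^ q ≤ C ^ 2 * cv μ (fun z => f z ^ q) x := by
  have h1 := lintegral_mul_rpow_le (μ := μ) hq (f := fun u => f (x - u)) (k := fun _ => 1)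
    (by fun_prop) (by fun_prop)
  simp only [mul_one, lintegral_const, one_mul] at h1
  refine h1.trans (mul_le_mul' ?_ le_rfl)
  calc μ Set.univ ^ (q - 1) ≤ (C : ℝ≥0∞) ^ (q - 1) :=
        ENNReal.rpow_le_rpow h.univ_le (by linarith)
    _ ≤ (C : ℝ≥0∞) ^ (2 : ℝ) :=
        ENNReal.rpow_le_rpow_of_exponent_le (by exact_mod_cast hC) (by linarith)
    _ = _ := by norm_cast

lemma Blur.lintegral_mul_Om_le {C : ℝ≥0} {R : ℝ} {μ : Measure (ℝ × ℝ)} [SFinite μ] (h : Blur C R μ)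
    {f : ℝ × ℝ → ℝ≥0∞} (hf : Measurable f) (y : ℝ × ℝ) :
    ∫⁻ z, cv μ f z * Om R (z - y) ≤ C * ∫⁻ z, f z * Om R (z - y) := by
  calc ∫⁻ z, cv μ f z * Om R (z - y) = ∫⁻ z, ∫⁻ u, f (z - u) * Om R (z - y) ∂μ := by
        refine lintegral_congr fun z => ?_
        rw [lintegral_mul_const _ (by fun_prop), cv]
    _ = ∫⁻ u, (∫⁻ z, f (z - u) * Om R (z - y)) ∂μ := by
        rw [lintegral_lintegral_swap (Measurable.aemeasurable (by fun_prop))]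
    _ = ∫⁻ u, (∫⁻ z, f z * Om R (y - z - u)) ∂μ := by
        refine lintegral_congr fun u => ?_
        rw [← lintegral_add_right_eq_self (μ := (volume : Measure (ℝ × ℝ))) _ u]
        refine lintegral_congr fun z => ?_
        rw [add_sub_cancel_right, Om_sub_comm, ← sub_sub]
    _ = ∫⁻ z, ∫⁻ u, f z * Om R (y - z - u) ∂μ := by
        rw [lintegral_lintegral_swap (Measurable.aemeasurable (by fun_prop))]
    _ ≤ ∫⁻ z, C * (f z * Om R (z - y)) := by
        refine lintegral_mono fun z => ?_
        rw [lintegral_const_mul _ (by fun_prop), mul_left_comm]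
        refine mul_le_mul' le_rfl ?_
        rw [Om_sub_comm R z y]
        exact h.conv_le _
    _ = _ := lintegral_const_mul' _ _ (by simp)

lemma exists_cv_local_constancy : ∃ C : ℝ≥0, ∀ s : ℝ, 1 ≤ s → s ≤ 3 → ∀ (a R : ℝ), 0 < R →
    ∀ (μ : Measure (ℝ × ℝ)) [SFinite μ],
    ∀ g : ℝ → ℂ, Integrable g → (∀ ξ, g ξ ≠ 0 → R * (ξ - a) ^ 2 ≤ 2) → ∀ x : ℝ × ℝ,
    cv μ (fun z => ‖ext g z‖ₑ ^ s) x ≤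
      C * ∫⁻ τ, cv μ (fun z => ‖ext g z‖ₑ ^ s) (x - vel a τ) * lk R τ := by
  obtain ⟨C, H⟩ := exists_local_constancy
  refine ⟨C, fun s hs hs' a R hR μ _ g hg hsupp x => ?_⟩
  have hE : Measurable (ext g) := (continuous_ext hg).measurable
  have hv := continuous_vel a
  calc cv μ (fun z => ‖ext g z‖ₑ ^ s) x
      ≤ ∫⁻ u, (C * ∫⁻ τ, ‖ext g (x - u - vel a τ)‖ₑ ^ s * lk R τ) ∂μ :=
        lintegral_mono fun u => H s hs hs' a R hR g hg hsupp (x - u)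
    _ = C * ∫⁻ τ, ∫⁻ u, ‖ext g (x - u - vel a τ)‖ₑ ^ s * lk R τ ∂μ := by
        rw [lintegral_const_mul' _ _ (by simp), lintegral_lintegral_swap]
        exact Measurable.aemeasurable (by fun_prop)
    _ = _ := by
        congr 1
        refine lintegral_congr fun τ => ?_
        rw [cv, ← lintegral_mul_const _ (by fun_prop)]
        refine lintegral_congr fun u => ?_
        rw [sub_right_comm]

/-- Interpolation of `L^{p/2}` between `L²` and `L^p`. -/
lemma lintegral_interpolate {p : ℝ} (hp : 4 < p) {f k : ℝ × ℝ → ℝ≥0∞} (hf : Measurable f)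
    (hk : Measurable k) :
    (∫⁻ z, f z ^ (p / 2) * k z) ^ (4 / p) ≤ (∫⁻ z, f z ^ 2 * k z) ^ (2 / (p - 2)) *
      ((∫⁻ z, f z ^ p * k z) ^ (2 / p)) ^ ((p - 4) / (p - 2)) := by
  have hp2 : 0 < p - 2 := by linarith
  have hp4 : 0 < p - 4 := by linarith
  have hp0 : 0 < p := by linarith
  have hu : 0 ≤ 2 / (p - 2) * (p / 4) := by positivity
  have hv : 0 ≤ (p - 4) / (p - 2) / 2 := by positivity
  have huv : 2 / (p - 2) * (p / 4) + (p - 4) / (p - 2) / 2 = 1 := by field_simp; ring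
  have h := ENNReal.lintegral_mul_norm_pow_le (μ := (volume : Measure (ℝ × ℝ)))
    (f := fun z => f z ^ 2 * k z) (g := fun z => f z ^ p * k z) (by fun_prop) (by fun_prop)
    hu hv huv
  have e : ∀ z, (f z ^ 2 * k z) ^ (2 / (p - 2) * (p / 4)) * (f z ^ p * k z) ^ ((p - 4) / (p - 2) / 2)
      = f z ^ (p / 2) * k z := by
    intro z
    rw [ENNReal.mul_rpow_of_nonneg _ _ hu, ENNReal.mul_rpow_of_nonneg _ _ hv, mul_mul_mul_comm,
      ← ENNReal.rpow_add_of_nonneg _ _ hu hv, huv, ENNReal.rpow_one, ← ENNReal.rpow_natCast,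
      ← ENNReal.rpow_mul, ← ENNReal.rpow_mul,
      ← ENNReal.rpow_add_of_nonneg _ _ (by positivity) (by positivity)]
    congr 2
    push_cast
    field_simp
    ring
  simp_rw [e] at h
  refine (ENNReal.rpow_le_rpow h (by positivity)).trans (le_of_eq ?_)
  rw [ENNReal.mul_rpow_of_nonneg _ _ (by positivity), ← ENNReal.rpow_mul, ← ENNReal.rpow_mul,
    ← ENNReal.rpow_mul]
  congr 2 <;> field_simp
  norm_num

lemma sum_mul_sum_rpow {ι κ : Type*} (s : Finset ι) (t : Finset κ) (K : ℝ≥0∞) {q : ℝ}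
    (hq : 0 < q) (f : ι → ℝ≥0∞) (g : κ → ℝ≥0∞) :
    (∑ i ∈ s ×ˢ t, (K * (f i.1 * g i.2)) ^ (1 / q)) ^ q =
      K * ((∑ i ∈ s, f i ^ (1 / q)) ^ q * (∑ j ∈ t, g j ^ (1 / q)) ^ q) := by
  have h1 : (0 : ℝ) ≤ 1 / q := by positivity
  simp_rw [ENNReal.mul_rpow_of_nonneg _ _ h1]
  rw [← Finset.mul_sum, Finset.sum_product]
  dsimp only
  rw [← Finset.sum_mul_sum,
    ENNReal.mul_rpow_of_nonneg _ _ hq.le, ENNReal.mul_rpow_of_nonneg _ _ hq.le, ← ENNReal.rpow_mul,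
    one_div_mul_cancel hq.ne', ENNReal.rpow_one]

/-- The family of functions is integrable, and the `i`-th one is supported near `a i`, at distance
`O(R^{-1/2})`. -/
structure Cells {ι : Type*} (R : ℝ) (s : Finset ι) (a : ι → ℝ) (h : ι → ℝ → ℂ) : Prop where
  integrable : ∀ i, Integrable (h i)
  center_le : ∀ i ∈ s, |a i| ≤ 2
  support : ∀ i ∈ s, ∀ ξ, h i ξ ≠ 0 → R * (ξ - a i) ^ 2 ≤ 2

/-- Square function of a family of extensions, blurred by `μ`. -/
noncomputable def sqf {ι : Type*} (μ : Measure (ℝ × ℝ)) (s : Finset ι) (h : ι → ℝ → ℂ)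
    (x : ℝ × ℝ) : ℝ≥0∞ := ∑ i ∈ s, cv μ (fun z => ‖ext (h i) z‖ₑ ^ 2) x

lemma measurable_enorm_ext {g : ℝ → ℂ} (hg : Integrable g) : Measurable fun z => ‖ext g z‖ₑ :=
  (continuous_ext hg).measurable.enorm

lemma measurable_sqf {ι : Type*} (μ : Measure (ℝ × ℝ)) [SFinite μ] (s : Finset ι) {h : ι → ℝ → ℂ}
    (hh : ∀ i, Integrable (h i)) : Measurable (sqf μ s h) := by
  refine Finset.measurable_fun_sum _ fun i _ => measurable_cv μ ?_
  have := measurable_enorm_ext (hh i)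
  fun_prop

lemma exists_lintegral_cv_mul_cv_le (C₁ : ℝ≥0) (hC₁ : 1 ≤ C₁) : ∃ C : ℝ≥0, ∀ p : ℝ, 4 < p → p < 6 →
    ∀ R S : ℝ, 0 < R → 0 < S → ∀ (μ : Measure (ℝ × ℝ)) [SFinite μ], Blur C₁ R μ →
    ∀ a a' : ℝ, |a| ≤ 2 → |a'| ≤ 2 → S⁻¹ ≤ |a - a'| → ∀ g g' : ℝ → ℂ, Integrable g → Integrable g' →
    (∀ ξ, g ξ ≠ 0 → R * (ξ - a) ^ 2 ≤ 2) → (∀ ξ, g' ξ ≠ 0 → R * (ξ - a') ^ 2 ≤ 2) → ∀ y,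
    (ENNReal.ofReal R)⁻¹ ^ 2 * ∫⁻ x in Metric.closedBall y R,
      (cv μ (fun z => ‖ext g z‖ₑ ^ 2) x * cv μ (fun z => ‖ext g' z‖ₑ ^ 2) x) ^ (p / 4) ≤
    C * ENNReal.ofReal S * ((∫⁻ z, ‖ext g z‖ₑ ^ (p / 2) * Om R (z - y)) *
      ∫⁻ z, ‖ext g' z‖ₑ ^ (p / 2) * Om R (z - y)) := by
  obtain ⟨C₂, h₂⟩ := exists_cv_local_constancy
  obtain ⟨C₃, h₃⟩ := exists_kakeya
  refine ⟨(C₁ ^ 2 * C₂) ^ 2 * C₃ * C₁ ^ 2, fun p hp hp' R S hR hS μ _ hμ a a' ha ha' hsep g g' hg hg'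
    hsupp hsupp' y => ?_⟩
  have key : ∀ (b : ℝ) (k : ℝ → ℂ), Integrable k → (∀ ξ, k ξ ≠ 0 → R * (ξ - b) ^ 2 ≤ 2) → ∀ x,
      cv μ (fun z => ‖ext k z‖ₑ ^ 2) x ^ (p / 4) ≤ (C₁ ^ 2 * C₂) *
        ∫⁻ τ, cv μ (fun z => ‖ext k z‖ₑ ^ (p / 2)) (x - vel b τ) * lk R τ := by
    intro b k hk hks x
    have hm := measurable_enorm_ext hk
    have e : ∀ z, (‖ext k z‖ₑ ^ 2) ^ (p / 4) = ‖ext k z‖ₑ ^ (p / 2) := by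
      intro z
      rw [← ENNReal.rpow_natCast, ← ENNReal.rpow_mul]
      congr 1
      push_cast
      ring
    have h1 := hμ.rpow_le hC₁ (q := p / 4) (by linarith) (by linarith)
      (f := fun z => ‖ext k z‖ₑ ^ 2) (by fun_prop) x
    simp_rw [e] at h1
    rw [mul_assoc]
    exact h1.trans (mul_le_mul' le_rfl
      (h₂ (p / 2) (by linarith) (by linarith) b R hR μ k hk hks x))
  have hm := measurable_enorm_ext hg
  have hm' := measurable_enorm_ext hg'
  have hm1 : Measurable fun z => ‖ext g z‖ₑ ^ (p / 2) := by fun_prop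
  have hm1' : Measurable fun z => ‖ext g' z‖ₑ ^ (p / 2) := by fun_prop
  calc _ ≤ (ENNReal.ofReal R)⁻¹ ^ 2 * ∫⁻ x in Metric.closedBall y R, (C₁ ^ 2 * C₂) ^ 2 *
        ((∫⁻ τ, cv μ (fun z => ‖ext g z‖ₑ ^ (p / 2)) (x - vel a τ) * lk R τ) *
        ∫⁻ τ, cv μ (fun z => ‖ext g' z‖ₑ ^ (p / 2)) (x - vel a' τ) * lk R τ) := by
        refine mul_le_mul' le_rfl (lintegral_mono fun x => ?_)
        rw [ENNReal.mul_rpow_of_nonneg _ _ (by linarith)]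
        refine (mul_le_mul' (key a g hg hsupp x) (key a' g' hg' hsupp' x)).trans (le_of_eq ?_)
        ring
    _ = (C₁ ^ 2 * C₂) ^ 2 * ((ENNReal.ofReal R)⁻¹ ^ 2 * ∫⁻ x in Metric.closedBall y R,
        ((∫⁻ τ, cv μ (fun z => ‖ext g z‖ₑ ^ (p / 2)) (x - vel a τ) * lk R τ) *
        ∫⁻ τ, cv μ (fun z => ‖ext g' z‖ₑ ^ (p / 2)) (x - vel a' τ) * lk R τ)) := by
        rw [lintegral_const_mul' _ _ (by finiteness)]
        ring
    _ ≤ (C₁ ^ 2 * C₂) ^ 2 * (C₃ * ENNReal.ofReal S *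
        ((C₁ * ∫⁻ z, ‖ext g z‖ₑ ^ (p / 2) * Om R (z - y)) *
        (C₁ * ∫⁻ z, ‖ext g' z‖ₑ ^ (p / 2) * Om R (z - y)))) := by
        refine mul_le_mul' le_rfl ((h₃ a a' R S ha ha' hR hS hsep _ _ (measurable_cv μ hm1)
          (measurable_cv μ hm1') y).trans (mul_le_mul' le_rfl (mul_le_mul' ?_ ?_)))
        · exact hμ.lintegral_mul_Om_le hm1 y
        · exact hμ.lintegral_mul_Om_le hm1' y
    _ = _ := by push_cast; ring

lemma sum_interpolate {ι : Type*} {p : ℝ} (hp : 4 < p) {k : ℝ × ℝ → ℝ≥0∞} (hk : Measurable k)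
    (s : Finset ι) {h : ι → ℝ → ℂ} (hh : ∀ i, Integrable (h i)) :
    (∑ i ∈ s, (∫⁻ z, ‖ext (h i) z‖ₑ ^ (p / 2) * k z) ^ (1 / (p / 4))) ^ (p / 4) ≤
      ((∑ i ∈ s, ∫⁻ z, ‖ext (h i) z‖ₑ ^ 2 * k z) ^ (p / 4)) ^ (2 / (p - 2)) *
      (l2p p k s (fun i => ext (h i)) ^ (p / 4)) ^ ((p - 4) / (p - 2)) := by
  have hp2 : 0 < p - 2 := by linarith
  have hp4 : 0 < p - 4 := by linarith
  rw [← ENNReal.rpow_mul, ← ENNReal.rpow_mul, mul_comm (p / 4), mul_comm (p / 4), ENNReal.rpow_mul,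
    ENNReal.rpow_mul, ← ENNReal.mul_rpow_of_nonneg _ _ (by linarith)]
  refine ENNReal.rpow_le_rpow ?_ (by linarith)
  refine le_trans (Finset.sum_le_sum fun i _ => ?_) (sum_rpow_mul_rpow_le s
    (fun i => ∫⁻ z, ‖ext (h i) z‖ₑ ^ 2 * k z) (fun i => Np p k (ext (h i)) ^ (2 / p))
    (by positivity) (by positivity) (by field_simp; ring))
  have e : 1 / (p / 4) = 4 / p := by field_simp
  rw [e]
  exact lintegral_interpolate hp (measurable_enorm_ext (hh i)) hk

/-- The pointwise form of the bilinear inequality, averaged over a ball of radius `R`. -/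
lemma exists_bilinear_local (C₁ : ℝ≥0) (hC₁ : 1 ≤ C₁) : ∃ C : ℝ≥0, ∀ p : ℝ, 4 < p → p < 6 →
    ∀ R S : ℝ, 0 < R → 0 < S → ∀ (μ : Measure (ℝ × ℝ)) [SFinite μ], Blur C₁ R μ →
    ∀ {ι κ : Type} (s : Finset ι) (t : Finset κ) (a : ι → ℝ) (b : κ → ℝ)
      (h : ι → ℝ → ℂ) (k : κ → ℝ → ℂ), Cells R s a h → Cells R t b k →
    (∀ i ∈ s, ∀ j ∈ t, S⁻¹ ≤ |a i - b j|) → ∀ y,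
    (ENNReal.ofReal R)⁻¹ ^ 2 * ∫⁻ x in Metric.closedBall y R,
      (sqf μ s h x ^ (p / 4) * sqf μ t k x ^ (p / 4)) ≤
    C * ENNReal.ofReal S *
      (((∑ i ∈ s, ∫⁻ z, ‖ext (h i) z‖ₑ ^ 2 * Om R (z - y)) ^ (p / 4) *
        (∑ i ∈ t, ∫⁻ z, ‖ext (k i) z‖ₑ ^ 2 * Om R (z - y)) ^ (p / 4)) ^ (2 / (p - 2)) *
      (l2p p (fun z => Om R (z - y)) s (fun i => ext (h i)) ^ (p / 4) *
        l2p p (fun z => Om R (z - y)) t (fun i => ext (k i)) ^ (p / 4)) ^ ((p - 4) / (p - 2))) := by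
  obtain ⟨C, H⟩ := exists_lintegral_cv_mul_cv_le C₁ hC₁
  refine ⟨C, fun p hp hp' R S hR hS μ _ hμ ι κ s t a b h k hs ht hsep y => ?_⟩
  have hp2 : 0 < p - 2 := by linarith
  have hp4 : 0 < p - 4 := by linarith
  have hq : 1 ≤ p / 4 := by linarith
  have hq0 : 0 < p / 4 := by linarith
  have hRi : (ENNReal.ofReal R)⁻¹ ≠ ⊤ := ENNReal.inv_ne_top.2 (by simpa using hR)
  set ν : Measure (ℝ × ℝ) := (ENNReal.ofReal R)⁻¹ ^ 2 • volume.restrict (Metric.closedBall y R)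
  have hν : ∀ F : ℝ × ℝ → ℝ≥0∞, (ENNReal.ofReal R)⁻¹ ^ 2 * ∫⁻ x in Metric.closedBall y R, F x =
      ∫⁻ x, F x ∂ν := fun F => by rw [lintegral_smul_measure, smul_eq_mul]
  have hmU : ∀ i, Measurable (cv μ fun z => ‖ext (h i) z‖ₑ ^ 2) := fun i =>
    measurable_cv μ (by have := measurable_enorm_ext (hs.integrable i); fun_prop)
  have hmV : ∀ j, Measurable (cv μ fun z => ‖ext (k j) z‖ₑ ^ 2) := fun j =>
    measurable_cv μ (by have := measurable_enorm_ext (ht.integrable j); fun_prop)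
  have e1 : ∀ x, sqf μ s h x ^ (p / 4) * sqf μ t k x ^ (p / 4) =
      (∑ i ∈ s ×ˢ t, cv μ (fun z => ‖ext (h i.1) z‖ₑ ^ 2) x *
        cv μ (fun z => ‖ext (k i.2) z‖ₑ ^ 2) x) ^ (p / 4) := by
    intro x
    rw [← ENNReal.mul_rpow_of_nonneg _ _ hq0.le, sqf, sqf, Finset.sum_mul_sum, Finset.sum_product]
  rw [hν]
  simp_rw [e1]
  calc _ ≤ (∑ i ∈ s ×ˢ t, (∫⁻ x, (cv μ (fun z => ‖ext (h i.1) z‖ₑ ^ 2) x *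
        cv μ (fun z => ‖ext (k i.2) z‖ₑ ^ 2) x) ^ (p / 4) ∂ν) ^ (1 / (p / 4))) ^ (p / 4) :=
        lintegral_sum_rpow_le' hq _ fun i _ => ((hmU i.1).mul (hmV i.2)).aemeasurable
    _ ≤ (∑ i ∈ s ×ˢ t, (C * ENNReal.ofReal S *
        ((∫⁻ z, ‖ext (h i.1) z‖ₑ ^ (p / 2) * Om R (z - y)) *
        ∫⁻ z, ‖ext (k i.2) z‖ₑ ^ (p / 2) * Om R (z - y))) ^ (1 / (p / 4))) ^ (p / 4) := by
        refine ENNReal.rpow_le_rpow (Finset.sum_le_sum fun i hi => ?_) hq0.le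
        obtain ⟨h1, h2⟩ := Finset.mem_product.1 hi
        refine ENNReal.rpow_le_rpow ?_ (by positivity)
        rw [← hν]
        exact H p hp hp' R S hR hS μ hμ _ _ (hs.center_le _ h1) (ht.center_le _ h2)
          (hsep _ h1 _ h2) _ _ (hs.integrable _) (ht.integrable _) (hs.support _ h1)
          (ht.support _ h2) y
    _ ≤ _ := by
        rw [sum_mul_sum_rpow s t _ hq0
          (fun i => ∫⁻ z, ‖ext (h i) z‖ₑ ^ (p / 2) * Om R (z - y))
          (fun j => ∫⁻ z, ‖ext (k j) z‖ₑ ^ (p / 2) * Om R (z - y))]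
        refine mul_le_mul' le_rfl ?_
        refine (mul_le_mul' (sum_interpolate hp (by fun_prop) s hs.integrable)
          (sum_interpolate hp (by fun_prop) t ht.integrable)).trans (le_of_eq ?_)
        rw [ENNReal.mul_rpow_of_nonneg _ _ (by positivity),
          ENNReal.mul_rpow_of_nonneg _ _ (by positivity)]
        ring

lemma Slow.lintegral_mul_le {A : ℝ≥0} {R : ℝ} {w F : ℝ × ℝ → ℝ≥0∞} (h : Slow A R w) (hR : 0 < R)
    (hw : Measurable w) (hF : Measurable F) : ∫⁻ x, w x * F x ≤
      A * 2 ^ 100 * ∫⁻ y, w y * ((ENNReal.ofReal R)⁻¹ ^ 2 * ∫⁻ x in Metric.closedBall y R, F x) := by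
  calc ∫⁻ x, w x * F x
      ≤ ∫⁻ x, A * 2 ^ 100 * (ENNReal.ofReal R)⁻¹ ^ 2 *
        (F x * ∫⁻ y in Metric.closedBall x R, w y) := by
        refine lintegral_mono fun x => ?_
        refine (mul_le_mul' (h.le_average hR le_rfl x) le_rfl).trans (le_of_eq ?_)
        rw [mul_comm (F x)]
        simp only [mul_assoc]
    _ = A * 2 ^ 100 * (ENNReal.ofReal R)⁻¹ ^ 2 *
        ∫⁻ x, F x * ∫⁻ y in Metric.closedBall x R, w y := by
        rw [lintegral_const_mul]
        refine hF.mul ?_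
        have : MeasurableSet {z : (ℝ × ℝ) × (ℝ × ℝ) | dist z.2 z.1 ≤ R} :=
          measurableSet_le (by fun_prop) (by fun_prop)
        have e : ∀ x, ∫⁻ y in Metric.closedBall x R, w y =
            ∫⁻ y, {z : (ℝ × ℝ) × (ℝ × ℝ) | dist z.2 z.1 ≤ R}.indicator (fun z => w z.2) (x, y) := by
          intro x
          rw [← lintegral_indicator Metric.isClosed_closedBall.measurableSet]
          rfl
        simp_rw [e]
        exact Measurable.lintegral_prod_right' ((by fun_prop : Measurable _).indicator this)
    _ = A * 2 ^ 100 * (ENNReal.ofReal R)⁻¹ ^ 2 *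
        ∫⁻ y, w y * ∫⁻ x in Metric.closedBall y R, F x := by
        rw [lintegral_mul_average hF hw]
    _ = _ := by
        have hc : (ENNReal.ofReal R)⁻¹ ^ 2 ≠ ⊤ := by
          simp [ENNReal.inv_eq_top, hR]
        rw [mul_assoc, ← lintegral_const_mul' _ _ hc]
        simp_rw [mul_left_comm]

lemma lintegral_mul_rpow_mul_rpow_le {w X Y : ℝ × ℝ → ℝ≥0∞} (hw : Measurable w) (hX : Measurable X)
    (hY : Measurable Y) {u v : ℝ} (hu : 0 ≤ u) (hv : 0 ≤ v) (huv : u + v = 1) :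
    ∫⁻ y, w y * (X y ^ u * Y y ^ v) ≤ (∫⁻ y, w y * X y) ^ u * (∫⁻ y, w y * Y y) ^ v := by
  have h := ENNReal.lintegral_mul_norm_pow_le (μ := (volume : Measure (ℝ × ℝ)))
    (f := fun y => w y * X y) (g := fun y => w y * Y y) (by fun_prop) (by fun_prop) hu hv huv
  refine le_trans (le_of_eq (lintegral_congr fun y => ?_)) h
  rw [ENNReal.mul_rpow_of_nonneg _ _ hu, ENNReal.mul_rpow_of_nonneg _ _ hv, mul_mul_mul_comm,
    ← ENNReal.rpow_add_of_nonneg _ _ hu hv, huv, ENNReal.rpow_one]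

/-- Product of two square functions, by Cauchy-Schwarz and Minkowski. -/
lemma lintegral_mul_l2_rpow_le {p : ℝ} (hp : 4 < p) {w : ℝ × ℝ → ℝ≥0∞} (hw : Measurable w)
    {ι κ : Type} (s : Finset ι) (t : Finset κ) (f : ι → ℝ × ℝ → ℝ≥0∞) (g : κ → ℝ × ℝ → ℝ≥0∞)
    (hf : ∀ i, Measurable (f i)) (hg : ∀ i, Measurable (g i)) (K : ℝ≥0∞) (a : ι → ℝ≥0∞)
    (b : κ → ℝ≥0∞) (ha : ∀ i ∈ s, ∫⁻ y, w y * f i y ^ (p / 2) ≤ K * a i)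
    (hb : ∀ i ∈ t, ∫⁻ y, w y * g i y ^ (p / 2) ≤ K * b i) :
    ∫⁻ y, w y * ((∑ i ∈ s, f i y) ^ (p / 4) * (∑ i ∈ t, g i y) ^ (p / 4)) ≤
      K * ((∑ i ∈ s, a i ^ (2 / p)) ^ (p / 4) * (∑ i ∈ t, b i ^ (2 / p)) ^ (p / 4)) := by
  have hp2 : 1 ≤ p / 2 := by linarith
  have hp0 : 0 < p := by linarith
  have e : ∀ F : ℝ × ℝ → ℝ≥0∞, Measurable F →
      ∫⁻ y, w y * F y = ∫⁻ y, F y ∂volume.withDensity w := fun F hF => by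
    rw [lintegral_withDensity_eq_lintegral_mul _ hw hF]
    rfl
  have key : ∀ {η : Type} (r : Finset η) (f : η → ℝ × ℝ → ℝ≥0∞) (a : η → ℝ≥0∞),
      (∀ i, Measurable (f i)) → (∀ i ∈ r, ∫⁻ y, w y * f i y ^ (p / 2) ≤ K * a i) →
      (∫⁻ y, (∑ i ∈ r, f i y) ^ (2 * (p / 4)) ∂volume.withDensity w) ^ (1 / 2 : ℝ) ≤
        K ^ (1 / 2 : ℝ) * (∑ i ∈ r, a i ^ (2 / p)) ^ (p / 4) := by
    intro η r f a hf ha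
    have h1 : (2 : ℝ) * (p / 4) = p / 2 := by ring
    have h2 : p / 4 = p / 2 * (1 / 2) := by ring
    rw [h1, h2, ENNReal.rpow_mul _ (p / 2), ← ENNReal.mul_rpow_of_nonneg _ _ (by norm_num),
      ← sum_const_mul_rpow hp0]
    refine ENNReal.rpow_le_rpow ((lintegral_sum_rpow_le' hp2 r
      fun i _ => (hf i).aemeasurable).trans ?_) (by norm_num)
    rw [one_div_div]
    refine ENNReal.rpow_le_rpow (Finset.sum_le_sum fun i hi =>
      ENNReal.rpow_le_rpow ?_ (by positivity)) (by positivity)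
    rw [← e _ ((hf i).pow_const _)]
    exact ha i hi
  have hmf : Measurable fun y => ∑ i ∈ s, f i y := Finset.measurable_fun_sum _ fun i _ => hf i
  have hmg : Measurable fun y => ∑ i ∈ t, g i y := Finset.measurable_fun_sum _ fun i _ => hg i
  rw [e _ (by fun_prop)]
  refine (lintegral_sq_le hmf.aemeasurable hmg.aemeasurable).trans
    ((mul_le_mul' (key s f a hf ha) (key t g b hg hb)).trans (le_of_eq ?_))
  rw [mul_mul_mul_comm, ← ENNReal.rpow_add_of_nonneg _ _ (by norm_num) (by norm_num)]
  norm_num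

instance {R : ℝ} : SFinite (volume.withDensity (Om R)) := inferInstance

lemma cv_withDensity (R : ℝ) {f : ℝ × ℝ → ℝ≥0∞} (hf : Measurable f) (y : ℝ × ℝ) :
    cv (volume.withDensity (Om R)) f y = ∫⁻ z, f z * Om R (z - y) := by
  rw [cv, lintegral_withDensity_eq_lintegral_mul _ (measurable_Om R) (by fun_prop),
    ← lintegral_sub_left_eq_self _ y]
  refine lintegral_congr fun z => ?_
  simp only [Pi.mul_apply]
  rw [sub_sub_cancel, Om_sub_comm, mul_comm]

lemma exists_lintegral_mul_cv_le : ∃ C : ℝ≥0, ∀ (A : ℝ≥0) (R : ℝ), 0 < R →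
    ∀ w : ℝ × ℝ → ℝ≥0∞, Measurable w → Slow A R w → ∀ f : ℝ × ℝ → ℝ≥0∞, Measurable f →
    ∫⁻ y, w y * cv (volume.withDensity (Om R)) f y ≤ C * A * ∫⁻ z, f z * w z := by
  obtain ⟨C, hC⟩ := exists_slow_conv
  refine ⟨C, fun A R hR w hw hs f hf => ?_⟩
  have hO := measurable_Om R
  calc ∫⁻ y, w y * cv (volume.withDensity (Om R)) f y
      = ∫⁻ y, ∫⁻ z, w y * (f z * Om R (z - y)) := by
        refine lintegral_congr fun y => ?_
        rw [cv_withDensity R hf, lintegral_const_mul _ (by fun_prop)]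
    _ = ∫⁻ z, ∫⁻ y, w y * (f z * Om R (z - y)) :=
        lintegral_lintegral_swap (Measurable.aemeasurable (by fun_prop))
    _ ≤ ∫⁻ z, C * A * (f z * w z) := by
        refine lintegral_mono fun z => ?_
        calc ∫⁻ y, w y * (f z * Om R (z - y)) = f z * ∫⁻ y, w y * Om R (y - z) := by
              rw [← lintegral_const_mul _ (by fun_prop)]
              refine lintegral_congr fun y => ?_
              rw [Om_sub_comm R z y]
              ring
          _ ≤ f z * (C * A * w z) := mul_le_mul' le_rfl (hC A R hR w hs z)
          _ = _ := by ring
    _ = _ := lintegral_const_mul' _ _ (by finiteness)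

lemma exists_bilinear_global (A C₁ : ℝ≥0) (hC₁ : 1 ≤ C₁) : ∃ C : ℝ≥0, ∀ p : ℝ, 4 < p → p < 6 →
    ∀ R S : ℝ, 0 < R → 0 < S → ∀ (μ : Measure (ℝ × ℝ)) [SFinite μ], Blur C₁ R μ →
    ∀ {ι κ : Type} (s : Finset ι) (t : Finset κ) (a : ι → ℝ) (b : κ → ℝ)
      (h : ι → ℝ → ℂ) (k : κ → ℝ → ℂ), Cells R s a h → Cells R t b k →
    (∀ i ∈ s, ∀ j ∈ t, S⁻¹ ≤ |a i - b j|) →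
    ∀ w : ℝ × ℝ → ℝ≥0∞, Measurable w → Slow A R w →
    ∫⁻ x, w x * (sqf μ s h x ^ (p / 4) * sqf μ t k x ^ (p / 4)) ≤
    C * ENNReal.ofReal S *
      ((∫⁻ x, w x * (sqf (volume.withDensity (Om R)) s h x ^ (p / 4) *
        sqf (volume.withDensity (Om R)) t k x ^ (p / 4))) ^ (2 / (p - 2)) *
      (l2p p w s (fun i => ext (h i)) ^ (p / 4) *
        l2p p w t (fun i => ext (k i)) ^ (p / 4)) ^ ((p - 4) / (p - 2))) := by
  obtain ⟨C, hC⟩ := exists_bilinear_local C₁ hC₁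
  obtain ⟨C', hC'⟩ := exists_lintegral_mul_cv_le
  refine ⟨A * 2 ^ 100 * C * max 1 (C' * A), fun p hp hp' R S hR hS μ _ hμ ι κ s t a b h k hs ht hst w
    hw hsl => ?_⟩
  have hp0 : 0 < p := by linarith
  have hp2 : 0 < p - 2 := by linarith
  have hp4 : 0 < p - 4 := by linarith
  have hν : ∀ {η : Type} (r : Finset η) (f : η → ℝ → ℂ), (∀ i, Integrable (f i)) → ∀ y,
      ∑ i ∈ r, ∫⁻ z, ‖ext (f i) z‖ₑ ^ 2 * Om R (z - y) =
        sqf (volume.withDensity (Om R)) r f y := by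
    intro η r f hf y
    refine Finset.sum_congr rfl fun i _ => ?_
    have := measurable_enorm_ext (hf i)
    rw [cv_withDensity R (by fun_prop)]
  have hN : ∀ {η : Type} (f : η → ℝ → ℂ), (∀ i, Integrable (f i)) → ∀ i y,
      Np p (fun z => Om R (z - y)) (ext (f i)) =
        cv (volume.withDensity (Om R)) (fun z => ‖ext (f i) z‖ₑ ^ p) y := by
    intro η f hf i y
    have := measurable_enorm_ext (hf i)
    rw [cv_withDensity R (by fun_prop), Np]
  have hmN : ∀ {η : Type} (f : η → ℝ → ℂ), (∀ i, Integrable (f i)) → ∀ i,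
      Measurable fun y => Np p (fun z => Om R (z - y)) (ext (f i)) ^ (2 / p) := by
    intro η f hf i
    have := measurable_enorm_ext (hf i)
    simp_rw [hN f hf]
    exact (measurable_cv _ (by fun_prop)).pow_const _
  have hml : ∀ {η : Type} (r : Finset η) (f : η → ℝ → ℂ), (∀ i, Integrable (f i)) →
      Measurable fun y => l2p p (fun z => Om R (z - y)) r (fun i => ext (f i)) := by
    intro η r f hf
    unfold l2p
    exact Finset.measurable_fun_sum _ fun i _ => hmN f hf i
  have hY : ∀ {η : Type} (f : η → ℝ → ℂ), (∀ i, Integrable (f i)) → ∀ i,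
      ∫⁻ y, w y * (Np p (fun z => Om R (z - y)) (ext (f i)) ^ (2 / p)) ^ (p / 2) ≤
        (C' * A) * Np p w (ext (f i)) := by
    intro η f hf i
    have := measurable_enorm_ext (hf i)
    have e : 2 / p * (p / 2) = 1 := by field_simp
    simp_rw [← ENNReal.rpow_mul, e, ENNReal.rpow_one, hN f hf]
    exact hC' A R hR w hw hsl _ (by fun_prop)
  have hms := measurable_sqf μ s hs.integrable
  have hmt := measurable_sqf μ t ht.integrable
  have hms' := measurable_sqf (volume.withDensity (Om R)) s hs.integrable
  have hmt' := measurable_sqf (volume.withDensity (Om R)) t ht.integrable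
  have hml1 := hml s h hs.integrable
  have hml2 := hml t k ht.integrable
  have hu : 0 ≤ 2 / (p - 2) := by positivity
  have hv : 0 ≤ (p - 4) / (p - 2) := by positivity
  have hv1 : (p - 4) / (p - 2) ≤ 1 := by rw [div_le_one hp2]; linarith
  calc ∫⁻ x, w x * (sqf μ s h x ^ (p / 4) * sqf μ t k x ^ (p / 4))
      ≤ A * 2 ^ 100 * ∫⁻ y, w y * (C * ENNReal.ofReal S *
        ((sqf (volume.withDensity (Om R)) s h y ^ (p / 4) *
          sqf (volume.withDensity (Om R)) t k y ^ (p / 4)) ^ (2 / (p - 2)) *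
        (l2p p (fun z => Om R (z - y)) s (fun i => ext (h i)) ^ (p / 4) *
          l2p p (fun z => Om R (z - y)) t (fun i => ext (k i)) ^ (p / 4)) ^
            ((p - 4) / (p - 2)))) := by
        refine (hsl.lintegral_mul_le hR hw (by fun_prop)).trans (mul_le_mul' le_rfl
          (lintegral_mono fun y => mul_le_mul' le_rfl ?_))
        have := hC p hp hp' R S hR hS μ hμ s t a b h k hs ht hst y
        rwa [hν s h hs.integrable, hν t k ht.integrable] at this
    _ = A * 2 ^ 100 * C * ENNReal.ofReal S * ∫⁻ y, w y *
        ((sqf (volume.withDensity (Om R)) s h y ^ (p / 4) *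
          sqf (volume.withDensity (Om R)) t k y ^ (p / 4)) ^ (2 / (p - 2)) *
        (l2p p (fun z => Om R (z - y)) s (fun i => ext (h i)) ^ (p / 4) *
          l2p p (fun z => Om R (z - y)) t (fun i => ext (k i)) ^ (p / 4)) ^
            ((p - 4) / (p - 2))) := by
        simp_rw [mul_left_comm (w _)]
        rw [lintegral_const_mul' _ _ (by finiteness)]
        ring
    _ ≤ A * 2 ^ 100 * C * ENNReal.ofReal S *
        ((∫⁻ x, w x * (sqf (volume.withDensity (Om R)) s h x ^ (p / 4) *
        sqf (volume.withDensity (Om R)) t k x ^ (p / 4))) ^ (2 / (p - 2)) *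
        (max 1 (C' * A) * (l2p p w s (fun i => ext (h i)) ^ (p / 4) *
        l2p p w t (fun i => ext (k i)) ^ (p / 4)) ^ ((p - 4) / (p - 2)))) := by
        refine mul_le_mul' le_rfl ((lintegral_mul_rpow_mul_rpow_le hw (by fun_prop) (by fun_prop)
          hu hv (by field_simp; ring)).trans (mul_le_mul' le_rfl ?_))
        have hZ := lintegral_mul_l2_rpow_le hp hw s t _ _ (hmN h hs.integrable)
          (hmN k ht.integrable) _ _ _ (fun i _ => hY h hs.integrable i)
          (fun i _ => hY k ht.integrable i)
        refine (ENNReal.rpow_le_rpow hZ hv).trans ?_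
        rw [ENNReal.mul_rpow_of_nonneg _ _ hv]
        refine mul_le_mul' ?_ le_rfl
        calc ((C' : ℝ≥0∞) * A) ^ ((p - 4) / (p - 2))
            ≤ (max 1 (C' * A) : ℝ≥0∞) ^ ((p - 4) / (p - 2)) :=
              ENNReal.rpow_le_rpow (le_max_right _ _) hv
          _ ≤ (max 1 (C' * A) : ℝ≥0∞) ^ (1 : ℝ) :=
              ENNReal.rpow_le_rpow_of_exponent_le (le_max_left _ _) hv1
          _ = _ := ENNReal.rpow_one _
    _ = _ := by
        push_cast
        ring

lemma mem_of_piece_ne_zero {g : ℝ → ℂ} {M : ℝ} (hM : 0 < M) {l : ℤ} {ξ : ℝ}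
    (h : piece g M l ξ ≠ 0) : (l : ℝ) ≤ M * ξ ∧ M * ξ < l + 1 := by
  have := Set.mem_of_indicator_ne_zero h
  rw [Set.mem_Ico, div_le_iff₀ hM, lt_div_iff₀ hM] at this
  constructor <;> linarith

lemma sum_range_mul {X : Type*} [AddCommMonoid X] (f : ℕ → X) (n q : ℕ) :
    ∑ t ∈ Finset.range (n * q), f t =
      ∑ r ∈ Finset.range n, ∑ k ∈ Finset.range q, f (r * q + k) := by
  induction n with
  | zero => simp
  | succ n ih => rw [Finset.sum_range_succ, ← ih, Nat.succ_mul, Finset.sum_range_add]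

/-- The part of `g` in the `r`-th of the cells of length `1 / (m n)` that make up the cell
`[l / m, (l + 1) / m)`. -/
noncomputable def subPiece (g : ℝ → ℂ) (m : ℕ) (l : ℤ) (n : ℕ) (r : ℕ) : ℝ → ℂ :=
  piece g (m * n : ℕ) (l * n + r)

lemma exists_sqf_refine : ∃ C : ℝ≥0, ∀ g : ℝ → ℂ, Integrable g → ∀ (m : ℕ) (l : ℤ) (n q : ℕ),
    0 < m → 0 < n → 0 < q → ∀ R : ℝ, (m * n * q : ℕ) ≤ R → ∀ y,
    sqf (volume.withDensity (Om R)) (Finset.range n) (subPiece g m l n) y ≤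
      C * sqf (volume.withDensity (Om R)) (Finset.range (n * q)) (subPiece g m l (n * q)) y := by
  obtain ⟨C, hC⟩ := exists_local_orthogonality
  refine ⟨C, fun g hg m l n q hm hn hq R hR y => ?_⟩
  have hD : 0 < ((m * n * q : ℕ) : ℝ) := by positivity
  have hR0 : 0 < R := hD.trans_le hR
  have hmeas : ∀ M L, Measurable fun z => ‖ext (piece g M L) z‖ₑ ^ 2 := fun M L => by
    have := measurable_enorm_ext (integrable_piece hg M L)
    fun_prop
  unfold sqf
  rw [sum_range_mul, Finset.mul_sum]
  refine Finset.sum_le_sum fun r hr => ?_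
  have key := hC (fun k => piece g (m * n * q : ℕ) ((l * n + r) * q + k))
    (fun k => integrable_piece hg _ _) R hR0 (fun i j hij ξ η hξ hη => ?_) q y
  · unfold subPiece
    rw [cv_withDensity R (hmeas _ _)]
    have e : ∀ k, cv (volume.withDensity (Om R)) (fun z => ‖ext (piece g (m * (n * q) : ℕ)
        (l * (n * q : ℕ) + (r * q + k : ℕ))) z‖ₑ ^ 2) y =
        ∫⁻ z, ‖ext (piece g (m * n * q : ℕ) ((l * n + r) * q + k)) z‖ₑ ^ 2 * Om R (z - y) := by
      intro k
      have e : (l * (n * q : ℕ) + (r * q + k : ℕ) : ℤ) = (l * n + r) * q + k := by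
        push_cast
        ring
      rw [cv_withDensity R (hmeas _ _), mul_assoc m, e]
    simp_rw [e]
    refine le_trans (le_of_eq (lintegral_congr fun z => ?_)) key
    rw [ext_piece_eq_sum hg (by positivity) _ hq]
    push_cast
    rfl
  · obtain ⟨h1, h2⟩ := mem_of_piece_ne_zero hD hξ
    obtain ⟨h3, h4⟩ := mem_of_piece_ne_zero hD hη
    push_cast at h1 h2 h3 h4 hR hD
    have h5 : (1 : ℝ) ≤ |(m * n * q : ℝ) * (ξ - η)| := by
      rw [le_abs]
      rcases hij with h | h
      · right
        have : (i : ℝ) + 1 + 1 ≤ j := by exact_mod_cast h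
        linarith
      · left
        have : (j : ℝ) + 1 + 1 ≤ i := by exact_mod_cast h
        linarith
    rw [abs_mul, abs_of_pos hD] at h5
    rw [abs_mul, abs_of_pos hR0]
    exact h5.trans (mul_le_mul_of_nonneg_right hR (abs_nonneg _))

/-- The bilinear quantity attached to the cells `l` and `l'` at scale `1 / m`, split into `n`
pieces each. -/
noncomputable def bil (p : ℝ) (w : ℝ × ℝ → ℝ≥0∞) (μ : Measure (ℝ × ℝ)) (g : ℝ → ℂ) (m : ℕ)
    (l l' : ℤ) (n : ℕ) : ℝ≥0∞ :=
  ∫⁻ x, w x * (sqf μ (Finset.range n) (subPiece g m l n) x ^ (p / 4) *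
    sqf μ (Finset.range n) (subPiece g m l' n) x ^ (p / 4))

/-- The `ℓ²` sum over the `n` pieces of the cell `l` at scale `1 / m`. -/
noncomputable def l2c (p : ℝ) (w : ℝ × ℝ → ℝ≥0∞) (g : ℝ → ℂ) (m : ℕ) (l : ℤ) (n : ℕ) : ℝ≥0∞ :=
  l2p p w (Finset.range n) fun r => ext (subPiece g m l n r)

lemma integrable_subPiece {g : ℝ → ℂ} (hg : Integrable g) (m : ℕ) (l : ℤ) (n r : ℕ) :
    Integrable (subPiece g m l n r) := integrable_piece hg _ _

lemma cells_subPiece {g : ℝ → ℂ} (hg : Integrable g) {m n : ℕ} (hm : 0 < m) (hn : 0 < n) {l : ℤ}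
    (hl : 0 ≤ l) (hl' : l < 2 * m) : Cells ((m * n : ℕ) ^ 2) (Finset.range n)
      (fun r => (l * n + r : ℝ) / (m * n : ℕ)) (subPiece g m l n) := by
  have hD : 0 < ((m * n : ℕ) : ℝ) := by positivity
  have hl0 : (0 : ℝ) ≤ l := by exact_mod_cast hl
  refine ⟨fun r => integrable_subPiece hg _ _ _ _, fun r hr => ?_, fun r _ ξ hξ => ?_⟩
  · rw [abs_of_nonneg (by positivity), div_le_iff₀ hD]
    have hr : (r : ℝ) ≤ n := by exact_mod_cast (Finset.mem_range.1 hr).le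
    have h1 : (l : ℝ) + 1 ≤ 2 * m := by exact_mod_cast hl'
    push_cast
    nlinarith [mul_le_mul_of_nonneg_right h1 (Nat.cast_nonneg (α := ℝ) n)]
  · obtain ⟨h1, h2⟩ := mem_of_piece_ne_zero hD hξ
    rw [← mul_pow, mul_sub, mul_div_cancel₀ _ hD.ne']
    push_cast at h1 h2 ⊢
    nlinarith

lemma inv_le_abs_center_sub {m n : ℕ} (hm : 0 < m) (hn : 0 < n) {l l' : ℤ} (h : l + 1 < l') {r r' : ℕ}
    (hr : r < n) : (m : ℝ)⁻¹ ≤ |(l * n + r : ℝ) / (m * n : ℕ) - (l' * n + r') / (m * n : ℕ)| := by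
  have hD : 0 < ((m * n : ℕ) : ℝ) := by positivity
  have hm' : 0 < (m : ℝ) := by positivity
  have hn' : 0 < (n : ℝ) := by positivity
  rw [← sub_div, abs_div, abs_of_pos hD, le_div_iff₀ hD, Nat.cast_mul, inv_mul_cancel_left₀ hm'.ne',
    le_abs]
  right
  have h1 : (l : ℝ) + 1 + 1 ≤ l' := by exact_mod_cast h
  have h2 : (r : ℝ) + 1 ≤ n := by exact_mod_cast hr
  nlinarith [mul_le_mul_of_nonneg_right h1 hn'.le, Nat.cast_nonneg (α := ℝ) r']

lemma exists_bil_step (A C₁ : ℝ≥0) (hC₁ : 1 ≤ C₁) : ∃ C : ℝ≥0, ∀ p : ℝ, 4 < p → p < 6 →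
    ∀ (μ : Measure (ℝ × ℝ)) [SFinite μ] (m n q : ℕ), 0 < m → 0 < n → 0 < q → q ≤ m * n →
    Blur C₁ ((m * n : ℕ) ^ 2) μ → ∀ g : ℝ → ℂ, Integrable g → ∀ l l' : ℤ, 0 ≤ l → l + 1 < l' →
    l' < 2 * m → ∀ w : ℝ × ℝ → ℝ≥0∞, Measurable w → Slow A ((m * n : ℕ) ^ 2) w →
    bil p w μ g m l l' n ≤ C * m *
      (bil p w (volume.withDensity (Om ((m * n : ℕ) ^ 2))) g m l l' (n * q) ^ (2 / (p - 2)) *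
      (l2c p w g m l n ^ (p / 4) * l2c p w g m l' n ^ (p / 4)) ^ ((p - 4) / (p - 2))) := by
  obtain ⟨C, hC⟩ := exists_bilinear_global A C₁ hC₁
  obtain ⟨C', hC'⟩ := exists_sqf_refine
  refine ⟨C * max 1 C' ^ 3, fun p hp hp' μ _ m n q hm hn hq hqmn hμ g hg l l' hl hll hl' w hw hsl => ?_⟩
  have hD : 0 < ((m * n : ℕ) : ℝ) := by positivity
  have hm' : 0 < (m : ℝ) := by positivity
  have hp2 : 0 < p - 2 := by linarith
  set ν := volume.withDensity (Om ((m * n : ℕ) ^ 2))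
  have hR : ((m * n * q : ℕ) : ℝ) ≤ (m * n : ℕ) ^ 2 := by
    rw [Nat.cast_mul, sq]
    exact mul_le_mul_of_nonneg_left (by exact_mod_cast hqmn) hD.le
  have h1 := hC p hp hp' ((m * n : ℕ) ^ 2) m (by positivity) hm' μ hμ _ _ _ _ _ _
    (cells_subPiece hg hm hn hl (by omega)) (cells_subPiece hg hm hn (by omega) hl')
    (fun i hi j _ => inv_le_abs_center_sub hm hn hll (Finset.mem_range.1 hi)) w hw hsl
  refine h1.trans ?_
  rw [ENNReal.ofReal_natCast]
  have h2 : (∫⁻ x, w x * (sqf ν (Finset.range n) (subPiece g m l n) x ^ (p / 4) *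
      sqf ν (Finset.range n) (subPiece g m l' n) x ^ (p / 4))) ≤
      (C' : ℝ≥0∞) ^ (p / 2) * bil p w ν g m l l' (n * q) := by
    unfold bil
    rw [← lintegral_const_mul' _ _ (by finiteness)]
    refine lintegral_mono fun x => ?_
    calc _ ≤ w x * ((C' * sqf ν (Finset.range (n * q)) (subPiece g m l (n * q)) x) ^ (p / 4) *
          (C' * sqf ν (Finset.range (n * q)) (subPiece g m l' (n * q)) x) ^ (p / 4)) :=
          mul_le_mul' le_rfl (mul_le_mul'
            (ENNReal.rpow_le_rpow (hC' g hg m l n q hm hn hq _ hR x) (by linarith))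
            (ENNReal.rpow_le_rpow (hC' g hg m l' n q hm hn hq _ hR x) (by linarith)))
      _ = _ := by
          rw [ENNReal.mul_rpow_of_nonneg _ _ (by linarith : 0 ≤ p / 4),
            ENNReal.mul_rpow_of_nonneg _ _ (by linarith : 0 ≤ p / 4),
            show p / 2 = p / 4 + p / 4 by ring,
            ENNReal.rpow_add_of_nonneg (p / 4) (p / 4) (by linarith) (by linarith)]
          ring
  have h3 := ENNReal.rpow_le_rpow h2 (z := 2 / (p - 2)) (by positivity)
  rw [ENNReal.mul_rpow_of_nonneg _ _ (by positivity), ← ENNReal.rpow_mul] at h3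
  have h4 : (C' : ℝ≥0∞) ^ (p / 2 * (2 / (p - 2))) ≤ (max 1 C' : ℝ≥0∞) ^ 3 := by
    have h5 : p / 2 * (2 / (p - 2)) ≤ 3 := by
      rw [div_mul_div_comm, div_le_iff₀ (by positivity)]
      linarith
    calc _ ≤ (max 1 C' : ℝ≥0∞) ^ (p / 2 * (2 / (p - 2))) :=
          ENNReal.rpow_le_rpow (le_max_right _ _) (by positivity)
      _ ≤ (max 1 C' : ℝ≥0∞) ^ (3 : ℝ) :=
          ENNReal.rpow_le_rpow_of_exponent_le (le_max_left _ _) h5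
      _ = _ := by norm_cast
  calc _ ≤ C * m * (((max 1 C' : ℝ≥0∞) ^ 3 * bil p w ν g m l l' (n * q) ^ (2 / (p - 2))) *
      (l2c p w g m l n ^ (p / 4) * l2c p w g m l' n ^ (p / 4)) ^ ((p - 4) / (p - 2))) :=
        mul_le_mul' le_rfl (mul_le_mul' (h3.trans (mul_le_mul' h4 le_rfl)) le_rfl)
    _ = _ := by
        push_cast
        ring

lemma cv_dirac (f : ℝ × ℝ → ℝ≥0∞) (x : ℝ × ℝ) : cv (Measure.dirac 0) f x = f x := by
  rw [cv, lintegral_dirac, sub_zero]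

lemma blur_dirac {C : ℝ≥0} (hC : 1 ≤ C) (R : ℝ) : Blur C R (Measure.dirac 0) := by
  have hC' : (1 : ℝ≥0∞) ≤ C := by exact_mod_cast hC
  refine ⟨by simpa using hC', fun z => ?_⟩
  rw [lintegral_dirac, sub_zero]
  exact le_mul_of_one_le_left zero_le hC'

lemma exists_blur_Om : ∃ C : ℝ≥0, 1 ≤ C ∧ ∀ r R : ℝ, 0 < r → r ≤ R →
    Blur C R (volume.withDensity (Om r)) := by
  obtain ⟨C, hC⟩ := exists_normalized_br
  obtain ⟨C', hC'⟩ := exists_Om_conv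
  refine ⟨max 1 (max C C'), le_max_left _ _, fun r R hr hrR => ⟨?_, fun z => ?_⟩⟩
  · rw [withDensity_apply _ MeasurableSet.univ, Measure.restrict_univ]
    refine (hC r hr 104 (by norm_num)).trans ?_
    exact_mod_cast (le_max_left C C').trans (le_max_right _ _)
  · have hO := measurable_Om R
    rw [lintegral_withDensity_eq_lintegral_mul _ (measurable_Om r) (by fun_prop)]
    simp only [Pi.mul_apply]
    simp_rw [mul_comm (Om r _)]
    refine (hC' r R hr hrR z).trans (mul_le_mul' ?_ le_rfl)
    exact_mod_cast (le_max_right C C').trans (le_max_right _ _)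

lemma exists_bil_end (A : ℝ≥0) : ∃ C : ℝ≥0, ∀ p : ℝ, 4 < p → p < 6 →
    ∀ (m n : ℕ) (R : ℝ), 0 < R → ∀ g : ℝ → ℂ, Integrable g → ∀ l l' : ℤ,
    ∀ w : ℝ × ℝ → ℝ≥0∞, Measurable w → Slow A R w →
    bil p w (volume.withDensity (Om R)) g m l l' n ≤
      C * (l2c p w g m l n ^ (p / 4) * l2c p w g m l' n ^ (p / 4)) := by
  obtain ⟨C₁, hC₁, hB⟩ := exists_blur_Om
  obtain ⟨C', hC'⟩ := exists_lintegral_mul_cv_le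
  refine ⟨C₁ ^ 2 * (C' * A), fun p hp hp' m n R hR g hg l l' w hw hsl => ?_⟩
  set ν := volume.withDensity (Om R)
  have hm : ∀ l r, Measurable fun z => ‖ext (subPiece g m l n r) z‖ₑ := fun l r =>
    measurable_enorm_ext (integrable_subPiece hg m l n r)
  have hmc : ∀ l r, Measurable fun y => cv ν (fun z => ‖ext (subPiece g m l n r) z‖ₑ ^ 2) y :=
    fun l r => measurable_cv ν ((hm l r).pow_const 2)
  have key : ∀ l r, ∫⁻ y, w y * cv ν (fun z => ‖ext (subPiece g m l n r) z‖ₑ ^ 2) y ^ (p / 2) ≤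
      ((C₁ ^ 2 * (C' * A) : ℝ≥0) : ℝ≥0∞) * Np p w (ext (subPiece g m l n r)) := by
    intro l r
    have := hm l r
    have e : ∀ z, (‖ext (subPiece g m l n r) z‖ₑ ^ 2) ^ (p / 2) =
        ‖ext (subPiece g m l n r) z‖ₑ ^ p := fun z => by
      rw [← ENNReal.rpow_natCast, ← ENNReal.rpow_mul]
      congr 1
      push_cast
      ring
    calc _ ≤ ∫⁻ y, C₁ ^ 2 * (w y * cv ν (fun z => ‖ext (subPiece g m l n r) z‖ₑ ^ p) y) := by
          refine lintegral_mono fun y => ?_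
          have h := (hB R R hR le_rfl).rpow_le hC₁ (q := p / 2) (by linarith) (by linarith)
            (f := fun z => ‖ext (subPiece g m l n r) z‖ₑ ^ 2) (by fun_prop) y
          simp_rw [e] at h
          rw [mul_left_comm]
          exact mul_le_mul' le_rfl h
      _ = C₁ ^ 2 * ∫⁻ y, w y * cv ν (fun z => ‖ext (subPiece g m l n r) z‖ₑ ^ p) y :=
          lintegral_const_mul' _ _ (by finiteness)
      _ ≤ C₁ ^ 2 * (C' * A * ∫⁻ z, ‖ext (subPiece g m l n r) z‖ₑ ^ p * w z) :=
          mul_le_mul' le_rfl (hC' A R hR w hw hsl _ (by fun_prop))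
      _ = _ := by
          rw [Np]
          push_cast
          ring
  exact lintegral_mul_l2_rpow_le hp hw _ _ _ _ (hmc l) (hmc l') _ _ _ (fun r _ => key l r)
    (fun r _ => key l' r)

lemma le_of_recurrence {α θ : ℝ} (hα : 0 ≤ α) (hθ : 0 ≤ θ) (h1 : α + θ = 1) (Q B : ℕ → ℝ≥0∞)
    (Z : ℝ≥0∞) (J : ℕ) (h : ∀ i < J, Q i ≤ B i * (Q (i + 1) ^ α * Z ^ θ)) :
    Q 0 ≤ (∏ i ∈ Finset.range J, B i ^ (α ^ i)) * (Z ^ (1 - α ^ J) * Q J ^ (α ^ J)) := by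
  have hα1 : α ≤ 1 := by linarith
  induction J with
  | zero => simp
  | succ J ih =>
    have hJ : 0 ≤ α ^ J := by positivity
    have hJ1 : α ^ J ≤ 1 := pow_le_one₀ hα hα1
    have hz : Z ^ (1 - α ^ (J + 1)) = Z ^ (1 - α ^ J) * Z ^ (θ * α ^ J) := by
      rw [← ENNReal.rpow_add_of_nonneg _ _ (by linarith) (by positivity)]
      congr 1
      linear_combination (-α ^ J) * h1
    refine (ih fun i hi => h i (hi.trans (Nat.lt_succ_self J))).trans ?_
    rw [Finset.prod_range_succ, hz]
    have h2 := ENNReal.rpow_le_rpow (h J (Nat.lt_succ_self J)) hJ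
    rw [ENNReal.mul_rpow_of_nonneg _ _ hJ, ENNReal.mul_rpow_of_nonneg _ _ hJ, ← ENNReal.rpow_mul,
      ← ENNReal.rpow_mul] at h2
    refine (mul_le_mul' le_rfl (mul_le_mul' le_rfl h2)).trans (le_of_eq ?_)
    rw [pow_succ, mul_comm α]
    ring

lemma exists_bil_iter (A : ℝ≥0) : ∃ C : ℝ≥0, 1 ≤ C ∧ ∀ p : ℝ, 4 < p → p < 6 → ∀ (N m : ℕ), 0 < m →
    ∀ e : ℕ → ℕ, e 0 = 0 → Monotone e → (∀ i ≤ N, e (i + 1) ≤ 2 * e i + 1) →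
    ∀ g : ℝ → ℂ, Integrable g → ∀ l l' : ℤ, 0 ≤ l → l + 1 < l' → l' < 2 * m →
    ∀ w : ℝ × ℝ → ℝ≥0∞, Measurable w → Slow A ((m * m ^ e N : ℕ) ^ 2) w → ∀ D : ℕ → ℝ≥0∞,
    (∀ i ≤ N, l2c p w g m l (m ^ e i) ≤ D i ^ 2 * l2c p w g m l (m ^ e (N + 1))) →
    (∀ i ≤ N, l2c p w g m l' (m ^ e i) ≤ D i ^ 2 * l2c p w g m l' (m ^ e (N + 1))) →
    bil p w (Measure.dirac 0) g m l l' 1 ≤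
      (∏ i ∈ Finset.range (N + 1), (C * m * D i ^ (p * ((p - 4) / (p - 2)))) ^ ((2 / (p - 2)) ^ i)) *
      (C * (l2c p w g m l (m ^ e (N + 1)) ^ (p / 4) * l2c p w g m l' (m ^ e (N + 1)) ^ (p / 4))) := by
  obtain ⟨C₁, hC₁, hB⟩ := exists_blur_Om
  obtain ⟨C₂, h₂⟩ := exists_bil_step A C₁ hC₁
  obtain ⟨C₃, h₃⟩ := exists_bil_end A
  set C := max 1 (max C₂ C₃)
  have hC1 : (1 : ℝ≥0∞) ≤ C := by exact_mod_cast le_max_left _ _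
  have hC2 : (C₂ : ℝ≥0∞) ≤ C := by exact_mod_cast (le_max_left _ _).trans (le_max_right _ _)
  have hC3 : (C₃ : ℝ≥0∞) ≤ C := by exact_mod_cast (le_max_right _ _).trans (le_max_right _ _)
  refine ⟨C, le_max_left _ _, fun p hp hp' N m hm e he0 hmono he g hg l l' hl hll hl' w hw hsl D
    hD hD' => ?_⟩
  have hm0 : 0 < (m : ℝ) := by positivity
  have hp2 : 0 < p - 2 := by linarith
  have hp4 : 0 < p - 4 := by linarith
  have hα : 0 ≤ 2 / (p - 2) := by positivity
  have hθ : 0 ≤ (p - 4) / (p - 2) := by positivity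
  have hαθ : 2 / (p - 2) + (p - 4) / (p - 2) = 1 := by field_simp; ring
  have hα1 : 2 / (p - 2) ≤ 1 := by linarith
  set R : ℕ → ℝ := fun i => (m * m ^ e i : ℕ) ^ 2 with hR
  have hR0 : ∀ i, 0 < R i := fun i => by simp only [hR]; positivity
  have hRm : Monotone R := fun i j hij => by
    simp only [hR]
    have : m * m ^ e i ≤ m * m ^ e j := Nat.mul_le_mul_left _ (Nat.pow_le_pow_right hm (hmono hij))
    gcongr
  obtain ⟨μ, hμ0, hμ1⟩ : ∃ μ : ℕ → Measure (ℝ × ℝ), μ 0 = Measure.dirac 0 ∧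
      ∀ i, μ (i + 1) = volume.withDensity (Om (R i)) :=
    ⟨fun i => Nat.casesOn i (Measure.dirac 0) fun j => volume.withDensity (Om (R j)), rfl,
      fun _ => rfl⟩
  have hμs : ∀ i, SFinite (μ i) := fun i => by
    cases i with
    | zero => rw [hμ0]; infer_instance
    | succ i => rw [hμ1]; infer_instance
  have hμB : ∀ i, Blur C₁ (R i) (μ i) := fun i => by
    cases i with
    | zero => rw [hμ0]; exact blur_dirac hC₁ _
    | succ i => rw [hμ1]; exact hB _ _ (hR0 i) (hRm (Nat.le_succ i))
  set Z := l2c p w g m l (m ^ e (N + 1)) ^ (p / 4) * l2c p w g m l' (m ^ e (N + 1)) ^ (p / 4)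
  have hslow : ∀ i ≤ N, Slow A (R i) w := fun i hi => hsl.mono (hR0 i) (hRm hi)
  have hstep : ∀ i < N + 1, bil p w (μ i) g m l l' (m ^ e i) ≤
      (C * m * D i ^ (p * ((p - 4) / (p - 2)))) *
        (bil p w (μ (i + 1)) g m l l' (m ^ e (i + 1)) ^ (2 / (p - 2)) * Z ^ ((p - 4) / (p - 2))) := by
    intro i hi
    have hi' : i ≤ N := Nat.lt_succ_iff.1 hi
    have hle := hmono (Nat.le_succ i)
    have hq : m ^ e i * m ^ (e (i + 1) - e i) = m ^ e (i + 1) := by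
      rw [← pow_add, Nat.add_sub_cancel' hle]
    have hqm : m ^ (e (i + 1) - e i) ≤ m * m ^ e i := by
      rw [← pow_succ']
      exact Nat.pow_le_pow_right hm (by have := he i hi'; omega)
    have hμi := hμs i
    have h := h₂ p hp hp' (μ i) m (m ^ e i) (m ^ (e (i + 1) - e i)) hm (by positivity)
      (by positivity) hqm (hμB i) g hg l l' hl hll hl' w hw (hslow i hi')
    rw [hq] at h
    have hZ : (l2c p w g m l (m ^ e i) ^ (p / 4) * l2c p w g m l' (m ^ e i) ^ (p / 4)) ^
        ((p - 4) / (p - 2)) ≤ D i ^ (p * ((p - 4) / (p - 2))) * Z ^ ((p - 4) / (p - 2)) := by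
      have hp40 : 0 ≤ p / 4 := by linarith
      rw [ENNReal.rpow_mul, ← ENNReal.mul_rpow_of_nonneg _ _ hθ]
      refine ENNReal.rpow_le_rpow ?_ hθ
      refine (mul_le_mul' (ENNReal.rpow_le_rpow (hD i hi') hp40)
        (ENNReal.rpow_le_rpow (hD' i hi') hp40)).trans (le_of_eq ?_)
      rw [ENNReal.mul_rpow_of_nonneg _ _ hp40, ENNReal.mul_rpow_of_nonneg _ _ hp40, mul_mul_mul_comm,
        ← ENNReal.rpow_natCast, ← ENNReal.rpow_mul,
        ← ENNReal.rpow_add_of_nonneg _ _ (by positivity) (by positivity)]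
      congr 2
      push_cast
      ring
    refine h.trans ((mul_le_mul' (mul_le_mul' hC2 le_rfl) (mul_le_mul' le_rfl hZ)).trans
      (le_of_eq ?_))
    rw [hμ1, mul_left_comm _ (D i ^ (p * ((p - 4) / (p - 2))))]
    simp only [mul_assoc]
    rfl
  have hend : bil p w (μ (N + 1)) g m l l' (m ^ e (N + 1)) ≤ C * Z :=
    hμ1 N ▸ (h₃ p hp hp' m (m ^ e (N + 1)) (R N) (hR0 N) g hg l l' w hw hsl).trans (mul_le_mul' hC3 le_rfl)
  have hrec := le_of_recurrence hα hθ hαθ (fun i => bil p w (μ i) g m l l' (m ^ e i))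
    (fun i => C * m * D i ^ (p * ((p - 4) / (p - 2)))) Z (N + 1) hstep
  rw [he0, hμ0, pow_zero] at hrec
  refine hrec.trans (mul_le_mul' le_rfl ?_)
  have hJ : 0 ≤ (2 / (p - 2)) ^ (N + 1) := by positivity
  have hJ1 : (2 / (p - 2)) ^ (N + 1) ≤ 1 := pow_le_one₀ hα hα1
  calc _ ≤ Z ^ (1 - (2 / (p - 2)) ^ (N + 1)) * (C * Z) ^ ((2 / (p - 2)) ^ (N + 1)) :=
        mul_le_mul' le_rfl (ENNReal.rpow_le_rpow hend hJ)
    _ = (C : ℝ≥0∞) ^ ((2 / (p - 2)) ^ (N + 1)) * Z := by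
        rw [ENNReal.mul_rpow_of_nonneg _ _ hJ, mul_left_comm,
          ← ENNReal.rpow_add_of_nonneg _ _ (by linarith) hJ, sub_add_cancel, ENNReal.rpow_one]
    _ ≤ (C : ℝ≥0∞) ^ (1 : ℝ) * Z :=
        mul_le_mul' (ENNReal.rpow_le_rpow_of_exponent_le hC1 hJ1) le_rfl
    _ = _ := by rw [ENNReal.rpow_one]

lemma dil_subPiece (g : ℝ → ℂ) {M m n : ℕ} (hM : 0 < M) (hm : 0 < m) (hn : 0 < n) (a l : ℤ) (r : ℕ) :
    subPiece (dil (a / M) M g) m l n r = dil (a / M) M (subPiece g (M * m) (a * m + l) n r) := by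
  have hM' : (0 : ℝ) < M := by positivity
  unfold subPiece
  rw [mul_assoc, Nat.cast_mul M, dil_piece g hM' a (by positivity) (l * n + r)]
  push_cast
  ring

lemma l2c_dil {p : ℝ} (hp : 0 < p) {g : ℝ → ℂ} (hg : Integrable g) {w : ℝ × ℝ → ℝ≥0∞}
    (hw : Measurable w) {M m n : ℕ} (hM : 0 < M) (hm : 0 < m) (hn : 0 < n) (a l : ℤ) :
    l2c p (fun y => w (parabInv (a / M) M y)) (dil (a / M) M g) m l n =
      ((ENNReal.ofReal ((M : ℝ) ^ 3))⁻¹ * ENNReal.ofReal M ^ p) ^ (2 / p) *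
        l2c p w g (M * m) (a * m + l) n := by
  have hM' : (0 : ℝ) < M := by positivity
  have hw' : Measurable fun y => w (parabInv (a / M) M y) :=
    hw.comp (measurable_parabInv (a / M) M)
  unfold l2c l2p
  rw [Finset.mul_sum]
  refine Finset.sum_congr rfl fun r _ => ?_
  dsimp only
  rw [dil_subPiece g hM hm hn, Np_dil hp.le _ hM' hw' (integrable_subPiece hg _ _ _ _),
    ENNReal.mul_rpow_of_nonneg _ _ (by positivity)]
  simp_rw [parabInv_parab _ hM']

lemma bil_dirac_dil {p : ℝ} (hp : 0 < p) {g : ℝ → ℂ} (hg : Integrable g) {w : ℝ × ℝ → ℝ≥0∞}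
    (hw : Measurable w) {M m n : ℕ} (hM : 0 < M) (hm : 0 < m) (hn : 0 < n) (a l l' : ℤ) :
    bil p (fun y => w (parabInv (a / M) M y)) (Measure.dirac 0) (dil (a / M) M g) m l l' n =
      ((ENNReal.ofReal ((M : ℝ) ^ 3))⁻¹ * ENNReal.ofReal M ^ p) *
        bil p w (Measure.dirac 0) g (M * m) (a * m + l) (a * m + l') n := by
  have hM' : (0 : ℝ) < M := by positivity
  have hw' := hw.comp (measurable_parabInv (a / M) M)
  have hgd := integrable_dil hg (a / M) hM'
  have hms : ∀ l, Measurable (sqf (Measure.dirac 0) (Finset.range n)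
      (subPiece (dil (a / M) M g) m l n)) := fun l =>
    measurable_sqf _ _ (integrable_subPiece hgd m l n)
  have h3 : ENNReal.ofReal ((M : ℝ) ^ 3) ≠ 0 := (ENNReal.ofReal_pos.2 (by positivity)).ne'
  have hs : ∀ l x, sqf (Measure.dirac 0) (Finset.range n) (subPiece (dil (a / M) M g) m l n)
      (parab (a / M) M x) = ENNReal.ofReal M ^ 2 *
        sqf (Measure.dirac 0) (Finset.range n) (subPiece g (M * m) (a * m + l) n) x := by
    intro l x
    unfold sqf
    simp_rw [cv_dirac]
    rw [Finset.mul_sum]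
    refine Finset.sum_congr rfl fun r _ => ?_
    rw [dil_subPiece g hM hm hn, ← mul_pow, ← ofReal_norm, norm_ext_dil _ hM',
      ENNReal.ofReal_mul hM'.le, ofReal_norm]
  have hml := hms l
  have hml' := hms l'
  have h := lintegral_parab (a / M) hM' (f := fun x => w (parabInv (a / M) M x) *
    (sqf (Measure.dirac 0) (Finset.range n) (subPiece (dil (a / M) M g) m l n) x ^ (p / 4) *
    sqf (Measure.dirac 0) (Finset.range n) (subPiece (dil (a / M) M g) m l' n) x ^ (p / 4)))
    (Measurable.mul hw' (by fun_prop))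
  have e : ∀ x, (w (parabInv (a / M) M (parab (a / M) M x)) *
    (sqf (Measure.dirac 0) (Finset.range n) (subPiece (dil (a / M) M g) m l n)
      (parab (a / M) M x) ^ (p / 4) *
    sqf (Measure.dirac 0) (Finset.range n) (subPiece (dil (a / M) M g) m l' n)
      (parab (a / M) M x) ^ (p / 4))) = ENNReal.ofReal M ^ p * (w x *
      (sqf (Measure.dirac 0) (Finset.range n) (subPiece g (M * m) (a * m + l) n) x ^ (p / 4) *
      sqf (Measure.dirac 0) (Finset.range n) (subPiece g (M * m) (a * m + l') n) x ^ (p / 4))) := by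
    intro x
    have hp4 : 0 ≤ p / 4 := by positivity
    rw [parabInv_parab _ hM', hs, hs, ENNReal.mul_rpow_of_nonneg _ _ hp4,
      ENNReal.mul_rpow_of_nonneg _ _ hp4, mul_mul_mul_comm, mul_left_comm (w x),
      ← ENNReal.rpow_natCast, ← ENNReal.rpow_mul,
      ← ENNReal.rpow_add_of_nonneg _ _ (by positivity) (by positivity)]
    congr 2
    push_cast
    ring
  simp_rw [e] at h
  rw [lintegral_const_mul' _ _ (by finiteness)] at h
  unfold bil
  rw [mul_assoc, h, ← mul_assoc, ENNReal.inv_mul_cancel h3 ENNReal.ofReal_ne_top, one_mul]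

lemma exists_bil_pair (A : ℝ≥0) : ∃ C : ℝ≥0, 1 ≤ C ∧ ∀ p : ℝ, 4 < p → p < 6 →
    ∀ (N m M : ℕ), 0 < m → 0 < M → ∀ e : ℕ → ℕ, e 0 = 0 → Monotone e →
    (∀ i ≤ N, e (i + 1) ≤ 2 * e i + 1) → ∀ g : ℝ → ℂ, Integrable g → ∀ a c c' : ℤ, 0 ≤ a → a ≤ M →
    a * m ≤ c → c + 1 < c' → c' < (a + 2) * m →
    ∀ w : ℝ × ℝ → ℝ≥0∞, Measurable w → Slow A ((M * (m * m ^ e N) : ℕ) ^ 2) w → ∀ D : ℕ → ℝ≥0∞,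
    (∀ i ≤ N, l2c p w g (M * m) c (m ^ e i) ≤ D i ^ 2 * l2c p w g (M * m) c (m ^ e (N + 1))) →
    (∀ i ≤ N, l2c p w g (M * m) c' (m ^ e i) ≤ D i ^ 2 * l2c p w g (M * m) c' (m ^ e (N + 1))) →
    bil p w (Measure.dirac 0) g (M * m) c c' 1 ≤
      (∏ i ∈ Finset.range (N + 1), (C * m * D i ^ (p * ((p - 4) / (p - 2)))) ^ ((2 / (p - 2)) ^ i)) *
      (C * (l2c p w g (M * m) c (m ^ e (N + 1)) ^ (p / 4) *
        l2c p w g (M * m) c' (m ^ e (N + 1)) ^ (p / 4))) := by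
  obtain ⟨C, hC1, hC⟩ := exists_bil_iter (A * 5 ^ 100)
  refine ⟨C, hC1, fun p hp hp' N m M hm hM e he0 hmono he g hg a c c' ha haM hc hcc hc' w hw hsl D hD
    hD' => ?_⟩
  have hp0 : 0 < p := by linarith
  have hM' : (0 : ℝ) < M := by positivity
  have hM1 : (1 : ℝ) ≤ M := by exact_mod_cast hM
  obtain ⟨l, rfl⟩ : ∃ l, c = a * m + l := ⟨c - a * m, by ring⟩
  obtain ⟨l', rfl⟩ : ∃ l', c' = a * m + l' := ⟨c' - a * m, by ring⟩
  have haM : |(a : ℝ) / M| ≤ 2 := by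
    have h0 : (0 : ℝ) ≤ a := by exact_mod_cast ha
    have h1 : (a : ℝ) ≤ M := by exact_mod_cast haM
    rw [abs_of_nonneg (by positivity), div_le_iff₀ hM']
    linarith
  have hsl' := hsl.comp_parabInv (by positivity) haM hM1
  rw [show ((M * (m * m ^ e N) : ℕ) : ℝ) ^ 2 / (M : ℝ) ^ 2 = (m * m ^ e N : ℕ) ^ 2 by
    push_cast; field_simp] at hsl'
  set κ := (ENNReal.ofReal ((M : ℝ) ^ 3))⁻¹ * ENNReal.ofReal M ^ p with hκ
  have hκ0 : κ ≠ 0 := by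
    rw [hκ]
    refine mul_ne_zero (by simp) ?_
    exact (ENNReal.rpow_pos (by simpa using hM') (by simp)).ne'
  have hκt : κ ≠ ⊤ := by
    rw [hκ]
    refine ENNReal.mul_ne_top ?_ (by finiteness)
    rw [ENNReal.inv_ne_top]
    exact (ENNReal.ofReal_pos.2 (by positivity)).ne'
  have hl2 : ∀ l i, l2c p (fun y => w (parabInv (a / M) M y)) (dil (a / M) M g) m l (m ^ e i) =
      κ ^ (2 / p) * l2c p w g (M * m) (a * m + l) (m ^ e i) := fun l i =>
    l2c_dil hp0 hg hw hM hm (by positivity) a l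
  have h := hC p hp hp' N m hm e he0 hmono he (dil (a / M) M g) (integrable_dil hg _ hM') l l'
    (by linarith) (by linarith) (by linarith) _ (hw.comp (measurable_parabInv (a / M) M)) hsl' D
    (fun i hi => by
      have := mul_le_mul' (le_refl (κ ^ (2 / p))) (hD i hi)
      rw [mul_left_comm, ← hl2, ← hl2] at this
      exact this)
    (fun i hi => by
      have := mul_le_mul' (le_refl (κ ^ (2 / p))) (hD' i hi)
      rw [mul_left_comm, ← hl2, ← hl2] at this
      exact this)
  have hb := bil_dirac_dil hp0 hg hw hM hm one_pos a l l'
  change bil p (fun y => w (parabInv (a / M) M y)) _ _ _ _ _ _ ≤ _ * (_ *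
    (l2c p (fun y => w (parabInv (a / M) M y)) _ _ _ _ ^ _ *
      l2c p (fun y => w (parabInv (a / M) M y)) _ _ _ _ ^ _)) at h
  rw [hb, hl2, hl2, ENNReal.mul_rpow_of_nonneg _ _ (by positivity : 0 ≤ p / 4),
    ENNReal.mul_rpow_of_nonneg _ _ (by positivity : 0 ≤ p / 4), mul_mul_mul_comm, ← hκ,
    ← ENNReal.rpow_mul, ← ENNReal.rpow_add_of_nonneg _ _ (by positivity) (by positivity),
    show 2 / p * (p / 4) + 2 / p * (p / 4) = 1 by field_simp; norm_num, ENNReal.rpow_one,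
    mul_left_comm _ κ, mul_left_comm _ κ, ENNReal.mul_le_mul_iff_right hκ0 hκt] at h
  exact h

lemma piece_apply (g : ℝ → ℂ) {M : ℝ} (hM : 0 < M) (l : ℤ) (ξ : ℝ) :
    piece g M l ξ = if ⌊ξ * M⌋ = l then g ξ else 0 := by
  rw [piece, Set.indicator_apply]
  congr 1
  rw [Set.mem_Ico, div_le_iff₀ hM, lt_div_iff₀ hM, ← Int.floor_eq_iff]

lemma floor_mul_natCast_ediv (ξ : ℝ) {n : ℕ} (hn : 0 < n) : ⌊ξ * n⌋ / (n : ℤ) = ⌊ξ⌋ := by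
  have hn' : (0 : ℝ) < n := by exact_mod_cast hn
  rw [← Int.floor_div_natCast, mul_div_cancel_right₀ _ hn'.ne']

lemma piece_piece_mul (g : ℝ → ℂ) {M : ℝ} (hM : 0 < M) {n : ℕ} (hn : 0 < n) (t l : ℤ) :
    piece (piece g M t) (M * n) l = if l / n = t then piece g (M * n) l else 0 := by
  have hn' : (0 : ℝ) < n := by exact_mod_cast hn
  funext ξ
  have h := floor_mul_natCast_ediv (ξ * M) hn
  rw [mul_assoc] at h
  rw [piece_apply _ (by positivity), piece_apply _ hM, ← h]
  split_ifs with h1 h2 h3 h3 <;> simp_all [piece_apply _ (by positivity : 0 < M * n)]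

lemma piece_mul_piece (g : ℝ → ℂ) {M : ℝ} (hM : 0 < M) {n : ℕ} (hn : 0 < n) (l : ℤ) :
    piece (piece g (M * n) l) M (l / n) = piece g (M * n) l := by
  have hn' : (0 : ℝ) < n := by exact_mod_cast hn
  funext ξ
  rw [piece_apply _ hM, piece_apply _ (by positivity), ← floor_mul_natCast_ediv (ξ * M) hn, mul_assoc]
  split_ifs with h1 h2 <;> simp_all

lemma exists_decoupling_subcell (A : ℝ≥0) : ∃ C : ℝ≥0, 1 ≤ C ∧ ∀ p : ℝ, 4 < p → p < 6 →
    ∀ b k q : ℕ, 0 < b → 0 < k → 0 < q → ∀ t : ℤ, 0 ≤ t → t < b * k → ∀ g : ℝ → ℂ, Integrable g →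
    ∀ w : ℝ × ℝ → ℝ≥0∞, Measurable w → Slow A ((b * k * q : ℕ) ^ 2) w →
    Np p w (ext (piece g (b * k : ℕ) t)) ≤ (C * ENNReal.ofReal (Dconst p (k * q))) ^ p *
      l2p p w (Finset.range q) (fun s => ext (piece g (b * k * q : ℕ) (t * q + s))) ^ (p / 2) := by
  obtain ⟨C, hC⟩ := exists_decoupling_cell A
  refine ⟨max C 1, le_max_right _ _, fun p hp hp' b k q hb hk hq t ht ht' g hg w hw hsl => ?_⟩
  have hb' : (0 : ℝ) < b := by exact_mod_cast hb
  have hk' : (0 : ℝ) < k := by exact_mod_cast hk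
  have hq' : (0 : ℝ) < q := by exact_mod_cast hq
  have hkz : (0 : ℤ) < k := by exact_mod_cast hk
  have hqz : (0 : ℤ) < q := by exact_mod_cast hq
  have h0 : 0 ≤ t / k := Int.ediv_nonneg ht hkz.le
  have h1 : t / k < b := Int.ediv_lt_of_lt_mul hkz ht'
  have h := hC p hp hp' (k * q) (by positivity) b (by exact_mod_cast hb) (t / k) (by
      have h0' : (0 : ℝ) ≤ (t / k : ℤ) := by exact_mod_cast h0
      have h1' : ((t / k : ℤ) : ℝ) < b := by exact_mod_cast h1
      rw [abs_of_nonneg (by positivity), div_le_iff₀ hb']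
      linarith) (piece g (b * k) t) (integrable_piece hg _ _) w hw
      (by convert hsl using 2; push_cast; ring)
  rw [piece_mul_piece g hb' hk] at h
  push_cast at h ⊢
  refine h.trans ?_
  have hs : l2p p w (Finset.range (k * q)) (fun j => ext (piece (piece g (b * k) t) (b * (k * q))
      (t / k * (k * q) + j))) = l2p p w (Finset.range q) (fun s => ext (piece g (b * k * q)
      (t * q + s))) := by
    unfold l2p
    rw [sum_range_mul, Finset.sum_eq_single (t % k).toNat]
    · refine Finset.sum_congr rfl fun s hs => ?_
      have hm : ((t % k).toNat : ℤ) = t % k := Int.toNat_of_nonneg (Int.emod_nonneg _ hkz.ne')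
      have hs' : (s : ℤ) < q := by exact_mod_cast Finset.mem_range.1 hs
      have e : t / k * (k * q) + (((t % k).toNat * q + s : ℕ) : ℤ) = t * q + s := by
        push_cast
        rw [hm]
        linear_combination (q : ℤ) * Int.mul_ediv_add_emod t k
      dsimp only
      rw [e, ← mul_assoc, piece_piece_mul _ (by positivity) hq, if_pos]
      rw [mul_comm t, Int.add_comm, Int.add_mul_ediv_left _ _ hqz.ne',
        Int.ediv_eq_zero_of_lt (by positivity) hs', zero_add]
    · intro v _ hv
      refine Finset.sum_eq_zero fun s hs => ?_
      have hs' : (s : ℤ) < q := by exact_mod_cast Finset.mem_range.1 hs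
      dsimp only
      rw [← mul_assoc, piece_piece_mul _ (by positivity) hq, if_neg, ext_zero,
        Np_zero (by linarith), ENNReal.zero_rpow_of_pos (by positivity)]
      intro hc
      apply hv
      have e : t / k * (k * q) + ((v * q + s : ℕ) : ℤ) = s + q * (t / k * k + v) := by
        push_cast; ring
      rw [e, Int.add_mul_ediv_left _ _ hqz.ne', Int.ediv_eq_zero_of_lt (by positivity) hs',
        zero_add] at hc
      have := Int.mul_ediv_add_emod t k
      have hm : t % k = v := by linarith
      rw [hm, Int.toNat_natCast]
    · intro hv
      exfalso
      apply hv
      have := Int.emod_lt_of_pos t hkz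
      have := Int.emod_nonneg t hkz.ne'
      rw [Finset.mem_range]
      omega
  rw [hs]
  gcongr
  exact_mod_cast le_max_left _ _

lemma rpow_mul_rpow_half {p : ℝ} (hp : 0 < p) (a b : ℝ≥0∞) :
    (a ^ p * b ^ (p / 2)) ^ (2 / p) = a ^ 2 * b := by
  rw [ENNReal.mul_rpow_of_nonneg _ _ (by positivity), ← ENNReal.rpow_mul, ← ENNReal.rpow_mul,
    show p * (2 / p) = (2 : ℕ) by field_simp; norm_num, show p / 2 * (2 / p) = 1 by field_simp,
    ENNReal.rpow_natCast, ENNReal.rpow_one]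

/-- Decoupling of the pieces of one cell, in `ℓ²` form. -/
lemma exists_l2c_le (A : ℝ≥0) : ∃ C : ℝ≥0, 1 ≤ C ∧ ∀ p : ℝ, 4 < p → p < 6 →
    ∀ b k q M n : ℕ, 0 < b → 0 < k → 0 < q → 0 < n → M * n = b * k → ∀ c : ℤ, 0 ≤ c → c < M →
    ∀ g : ℝ → ℂ, Integrable g →
    ∀ w : ℝ × ℝ → ℝ≥0∞, Measurable w → Slow A ((b * k * q : ℕ) ^ 2) w →
    l2c p w g M c n ≤ (C * ENNReal.ofReal (Dconst p (k * q))) ^ 2 * l2c p w g M c (n * q) := by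
  obtain ⟨C, hC1, hC⟩ := exists_decoupling_subcell A
  refine ⟨C, hC1, fun p hp hp' b k q M n hb hk hq hn hMn c hc hcM g hg w hw hsl => ?_⟩
  unfold l2c l2p
  rw [sum_range_mul, Finset.mul_sum]
  refine Finset.sum_le_sum fun r hr => ?_
  have hr' : (r : ℤ) < n := by exact_mod_cast Finset.mem_range.1 hr
  have hz : (b * k : ℤ) = M * n := by exact_mod_cast hMn.symm
  have h := hC p hp hp' b k q hb hk hq (c * n + r) (by positivity) (by rw [hz]; nlinarith) g hg w hw
    hsl
  have h2 := ENNReal.rpow_le_rpow h (show 0 ≤ 2 / p by positivity)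
  rw [rpow_mul_rpow_half (by linarith)] at h2
  rw [← hMn] at h2
  refine h2.trans_eq ?_
  have e : ∀ s : ℕ, piece g (M * n * q : ℕ) ((c * n + r) * q + s) = subPiece g M c (n * q) (r * q + s) := by
    intro s
    unfold subPiece
    rw [mul_assoc M n q]
    congr 1
    push_cast
    ring
  simp_rw [e]
  rfl

/-- Cells with these indices are equal or neighbours. -/
def Adj (l l' : ℕ) : Prop := l ≤ l' + 1 ∧ l' ≤ l + 1

instance (l l' : ℕ) : Decidable (Adj l l') := inferInstanceAs (Decidable (_ ∧ _))

lemma Adj.symm {l l' : ℕ} (h : Adj l l') : Adj l' l := ⟨h.2, h.1⟩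

lemma Adj.div {l l' : ℕ} (h : Adj l l') {m : ℕ} (hm : 0 < m) : Adj (l / m) (l' / m) := by
  have key : ∀ {a b : ℕ}, a ≤ b + 1 → a / m ≤ b / m + 1 := fun {a b} h => by
    rw [← Nat.add_div_right _ hm]
    exact Nat.div_le_div_right (by omega)
  exact ⟨key h.1, key h.2⟩

/-- Sum over the neighbouring pairs of cells. -/
lemma sum_adj_refine {f F : ℕ → ℂ} {m : ℕ} (hm : 0 < m) (n : ℕ)
    (hF : ∀ l, f l = ∑ r ∈ Finset.range m, F (l * m + r)) :
    (∑ l ∈ Finset.range n, ∑ l' ∈ Finset.range n, if Adj l l' then f l * f l' else 0) =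
      (∑ c ∈ Finset.range (n * m), ∑ c' ∈ Finset.range (n * m),
        if Adj c c' then F c * F c' else 0) +
      ∑ c ∈ Finset.range (n * m), ∑ c' ∈ Finset.range (n * m),
        if Adj (c / m) (c' / m) ∧ ¬ Adj c c' then F c * F c' else 0 := by
  have hs : ∀ c c', ((if Adj c c' then F c * F c' else 0) +
      if Adj (c / m) (c' / m) ∧ ¬ Adj c c' then F c * F c' else 0) =
      if Adj (c / m) (c' / m) then F c * F c' else 0 := by
    intro c c'
    have := fun h : Adj c c' => h.div hm
    by_cases h : Adj c c'
    · simp [h, this h]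
    · simp [h]
  simp_rw [← Finset.sum_add_distrib, hs]
  rw [sum_range_mul]
  refine Finset.sum_congr rfl fun l _ => ?_
  rw [Finset.sum_comm]
  rw [sum_range_mul]
  refine Finset.sum_congr rfl fun l' _ => ?_
  have hd : ∀ a, ∀ r ∈ Finset.range m, (a * m + r) / m = a := by
    intro a r hr
    rw [mul_comm, Nat.mul_add_div hm, Nat.div_eq_of_lt (Finset.mem_range.1 hr), add_zero]
  rw [Finset.sum_congr rfl fun r' hr' => Finset.sum_congr rfl fun r hr => by
    rw [hd l r hr, hd l' r' hr']]
  split_ifs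
  · rw [hF, hF, Finset.sum_mul_sum, Finset.sum_comm]
  · simp

lemma sq_eq_whitney {F : ℕ → ℕ → ℂ} {m : ℕ} (hm : 0 < m)
    (hF : ∀ k l, F k l = ∑ r ∈ Finset.range m, F (k + 1) (l * m + r)) (K : ℕ) :
    F 0 0 ^ 2 = (∑ l ∈ Finset.range (m ^ K), ∑ l' ∈ Finset.range (m ^ K),
        if Adj l l' then F K l * F K l' else 0) +
      ∑ k ∈ Finset.range K, ∑ c ∈ Finset.range (m ^ (k + 1)), ∑ c' ∈ Finset.range (m ^ (k + 1)),
        if Adj (c / m) (c' / m) ∧ ¬ Adj c c' then F (k + 1) c * F (k + 1) c' else 0 := by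
  induction K with
  | zero => simp [Adj, sq]
  | succ K ih =>
    rw [ih, sum_adj_refine hm _ (hF K), Finset.sum_range_succ, pow_succ]
    ring

lemma card_adj_le {m : ℕ} (hm : 0 < m) (n c : ℕ) :
    ((Finset.range n).filter fun c' => Adj (c / m) (c' / m)).card ≤ 3 * m := by
  refine (Finset.card_le_card (t := Finset.Ico ((c / m - 1) * m) ((c / m - 1) * m + 3 * m))
    fun c' hc' => ?_).trans (by simp)
  obtain ⟨h1, h2⟩ := (Finset.mem_filter.1 hc').2
  rw [Finset.mem_Ico, ← add_mul]
  exact ⟨(Nat.mul_le_mul_right m (Nat.sub_le_iff_le_add.2 h1)).trans (Nat.div_mul_le_self c' m),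
    (Nat.div_lt_iff_lt_mul hm).1 (by omega)⟩

lemma sum_adj_le {m : ℕ} (hm : 0 < m) (n : ℕ) (a : ℕ → ℝ≥0∞) :
    (∑ c ∈ Finset.range n, ∑ c' ∈ Finset.range n,
      if Adj (c / m) (c' / m) then a c + a c' else 0) ≤ 6 * m * ∑ c ∈ Finset.range n, a c := by
  have h : (∑ c ∈ Finset.range n, ∑ c' ∈ Finset.range n,
      if Adj (c / m) (c' / m) then a c else 0) ≤ 3 * m * ∑ c ∈ Finset.range n, a c := by
    rw [Finset.mul_sum]
    refine Finset.sum_le_sum fun c _ => ?_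
    rw [← Finset.sum_filter, Finset.sum_const, nsmul_eq_mul]
    gcongr
    exact_mod_cast card_adj_le hm n c
  have h' := h
  rw [Finset.sum_comm] at h'
  have e : ∀ c c', (if Adj (c / m) (c' / m) then a c + a c' else 0) =
      (if Adj (c / m) (c' / m) then a c else 0) + if Adj (c' / m) (c / m) then a c' else 0 := by
    intro c c'
    have : Adj (c' / m) (c / m) ↔ Adj (c / m) (c' / m) := ⟨Adj.symm, Adj.symm⟩
    simp only [this]
    split_ifs <;> simp
  simp_rw [e, Finset.sum_add_distrib]
  exact (add_le_add h h').trans_eq (by ring)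

/-- The weighted `L^q` norm of a nonnegative function. -/
noncomputable def nrm (q : ℝ) (w f : ℝ × ℝ → ℝ≥0∞) : ℝ≥0∞ := (∫⁻ x, f x ^ q * w x) ^ (1 / q)

lemma nrm_mono {q : ℝ} (hq : 0 < q) (w : ℝ × ℝ → ℝ≥0∞) {f f' : ℝ × ℝ → ℝ≥0∞} (h : ∀ x, f x ≤ f' x) :
    nrm q w f ≤ nrm q w f' :=
  ENNReal.rpow_le_rpow (lintegral_mono fun x => mul_le_mul' (ENNReal.rpow_le_rpow (h x) hq.le) le_rfl)
    (by positivity)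

lemma nrm_sum_le {q : ℝ} (hq : 1 ≤ q) {w : ℝ × ℝ → ℝ≥0∞} (hw : Measurable w) {ι : Type*}
    (s : Finset ι) {f : ι → ℝ × ℝ → ℝ≥0∞} (hf : ∀ i ∈ s, Measurable (f i)) :
    nrm q w (fun x => ∑ i ∈ s, f i x) ≤ ∑ i ∈ s, nrm q w (f i) := by
  have hq0 : 0 < q := by linarith
  have h := ENNReal.rpow_le_rpow (lintegral_sum_rpow_le' (μ := volume) hq s
    (f := fun i x => f i x * w x ^ (1 / q)) fun i hi =>
      ((hf i hi).mul (hw.pow_const _)).aemeasurable) (show 0 ≤ 1 / q by positivity)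
  have e : ∀ a b : ℝ≥0∞, (a * b ^ (1 / q)) ^ q = a ^ q * b := fun a b => by
    rw [ENNReal.mul_rpow_of_nonneg _ _ hq0.le, ← ENNReal.rpow_mul, one_div_mul_cancel hq0.ne',
      ENNReal.rpow_one]
  simp_rw [← Finset.sum_mul, e] at h
  rwa [← ENNReal.rpow_mul, mul_one_div_cancel hq0.ne', ENNReal.rpow_one] at h

lemma nrm_add_le {q : ℝ} (hq : 1 ≤ q) {w : ℝ × ℝ → ℝ≥0∞} (hw : Measurable w)
    {f f' : ℝ × ℝ → ℝ≥0∞} (hf : Measurable f) (hf' : Measurable f') :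
    nrm q w (fun x => f x + f' x) ≤ nrm q w f + nrm q w f' := by
  have h := nrm_sum_le hq hw (Finset.univ : Finset Bool) (f := fun b => cond b f f')
    (fun b _ => by cases b <;> assumption)
  simpa using h

lemma nrm_sq {p : ℝ} (w : ℝ × ℝ → ℝ≥0∞) (f : ℝ × ℝ → ℂ) :
    nrm (p / 2) w (fun x => ‖f x‖ₑ ^ 2) = Np p w f ^ (2 / p) := by
  unfold nrm Np
  rw [one_div_div]
  congr 1
  refine lintegral_congr fun x => ?_
  dsimp only
  rw [← ENNReal.rpow_natCast, ← ENNReal.rpow_mul]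
  congr 2
  push_cast
  ring

lemma bil_dirac_one {p : ℝ} (w : ℝ × ℝ → ℝ≥0∞) (g : ℝ → ℂ) (m : ℕ) (l l' : ℤ) :
    bil p w (Measure.dirac 0) g m l l' 1 ^ (2 / p) =
      nrm (p / 2) w (fun x => ‖ext (piece g m l) x‖ₑ * ‖ext (piece g m l') x‖ₑ) := by
  unfold bil nrm
  rw [one_div_div]
  congr 1
  refine lintegral_congr fun x => ?_
  have h : ∀ l, sqf (Measure.dirac 0) (Finset.range 1) (subPiece g m l 1) x =
      ‖ext (piece g m l) x‖ₑ ^ 2 := by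
    intro l
    simp [sqf, cv_dirac, subPiece]
  dsimp only
  rw [h, h, mul_comm, ← ENNReal.mul_rpow_of_ne_top (by finiteness) (by finiteness), ← mul_pow,
    ← ENNReal.rpow_natCast, ← ENNReal.rpow_mul]
  congr 2
  push_cast
  ring

lemma rpow_mul_rpow_le_add {p : ℝ} (hp : 2 ≤ p) {C : ℝ≥0} (hC : 1 ≤ C) (a b : ℝ≥0∞) :
    (C * (a ^ (p / 4) * b ^ (p / 4))) ^ (2 / p) ≤ C * (a + b) := by
  have hp0 : 0 < p := by linarith
  have hC' : (1 : ℝ≥0∞) ≤ C := by exact_mod_cast hC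
  rw [ENNReal.mul_rpow_of_nonneg _ _ (by positivity), ENNReal.mul_rpow_of_nonneg _ _ (by positivity),
    ← ENNReal.rpow_mul, ← ENNReal.rpow_mul, show p / 4 * (2 / p) = 1 / 2 by field_simp; norm_num]
  refine mul_le_mul' ?_ ?_
  · calc (C : ℝ≥0∞) ^ (2 / p) ≤ C ^ (1 : ℝ) :=
          ENNReal.rpow_le_rpow_of_exponent_le hC' ((div_le_one hp0).2 hp)
      _ = C := ENNReal.rpow_one _
  · calc a ^ (1 / 2 : ℝ) * b ^ (1 / 2 : ℝ) ≤ (a + b) ^ (1 / 2 : ℝ) * (a + b) ^ (1 / 2 : ℝ) := by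
          gcongr
          · exact le_self_add
          · exact le_add_self
      _ = a + b := by
          rw [← ENNReal.rpow_add_of_nonneg _ _ (by norm_num) (by norm_num)]
          norm_num

/-- The exponents of the successive scales in the bilinear iteration. -/
lemma scale_exponents {N k : ℕ} (hk : k < 2 ^ N) : ∃ e : ℕ → ℕ, e 0 = 0 ∧ Monotone e ∧
    (∀ i ≤ N, e (i + 1) ≤ 2 * e i + 1) ∧ (∀ i ≤ N, e i + 1 = 2 ^ i) ∧
    e (N + 1) + (k + 1) = 2 ^ (N + 1) := by
  have hN : 2 ^ (N + 1) = 2 * 2 ^ N := pow_succ' _ _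
  have hpos : ∀ i : ℕ, 0 < 2 ^ i := fun i => by positivity
  refine ⟨fun i => if i ≤ N then 2 ^ i - 1 else 2 ^ (N + 1) - (k + 1), by simp, ?_, ?_, ?_, ?_⟩
  · refine monotone_nat_of_le_succ fun i => ?_
    have h1 : 2 ^ (i + 1) = 2 * 2 ^ i := pow_succ' _ _
    have h2 := hpos i
    rcases lt_trichotomy i N with h | rfl | h
    · simp only [h.le, Nat.succ_le_of_lt h, if_true]
      omega
    · simp
      omega
    · simp [h.not_ge, (h.trans (Nat.lt_succ_self i)).not_ge]
  · intro i hi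
    have h1 : 2 ^ (i + 1) = 2 * 2 ^ i := pow_succ' _ _
    have h2 := hpos i
    rcases hi.lt_or_eq with h | rfl
    · simp only [h.le, Nat.succ_le_of_lt h, if_true]
      omega
    · simp
      omega
  · intro i hi
    have h2 := hpos i
    simp only [hi, if_true]
    omega
  · simp
    omega

/-- Bilinear estimate for a separated pair of cells with neighbouring parents. -/
lemma exists_separated_le (A : ℝ≥0) : ∃ C : ℝ≥0, 1 ≤ C ∧ ∀ p : ℝ, 4 < p → p < 6 →
    ∀ N m k : ℕ, 0 < m → k < 2 ^ N → ∀ g : ℝ → ℂ, Integrable g →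
    ∀ w : ℝ × ℝ → ℝ≥0∞, Measurable w → Slow A ((m ^ 2 ^ (N + 1) : ℕ) ^ 2) w →
    ∀ c c' : ℕ, c < m ^ (k + 1) → c' < m ^ (k + 1) → Adj (c / m) (c' / m) → ¬ Adj c c' →
    nrm (p / 2) w (fun x => ‖ext (piece g (m ^ (k + 1) : ℕ) c) x‖ₑ *
        ‖ext (piece g (m ^ (k + 1) : ℕ) c') x‖ₑ) ≤
      (∏ i ∈ Finset.range (N + 1), (C * m * (C * ENNReal.ofReal
        (Dconst p (m ^ (2 ^ (N + 1) - 2 ^ i)))) ^ (p * ((p - 4) / (p - 2)))) ^ ((2 / (p - 2)) ^ i))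
          ^ (2 / p) *
      (C * (l2c p w g (m ^ (k + 1)) c (m ^ (2 ^ (N + 1) - (k + 1))) +
        l2c p w g (m ^ (k + 1)) c' (m ^ (2 ^ (N + 1) - (k + 1))))) := by
  obtain ⟨C₁, hC₁1, hC₁⟩ := exists_bil_pair A
  obtain ⟨C₂, hC₂1, hC₂⟩ := exists_l2c_le A
  refine ⟨max C₁ C₂, le_max_of_le_left hC₁1, fun p hp hp' N m k hm hk g hg w hw hsl c c' hc hc' had
    hnad => ?_⟩
  have hp0 : 0 < p := by linarith
  have hp2 : 0 < p - 2 := by linarith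
  have hp4 : 0 < p - 4 := by linarith
  wlog hcc : c < c' generalizing c c'
  · have h := this c' c hc' hc had.symm (fun h => hnad h.symm)
      (by unfold Adj at hnad; omega)
    rw [add_comm (l2c p w g (m ^ (k + 1)) c _)]
    simpa only [mul_comm ‖ext (piece g (m ^ (k + 1) : ℕ) c') _‖ₑ] using h
  have hcc' : c + 1 < c' := by unfold Adj at hnad; omega
  obtain ⟨e, he0, hmono, he, heN, heL⟩ := scale_exponents hk
  have heL' : 2 ^ (N + 1) - (k + 1) = e (N + 1) := by omega
  have hL : 2 ^ (N + 1) = 2 * 2 ^ N := pow_succ' _ _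
  have hl2 : ∀ c : ℕ, c < m ^ (k + 1) → ∀ i ≤ N, l2c p w g (m ^ k * m) c (m ^ e i) ≤
      (C₂ * ENNReal.ofReal (Dconst p (m ^ (2 ^ (N + 1) - 2 ^ i)))) ^ 2 *
        l2c p w g (m ^ k * m) c (m ^ e (N + 1)) := by
    intro c hc i hi
    have hi2 : 2 ^ i ≤ 2 ^ N := Nat.pow_le_pow_right (by norm_num) hi
    have h1 := heN i hi
    have h := hC₂ p hp hp' (m ^ 2 ^ i) (m ^ k) (m ^ (2 ^ (N + 1) - k - 2 ^ i)) (m ^ k * m) (m ^ e i)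
      (by positivity) (by positivity) (by positivity) (by positivity)
      (by rw [← h1, pow_succ]; ring) c (by positivity) (by rw [← pow_succ]; exact_mod_cast hc) g hg w hw
      (by rw [← pow_add, ← pow_add, show 2 ^ i + k + (2 ^ (N + 1) - k - 2 ^ i) = 2 ^ (N + 1) by omega]
          exact hsl)
    rwa [← pow_add, ← pow_add, show k + (2 ^ (N + 1) - k - 2 ^ i) = 2 ^ (N + 1) - 2 ^ i by omega,
      show e i + (2 ^ (N + 1) - k - 2 ^ i) = e (N + 1) by omega] at h
  have h := hC₁ p hp hp' N m (m ^ k) hm (by positivity) e he0 hmono he g hg (c / m : ℕ) c c'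
    (by positivity)
    (by
      have : c / m < m ^ k := Nat.div_lt_of_lt_mul (by rwa [mul_comm, ← pow_succ])
      exact_mod_cast this.le)
    (by exact_mod_cast Nat.div_mul_le_self c m) (by exact_mod_cast hcc')
    (by
      have h1 := had.2
      have : c' < (c / m + 2) * m := (Nat.div_lt_iff_lt_mul hm).1 (by omega)
      exact_mod_cast this)
    w hw
    (hsl.mono (by positivity) (by
      have h1 := heN N le_rfl
      have : m ^ k * (m * m ^ e N) ≤ m ^ 2 ^ (N + 1) := by
        rw [← pow_succ', ← pow_add]
        exact Nat.pow_le_pow_right hm (by omega)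
      have h2 : ((m ^ k * (m * m ^ e N) : ℕ) : ℝ) ≤ (m ^ 2 ^ (N + 1) : ℕ) := by exact_mod_cast this
      gcongr))
    (fun i => C₂ * ENNReal.ofReal (Dconst p (m ^ (2 ^ (N + 1) - 2 ^ i)))) (hl2 c hc) (hl2 c' hc')
  have h2 := ENNReal.rpow_le_rpow h (show 0 ≤ 2 / p by positivity)
  rw [bil_dirac_one, ENNReal.mul_rpow_of_nonneg _ _ (by positivity)] at h2
  rw [heL', pow_succ m k]
  refine h2.trans (mul_le_mul' ?_ ((rpow_mul_rpow_le_add (by linarith) hC₁1 _ _).trans ?_))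
  · gcongr
    · exact_mod_cast le_max_left _ _
    · exact_mod_cast le_max_right _ _
  · gcongr
    exact_mod_cast le_max_left _ _

lemma nrm_sum_pairs_le {q : ℝ} (hq : 1 ≤ q) {w : ℝ × ℝ → ℝ≥0∞} (hw : Measurable w) (n : ℕ)
    (R : ℕ → ℕ → Prop) [∀ c c', Decidable (R c c')] {f : ℕ → ℝ × ℝ → ℝ≥0∞}
    (hf : ∀ c, Measurable (f c)) :
    nrm q w (fun x => ∑ c ∈ Finset.range n, ∑ c' ∈ Finset.range n,
      if R c c' then f c x * f c' x else 0) ≤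
    ∑ c ∈ Finset.range n, ∑ c' ∈ Finset.range n,
      if R c c' then nrm q w (fun x => f c x * f c' x) else 0 := by
  have hm : ∀ c c', Measurable fun x => if R c c' then f c x * f c' x else 0 := fun c c' => by
    have := hf c
    have := hf c'
    split_ifs <;> fun_prop
  refine (nrm_sum_le hq hw _ fun c _ => Finset.measurable_fun_sum _ fun c' _ => hm c c').trans
    (Finset.sum_le_sum fun c _ => (nrm_sum_le hq hw _ fun c' _ => hm c c').trans
      (Finset.sum_le_sum fun c' _ => ?_))
  have hq0 : 0 < q := by linarith
  split_ifs
  · exact le_rfl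
  · simp [nrm, ENNReal.zero_rpow_of_pos hq0, ENNReal.zero_rpow_of_pos (inv_pos.2 hq0)]

lemma mul_le_sq_add_sq (a b : ℝ≥0∞) : a * b ≤ a ^ 2 + b ^ 2 := by
  rcases le_total a b with h | h
  · exact (mul_le_mul' h le_rfl).trans ((sq b).symm.le.trans le_add_self)
  · exact (mul_le_mul' le_rfl h).trans ((sq a).symm.le.trans le_self_add)

lemma l2c_one (p : ℝ) (w : ℝ × ℝ → ℝ≥0∞) (g : ℝ → ℂ) (n : ℕ) :
    l2c p w g 1 0 n = l2p p w (Finset.range n) fun k => ext (piece g n k) := by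
  simp [l2c, subPiece]

lemma sum_l2c (p : ℝ) (w : ℝ × ℝ → ℝ≥0∞) (g : ℝ → ℂ) (m n : ℕ) :
    ∑ c ∈ Finset.range m, l2c p w g m c n =
      l2p p w (Finset.range (m * n)) fun k => ext (piece g (m * n : ℕ) k) := by
  unfold l2c l2p subPiece
  rw [sum_range_mul]
  push_cast
  rfl

/-- Combination of the bilinear estimates over all scales. -/
lemma exists_whitney_le (A : ℝ≥0) : ∃ C : ℝ≥0, 1 ≤ C ∧ ∀ p : ℝ, 4 < p → p < 6 →
    ∀ N m : ℕ, 0 < m → ∀ g : ℝ → ℂ, Integrable g →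
    ∀ w : ℝ × ℝ → ℝ≥0∞, Measurable w → Slow A ((m ^ 2 ^ (N + 1) : ℕ) ^ 2) w →
    Np p w (ext (piece g 1 0)) ^ (2 / p) ≤
      (6 * (C * ENNReal.ofReal (Dconst p (m ^ (2 ^ (N + 1) - 2 ^ N)))) ^ 2 + 2 ^ N * ((∏ i ∈
        Finset.range (N + 1), (C * m * (C * ENNReal.ofReal (Dconst p (m ^ (2 ^ (N + 1) - 2 ^ i)))) ^
          (p * ((p - 4) / (p - 2)))) ^ ((2 / (p - 2)) ^ i)) ^ (2 / p) * (C * (6 * m)))) *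
      l2p p w (Finset.range (m ^ 2 ^ (N + 1)))
        (fun k => ext (piece g (m ^ 2 ^ (N + 1) : ℕ) k)) := by
  obtain ⟨C₁, hC₁1, hC₁⟩ := exists_separated_le A
  obtain ⟨C₂, hC₂1, hC₂⟩ := exists_l2c_le A
  refine ⟨max C₁ C₂, le_max_of_le_left hC₁1, fun p hp hp' N m hm g hg w hw hsl => ?_⟩
  have hp0 : 0 < p := by linarith
  have hp2 : 0 < p - 2 := by linarith
  have hp4 : 0 < p - 4 := by linarith
  have hq : 1 ≤ p / 2 := by linarith
  have hL : 2 ^ (N + 1) = 2 * 2 ^ N := pow_succ' _ _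
  have hm' : (0 : ℝ) < m := by exact_mod_cast hm
  set P := l2p p w (Finset.range (m ^ 2 ^ (N + 1)))
    (fun k => ext (piece g (m ^ 2 ^ (N + 1) : ℕ) k)) with hP
  set Y := (∏ i ∈ Finset.range (N + 1), (C₁ * m * (C₁ * ENNReal.ofReal
        (Dconst p (m ^ (2 ^ (N + 1) - 2 ^ i)))) ^ (p * ((p - 4) / (p - 2)))) ^ ((2 / (p - 2)) ^ i))
          ^ (2 / p) with hY
  have hms : ∀ k l, Measurable fun x => ‖ext (piece g (m ^ k : ℕ) (l : ℕ)) x‖ₑ := fun k l =>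
    measurable_enorm_ext (integrable_piece hg _ _)
  have hpt : ∀ x, ‖ext (piece g 1 0) x‖ₑ ^ 2 ≤
      (∑ l ∈ Finset.range (m ^ 2 ^ N), ∑ l' ∈ Finset.range (m ^ 2 ^ N), if Adj l l' then
        ‖ext (piece g (m ^ 2 ^ N : ℕ) (l : ℕ)) x‖ₑ * ‖ext (piece g (m ^ 2 ^ N : ℕ) (l' : ℕ)) x‖ₑ
          else 0) +
      ∑ k ∈ Finset.range (2 ^ N), ∑ c ∈ Finset.range (m ^ (k + 1)),
        ∑ c' ∈ Finset.range (m ^ (k + 1)), if Adj (c / m) (c' / m) ∧ ¬ Adj c c' then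
        ‖ext (piece g (m ^ (k + 1) : ℕ) (c : ℕ)) x‖ₑ * ‖ext (piece g (m ^ (k + 1) : ℕ) (c' : ℕ)) x‖ₑ
          else 0 := by
    intro x
    have hF : ∀ k l, ext (piece g (m ^ k : ℕ) (l : ℕ)) x =
        ∑ r ∈ Finset.range m, ext (piece g (m ^ (k + 1) : ℕ) (l * m + r : ℕ)) x := by
      intro k l
      have h := ext_piece_eq_sum hg (M := (m ^ k : ℕ)) (by positivity) l hm x
      rw [h, pow_succ]
      push_cast
      rfl
    have h := sq_eq_whitney (F := fun k l => ext (piece g (m ^ k : ℕ) (l : ℕ)) x) hm hF (2 ^ N)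
    simp only [pow_zero, Nat.cast_one, Nat.cast_zero] at h
    rw [← enorm_pow, h]
    refine (enorm_add_le _ _).trans (add_le_add ?_ ?_)
    · refine (enorm_sum_le _ _).trans (Finset.sum_le_sum fun l _ => (enorm_sum_le _ _).trans
        (Finset.sum_le_sum fun l' _ => ?_))
      split_ifs
      · rw [enorm_mul]
      · simp
    · refine (enorm_sum_le _ _).trans (Finset.sum_le_sum fun k _ => (enorm_sum_le _ _).trans
        (Finset.sum_le_sum fun l _ => (enorm_sum_le _ _).trans (Finset.sum_le_sum fun l' _ => ?_)))
      split_ifs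
      · rw [enorm_mul]
      · simp
  have hmp : ∀ k (R : ℕ → ℕ → Prop) [∀ c c', Decidable (R c c')], Measurable fun x =>
      ∑ c ∈ Finset.range (m ^ k), ∑ c' ∈ Finset.range (m ^ k), if R c c' then
        ‖ext (piece g (m ^ k : ℕ) (c : ℕ)) x‖ₑ * ‖ext (piece g (m ^ k : ℕ) (c' : ℕ)) x‖ₑ else 0 := by
    intro k R _
    refine Finset.measurable_fun_sum _ fun c _ => Finset.measurable_fun_sum _ fun c' _ => ?_
    have := hms k c
    have := hms k c'
    split_ifs <;> fun_prop
  have hadj : (∑ l ∈ Finset.range (m ^ 2 ^ N), ∑ l' ∈ Finset.range (m ^ 2 ^ N), if Adj l l' then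
      nrm (p / 2) w (fun x => ‖ext (piece g (m ^ 2 ^ N : ℕ) (l : ℕ)) x‖ₑ *
        ‖ext (piece g (m ^ 2 ^ N : ℕ) (l' : ℕ)) x‖ₑ) else 0) ≤
      6 * (C₂ * ENNReal.ofReal (Dconst p (m ^ (2 ^ (N + 1) - 2 ^ N)))) ^ 2 * P := by
    have h := sum_adj_le one_pos (m ^ 2 ^ N)
      (fun l => Np p w (ext (piece g (m ^ 2 ^ N : ℕ) (l : ℕ))) ^ (2 / p))
    simp only [Nat.div_one, Nat.cast_one, mul_one] at h
    refine (Finset.sum_le_sum fun l _ => Finset.sum_le_sum fun l' _ => ?_).trans (h.trans ?_)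
    · split_ifs
      · have := hms (2 ^ N) l
        have := hms (2 ^ N) l'
        rw [← nrm_sq, ← nrm_sq]
        exact (nrm_mono (by positivity) w fun x => mul_le_sq_add_sq _ _).trans
          (nrm_add_le hq hw (by fun_prop) (by fun_prop))
      · exact le_rfl
    · have h2 := hC₂ p hp hp' (m ^ 2 ^ N) 1 (m ^ (2 ^ (N + 1) - 2 ^ N)) 1 (m ^ 2 ^ N)
        (by positivity) one_pos (by positivity) (by positivity) (by ring) 0 le_rfl (by norm_num)
        g hg w hw
        (by rw [mul_one, ← pow_add, show 2 ^ N + (2 ^ (N + 1) - 2 ^ N) = 2 ^ (N + 1) by omega]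
            exact hsl)
      rw [one_mul, ← pow_add, show 2 ^ N + (2 ^ (N + 1) - 2 ^ N) = 2 ^ (N + 1) by omega, l2c_one,
        l2c_one, ← hP] at h2
      rw [mul_assoc]
      exact mul_le_mul' le_rfl h2
  have hsep : ∀ k ∈ Finset.range (2 ^ N), (∑ c ∈ Finset.range (m ^ (k + 1)),
      ∑ c' ∈ Finset.range (m ^ (k + 1)), if Adj (c / m) (c' / m) ∧ ¬ Adj c c' then
      nrm (p / 2) w (fun x => ‖ext (piece g (m ^ (k + 1) : ℕ) (c : ℕ)) x‖ₑ *
        ‖ext (piece g (m ^ (k + 1) : ℕ) (c' : ℕ)) x‖ₑ) else 0) ≤ Y * (C₁ * (6 * m)) * P := by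
    intro k hk
    have hk' : k < 2 ^ N := Finset.mem_range.1 hk
    have h := sum_adj_le hm (m ^ (k + 1)) (fun c => Y * (C₁ * l2c p w g (m ^ (k + 1)) c
      (m ^ (2 ^ (N + 1) - (k + 1)))))
    rw [← Finset.mul_sum, ← Finset.mul_sum, sum_l2c, ← pow_add,
      show k + 1 + (2 ^ (N + 1) - (k + 1)) = 2 ^ (N + 1) by omega, ← hP] at h
    refine (Finset.sum_le_sum fun c hc => Finset.sum_le_sum fun c' hc' => ?_).trans
      (h.trans_eq (by ring))
    by_cases ha : Adj (c / m) (c' / m)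
    · by_cases hn : Adj c c'
      · simp [hn]
      · rw [if_pos ⟨ha, hn⟩, if_pos ha, ← mul_add, ← mul_add]
        exact hC₁ p hp hp' N m k hm hk' g hg w hw hsl c c' (Finset.mem_range.1 hc)
          (Finset.mem_range.1 hc') ha hn
    · simp [ha]
  calc Np p w (ext (piece g 1 0)) ^ (2 / p)
      = nrm (p / 2) w (fun x => ‖ext (piece g 1 0) x‖ₑ ^ 2) := (nrm_sq w _).symm
    _ ≤ _ := nrm_mono (by positivity) w hpt
    _ ≤ _ := nrm_add_le hq hw (hmp _ _) (Finset.measurable_fun_sum _ fun k _ => hmp _ _)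
    _ ≤ 6 * (C₂ * ENNReal.ofReal (Dconst p (m ^ (2 ^ (N + 1) - 2 ^ N)))) ^ 2 * P +
        ∑ k ∈ Finset.range (2 ^ N), Y * (C₁ * (6 * m)) * P :=
      add_le_add ((nrm_sum_pairs_le hq hw _ _ (hms _)).trans hadj)
        ((nrm_sum_le hq hw _ fun k _ => hmp _ _).trans (Finset.sum_le_sum fun k hk =>
          (nrm_sum_pairs_le hq hw _ _ (hms _)).trans (hsep k hk)))
    _ = (6 * (C₂ * ENNReal.ofReal (Dconst p (m ^ (2 ^ (N + 1) - 2 ^ N)))) ^ 2 +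
        2 ^ N * (Y * (C₁ * (6 * m)))) * P := by
      rw [Finset.sum_const, Finset.card_range, nsmul_eq_mul, add_mul]
      push_cast
      simp only [mul_assoc]
    _ ≤ _ := by
      have h1 : (C₁ : ℝ≥0∞) ≤ (max C₁ C₂ : ℝ≥0) := by exact_mod_cast le_max_left _ _
      have h2 : (C₂ : ℝ≥0∞) ≤ (max C₁ C₂ : ℝ≥0) := by exact_mod_cast le_max_right _ _
      rw [hY]
      gcongr

lemma rpow_sum_eq_prod {x : ℝ≥0∞} (h0 : x ≠ 0) (ht : x ≠ ⊤) {ι : Type*} (s : Finset ι) (a : ι → ℝ) :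
    x ^ (∑ i ∈ s, a i) = ∏ i ∈ s, x ^ a i := by
  classical
  induction s using Finset.induction_on with
  | empty => simp
  | insert i s hi ih => rw [Finset.sum_insert hi, Finset.prod_insert hi, ENNReal.rpow_add _ _ h0 ht, ih]

lemma factor_le {C : ℝ≥0} (hC : 1 ≤ C) {p α θ : ℝ} (hp : 2 ≤ p) (hα : 0 ≤ α) (hα1 : α ≤ 1)
    (hθ : 0 ≤ θ) (hθ1 : θ ≤ 1) (x d : ℝ≥0∞) :
    ((C * x * (C * d) ^ (p * θ)) ^ α) ^ (2 / p) ≤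
      ((C : ℝ≥0∞) ^ 2) ^ 2 * (x ^ (2 / p * α) * (d ^ (θ * α)) ^ 2) := by
  have hp0 : 0 < p := by linarith
  have hC' : (1 : ℝ≥0∞) ≤ C := by exact_mod_cast hC
  have hb : ∀ a : ℝ, a ≤ 1 → (C : ℝ≥0∞) ^ a ≤ C := fun a ha =>
    (ENNReal.rpow_le_rpow_of_exponent_le hC' ha).trans_eq (ENNReal.rpow_one _)
  have e : ((C * x * (C * d) ^ (p * θ)) ^ α) ^ (2 / p) =
      C ^ (2 / p * α) * x ^ (2 / p * α) * (C ^ (θ * α) * d ^ (θ * α)) ^ 2 := by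
    rw [← ENNReal.rpow_mul, mul_comm α, ENNReal.mul_rpow_of_nonneg _ _ (by positivity),
      ENNReal.mul_rpow_of_nonneg _ _ (by positivity), ← ENNReal.rpow_mul,
      ← ENNReal.mul_rpow_of_nonneg _ _ (by positivity : 0 ≤ θ * α), ← ENNReal.rpow_natCast,
      ← ENNReal.rpow_mul]
    congr 2
    push_cast
    field_simp
  have h1 : 2 / p * α ≤ 1 := mul_le_one₀ ((div_le_one hp0).2 hp) hα hα1
  rw [e]
  calc (C : ℝ≥0∞) ^ (2 / p * α) * x ^ (2 / p * α) * (C ^ (θ * α) * d ^ (θ * α)) ^ 2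
      ≤ C ^ 2 * x ^ (2 / p * α) * (C * d ^ (θ * α)) ^ 2 := by
        gcongr
        · exact (hb _ h1).trans (le_self_pow₀ hC' two_ne_zero)
        · exact hb _ (mul_le_one₀ hθ1 hα hα1)
    _ = _ := by ring

lemma prod_factor_le {C : ℝ≥0} (hC : 1 ≤ C) {p α θ : ℝ} (hp : 2 ≤ p) (hα : 0 ≤ α) (hα1 : α ≤ 1)
    (hθ : 0 ≤ θ) (hθ1 : θ ≤ 1) {m : ℕ} (hm : 0 < m) (n : ℕ) (d : ℕ → ℝ≥0∞) :
    m * (∏ i ∈ Finset.range n, (C * m * (C * d i) ^ (p * θ)) ^ (α ^ i)) ^ (2 / p) ≤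
      (((C : ℝ≥0∞) ^ 2) ^ n * ((m : ℝ≥0∞) ^ (1 + 2 / p * ∑ i ∈ Finset.range n, α ^ i) *
        ∏ i ∈ Finset.range n, d i ^ (θ * α ^ i))) ^ 2 := by
  have hp0 : 0 < p := by linarith
  have hm0 : (m : ℝ≥0∞) ≠ 0 := by exact_mod_cast hm.ne'
  have hm1 : (1 : ℝ≥0∞) ≤ m := by exact_mod_cast hm
  have hmt : (m : ℝ≥0∞) ≠ ⊤ := ENNReal.natCast_ne_top m
  have hs : 0 ≤ 1 + 2 / p * ∑ i ∈ Finset.range n, α ^ i := by positivity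
  rw [← ENNReal.prod_rpow_of_nonneg (by positivity)]
  calc (m : ℝ≥0∞) * ∏ i ∈ Finset.range n, ((C * m * (C * d i) ^ (p * θ)) ^ (α ^ i)) ^ (2 / p)
      ≤ m * ∏ i ∈ Finset.range n,
        ((C : ℝ≥0∞) ^ 2) ^ 2 * ((m : ℝ≥0∞) ^ (2 / p * α ^ i) * (d i ^ (θ * α ^ i)) ^ 2) := by
        gcongr with i _
        exact factor_le hC hp (by positivity) (pow_le_one₀ hα hα1) hθ hθ1 _ _
    _ = (((C : ℝ≥0∞) ^ 2) ^ n * ∏ i ∈ Finset.range n, d i ^ (θ * α ^ i)) ^ 2 *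
        (m : ℝ≥0∞) ^ (1 + 2 / p * ∑ i ∈ Finset.range n, α ^ i) := by
        rw [Finset.prod_mul_distrib, Finset.prod_mul_distrib, Finset.prod_const, Finset.card_range,
          Finset.prod_pow, ENNReal.rpow_add _ _ hm0 hmt, ENNReal.rpow_one, Finset.mul_sum,
          rpow_sum_eq_prod hm0 hmt]
        ring
    _ ≤ (((C : ℝ≥0∞) ^ 2) ^ n * ∏ i ∈ Finset.range n, d i ^ (θ * α ^ i)) ^ 2 *
        ((m : ℝ≥0∞) ^ (1 + 2 / p * ∑ i ∈ Finset.range n, α ^ i)) ^ 2 := by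
        gcongr
        exact le_self_pow₀ (ENNReal.one_le_rpow hm1 (by positivity)) two_ne_zero
    _ = _ := by ring

lemma sq_add_sq_le_of_one_le {C : ℝ≥0} (hC : 1 ≤ C) (N : ℕ) {a b y : ℝ≥0∞}
    (hy : y ≤ (((C : ℝ≥0∞) ^ 2) ^ (N + 1) * b) ^ 2) :
    6 * (C * a) ^ 2 + 2 ^ N * (C * (6 * y)) ≤ (((12 * C ^ 3 : ℝ≥0) : ℝ≥0∞) ^ (N + 1) * (a + b)) ^ 2 := by
  have h12 : (12 : ℝ≥0) ^ (N + 1) ≤ (12 ^ (N + 1)) ^ 2 :=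
    le_self_pow₀ (one_le_pow₀ (by norm_num)) two_ne_zero
  have h1 : 6 * C ^ 2 ≤ ((12 * C ^ 3) ^ (N + 1)) ^ 2 := by
    calc 6 * C ^ 2 ≤ (12 * C ^ 3) ^ 2 := by
          rw [mul_pow, ← pow_mul]
          gcongr
          · norm_num
          · norm_num
      _ ≤ ((12 * C ^ 3) ^ (N + 1)) ^ 2 := by
          gcongr
          refine le_self_pow₀ ?_ (by omega)
          exact one_le_mul (by norm_num) (one_le_pow₀ hC)
  have h2 : 6 * 2 ^ N * C * ((C ^ 2) ^ (N + 1)) ^ 2 ≤ ((12 * C ^ 3) ^ (N + 1)) ^ 2 := by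
    calc 6 * 2 ^ N * C * ((C ^ 2) ^ (N + 1)) ^ 2
        ≤ 12 ^ (N + 1) * (C ^ (N + 1)) ^ 2 * ((C ^ 2) ^ (N + 1)) ^ 2 := by
          gcongr
          · calc (6 : ℝ≥0) * 2 ^ N ≤ 12 * 12 ^ N := by gcongr <;> norm_num
              _ = 12 ^ (N + 1) := (pow_succ' _ _).symm
          · rw [← pow_mul]
            exact le_self_pow₀ hC (by omega)
      _ ≤ (12 ^ (N + 1)) ^ 2 * (C ^ (N + 1)) ^ 2 * ((C ^ 2) ^ (N + 1)) ^ 2 := by gcongr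
      _ = _ := by rw [← mul_pow, ← mul_pow, ← mul_pow, ← mul_pow]; congr 2; ring
  have h1' : (6 : ℝ≥0∞) * (C : ℝ≥0∞) ^ 2 ≤ (((12 * C ^ 3 : ℝ≥0) : ℝ≥0∞) ^ (N + 1)) ^ 2 := by
    exact_mod_cast h1
  have h2' : (6 : ℝ≥0∞) * 2 ^ N * C * (((C : ℝ≥0∞) ^ 2) ^ (N + 1)) ^ 2 ≤
      (((12 * C ^ 3 : ℝ≥0) : ℝ≥0∞) ^ (N + 1)) ^ 2 := by
    exact_mod_cast h2
  set E := (((12 * C ^ 3 : ℝ≥0) : ℝ≥0∞) ^ (N + 1)) ^ 2 with hE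
  calc 6 * (C * a) ^ 2 + 2 ^ N * (C * (6 * y))
      ≤ 6 * (C * a) ^ 2 + 2 ^ N * (C * (6 * (((C : ℝ≥0∞) ^ 2) ^ (N + 1) * b) ^ 2)) := by gcongr
    _ = 6 * (C : ℝ≥0∞) ^ 2 * a ^ 2 + 6 * 2 ^ N * C * (((C : ℝ≥0∞) ^ 2) ^ (N + 1)) ^ 2 * b ^ 2 := by
        ring
    _ ≤ E * a ^ 2 + E * b ^ 2 := by gcongr
    _ ≤ E * a ^ 2 + E * b ^ 2 + 2 * E * a * b := le_self_add
    _ = _ := by rw [hE]; ring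

/-- Iteration inequality: for `δ = (1/m)^{2^{N+1}}` with `1/m < 1/100` (so that
`δ^{1/2^{N+1}} = 1/m ∈ ℕ⁻¹ ∩ (0, 1/100)`),
`D_p(δ) ≤ C^{N²} (D_p(δ^{1-1/2^{N+1}}) + δ^{-(1/2^{N+1})(1 + (2/p)Σ_{j≤N}(2/(p-2))^j)}
  Π_{j≤N} D_p(δ^{1-1/2^{j+1}})^{((p-4)/(p-2))(2/(p-2))^{N-j}})`,
where `δ^{1-1/2^{j+1}} = (1/m)^{2^{N+1} - 2^{N-j}}`. -/
theorem iteration_inequality :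
    ∃ C : ℝ, 1 ≤ C ∧ ∀ p : ℝ, 4 < p → p < 6 → ∀ N : ℕ, 1 ≤ N → ∀ m : ℕ, 100 < m →
      Dconst p (m ^ 2 ^ (N + 1)) ≤
        C ^ N ^ 2 *
          (Dconst p (m ^ (2 ^ (N + 1) - 2 ^ N)) +
            ((m : ℝ)⁻¹ ^ 2 ^ (N + 1)) ^
                (-(1 / (2 : ℝ) ^ (N + 1)) *
                  (1 + 2 / p * ∑ j ∈ Finset.range (N + 1), (2 / (p - 2)) ^ j)) *
              ∏ j ∈ Finset.range (N + 1),
                Dconst p (m ^ (2 ^ (N + 1) - 2 ^ (N - j))) ^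
                  ((p - 4) / (p - 2) * (2 / (p - 2)) ^ (N - j))) := by
  obtain ⟨C, hC1, hC⟩ := exists_whitney_le (2 ^ 100)
  set E : ℝ≥0 := 12 * C ^ 3 with hE
  have hE1 : 1 ≤ E := one_le_mul (by norm_num) (one_le_pow₀ hC1)
  have hG1 : (1 : ℝ) ≤ 2 ^ 50 * E := one_le_mul_of_one_le_of_one_le (by norm_num) (by exact_mod_cast hE1)
  refine ⟨(2 ^ 50 * E) ^ 2, one_le_pow₀ hG1, fun p hp hp' N hN m hm => ?_⟩
  have hp0 : 0 < p := by linarith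
  have hp2 : 0 < p - 2 := by linarith
  have hp4 : 0 < p - 4 := by linarith
  have hm0 : 0 < m := by omega
  have hmR : (0 : ℝ) < m := by exact_mod_cast hm0
  set θ := (p - 4) / (p - 2) with hθ
  set α := 2 / (p - 2) with hα
  have hθ0 : 0 ≤ θ := by positivity
  have hα0 : 0 ≤ α := by positivity
  have hθ1 : θ ≤ 1 := (div_le_one hp2).2 (by linarith)
  have hα1 : α ≤ 1 := (div_le_one hp2).2 (by linarith)
  set L := 2 ^ (N + 1) with hL
  set s := 1 + 2 / p * ∑ j ∈ Finset.range (N + 1), α ^ j with hs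
  set d : ℕ → ℝ := fun i => Dconst p (m ^ (L - 2 ^ i)) with hd
  have hd0 : ∀ i, 0 ≤ d i := fun i => Dconst_nonneg _ _
  have hpow : ((m : ℝ)⁻¹ ^ L) ^ (-(1 / (2 : ℝ) ^ (N + 1)) * s) = (m : ℝ) ^ s := by
    have hL' : (L : ℝ) = 2 ^ (N + 1) := by rw [hL]; push_cast; rfl
    rw [← Real.rpow_natCast, ← Real.rpow_mul (by positivity), hL', Real.inv_rpow hmR.le,
      ← Real.rpow_neg hmR.le]
    congr 1
    field_simp
  have hprod : ∏ j ∈ Finset.range (N + 1), Dconst p (m ^ (L - 2 ^ (N - j))) ^ (θ * α ^ (N - j)) =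
      ∏ i ∈ Finset.range (N + 1), d i ^ (θ * α ^ i) := by
    rw [← Finset.prod_range_reflect]
    refine Finset.prod_congr rfl fun i hi => ?_
    have hi' := Finset.mem_range.1 hi
    rw [show N - (N + 1 - 1 - i) = i by omega]
  rw [hpow, hprod]
  change _ ≤ _ * (d N + _)
  set b := (m : ℝ) ^ s * ∏ i ∈ Finset.range (N + 1), d i ^ (θ * α ^ i) with hb
  have hb0 : 0 ≤ b :=
    mul_nonneg (by positivity) (Finset.prod_nonneg fun i _ => Real.rpow_nonneg (hd0 i) _)
  have hbE : ENNReal.ofReal b = (m : ℝ≥0∞) ^ s *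
      ∏ i ∈ Finset.range (N + 1), ENNReal.ofReal (d i) ^ (θ * α ^ i) := by
    rw [hb, ENNReal.ofReal_mul (by positivity), ← ENNReal.ofReal_rpow_of_pos hmR,
      ENNReal.ofReal_natCast, ENNReal.ofReal_prod_of_nonneg fun i _ => Real.rpow_nonneg (hd0 i) _]
    congr 1
    refine Finset.prod_congr rfl fun i _ => ?_
    rw [ENNReal.ofReal_rpow_of_nonneg (hd0 i) (by positivity)]
  have hdb : 0 ≤ d N + b := add_nonneg (hd0 N) hb0
  have hmain : Dconst p (m ^ L) ≤ 2 ^ 50 * (E ^ (N + 1) * (d N + b)) := by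
    have hn : 0 < m ^ L := by positivity
    refine Dconst_le (by positivity) ((decIneq_iff hp0 hn (by positivity)).2 fun g hg c => ?_)
    have hR : (0 : ℝ) < ((m ^ L : ℕ) : ℝ) ^ 2 := by positivity
    have h := hC p hp hp' N m hm0 g hg (WB c (((m ^ L : ℕ) : ℝ) ^ 2)) (measurable_WB c hR)
      (slow_WB c hR)
    set P := l2p p (WB c (((m ^ L : ℕ) : ℝ) ^ 2)) (Finset.range (m ^ L))
      (fun k => ext (piece g (m ^ L : ℕ) k)) with hP
    have hy := prod_factor_le (p := p) hC1 (by linarith) hα0 hα1 hθ0 hθ1 hm0 (N + 1)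
      (fun i => ENNReal.ofReal (d i))
    rw [← hs, ← hbE] at hy
    have h2 := sq_add_sq_le_of_one_le hC1 N (a := ENNReal.ofReal (d N)) hy
    rw [← ENNReal.ofReal_add (hd0 N) hb0, ← hE] at h2
    have h3 : Np p (WB c (((m ^ L : ℕ) : ℝ) ^ 2)) (ext (piece g 1 0)) ^ (2 / p) ≤
        ((E : ℝ≥0∞) ^ (N + 1) * ENNReal.ofReal (d N + b)) ^ 2 * P := by
      refine h.trans (mul_le_mul' (le_trans (le_of_eq ?_) h2) le_rfl)
      congr 2
      ring
    have h4 := ENNReal.rpow_le_rpow h3 (show 0 ≤ p / 2 by positivity)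
    rw [← ENNReal.rpow_mul, show 2 / p * (p / 2) = 1 by field_simp, ENNReal.rpow_one,
      ENNReal.mul_rpow_of_nonneg _ _ (by positivity), ← ENNReal.rpow_natCast, ← ENNReal.rpow_mul,
      show ((2 : ℕ) : ℝ) * (p / 2) = p by push_cast; ring] at h4
    have h200 : (2 : ℝ≥0∞) ^ 200 ≤ (2 ^ 50) ^ p := by
      calc (2 : ℝ≥0∞) ^ 200 = (2 ^ 50) ^ (4 : ℝ) := by
            rw [show (4 : ℝ) = (4 : ℕ) by norm_num, ENNReal.rpow_natCast, ← pow_mul]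
        _ ≤ (2 ^ 50) ^ p := ENNReal.rpow_le_rpow_of_exponent_le (one_le_pow₀ (by norm_num)) hp.le
    calc _ ≤ 2 ^ 200 * Np p (WB c (((m ^ L : ℕ) : ℝ) ^ 2)) (ext (piece g 1 0)) :=
          setLIntegral_closedBall_le_Np p c hR _
      _ ≤ (2 ^ 50) ^ p * (((E : ℝ≥0∞) ^ (N + 1) * ENNReal.ofReal (d N + b)) ^ p * P ^ (p / 2)) :=
          mul_le_mul' h200 h4
      _ = _ := by
          rw [← mul_assoc, ← ENNReal.mul_rpow_of_nonneg _ _ hp0.le,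
            ENNReal.ofReal_mul (by positivity), ENNReal.ofReal_mul (by positivity),
            ENNReal.ofReal_pow (by positivity), ENNReal.ofReal_pow (by positivity)]
          simp
  refine hmain.trans ?_
  rw [← mul_assoc]
  gcongr
  calc (2 : ℝ) ^ 50 * (E : ℝ) ^ (N + 1) ≤ (2 ^ 50) ^ (N + 1) * (E : ℝ) ^ (N + 1) := by
        gcongr
        exact le_self_pow₀ (by norm_num) (by omega)
    _ = (2 ^ 50 * (E : ℝ)) ^ (N + 1) := (mul_pow _ _ _).symm
    _ ≤ (2 ^ 50 * (E : ℝ)) ^ (2 * N ^ 2) := pow_le_pow_right₀ hG1 (by nlinarith)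
    _ = _ := pow_mul _ _ _
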